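/- For every integer g ≥ 2 and every natural number K ≥ 1, there are infinitely many natural numbers n such that s_g(p_n) < s_g(p_{n+1}) < ⋯ < s_g(p_{n+K−1}), i.e., the base-g digit sum is strictly increasing along some run of K consecutive primes, for infinitely many starting indices n. -/

import Mathlib

set_option linter.all false

section
namespace DSR
open Complex Filter Topology

/-- Partial sums of a nonprincipal character are bounded by the modulus. -/
lemma char_sum_period {r : ℕ} [NeZero r] (χ : DirichletCharacter ℂ r) (hχ : χ ≠ 1) :
    ∑ i ∈ Finset.range r, χ (i : ZMod r) = 0 := by
  have h := MulChar.sum_eq_zero_of_ne_one hχ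
  rw [← h]
  refine Finset.sum_nbij' (fun i => (i : ZMod r)) (fun x => x.val) ?_ ?_ ?_ ?_ ?_
  · intro i _; simp
  · intro x _; simp [ZMod.val_lt]
  · intro i hi; exact ZMod.val_cast_of_lt (Finset.mem_range.mp hi)
  · intro x _; simp
  · intro i _; rfl

lemma char_sum_le {r : ℕ} [NeZero r] (χ : DirichletCharacter ℂ r) (hχ : χ ≠ 1) (N : ℕ) :
    ‖∑ i ∈ Finset.range N, χ (i : ZMod r)‖ ≤ r := by
  induction N using Nat.strong_induction_on with
  | _ N ih =>
    by_cases h : N < r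
    · calc ‖∑ i ∈ Finset.range N, χ (i : ZMod r)‖ ≤ ∑ i ∈ Finset.range N, ‖χ (i : ZMod r)‖ :=
          norm_sum_le _ _
        _ ≤ ∑ i ∈ Finset.range N, (1:ℝ) := Finset.sum_le_sum fun i _ => χ.norm_le_one _
        _ = N := by simp
        _ ≤ r := by exact_mod_cast h.le
    · push Not at h
      obtain ⟨M, rfl⟩ := Nat.exists_eq_add_of_le h
      rw [Finset.sum_range_add, char_sum_period χ hχ, zero_add]
      have := ih M (by have := NeZero.pos r; omega)
      simpa using this

/-- Abel summation for series. -/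
lemma abel_fin (a f : ℕ → ℂ) (N : ℕ) :
    ∑ i ∈ Finset.range N, a i * f i = (∑ i ∈ Finset.range N, a i) * f N +
      ∑ i ∈ Finset.range N, (∑ l ∈ Finset.range (i+1), a l) * (f i - f (i+1)) := by
  induction N with
  | zero => simp
  | succ N ih =>
    rw [Finset.sum_range_succ, ih, Finset.sum_range_succ (fun i => (∑ l ∈ Finset.range (i+1), a l) * (f i - f (i+1)))]
    rw [Finset.sum_range_succ a]
    ring

lemma abel_tsum (a f : ℕ → ℂ) (B : ℝ) (hS : ∀ N, ‖∑ i ∈ Finset.range N, a i‖ ≤ B)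
    (hsum : Summable fun n => a n * f n) (hf : Tendsto f atTop (𝓝 0))
    (hV : Summable fun n => ‖f n - f (n+1)‖) :
    ∑' n, a n * f n = ∑' n, (∑ l ∈ Finset.range (n+1), a l) * (f n - f (n+1)) := by
  have h1 := hsum.hasSum.tendsto_sum_nat
  have hs2 : Summable fun n => (∑ l ∈ Finset.range (n+1), a l) * (f n - f (n+1)) := by
    refine Summable.of_norm_bounded (hV.mul_left B) fun n => ?_
    rw [norm_mul]
    exact mul_le_mul_of_nonneg_right (hS _) (norm_nonneg _)
  have h2 := hs2.hasSum.tendsto_sum_nat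
  have h3 : Tendsto (fun N => (∑ i ∈ Finset.range N, a i) * f N) atTop (𝓝 0) := by
    have : Tendsto (fun N => B * ‖f N‖) atTop (𝓝 0) := by
      simpa using (hf.norm).const_mul B
    refine squeeze_zero_norm (fun N => ?_) this
    rw [norm_mul]
    exact mul_le_mul_of_nonneg_right (hS _) (norm_nonneg _)
  have h4 := h3.add h2
  rw [zero_add] at h4
  refine tendsto_nhds_unique h1 (h4.congr fun N => ?_)
  exact (abel_fin a f N).symm

lemma abel_bound (a f : ℕ → ℂ) (B : ℝ) (hS : ∀ N, ‖∑ i ∈ Finset.range N, a i‖ ≤ B)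
    (hsum : Summable fun n => a n * f n) (hf : Tendsto f atTop (𝓝 0))
    (hV : Summable fun n => ‖f n - f (n+1)‖) :
    ‖∑' n, a n * f n‖ ≤ B * ∑' n, ‖f n - f (n+1)‖ := by
  rw [abel_tsum a f B hS hsum hf hV, ← tsum_mul_left]
  refine tsum_of_norm_bounded (hV.mul_left B).hasSum fun n => ?_
  rw [norm_mul]
  exact mul_le_mul_of_nonneg_right (hS _) (norm_nonneg _)

/-- Tail of the zeta series. -/
lemma zeta_tail_step (σ : ℝ) (hσ : 0 < σ) (n : ℕ) (hn : 1 ≤ n) :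
    σ * ((n + 1 : ℕ) : ℝ) ^ (-σ - 1) ≤ (n : ℝ) ^ (-σ) - ((n + 1 : ℕ) : ℝ) ^ (-σ) := by
  have hn0 : (0:ℝ) < n := by exact_mod_cast hn
  set m : ℝ := ((n + 1 : ℕ) : ℝ) with hm
  have hmn : m = n + 1 := by simp [hm]
  have hm0 : 0 < m := by rw [hmn]; positivity
  have h1 : (n : ℝ) ^ (-σ) = m ^ (-σ) * (n / m) ^ (-σ) := by
    rw [← Real.mul_rpow hm0.le (by positivity)]
    congr 1; field_simp
  have h2 : 1 + σ / m ≤ (n / m) ^ (-σ) := by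
    have : (n / m : ℝ) = 1 - 1 / m := by rw [hmn]; field_simp; ring
    have h3 : Real.log (n / m) ≤ -(1 / m) := by
      have := Real.log_le_sub_one_of_pos (show 0 < (n / m : ℝ) by positivity)
      have e : (n / m : ℝ) = 1 - 1 / m := by rw [hmn]; field_simp; ring
      linarith
    rw [Real.rpow_def_of_pos (by positivity)]
    have h4 := Real.add_one_le_exp (Real.log (n / m) * -σ)
    have h5 : σ / m ≤ Real.log (n / m) * -σ := by
      have : σ / m = σ * (1 / m) := by ring
      nlinarith
    linarith
  have h6 : m ^ (-σ - 1) = m ^ (-σ) / m := by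
    rw [Real.rpow_sub hm0, Real.rpow_one]
  rw [h1, h6]
  have h7 : 0 < m ^ (-σ) := Real.rpow_pos_of_pos hm0 _
  have h8 := mul_le_mul_of_nonneg_left h2 h7.le
  have h9 : σ * (m ^ (-σ) / m) = m ^ (-σ) * (σ / m) := by ring
  rw [h9]; linarith

lemma zeta_tail (σ : ℝ) (hσ : 0 < σ) (N : ℕ) (hN : 1 ≤ N) :
    Summable (fun i : ℕ => ((i + N + 1 : ℕ) : ℝ) ^ (-σ - 1)) ∧
    ∑' i : ℕ, ((i + N + 1 : ℕ) : ℝ) ^ (-σ - 1) ≤ (N : ℝ) ^ (-σ) / σ := by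
  have key : ∀ M : ℕ, ∑ i ∈ Finset.range M, ((i + N + 1 : ℕ) : ℝ) ^ (-σ - 1) ≤ (N : ℝ) ^ (-σ) / σ := by
    intro M
    have : ∑ i ∈ Finset.range M, ((i + N + 1 : ℕ) : ℝ) ^ (-σ - 1) ≤
        ((N : ℝ) ^ (-σ) - ((M + N : ℕ) : ℝ) ^ (-σ)) / σ := by
      induction M with
      | zero => simp
      | succ M ih =>
        rw [Finset.sum_range_succ]
        have := zeta_tail_step σ hσ (M + N) (by omega)
        have e : M + 1 + N = M + N + 1 := by ring
        rw [e]
        rw [le_div_iff₀ hσ] at ih ⊢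
        nlinarith
    refine this.trans ?_
    gcongr
    have : 0 ≤ ((M + N : ℕ) : ℝ) ^ (-σ) := by positivity
    linarith
  have hnn : ∀ i : ℕ, 0 ≤ ((i + N + 1 : ℕ) : ℝ) ^ (-σ - 1) := fun i => by positivity
  exact ⟨summable_of_sum_range_le hnn key, Real.tsum_le_of_sum_range_le hnn key⟩

lemma cpow_diff (s : ℂ) (hs : 0 < s.re) (n : ℕ) (hn : 1 ≤ n) :
    ‖(n : ℂ) ^ (-s) - ((n + 1 : ℕ) : ℂ) ^ (-s)‖ ≤ ‖s‖ * (n : ℝ) ^ (-s.re - 1) := by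
  have hn0 : (0:ℝ) < n := by exact_mod_cast hn
  have hs0 : s ≠ 0 := by rintro rfl; simp at hs
  have := Convex.norm_image_sub_le_of_norm_hasDerivWithin_le (𝕜 := ℝ)
    (f := fun x : ℝ => (x : ℂ) ^ (-s)) (f' := fun x : ℝ => -s * (x:ℂ) ^ (-s - 1))
    (s := Set.Icc (n:ℝ) (n+1)) (C := ‖s‖ * (n : ℝ) ^ (-s.re - 1)) (x := (n+1 : ℝ)) (y := n)
    ?_ ?_ (convex_Icc _ _) (by simp) (by simp)
  · simpa using this
  · intro x hx
    have hx0 : 0 < x := hn0.trans_le hx.1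
    exact (hasDerivAt_ofReal_cpow_const hx0.ne' (by simpa using hs0)).hasDerivWithinAt
  · intro x hx
    have hx0 : 0 < x := hn0.trans_le hx.1
    rw [norm_mul, norm_neg, Complex.norm_cpow_eq_rpow_re_of_pos hx0]
    refine mul_le_mul_of_nonneg_left ?_ (norm_nonneg _)
    simp only [sub_re, neg_re, one_re]
    exact Real.rpow_le_rpow_of_nonpos hn0 hx.1 (by linarith)

end DSR
end

section
namespace DSR
open Complex Filter Topology

/-- The shifted partial sums. -/
lemma char_sum_shift_le {r : ℕ} [NeZero r] (χ : DirichletCharacter ℂ r) (hχ : χ ≠ 1) (M N : ℕ) :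
    ‖∑ i ∈ Finset.range N, χ ((i + M : ℕ) : ZMod r)‖ ≤ 2 * r := by
  have h : ∑ i ∈ Finset.range N, χ ((i + M : ℕ) : ZMod r) =
      ∑ i ∈ Finset.range (M + N), χ (i : ZMod r) - ∑ i ∈ Finset.range M, χ (i : ZMod r) := by
    rw [Finset.sum_range_add]
    rw [add_sub_cancel_left]
    refine Finset.sum_congr rfl fun i _ => by rw [add_comm]
  rw [h]
  refine (norm_sub_le _ _).trans ?_
  have := char_sum_le χ hχ (M+N)
  have := char_sum_le χ hχ M
  linarith

/-- tail function -/
noncomputable def Ltail {r : ℕ} (χ : DirichletCharacter ℂ r) (N : ℕ) (s : ℂ) : ℂ :=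
  ∑' i : ℕ, (∑ l ∈ Finset.range (i+1), χ ((l + (N + 1) : ℕ) : ZMod r)) *
    (((i + N + 1 : ℕ) : ℂ) ^ (-s) - ((i + N + 1 + 1 : ℕ) : ℂ) ^ (-s))

lemma Ltail_term_le {r : ℕ} [NeZero r] (χ : DirichletCharacter ℂ r) (hχ : χ ≠ 1) (N : ℕ)
    (s : ℂ) (hs : 0 < s.re) (i : ℕ) :
    ‖(∑ l ∈ Finset.range (i+1), χ ((l + (N + 1) : ℕ) : ZMod r)) *
    (((i + N + 1 : ℕ) : ℂ) ^ (-s) - ((i + N + 1 + 1 : ℕ) : ℂ) ^ (-s))‖ ≤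
      2 * r * ‖s‖ * ((i + N + 1 : ℕ) : ℝ) ^ (-s.re - 1) := by
  rw [norm_mul, mul_assoc (2 * (r:ℝ))]
  have h1 := char_sum_shift_le χ hχ (N+1) (i+1)
  have h2 := cpow_diff s hs (i + N + 1) (by omega)
  exact mul_le_mul h1 h2 (norm_nonneg _) (by positivity)

lemma Ltail_norm_le {r : ℕ} [NeZero r] (χ : DirichletCharacter ℂ r) (hχ : χ ≠ 1) (N : ℕ)
    (hN : 1 ≤ N) (s : ℂ) (hs : 0 < s.re) :
    ‖Ltail χ N s‖ ≤ 2 * r * ‖s‖ * ((N : ℝ) ^ (-s.re) / s.re) := by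
  obtain ⟨h1, h2⟩ := zeta_tail s.re hs N hN
  refine (tsum_of_norm_bounded (h1.mul_left (2 * r * ‖s‖)).hasSum
    (Ltail_term_le χ hχ N s hs)).trans ?_
  rw [tsum_mul_left]
  exact mul_le_mul_of_nonneg_left h2 (by positivity)

lemma Ltail_diff {r : ℕ} [NeZero r] (χ : DirichletCharacter ℂ r) (hχ : χ ≠ 1) (N : ℕ) (hN : 1 ≤ N)
    (δ B : ℝ) (hδ : 0 < δ) :
    DifferentiableOn ℂ (Ltail χ N) ({s | δ < s.re} ∩ Metric.ball 0 B) := by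
  obtain ⟨h1, h2⟩ := zeta_tail δ hδ N hN
  refine differentiableOn_tsum_of_summable_norm (h1.mul_left (2 * r * B)) ?_ ?_ ?_
  · intro i s hs
    refine DifferentiableAt.differentiableWithinAt ?_
    have a1 : ((i + N + 1 : ℕ) : ℂ) ≠ 0 := Nat.cast_ne_zero.mpr (by omega)
    have a2 : ((i + N + 1 + 1 : ℕ) : ℂ) ≠ 0 := Nat.cast_ne_zero.mpr (by omega)
    refine DifferentiableAt.const_mul (DifferentiableAt.sub ?_ ?_) _
    · exact differentiableAt_id.neg.const_cpow (Or.inl a1)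
    · exact differentiableAt_id.neg.const_cpow (Or.inl a2)
  · exact (isOpen_lt continuous_const continuous_re).inter Metric.isOpen_ball
  · intro i s hs
    have hs1 : δ < s.re := hs.1
    have hs2 : ‖s‖ < B := by simpa using hs.2
    refine (Ltail_term_le χ hχ N s (hδ.trans hs1) i).trans ?_
    have : ((i + N + 1 : ℕ) : ℝ) ^ (-s.re - 1) ≤ ((i + N + 1 : ℕ) : ℝ) ^ (-δ - 1) := by
      refine Real.rpow_le_rpow_of_exponent_le ?_ (by linarith)
      have : 1 ≤ i + N + 1 := by omega
      exact_mod_cast this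
    have hB : 0 ≤ B := (norm_nonneg s).trans hs2.le
    gcongr

lemma L_eq_of_one_lt {r : ℕ} [NeZero r] (χ : DirichletCharacter ℂ r) (hχ : χ ≠ 1) (N : ℕ)
    (hN : 1 ≤ N) (s : ℂ) (hs : 1 < s.re) :
    DirichletCharacter.LFunction χ s = ∑ n ∈ Finset.range (N+1), LSeries.term (χ ·) s n
      + Ltail χ N s := by
  rw [DirichletCharacter.LFunction_eq_LSeries χ hs]
  have hsum : LSeriesSummable (χ ·) s := DirichletCharacter.LSeriesSummable_of_one_lt_re χ hs
  have hsum' : Summable (LSeries.term (χ ·) s) := hsum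
  rw [LSeries, ← hsum'.sum_add_tsum_nat_add (N+1)]
  congr 1
  have e : ∀ i, LSeries.term (χ ·) s (i + (N+1)) =
      χ ((i + (N + 1) : ℕ) : ZMod r) * ((i + N + 1 : ℕ) : ℂ) ^ (-s) := by
    intro i
    rw [LSeries.term_of_ne_zero (by omega), Complex.cpow_neg, div_eq_mul_inv, ← add_assoc]
  simp_rw [e]
  have hs0 : 0 < s.re := by linarith
  rw [abel_tsum (fun i => χ ((i + (N + 1) : ℕ) : ZMod r)) (fun i => ((i + N + 1 : ℕ) : ℂ) ^ (-s)) (2*r)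
    (fun M => char_sum_shift_le χ hχ (N+1) M)]
  · unfold Ltail
    refine tsum_congr fun i => ?_
    have : i + 1 + N + 1 = i + N + 1 + 1 := by ring
    simp only [this]
  · have := (summable_nat_add_iff (N+1)).mpr hsum'
    simpa only [e] using this
  · have h0 : Tendsto (fun i : ℕ => ((i + N + 1 : ℕ) : ℝ) ^ (-s.re)) atTop (𝓝 0) := by
      have := tendsto_rpow_neg_atTop hs0
      refine this.comp (tendsto_natCast_atTop_atTop.comp ?_)
      exact tendsto_atTop_mono (fun i => by simp only [id]; omega) tendsto_id
    refine squeeze_zero_norm (fun i => ?_) h0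
    rw [Complex.norm_natCast_cpow_of_pos (by omega)]
    simp
  · refine Summable.of_nonneg_of_le (fun _ => norm_nonneg _) (fun i => ?_)
      ((zeta_tail s.re hs0 N hN).1.mul_left ‖s‖)
    have := cpow_diff s hs0 (i + N + 1) (by omega)
    have e2 : i + 1 + N + 1 = i + N + 1 + 1 := by ring
    simpa only [e2] using this

lemma L_eq {r : ℕ} [NeZero r] (χ : DirichletCharacter ℂ r) (hχ : χ ≠ 1) (N : ℕ)
    (hN : 1 ≤ N) (s : ℂ) (hs : 0 < s.re) :
    DirichletCharacter.LFunction χ s = ∑ n ∈ Finset.range (N+1), LSeries.term (χ ·) s n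
      + Ltail χ N s := by
  set δ := s.re / 2 with hδ
  set B := ‖s‖ + 4 + δ with hB
  have hδ0 : 0 < δ := by positivity
  set V := ({s : ℂ | δ < s.re} ∩ Metric.ball 0 B) with hV
  have hVo : IsOpen V := (isOpen_lt continuous_const continuous_re).inter Metric.isOpen_ball
  have hVc : Convex ℝ V := (convex_halfSpace_re_gt δ).inter (convex_ball 0 B)
  have hf : AnalyticOnNhd ℂ (DirichletCharacter.LFunction χ) V :=
    (DirichletCharacter.differentiable_LFunction hχ).differentiableOn.analyticOnNhd hVo
  have hg : AnalyticOnNhd ℂ (fun s => ∑ n ∈ Finset.range (N+1), LSeries.term (χ ·) s n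
      + Ltail χ N s) V := by
    refine DifferentiableOn.analyticOnNhd ?_ hVo
    refine DifferentiableOn.add ?_ (Ltail_diff χ hχ N hN δ B hδ0)
    refine DifferentiableOn.fun_sum fun n _ => ?_
    intro z _
    exact (LSeries.hasDerivAt_term _ n z).differentiableAt.differentiableWithinAt
  have hδs : δ + 2 ∈ Set.Ioi (1:ℝ) := by simp; linarith
  have hz : ((δ + 2 : ℝ) : ℂ) ∈ V := by
    refine ⟨by simp, ?_⟩
    simp only [Metric.mem_ball, dist_zero_right, Complex.norm_real, Real.norm_eq_abs]
    rw [abs_of_pos (by linarith)]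
    have := norm_nonneg s
    linarith
  have := hf.eqOn_of_preconnected_of_eventuallyEq hg hVc.isPreconnected hz ?_
  · refine this ⟨by simp [hδ]; linarith, ?_⟩
    simp [hB]; linarith
  · have hmem : {z : ℂ | 1 < z.re} ∈ 𝓝 ((δ + 2 : ℝ) : ℂ) :=
      (isOpen_lt continuous_const continuous_re).mem_nhds (by simp; linarith)
    filter_upwards [hmem] with z hz
    exact L_eq_of_one_lt χ hχ N hN z hz

lemma norm_term_le {r : ℕ} (χ : DirichletCharacter ℂ r) (s : ℂ) (n : ℕ) (hn : n ≠ 0) :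
    ‖LSeries.term (χ ·) s n‖ ≤ (n:ℝ) ^ (-s.re) := by
  rw [LSeries.norm_term_eq, if_neg hn, Real.rpow_neg (by positivity), div_eq_mul_inv]
  have := χ.norm_le_one (n : ZMod r)
  have h2 : 0 ≤ ((n:ℝ) ^ s.re)⁻¹ := by positivity
  nlinarith

/-- crude bound -/
lemma L_crude {r : ℕ} [NeZero r] (χ : DirichletCharacter ℂ r) (hχ : χ ≠ 1) (s : ℂ)
    (hs : 1/2 ≤ s.re) (hs' : ‖s‖ ≤ 4) : ‖DirichletCharacter.LFunction χ s‖ ≤ 17 * r := by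
  have hs0 : 0 < s.re := by linarith
  rw [L_eq χ hχ 1 le_rfl s hs0]
  refine (norm_add_le _ _).trans ?_
  have h1 : ‖∑ n ∈ Finset.range (1+1), LSeries.term (χ ·) s n‖ ≤ 1 := by
    simp only [Finset.sum_range_succ, Finset.range_zero, Finset.sum_empty, zero_add]
    have := norm_term_le χ s 1 one_ne_zero
    simpa using this
  have h2 := Ltail_norm_le χ hχ 1 le_rfl s hs0
  have hr : (1:ℝ) ≤ r := by exact_mod_cast NeZero.one_le
  have h3 : ((1:ℕ):ℝ) ^ (-s.re) / s.re ≤ 2 := by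
    simp only [Nat.cast_one, Real.one_rpow]
    rw [div_le_iff₀ hs0]; linarith
  have h4 : 2 * r * ‖s‖ * (((1:ℕ):ℝ) ^ (-s.re) / s.re) ≤ 2 * r * 4 * 2 := by gcongr
  linarith

lemma harm (N : ℕ) (hN : 1 ≤ N) : ∑ n ∈ Finset.Icc 1 N, (1:ℝ) / n ≤ 1 + Real.log N := by
  have := harmonic_le_one_add_log N
  rw [harmonic_eq_sum_Icc] at this
  push_cast at this
  simpa using this

/-- log bound near the line 1 -/
lemma L_log {r : ℕ} [NeZero r] (χ : DirichletCharacter ℂ r) (hχ : χ ≠ 1) (s : ℂ)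
    (hs : 1 - 1/(2 + Real.log r) ≤ s.re) (hs' : ‖s‖ ≤ 4) :
    ‖DirichletCharacter.LFunction χ s‖ ≤ 60 * (2 + Real.log r) := by
  have hr1 : 1 ≤ r := NeZero.one_le
  have hr : (1:ℝ) ≤ r := by exact_mod_cast hr1
  have hlog : 0 ≤ Real.log r := Real.log_nonneg hr
  set ℓ := 2 + Real.log r with hℓ
  have hℓ2 : 2 ≤ ℓ := by linarith
  have hi : 1/ℓ ≤ 1/2 := one_div_le_one_div_of_le (by norm_num) hℓ2
  have hs0 : 1/2 ≤ s.re := by linarith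
  have hs1 : 0 < s.re := by linarith
  have hpow : ∀ n : ℕ, 1 ≤ n → n ≤ r → (n:ℝ) ^ (-s.re) ≤ Real.exp 1 * (1 / n) := by
    intro n hn hnr
    have hn0 : (0:ℝ) < n := by exact_mod_cast hn
    have hln : 0 ≤ Real.log n := Real.log_nonneg (by exact_mod_cast hn)
    have hlnr : Real.log n ≤ ℓ := by
      have := Real.log_le_log hn0 (show (n:ℝ) ≤ r by exact_mod_cast hnr)
      linarith
    rw [Real.rpow_def_of_pos hn0]
    have : Real.exp 1 * (1/n) = Real.exp (1 - Real.log n) := by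
      rw [Real.exp_sub, Real.exp_log hn0]; ring
    rw [this]
    apply Real.exp_le_exp.mpr
    have h5 : Real.log n * (1 - 1/ℓ) ≤ Real.log n * s.re := mul_le_mul_of_nonneg_left hs hln
    have h6 : Real.log n * (1/ℓ) ≤ 1 := by
      rw [mul_one_div, div_le_one (by linarith)]; exact hlnr
    nlinarith
  rw [L_eq χ hχ r hr1 s hs1]
  refine (norm_add_le _ _).trans ?_
  have h1 : ‖∑ n ∈ Finset.range (r+1), LSeries.term (χ ·) s n‖ ≤ Real.exp 1 * (1 + Real.log r) := by
    refine (norm_sum_le _ _).trans ?_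
    rw [Finset.sum_range_succ']
    simp only [LSeries.term_zero, norm_zero, add_zero]
    calc ∑ n ∈ Finset.range r, ‖LSeries.term (χ ·) s (n+1)‖
        ≤ ∑ n ∈ Finset.range r, Real.exp 1 * (1 / ((n+1 : ℕ):ℝ)) := by
          refine Finset.sum_le_sum fun n hn => ?_
          exact (norm_term_le χ s (n+1) (by omega)).trans (hpow _ (by omega) (by simp at hn; omega))
      _ = Real.exp 1 * ∑ n ∈ Finset.Icc 1 r, (1:ℝ)/n := by
          rw [← Finset.mul_sum]
          congr 1
          rw [Finset.range_eq_Ico, Finset.sum_Ico_add' (fun n : ℕ => (1:ℝ) / (n:ℝ))]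
          rfl
      _ ≤ _ := by gcongr; exact harm r hr1
  have h2 := Ltail_norm_le χ hχ r hr1 s hs1
  have h3 : 2 * r * ‖s‖ * ((r:ℝ) ^ (-s.re) / s.re) ≤ 16 * Real.exp 1 := by
    have a := hpow r hr1 le_rfl
    calc 2 * r * ‖s‖ * ((r:ℝ) ^ (-s.re) / s.re) ≤ 2 * r * 4 * ((Real.exp 1 * (1/r)) / (1/2)) := by
          gcongr
      _ = 16 * Real.exp 1 := by field_simp; ring
  have he : Real.exp 1 < 3 := by have := Real.exp_one_lt_d9; linarith
  have he0 := Real.exp_pos 1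
  nlinarith

lemma L_deriv {r : ℕ} [NeZero r] (χ : DirichletCharacter ℂ r) (hχ : χ ≠ 1) (s : ℂ)
    (hs : 1 - 1/(2*(2 + Real.log r)) ≤ s.re) (hs' : ‖s‖ ≤ 7/2) :
    ‖deriv (DirichletCharacter.LFunction χ) s‖ ≤ 120 * (2 + Real.log r)^2 := by
  have hr1 : 1 ≤ r := NeZero.one_le
  have hr : (1:ℝ) ≤ r := by exact_mod_cast hr1
  have hlog : 0 ≤ Real.log r := Real.log_nonneg hr
  set ℓ := 2 + Real.log r with hℓ
  have hℓ2 : 2 ≤ ℓ := by linarith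
  have hR : 0 < 1/(2*ℓ) := by positivity
  have hi : 1/(2*ℓ) ≤ 1/4 := one_div_le_one_div_of_le (by norm_num) (by linarith)
  have e : 1/ℓ = 2 * (1/(2*ℓ)) := by field_simp
  have := Complex.norm_deriv_le_of_forall_mem_sphere_norm_le (c := s) (R := 1/(2*ℓ))
    (C := 60 * ℓ) (f := DirichletCharacter.LFunction χ) hR
    (DirichletCharacter.differentiable_LFunction hχ).diffContOnCl ?_
  · refine this.trans (le_of_eq ?_)
    field_simp; ring
  · intro z hz
    have hz' : ‖z - s‖ = 1/(2*ℓ) := by simpa [dist_eq_norm] using hz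
    apply L_log χ hχ z
    · have h1 := Complex.abs_re_le_norm (z - s)
      rw [hz', sub_re, abs_le] at h1
      rw [← hℓ, e]; linarith [h1.1]
    · have : ‖z‖ ≤ ‖z - s‖ + ‖s‖ := by simpa using norm_add_le (z - s) s
      linarith

end DSR
end

section
namespace DSR
open Complex Filter Topology

/-- The weight. -/
noncomputable def Fw (j n : ℕ) : ℝ := (Real.log n) ^ j / (n:ℝ)^2

lemma Fw_nonneg (j n : ℕ) : 0 ≤ Fw j n := by
  unfold Fw
  have : 0 ≤ Real.log n := Real.log_natCast_nonneg n
  positivity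

lemma Fw_zero (j : ℕ) : Fw j 0 = 0 := by simp [Fw]

lemma logMul_iter (f : ℕ → ℂ) (j n : ℕ) : (LSeries.logMul^[j] f) n = (Real.log n : ℂ)^j * f n := by
  induction j generalizing f with
  | zero => simp
  | succ j ih =>
    rw [Function.iterate_succ_apply, ih]
    simp only [LSeries.logMul, pow_succ]
    rw [← Complex.natCast_log]; ring

lemma term_logMul (f : ℕ → ℂ) (j n : ℕ) :
    LSeries.term (LSeries.logMul^[j] f) 2 n = f n * (Fw j n : ℂ) := by
  rcases eq_or_ne n 0 with rfl | hn
  · simp [Fw]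
  · rw [LSeries.term_of_ne_zero hn, logMul_iter]
    simp only [Fw]
    push_cast
    have : ((n:ℂ) ^ (2:ℂ)) = (n:ℂ)^2 := by
      exact_mod_cast Complex.cpow_natCast (n:ℂ) 2
    rw [this]; ring

lemma abscissa_le_one (f : ℕ → ℂ) (hf : ∀ s : ℂ, 1 < s.re → LSeriesSummable f s) :
    LSeries.abscissaOfAbsConv f ≤ 1 := by
  apply LSeries.abscissaOfAbsConv_le_of_forall_lt_LSeriesSummable
  intro y hy
  exact hf _ (by simpa using hy)

lemma sumF_eq (f : ℕ → ℂ) (hf : ∀ s : ℂ, 1 < s.re → LSeriesSummable f s) (H : ℂ → ℂ)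
    (hH : ∀ s : ℂ, 1 < s.re → H s = LSeries f s) (j : ℕ) :
    ∑' n, f n * (Fw j n : ℂ) = (-1)^j * iteratedDeriv j H 2 := by
  have h1 : LSeries.abscissaOfAbsConv f < ((2:ℂ).re : EReal) := by
    refine (abscissa_le_one f hf).trans_lt ?_
    simp
    exact_mod_cast (by norm_num : (1:ℝ) < 2)
  have h2 := LSeries_iteratedDeriv j h1
  have h3 : H =ᶠ[𝓝 2] LSeries f := by
    have hmem : {z : ℂ | 1 < z.re} ∈ 𝓝 (2:ℂ) :=
      (isOpen_lt continuous_const continuous_re).mem_nhds (by simp)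
    filter_upwards [hmem] with z hz using hH z hz
  rw [h3.iteratedDeriv_eq, h2, ← mul_assoc, ← mul_pow]
  simp only [mul_neg, mul_one, neg_neg, one_pow, one_mul, LSeries]
  exact tsum_congr fun n => (term_logMul f j n).symm

lemma sumF_summable (f : ℕ → ℂ) (hf : ∀ s : ℂ, 1 < s.re → LSeriesSummable f s) (j : ℕ) :
    Summable (fun n => f n * (Fw j n : ℂ)) := by
  have h1 : LSeries.abscissaOfAbsConv f < ((2:ℂ).re : EReal) := by
    refine (abscissa_le_one f hf).trans_lt ?_
    simp
    exact_mod_cast (by norm_num : (1:ℝ) < 2)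
  have : LSeriesSummable (LSeries.logMul^[j] f) 2 := by
    apply LSeriesSummable_of_abscissaOfAbsConv_lt_re
    rw [LSeries.absicssaOfAbsConv_logPowMul]
    exact h1
  exact (this : Summable _).congr fun n => (term_logMul f j n)

lemma sumF_bound (f : ℕ → ℂ) (hf : ∀ s : ℂ, 1 < s.re → LSeriesSummable f s) (H : ℂ → ℂ)
    (hH : ∀ s : ℂ, 1 < s.re → H s = LSeries f s) (j : ℕ) (ρ M : ℝ) (hρ : 0 < ρ)
    (hd : DiffContOnCl ℂ H (Metric.ball 2 ρ)) (hM : ∀ z ∈ Metric.sphere (2:ℂ) ρ, ‖H z‖ ≤ M) :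
    ‖∑' n, f n * (Fw j n : ℂ)‖ ≤ j.factorial * M / ρ^j := by
  rw [sumF_eq f hf H hH j, norm_mul]
  simp only [norm_pow, norm_neg, norm_one, one_pow, one_mul]
  exact Complex.norm_iteratedDeriv_le_of_forall_mem_sphere_norm_le j hρ hd hM

/-- trivial bound: log^i ≤ i! n^λ λ^{-i} -/
lemma log_pow_le (i n : ℕ) (hn : 1 ≤ n) (lam : ℝ) (hl : 0 < lam) :
    (Real.log n)^i ≤ i.factorial * (n:ℝ)^lam / lam^i := by
  have hn0 : (0:ℝ) < n := by positivity
  have h0 : 0 ≤ lam * Real.log n := by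
    have : 0 ≤ Real.log n := Real.log_natCast_nonneg n
    positivity
  have := Real.pow_div_factorial_le_exp (lam * Real.log n) h0 i
  rw [Real.rpow_def_of_pos hn0, mul_comm (Real.log n)]
  rw [div_le_iff₀ (by positivity)] at this
  rw [le_div_iff₀ (by positivity)]
  calc _ = (lam * Real.log n)^i := by rw [mul_pow]; ring
    _ ≤ _ := by linarith

lemma Fw_le (j n : ℕ) (hn : 1 ≤ n) (lam : ℝ) (hl : 0 < lam) :
    Fw j n ≤ j.factorial * (n:ℝ)^(lam - 2) / lam^j := by
  have hn0 : (0:ℝ) < n := by positivity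
  have := log_pow_le j n hn lam hl
  unfold Fw
  rw [Real.rpow_sub hn0, div_le_iff₀ (by positivity)]
  refine this.trans (le_of_eq ?_)
  have : (n:ℝ)^(2:ℝ) = (n:ℝ)^2 := by exact_mod_cast Real.rpow_natCast (n:ℝ) 2
  rw [this]; field_simp

noncomputable def psi {r : ℕ} (χ : DirichletCharacter ℂ r) (j : ℕ) : ℂ :=
  ∑' n : ℕ, (χ n * (ArithmeticFunction.vonMangoldt n : ℂ)) * (Fw j n : ℂ)

end DSR
end

section
namespace DSR
open Complex Filter Topology

lemma iter_deriv_pole (j : ℕ) : iteratedDeriv j (fun z : ℂ => (z - 1)⁻¹) 2 = (-1)^j * j.factorial := by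
  have := iter_deriv_inv_linear_sub j (1:ℂ) 1
  rw [iteratedDeriv_eq_iterate]
  simp only [one_mul] at this
  rw [this]
  norm_num

lemma sumF_pole (f : ℕ → ℂ) (hf : ∀ s : ℂ, 1 < s.re → LSeriesSummable f s) (H : ℂ → ℂ)
    (hH : ∀ s : ℂ, 1 < s.re → LSeries f s = H s + (s - 1)⁻¹) (j : ℕ) (ρ M : ℝ) (hρ : 0 < ρ)
    (hd : DiffContOnCl ℂ H (Metric.ball 2 ρ)) (hM : ∀ z ∈ Metric.sphere (2:ℂ) ρ, ‖H z‖ ≤ M) :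
    ‖∑' n, f n * (Fw j n : ℂ) - j.factorial‖ ≤ j.factorial * M / ρ^j := by
  rw [sumF_eq f hf (fun s => H s + (s-1)⁻¹) (fun s hs => (hH s hs).symm) j]
  have hHa : AnalyticAt ℂ H 2 := hd.differentiableOn.analyticAt (Metric.ball_mem_nhds _ hρ)
  have hp : AnalyticAt ℂ (fun z : ℂ => (z - 1)⁻¹) 2 :=
    (analyticAt_id.sub analyticAt_const).inv (by norm_num)
  rw [iteratedDeriv_fun_add hHa.contDiffAt hp.contDiffAt, iter_deriv_pole, mul_add, ← mul_assoc,
    ← mul_pow]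
  simp only [mul_neg, mul_one, neg_neg, one_pow, one_mul, add_sub_cancel_right]
  rw [norm_mul]
  simp only [norm_pow, norm_neg, norm_one, one_pow, one_mul]
  exact Complex.norm_iteratedDeriv_le_of_forall_mem_sphere_norm_le j hρ hd hM

/-- (s-1)ζ(s) -/
noncomputable def Zf : ℂ → ℂ := DirichletCharacter.LFunctionTrivChar₁ 1

lemma Zf_diff : Differentiable ℂ Zf := DirichletCharacter.differentiable_LFunctionTrivChar₁ 1

lemma Zf_one : Zf 1 = 1 := by simp [Zf]

lemma Zf_ne {s : ℂ} (hs : s ≠ 1) : Zf s = (s - 1) * riemannZeta s := by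
  simp only [Zf, DirichletCharacter.LFunctionTrivChar₁, DirichletCharacter.LFunctionTrivChar]
  rw [Function.update_of_ne hs, DirichletCharacter.LFunction_modOne_eq]

lemma exists_sphere_bound (H : ℂ → ℂ) (ρ : ℝ) (hc : ContinuousOn H (Metric.sphere 2 ρ)) :
    ∃ M : ℝ, 0 ≤ M ∧ ∀ z ∈ Metric.sphere (2:ℂ) ρ, ‖H z‖ ≤ M := by
  obtain ⟨M, hM⟩ := (isCompact_sphere (2:ℂ) ρ).exists_bound_of_continuousOn hc
  exact ⟨max M 0, le_max_right _ _, fun z hz => (hM z hz).trans (le_max_left _ _)⟩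

lemma sum_F : ∃ C : ℝ, 0 ≤ C ∧ ∀ j : ℕ,
    |∑' n, Fw j n - j.factorial| ≤ C * j.factorial / (3/2)^j := by
  have hE : Differentiable ℂ (dslope Zf 1) := by
    rw [← differentiableOn_univ]
    exact (Complex.differentiableOn_dslope Filter.univ_mem).mpr Zf_diff.differentiableOn
  obtain ⟨M, hM0, hM⟩ := exists_sphere_bound (dslope Zf 1) (3/2) hE.continuous.continuousOn
  refine ⟨M, hM0, fun j => ?_⟩
  have := sumF_pole 1 (fun s hs => LSeriesSummable_one_iff.mpr hs) (dslope Zf 1) ?_ j (3/2) M (by norm_num)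
    hE.diffContOnCl hM
  · simp only [Pi.one_apply, one_mul] at this
    rw [← Complex.ofReal_tsum] at this
    have e : ((∑' n, Fw j n : ℝ) : ℂ) - (j.factorial : ℂ) = ((∑' n, Fw j n - j.factorial : ℝ) : ℂ) := by
      push_cast; rfl
    rw [e, Complex.norm_real, Real.norm_eq_abs] at this
    rw [mul_comm M]; exact this
  · intro s hs
    have hs1 : s ≠ 1 := by rintro rfl; simp at hs
    rw [LSeries_one_eq_riemannZeta hs, dslope_of_ne _ hs1, slope_def_field, Zf_one, Zf_ne hs1]
    have : s - 1 ≠ 0 := sub_ne_zero.mpr hs1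
    field_simp; ring

lemma Zf_ne_zero {s : ℂ} (hs : 1 ≤ s.re) : Zf s ≠ 0 := by
  by_cases h : s = 1
  · rw [h, Zf_one]; exact one_ne_zero
  · rw [Zf_ne h]
    exact mul_ne_zero (sub_ne_zero.mpr h) (riemannZeta_ne_zero_of_one_le_re hs)

lemma exists_radius : ∃ ρ : ℝ, 1 < ρ ∧ ρ ≤ 3/2 ∧ ∀ s ∈ Metric.closedBall (2:ℂ) ρ, Zf s ≠ 0 := by
  have hK : IsCompact (Metric.closedBall (2:ℂ) 1) := isCompact_closedBall _ _
  have hU : IsOpen {s | Zf s ≠ 0} := isOpen_ne_fun Zf_diff.continuous continuous_const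
  have hsub : Metric.closedBall (2:ℂ) 1 ⊆ {s | Zf s ≠ 0} := by
    intro s hs
    apply Zf_ne_zero
    have h1 := Complex.abs_re_le_norm (s - 2)
    have h2 : ‖s - 2‖ ≤ 1 := by simpa [dist_eq_norm] using hs
    rw [sub_re, abs_le] at h1
    simp at h1; linarith
  obtain ⟨δ, hδ, h⟩ := hK.exists_cthickening_subset_open hU hsub
  refine ⟨1 + min δ (1/2), ?_, ?_, ?_⟩
  · have : 0 < min δ (1/2) := lt_min hδ (by norm_num)
    linarith
  · have := min_le_right δ (1/2); linarith
  · intro s hs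
    apply h
    rw [cthickening_closedBall hδ.le (by norm_num)]
    refine Metric.closedBall_subset_closedBall ?_ hs
    have := min_le_left δ (1/2); linarith

open ArithmeticFunction in
lemma sum_LF : ∃ C ρ : ℝ, 0 ≤ C ∧ 1 < ρ ∧ ∀ j : ℕ,
    |∑' n, (vonMangoldt n) * Fw j n - j.factorial| ≤ C * j.factorial / ρ^j := by
  obtain ⟨ρ, hρ1, _, hρ⟩ := exists_radius
  have hZd : Differentiable ℂ (deriv Zf) := Zf_diff.contDiff.differentiable_deriv_two
  set H : ℂ → ℂ := fun s => -(deriv Zf s / Zf s) with hH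
  have hHd : DifferentiableOn ℂ H (Metric.closedBall 2 ρ) := by
    intro s hs
    exact ((hZd s).div (Zf_diff s) (hρ s hs)).neg.differentiableWithinAt
  obtain ⟨M, hM0, hM⟩ := exists_sphere_bound H ρ (hHd.continuousOn.mono Metric.sphere_subset_closedBall)
  refine ⟨M, ρ, hM0, hρ1, fun j => ?_⟩
  have := sumF_pole (fun n => (vonMangoldt n : ℂ)) (fun s hs => LSeriesSummable_vonMangoldt hs) H ?_ j ρ M
    (by linarith) ?_ hM
  · have e0 : ∀ n, ((vonMangoldt n : ℝ) : ℂ) * (Fw j n : ℂ) = ((vonMangoldt n * Fw j n : ℝ) : ℂ) := by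
      intro n; push_cast; rfl
    simp_rw [e0] at this
    rw [← Complex.ofReal_tsum] at this
    have e : ((∑' n, vonMangoldt n * Fw j n : ℝ) : ℂ) - (j.factorial : ℂ) = ((∑' n, vonMangoldt n * Fw j n - j.factorial : ℝ) : ℂ) := by
      push_cast; rfl
    rw [e, Complex.norm_real, Real.norm_eq_abs] at this
    rw [mul_comm M]; exact this
  · intro s hs
    have hs1 : s ≠ 1 := by rintro rfl; simp at hs
    have hs1' : s - 1 ≠ 0 := sub_ne_zero.mpr hs1
    rw [LSeries_vonMangoldt_eq_deriv_riemannZeta_div hs]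
    have hz : riemannZeta s ≠ 0 := riemannZeta_ne_zero_of_one_lt_re hs
    have hd : deriv Zf s = (s - 1) * deriv riemannZeta s + riemannZeta s := by
      have := DirichletCharacter.deriv_LFunctionTrivChar₁_apply_of_ne_one 1 hs1
      rw [Zf, this]
      simp only [DirichletCharacter.LFunctionTrivChar, DirichletCharacter.LFunction_modOne_eq]
    rw [hH]; simp only
    rw [hd, Zf_ne hs1]
    field_simp; ring
  · refine (hHd.mono ?_).diffContOnCl
    exact Metric.closure_ball_subset_closedBall

end DSR
end

section
namespace DSR
open Complex Filter Topology DirichletCharacter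

noncomputable def prodChar {r₁ r₂ : ℕ} (χ₁ : DirichletCharacter ℂ r₁) (χ₂ : DirichletCharacter ℂ r₂) :
    DirichletCharacter ℂ (r₁ * r₂) :=
  changeLevel (Nat.dvd_mul_right r₁ r₂) χ₁ * changeLevel (Nat.dvd_mul_left r₂ r₁) χ₂

lemma char_nat_eq_zero {r : ℕ} (χ : DirichletCharacter ℂ r) {n : ℕ} (h : ¬ n.Coprime r) :
    χ (n : ZMod r) = 0 := by
  apply MulChar.map_nonunit
  rwa [ZMod.isUnit_iff_coprime]

lemma changeLevel_nat {r m : ℕ} (χ : DirichletCharacter ℂ r) (hm : r ∣ m) {n : ℕ} (h : n.Coprime m) :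
    changeLevel hm χ (n : ZMod m) = χ (n : ZMod r) := by
  have := changeLevel_eq_cast_of_dvd' χ hm (a := (n:ℤ)) (by exact_mod_cast Nat.isCoprime_iff_coprime.mpr h)
  simpa using this

lemma prodChar_apply {r₁ r₂ : ℕ} (χ₁ : DirichletCharacter ℂ r₁) (χ₂ : DirichletCharacter ℂ r₂) (n : ℕ) :
    prodChar χ₁ χ₂ (n : ZMod (r₁ * r₂)) = χ₁ (n : ZMod r₁) * χ₂ (n : ZMod r₂) := by
  by_cases h : n.Coprime (r₁ * r₂)
  · rw [prodChar, MulChar.mul_apply, changeLevel_nat _ _ h, changeLevel_nat _ _ h]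
  · rw [char_nat_eq_zero _ h]
    rw [Nat.coprime_mul_iff_right, not_and_or] at h
    rcases h with h | h
    · rw [char_nat_eq_zero _ h, zero_mul]
    · rw [char_nat_eq_zero χ₂ h, mul_zero]

lemma prodChar_ne_one {r₁ r₂ : ℕ} [NeZero r₁] [NeZero r₂] (χ₁ : DirichletCharacter ℂ r₁)
    (χ₂ : DirichletCharacter ℂ r₂) (h1 : χ₁.IsPrimitive) (h2 : χ₂.IsPrimitive) (hne : r₁ ≠ r₂) :
    prodChar χ₁ χ₂ ≠ 1 := by
  intro h
  have h3 := eq_inv_of_mul_eq_one_left h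
  have h4 := congrArg DirichletCharacter.conductor h3
  rw [conductor_inv, conductor_changeLevel, conductor_changeLevel] at h4
  rw [h1, h2] at h4
  exact hne h4

lemma prodChar_ne_one' {r : ℕ} [NeZero r] (χ₁ χ₂ : DirichletCharacter ℂ r) (hne : χ₁ ≠ χ₂) :
    prodChar χ₁ χ₂⁻¹ ≠ 1 := by
  intro h
  have h3 := eq_inv_of_mul_eq_one_left h
  rw [← map_inv, inv_inv] at h3
  have e : Nat.dvd_mul_left r r = Nat.dvd_mul_right r r := rfl
  exact hne (changeLevel_injective _ h3)

/-- zeta bound via series -/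
lemma norm_LSeries_le (f : ℕ → ℂ) (hf : ∀ n, ‖f n‖ ≤ 1) (s : ℂ) (x : ℝ) (hx : 0 < x) (hx1 : x ≤ 1)
    (hs : 1 + x ≤ s.re) :
    ‖LSeries f s‖ ≤ 2 / x := by
  have h1 := zeta_tail x hx 1 le_rfl
  set a : ℕ → ℝ := fun n => if n = 0 then 0 else (n:ℝ)^(-x-1) with ha
  have hsum : Summable a := by
    rw [← summable_nat_add_iff 2]
    refine h1.1.congr fun i => ?_
    simp [ha, add_assoc, one_add_one_eq_two]
  have hle : ∀ n, ‖LSeries.term f s n‖ ≤ a n := by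
    intro n
    rw [LSeries.norm_term_eq]
    simp only [ha]
    split_ifs with h
    · exact le_rfl
    · have hn : (1:ℝ) ≤ n := by exact_mod_cast Nat.one_le_iff_ne_zero.mpr h
      rw [show -x-1 = -(1+x) by ring, Real.rpow_neg (by positivity), ← one_div]
      gcongr
      exact hf n
  refine (tsum_of_norm_bounded hsum.hasSum hle).trans ?_
  rw [← hsum.sum_add_tsum_nat_add 2]
  have e : ∀ i, a (i + 2) = ((i + 1 + 1 : ℕ):ℝ)^(-x-1) := by intro i; simp [ha, add_assoc, one_add_one_eq_two]
  simp_rw [e]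
  have h2 := h1.2
  simp only [Nat.cast_one, Real.one_rpow] at h2
  have h3 : ∑ i ∈ Finset.range 2, a i = 1 := by simp [Finset.sum_range_succ, ha]
  rw [h3]
  have : 1 ≤ 1/x := by rw [le_div_iff₀ hx]; linarith
  calc _ ≤ 1 + 1/x := by linarith
    _ ≤ 1/x + 1/x := by linarith
    _ = 2/x := by ring

lemma local_ineq (t : ℝ) (ht0 : 0 ≤ t) (ht : t < 1) (a b : ℂ) (ha : a = 0 ∨ a = 1 ∨ a = -1)
    (hb : b = 0 ∨ b = 1 ∨ b = -1) :
    0 ≤ (-log (1 - t)).re + (-log (1 - a * t)).re + (-log (1 - b * t)).re + (-log (1 - a * b * t)).re := by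
  have e1 : (log (1 - (t:ℂ))).re = Real.log (1 - t) := by
    rw [Complex.log_re]; congr 1
    rw [← Complex.ofReal_one, ← Complex.ofReal_sub, Complex.norm_real, Real.norm_eq_abs, abs_of_pos (by linarith)]
  have e2 : (log (1 + (t:ℂ))).re = Real.log (1 + t) := by
    rw [Complex.log_re]; congr 1
    rw [← Complex.ofReal_one, ← Complex.ofReal_add, Complex.norm_real, Real.norm_eq_abs, abs_of_pos (by linarith)]
  have l1 : Real.log (1 - t) ≤ 0 := Real.log_nonpos (by linarith) (by linarith)
  have l2 : Real.log (1 - t) + Real.log (1 + t) ≤ 0 := by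
    rw [← Real.log_mul (by linarith) (by linarith)]
    exact Real.log_nonpos (by nlinarith) (by nlinarith)
  rcases ha with rfl | rfl | rfl <;> rcases hb with rfl | rfl | rfl <;>
    simp [e1, e2] <;> linarith

lemma real_vals {r : ℕ} (χ : DirichletCharacter ℂ r) (h : χ ^ 2 = 1) (n : ZMod r) :
    χ n = 0 ∨ χ n = 1 ∨ χ n = -1 := by
  by_cases hn : IsUnit n
  · right
    have : (χ n)^2 = 1 := by
      rw [← MulChar.pow_apply' χ two_ne_zero, h, MulChar.one_apply hn]
    rcases mul_eq_zero.mp (show (χ n - 1) * (χ n + 1) = 0 by linear_combination this) with h | h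
    · left; exact sub_eq_zero.mp h
    · right; exact eq_neg_of_add_eq_zero_left h
  · left; exact MulChar.map_nonunit _ hn

lemma pair_prod {r₁ r₂ : ℕ} (χ₁ : DirichletCharacter ℂ r₁) (χ₂ : DirichletCharacter ℂ r₂)
    (h1 : χ₁^2 = 1) (h2 : χ₂^2 = 1) (x : ℝ) (hx : 0 < x) :
    1 ≤ ‖LSeries (fun n => (1 : DirichletCharacter ℂ 1) n) (1+x) * LSeries (fun n => χ₁ n) (1+x) *
      LSeries (fun n => χ₂ n) (1+x) * LSeries (fun n => prodChar χ₁ χ₂ n) (1+x)‖ := by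
  have hs : 1 < (1 + x : ℂ).re := by simp [hx]
  have H₀ := summable_neg_log_one_sub_mul_prime_cpow (1 : DirichletCharacter ℂ 1) hs
  have H₁ := summable_neg_log_one_sub_mul_prime_cpow χ₁ hs
  have H₂ := summable_neg_log_one_sub_mul_prime_cpow χ₂ hs
  have H₃ := summable_neg_log_one_sub_mul_prime_cpow (prodChar χ₁ χ₂) hs
  rw [← LSeries_eulerProduct_exp_log _ hs, ← LSeries_eulerProduct_exp_log χ₁ hs,
    ← LSeries_eulerProduct_exp_log _ hs, ← LSeries_eulerProduct_exp_log _ hs]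
  rw [← Complex.exp_add, ← Complex.exp_add, ← Complex.exp_add, Complex.norm_exp, Real.one_le_exp_iff,
    ← H₀.tsum_add H₁, ← (H₀.add H₁).tsum_add H₂, ← ((H₀.add H₁).add H₂).tsum_add H₃,
    re_tsum (((H₀.add H₁).add H₂).add H₃)]
  refine tsum_nonneg fun p => ?_
  have hp : (2:ℝ) ≤ (p:ℕ) := by exact_mod_cast p.prop.two_le
  have ht : ((p:ℕ):ℂ)^(-(1+x:ℂ)) = ((((p:ℕ):ℝ)^(-(1+x)) : ℝ) : ℂ) := by
    rw [Complex.ofReal_cpow (by positivity)]; push_cast; rfl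
  have ht1 : (((p:ℕ):ℝ)^(-(1+x)) : ℝ) < 1 := Real.rpow_lt_one_of_one_lt_of_neg (by linarith) (by linarith)
  have := local_ineq (((p:ℕ):ℝ)^(-(1+x))) (by positivity) ht1 (χ₁ (p:ℕ)) (χ₂ (p:ℕ))
    (real_vals χ₁ h1 _) (real_vals χ₂ h2 _)
  rw [ht, prodChar_apply]
  have e1 : (1 : DirichletCharacter ℂ 1) ((p:ℕ) : ZMod 1) = 1 := by
    apply MulChar.one_apply; exact isUnit_of_subsingleton _
  rw [e1, one_mul]
  simpa only [add_re] using this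

lemma L_lip {r : ℕ} [NeZero r] (χ : DirichletCharacter ℂ r) (hχ : χ ≠ 1) (ℓ : ℝ)
    (hℓ : 2 + Real.log r ≤ ℓ) (s : ℂ) (hs : 1 - 1/(2*ℓ) ≤ s.re) (hs' : ‖s‖ ≤ 7/2) :
    ‖LFunction χ s - LFunction χ 1‖ ≤ 120 * ℓ^2 * ‖s - 1‖ := by
  have hr1 : 1 ≤ r := NeZero.one_le
  have hlog : 0 ≤ Real.log r := Real.log_nonneg (by exact_mod_cast hr1)
  have hconv : Convex ℝ ({s : ℂ | 1 - 1/(2*ℓ) ≤ s.re} ∩ Metric.closedBall 0 (7/2)) :=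
    (convex_halfSpace_re_ge _).inter (convex_closedBall _ _)
  refine hconv.norm_image_sub_le_of_norm_deriv_le (f := LFunction χ) (C := 120 * ℓ^2) ?_ ?_ ?_ ?_
  · intro z _; exact (differentiable_LFunction hχ) z
  · intro z hz
    refine (L_deriv χ hχ z ?_ (by simpa using hz.2)).trans ?_
    · refine le_trans ?_ hz.1
      gcongr
    · gcongr
  · refine ⟨?_, ?_⟩
    · have : 0 < 1/(2*ℓ) := by have : 0 < ℓ := by linarith
                               positivity
      simp only [Set.mem_setOf_eq, one_re]; linarith
    · simp; norm_num
  · exact ⟨hs, by simpa using hs'⟩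

lemma norm_one_add (x : ℝ) (hx : 0 < x) (hx1 : x ≤ 1) : ‖(1 + x : ℂ)‖ ≤ 2 := by
  refine (norm_add_le _ _).trans ?_
  rw [norm_one, Complex.norm_real, Real.norm_eq_abs, abs_of_pos hx]; linarith

lemma L_log' {r : ℕ} [NeZero r] (χ : DirichletCharacter ℂ r) (hχ : χ ≠ 1) (ℓ : ℝ)
    (hℓ : 2 + Real.log r ≤ ℓ) (x : ℝ) (hx : 0 < x) (hx1 : x ≤ 1) :
    ‖LFunction χ (1 + x)‖ ≤ 60 * ℓ := by
  have hr1 : 1 ≤ r := NeZero.one_le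
  have hlog : 0 ≤ Real.log r := Real.log_nonneg (by exact_mod_cast hr1)
  refine (L_log χ hχ (1+x) ?_ ?_).trans (by gcongr)
  · have : 0 < 1/(2 + Real.log r) := by positivity
    simp only [add_re, one_re, ofReal_re]; linarith
  · have := norm_one_add x hx hx1; linarith

lemma L_step {r : ℕ} [NeZero r] (χ : DirichletCharacter ℂ r) (hχ : χ ≠ 1) (ℓ : ℝ)
    (hℓ : 2 + Real.log r ≤ ℓ) (x : ℝ) (hx : 0 < x) (hx1 : x ≤ 1) :
    ‖LFunction χ (1 + x)‖ ≤ ‖LFunction χ 1‖ + 120 * ℓ^2 * x := by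
  have hr1 : 1 ≤ r := NeZero.one_le
  have hlog : 0 ≤ Real.log r := Real.log_nonneg (by exact_mod_cast hr1)
  have := L_lip χ hχ ℓ hℓ (1+x) ?_ ?_
  · have h2 : ‖(1 + x - 1 : ℂ)‖ = x := by simp [abs_of_pos hx]
    rw [h2] at this
    have h3 := norm_sub_norm_le (LFunction χ (1+x)) (LFunction χ 1)
    linarith
  · have : 0 < 1/(2 * ℓ) := by have : 0 < ℓ := by linarith
                               positivity
    simp only [add_re, one_re, ofReal_re]; linarith
  · have := norm_one_add x hx hx1; linarith

lemma lower_nonreal {r : ℕ} [NeZero r] (χ : DirichletCharacter ℂ r) (hχ : χ^2 ≠ 1) (ℓ : ℝ)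
    (hℓ : 2 + Real.log r ≤ ℓ) : (1/10^11) / ℓ^7 ≤ ‖LFunction χ 1‖ := by
  have hχ1 : χ ≠ 1 := by rintro rfl; simp at hχ
  have hr1 : 1 ≤ r := NeZero.one_le
  have hlog : 0 ≤ Real.log r := Real.log_nonneg (by exact_mod_cast hr1)
  have hℓ2 : 2 ≤ ℓ := by linarith
  by_contra hcon
  push Not at hcon
  set x : ℝ := (1/10^13) / ℓ^9 with hx
  have hx0 : 0 < x := by positivity
  have hx1 : x ≤ 1 := by
    rw [hx, div_le_one (by positivity)]
    have : (1:ℝ) ≤ ℓ^9 := one_le_pow₀ (by linarith)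
    linarith
  have h1 := norm_LFunction_product_ge_one χ hx0 0
  simp only [ofReal_zero, mul_zero, add_zero] at h1
  rw [norm_mul, norm_mul, norm_pow, norm_pow] at h1
  have a1 : ‖LFunctionTrivChar r (1 + x)‖ ≤ 2 / x := by
    rw [LFunctionTrivChar, LFunction_eq_LSeries _ (by simp [hx0])]
    exact norm_LSeries_le _ (fun n => norm_le_one _ _) _ x hx0 hx1 (by simp)
  have a2 : ‖LFunction χ (1 + x)‖ ≤ 240 * (1/10^13) / ℓ^7 := by
    refine (L_step χ hχ1 ℓ hℓ x hx0 hx1).trans ?_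
    have : 120 * ℓ^2 * x = 120 * (1/10^13) / ℓ^7 := by rw [hx]; field_simp
    rw [this]
    have e : 240 * (1/10^13) / ℓ^7 = 120 * (1/10^13) / ℓ^7 + 120 * (1/10^13) / ℓ^7 := by ring
    rw [e]
    have : (1/10^11) / ℓ^7 ≤ 120 * (1/10^13) / ℓ^7 := by gcongr; norm_num
    linarith
  have a3 : ‖LFunction (χ^2) (1 + x)‖ ≤ 60 * ℓ := L_log' (χ^2) hχ ℓ hℓ x hx0 hx1
  have : (1:ℝ) ≤ (2/x)^3 * (240 * (1/10^13) / ℓ^7)^4 * (60 * ℓ) := by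
    refine le_trans h1 ?_
    gcongr
  have e : (2/x)^3 * (240 * (1/10^13) / ℓ^7)^4 * (60 * ℓ) = 8 * 10^39 * (240 * (1/10^13))^4 * 60 := by
    rw [hx]; field_simp; norm_num
  rw [e] at this
  norm_num at this

lemma lower_real_pair {r₁ r₂ : ℕ} [NeZero r₁] [NeZero r₂] (χ₁ : DirichletCharacter ℂ r₁)
    (χ₂ : DirichletCharacter ℂ r₂) (h1 : χ₁.IsPrimitive) (h2 : χ₂.IsPrimitive)
    (hc1 : χ₁ ≠ 1) (hc2 : χ₂ ≠ 1) (hne : r₁ ≠ r₂)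
    (hs1 : χ₁^2 = 1) (hs2 : χ₂^2 = 1) (ℓ : ℝ) (hℓ : 2 + Real.log r₁ + Real.log r₂ ≤ ℓ)
    (hb1 : ‖LFunction χ₁ 1‖ < (1/10^11) / ℓ^7) (hb2 : ‖LFunction χ₂ 1‖ < (1/10^11) / ℓ^7) : False := by
  have hr1 : 1 ≤ r₁ := NeZero.one_le
  have hr2 : 1 ≤ r₂ := NeZero.one_le
  have hlog1 : 0 ≤ Real.log r₁ := Real.log_nonneg (by exact_mod_cast hr1)
  have hlog2 : 0 ≤ Real.log r₂ := Real.log_nonneg (by exact_mod_cast hr2)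
  have hℓ2 : 2 ≤ ℓ := by linarith
  set x : ℝ := (1/10^13) / ℓ^9 with hx
  have hx0 : 0 < x := by positivity
  have hx1 : x ≤ 1 := by
    rw [hx, div_le_one (by positivity)]
    have : (1:ℝ) ≤ ℓ^9 := one_le_pow₀ (by linarith)
    linarith
  have hre : 1 < (1 + x : ℂ).re := by simp [hx0]
  have key := pair_prod χ₁ χ₂ hs1 hs2 x hx0
  rw [← LFunction_eq_LSeries χ₁ hre, ← LFunction_eq_LSeries χ₂ hre, ← LFunction_eq_LSeries (prodChar χ₁ χ₂) hre,
    norm_mul, norm_mul, norm_mul] at key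
  have a1 : ‖LSeries (fun n => (1 : DirichletCharacter ℂ 1) n) (1+x)‖ ≤ 2/x :=
    norm_LSeries_le _ (fun n => norm_le_one _ _) _ x hx0 hx1 (by simp)
  have st : ∀ {r : ℕ} [NeZero r] (χ : DirichletCharacter ℂ r) (hχ : χ ≠ 1) (hr : 2 + Real.log r ≤ ℓ)
      (hb : ‖LFunction χ 1‖ < (1/10^11) / ℓ^7), ‖LFunction χ (1 + x)‖ ≤ 240 * (1/10^13) / ℓ^7 := by
    intro r _ χ hχ hr hb
    refine (L_step χ hχ ℓ hr x hx0 hx1).trans ?_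
    have : 120 * ℓ^2 * x = 120 * (1/10^13) / ℓ^7 := by rw [hx]; field_simp
    rw [this]
    have e : 240 * (1/10^13) / ℓ^7 = 120 * (1/10^13) / ℓ^7 + 120 * (1/10^13) / ℓ^7 := by ring
    rw [e]
    have : (1/10^11) / ℓ^7 ≤ 120 * (1/10^13) / ℓ^7 := by gcongr; norm_num
    linarith
  have a2 := st χ₁ hc1 (by linarith) hb1
  have a3 := st χ₂ hc2 (by linarith) hb2
  have a4 : ‖LFunction (prodChar χ₁ χ₂) (1+x)‖ ≤ 60 * ℓ := by
    refine L_log' _ (prodChar_ne_one χ₁ χ₂ h1 h2 hne) ℓ ?_ x hx0 hx1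
    push_cast
    rw [Real.log_mul (by positivity) (by positivity)]; linarith
  have : (1:ℝ) ≤ (2/x) * (240 * (1/10^13) / ℓ^7) * (240 * (1/10^13) / ℓ^7) * (60 * ℓ) := by
    refine le_trans key ?_
    gcongr
  have e : (2/x) * (240 * (1/10^13) / ℓ^7) * (240 * (1/10^13) / ℓ^7) * (60 * ℓ) =
      2 * 10^13 * (240 * (1/10^13))^2 * 60 / ℓ^4 := by
    rw [hx]; field_simp
  rw [e, le_div_iff₀ (by positivity)] at this
  have h5 : (1:ℝ) ≤ ℓ^4 := one_le_pow₀ (by linarith)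
  norm_num at this
  linarith

end DSR
end

section
namespace DSR
open Complex Filter Topology DirichletCharacter

lemma inv_L_bound {r : ℕ} [NeZero r] (χ : DirichletCharacter ℂ r) (s : ℂ) (x : ℝ) (hx : 0 < x) (hx1 : x ≤ 1)
    (hs : 1 + x ≤ s.re) : 1 ≤ ‖LFunction χ s‖ * (2 / x) := by
  have hs1 : 1 < s.re := by linarith
  have h := LSeries.mul_mu_eq_one χ hs1
  rw [← LFunction_eq_LSeries χ hs1] at h
  have h2 := congrArg norm h
  rw [norm_mul, norm_one] at h2
  rw [← h2]
  refine mul_le_mul_of_nonneg_left ?_ (norm_nonneg _)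
  refine norm_LSeries_le _ (fun n => ?_) s x hx hx1 hs
  simp only [Pi.mul_apply, norm_mul]
  have h3 := χ.norm_le_one n
  have h4 : ‖((ArithmeticFunction.moebius n : ℤ) : ℂ)‖ ≤ 1 := by
    rw [Complex.norm_intCast]
    exact_mod_cast ArithmeticFunction.abs_moebius_le_one
  calc _ ≤ (1:ℝ) * 1 := by gcongr
    _ = 1 := by norm_num

lemma psi_eq {r : ℕ} [NeZero r] (χ : DirichletCharacter ℂ r) {s : ℂ} (hs : 1 < s.re) :
    -(deriv (LFunction χ) s / LFunction χ s) =
      LSeries (fun n => χ n * (ArithmeticFunction.vonMangoldt n : ℂ)) s := by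
  have := LSeries_twist_vonMangoldt_eq χ hs
  rw [deriv_LFunction_eq_deriv_LSeries χ hs, LFunction_eq_LSeries χ hs, ← neg_div, ← this]
  rfl

lemma deriv_L_diff {r : ℕ} [NeZero r] (χ : DirichletCharacter ℂ r) (hχ : χ ≠ 1) :
    Differentiable ℂ (deriv (LFunction χ)) :=
  (differentiable_LFunction hχ).contDiff.differentiable_deriv_two

lemma psi_nonbad {r : ℕ} [NeZero r] (χ : DirichletCharacter ℂ r) (hχ : χ ≠ 1) (ℓ δ η : ℝ)
    (hℓ : 2 + Real.log r ≤ ℓ) (hη : 0 < η) (hδ1 : δ ≤ 1) (hηδ : 720 * ℓ^2 * η ≤ δ)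
    (hδ : δ ≤ ‖LFunction χ 1‖) (j : ℕ) :
    ‖psi χ j‖ ≤ j.factorial * (240 * ℓ^2 / η^2) / (1 + η^2)^j := by
  have hr1 : 1 ≤ r := NeZero.one_le
  have hlog : 0 ≤ Real.log r := Real.log_nonneg (by exact_mod_cast hr1)
  have hℓ2 : 2 ≤ ℓ := by linarith
  have hη3 : 1440 * ℓ * η ≤ 1 := by nlinarith [mul_pos (by linarith : 0 < ℓ) hη]
  have hη1 : η ≤ 1/2000 := by nlinarith
  have hεη : η^2 ≤ η := by nlinarith
  have hηδ' : η ≤ δ := by nlinarith [mul_pos (by linarith : 0 < ℓ) hη]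
  have hε2 : η^2 ≤ 1/(2*ℓ) := by
    rw [le_div_iff₀ (by positivity)]; nlinarith
  -- lower bound for L
  have key : ∀ s ∈ Metric.closedBall (2:ℂ) (1 + η^2), 1 - η^2 ≤ s.re ∧ ‖s‖ ≤ 7/2 ∧ 
      η^2/2 ≤ ‖LFunction χ s‖ := by
    intro s hs
    have hs2 : ‖s - 2‖ ≤ 1 + η^2 := by simpa [dist_eq_norm] using hs
    have h1 := Complex.abs_re_le_norm (s - 2)
    rw [sub_re, abs_le] at h1
    simp only [re_ofNat] at h1
    have hre : 1 - η^2 ≤ s.re := by linarith [h1.1]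
    have hnorm : ‖s‖ ≤ 7/2 := by
      have : ‖s‖ ≤ ‖s - 2‖ + ‖(2:ℂ)‖ := by simpa using norm_add_le (s - 2) 2
      simp only [Complex.norm_ofNat] at this
      nlinarith
    refine ⟨hre, hnorm, ?_⟩
    by_cases hc : 1 + η^2 ≤ s.re
    · have := inv_L_bound χ s (η^2) (by positivity) (by nlinarith) hc
      have e : ‖LFunction χ s‖ * (2/η^2) = ‖LFunction χ s‖ / (η^2/2) := by field_simp
      rw [e, le_div_iff₀ (by positivity)] at this
      linarith
    · push Not at hc
      have hsq : ‖s - 1‖^2 ≤ (3*η)^2 := by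
        have e1 : ‖s - 2‖^2 = (s.re - 2)^2 + s.im^2 := by
          rw [Complex.sq_norm, Complex.normSq_apply]; simp; ring
        have e2 : ‖s - 1‖^2 = (s.re - 1)^2 + s.im^2 := by
          rw [Complex.sq_norm, Complex.normSq_apply]; simp; ring
        have e3 : ‖s - 2‖^2 ≤ (1 + η^2)^2 := by gcongr
        nlinarith
      have hs1 : ‖s - 1‖ ≤ 3 * η := by
        exact le_of_sq_le_sq hsq (by positivity) 
      have hl := L_lip χ hχ ℓ hℓ s (by linarith) hnorm
      have h3 := norm_sub_norm_le (LFunction χ 1) (LFunction χ s)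
      rw [norm_sub_rev] at h3
      have h4 : 120 * ℓ^2 * ‖s - 1‖ ≤ 120 * ℓ^2 * (3 * η) := by gcongr
      nlinarith
  have hne : ∀ s ∈ Metric.closedBall (2:ℂ) (1 + η^2), LFunction χ s ≠ 0 := by
    intro s hs h0
    have := (key s hs).2.2
    rw [h0, norm_zero] at this
    have : 0 < η^2/2 := by positivity
    linarith
  have hd : DifferentiableOn ℂ (fun s => -(deriv (LFunction χ) s / LFunction χ s)) (Metric.closedBall (2:ℂ) (1 + η^2)) := by
    intro s hs
    exact ((deriv_L_diff χ hχ s).div (differentiable_LFunction hχ s) (hne s hs)).neg.differentiableWithinAt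
  refine sumF_bound (fun n => χ n * (ArithmeticFunction.vonMangoldt n : ℂ)) 
    (fun s hs => LSeriesSummable_twist_vonMangoldt χ hs)
    (fun s => -(deriv (LFunction χ) s / LFunction χ s)) (fun s hs => psi_eq χ hs) j (1 + η^2) _ (by positivity)
    (hd.mono Metric.closure_ball_subset_closedBall).diffContOnCl ?_
  intro s hs
  have hs' := Metric.sphere_subset_closedBall hs
  obtain ⟨k1, k2, k3⟩ := key s hs'
  rw [norm_neg, norm_div]
  have h5 : ‖deriv (LFunction χ) s‖ ≤ 120 * ℓ^2 := by
    refine (L_deriv χ hχ s ?_ k2).trans (by gcongr)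
    have : 1/(2*ℓ) ≤ 1/(2*(2 + Real.log r)) := by gcongr
    linarith
  calc _ ≤ 120 * ℓ^2 / (η^2/2) := by gcongr
    _ = _ := by field_simp; ring

/-- ell -/
noncomputable def ellA (A : ℕ) (j : ℕ) : ℝ := 2 + 2 * A * Real.log j

lemma ev1 (A : ℕ) : ∀ᶠ j : ℕ in atTop, 720 * (ellA A j)^9 * (j:ℝ)^(-(1/4:ℝ)) ≤ (1/10^11) := by
  have h1 : Tendsto (fun x : ℝ => (2 + 2 * A * Real.log x) / x^(1/36:ℝ)) atTop (𝓝 0) := by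
    have a := (isLittleO_log_rpow_atTop (show (0:ℝ) < 1/36 by norm_num)).tendsto_div_nhds_zero
    have b := (tendsto_rpow_neg_atTop (show (0:ℝ) < 1/36 by norm_num)).const_mul 2
    have c := b.add (a.const_mul (2 * (A:ℝ)))
    simp only [mul_zero, add_zero] at c
    refine c.congr' ?_
    filter_upwards [eventually_gt_atTop 0] with x hx
    rw [Real.rpow_neg hx.le]; field_simp
  have h2 := (h1.pow 9).const_mul 720
  simp only [ne_eq, OfNat.ofNat_ne_zero, not_false_eq_true, zero_pow, mul_zero] at h2
  have h3 := (h2.comp tendsto_natCast_atTop_atTop).eventually (ge_mem_nhds (show (0:ℝ) < (1/10^11) by norm_num))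
  filter_upwards [h3, eventually_gt_atTop 0] with j hj hj0
  have hj0' : (0:ℝ) < j := by exact_mod_cast hj0
  simp only [Function.comp] at hj
  refine le_trans (le_of_eq ?_) hj
  rw [div_pow, ellA, ← Real.rpow_natCast ((j:ℝ)^(1/36:ℝ)) 9, ← Real.rpow_mul hj0'.le]
  norm_num
  rw [Real.rpow_neg hj0'.le]; field_simp

lemma ev2 (A B : ℕ) : ∀ᶠ j : ℕ in atTop, 240 * (ellA A j)^2 / ((j:ℝ)^(-(1/4:ℝ)))^2 / (1 + ((j:ℝ)^(-(1/4:ℝ)))^2)^j ≤ 1/(j:ℝ)^B := by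
  have h1 : ∀ᶠ x : ℝ in atTop, 2 + 2 * A * Real.log x ≤ x := by
    have a := Real.isLittleO_log_id_atTop.tendsto_div_nhds_zero
    have b := (tendsto_inv_atTop_zero (𝕜 := ℝ)).const_mul 2
    have c := b.add (a.const_mul (2 * (A:ℝ)))
    simp only [mul_zero, add_zero] at c
    filter_upwards [c.eventually (ge_mem_nhds (show (0:ℝ) < 1 by norm_num)), eventually_gt_atTop 0] with x hx hx0
    simp only [id] at hx
    have : 2 * x⁻¹ + 2 * A * (Real.log x / x) = (2 + 2 * A * Real.log x)/x := by field_simp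
    rw [this, div_le_one hx0] at hx
    exact hx
  have h2 : ∀ᶠ u : ℝ in atTop, u^(2*B+8) ≤ Real.exp (1/2 * u) := by
    have := (isLittleO_pow_exp_pos_mul_atTop (2*B+8) (show (0:ℝ) < 1/2 by norm_num)).bound (show (0:ℝ) < 1 by norm_num)
    filter_upwards [this, eventually_gt_atTop 0] with u hu hu0
    rw [Real.norm_eq_abs, Real.norm_eq_abs, abs_of_pos (by positivity), abs_of_pos (by positivity)] at hu
    linarith
  have h2' := (Real.tendsto_sqrt_atTop.comp tendsto_natCast_atTop_atTop).eventually h2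
  filter_upwards [tendsto_natCast_atTop_atTop.eventually h1, h2', eventually_ge_atTop 240] with j a b hj
  have hj0 : (240:ℝ) ≤ j := by exact_mod_cast hj
  have hsq : ((j:ℝ)^(-(1/4:ℝ)))^2 = 1/Real.sqrt j := by
    rw [← Real.rpow_natCast, ← Real.rpow_mul (by positivity), Real.sqrt_eq_rpow,
      show (-(1/4:ℝ)*((2:ℕ):ℝ)) = -(1/2) by norm_num, Real.rpow_neg (by positivity), one_div]
    norm_num
  rw [hsq]
  set u := Real.sqrt j with hu
  have hu0 : 0 < u := Real.sqrt_pos.mpr (by linarith)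
  have hju : (j:ℝ) = u^2 := (Real.sq_sqrt (by linarith)).symm
  have hu1 : 1 ≤ u := by rw [hu]; exact Real.one_le_sqrt.mpr (by linarith)
  have hexp : Real.exp (1/2*u) ≤ (1 + 1/u)^j := by
    have hy : Real.exp (1/u/2) ≤ 1 + 1/u := by
      have hy1 : 1/u ≤ 1 := by rw [div_le_one hu0]; exact hu1
      have hy0 : 0 < 1/u := by positivity
      have := Real.exp_bound_div_one_sub_of_interval (x := 1/u/2) (by positivity) (by linarith)
      refine this.trans ?_
      rw [div_le_iff₀ (by linarith)]
      nlinarith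
    calc Real.exp (1/2*u) = (Real.exp (1/u/2))^j := by
          rw [← Real.exp_nat_mul, hju]; congr 1; field_simp
      _ ≤ _ := by gcongr
  have hell0 : 0 ≤ ellA A j := by
    unfold ellA
    have : 0 ≤ Real.log j := Real.log_natCast_nonneg j
    positivity
  have hell : ellA A j ≤ u^2 := by rw [← hju]; exact a
  simp only [Function.comp] at b
  rw [div_le_div_iff₀ (by positivity) (by positivity), one_mul]
  refine le_trans ?_ (b.trans hexp)
  have h240 : (240:ℝ) ≤ u^2 := by rw [← hju]; exact hj0
  calc 240 * (ellA A j)^2 / (1/u) * (j:ℝ)^B ≤ u^2 * (u^2)^2 / (1/u) * (j:ℝ)^B := by gcongr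
    _ = u^(2*B+7) := by rw [hju]; field_simp; ring
    _ ≤ u^(2*B+8) := pow_le_pow_right₀ hu1 (by omega)

lemma psi_small (A B W : ℕ) (hW : W ≠ 0) : ∀ᶠ j : ℕ in atTop, ∃ rs : ℕ, ∀ r : ℕ, 1 < r → r ≤ j^A →
    (r ≠ rs ∨ r ∣ W) → ∀ χ : DirichletCharacter ℂ r, χ.IsPrimitive → χ ≠ 1 →
    ‖psi χ j‖ ≤ j.factorial / (j:ℝ)^B := by
  have hfix : ∀ᶠ j : ℕ in atTop, ∀ r ∈ W.divisors, ∀ _ : NeZero r, ∀ χ : DirichletCharacter ℂ r, χ ≠ 1 →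
      (1/10^11) / (ellA (A+1) j)^7 ≤ ‖LFunction χ 1‖ := by
    rw [Filter.eventually_all_finset]
    intro r hr
    rw [Filter.eventually_all]
    intro _
    rw [Filter.eventually_all]
    intro χ
    by_cases hχ : χ = 1
    · simp [hχ]
    · have hpos : 0 < ‖LFunction χ 1‖ := norm_pos_iff.mpr (LFunction_apply_one_ne_zero hχ)
      have ht : Tendsto (fun j : ℕ => (1/10^11) / (ellA (A+1) j)^7) atTop (𝓝 0) := by
        refine Tendsto.const_div_atTop ?_ _
        refine (tendsto_pow_atTop (by norm_num)).comp ?_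
        unfold ellA
        refine tendsto_atTop_add_const_left _ _ ?_
        refine Tendsto.const_mul_atTop (by positivity) ?_
        exact Real.tendsto_log_atTop.comp tendsto_natCast_atTop_atTop
      filter_upwards [ht.eventually (ge_mem_nhds hpos)] with j hj _ using hj
  filter_upwards [hfix, ev1 (A+1), ev2 (A+1) B, eventually_ge_atTop 1] with j hfix h1 h2 hj1
  set ℓ := ellA (A+1) j with hℓ
  set δ := (1/10^11) / ℓ^7 with hδ
  set η := (j:ℝ)^(-(1/4:ℝ)) with hη
  have hlj : 0 ≤ Real.log j := Real.log_natCast_nonneg j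
  have hℓ2 : 2 ≤ ℓ := by
    rw [hℓ, ellA]; have : 0 ≤ 2 * ((A+1:ℕ):ℝ) * Real.log j := by positivity
    linarith
  have hlogr : ∀ r : ℕ, 1 < r → r ≤ j^A → Real.log r ≤ A * Real.log j := by
    intro r hr1 hr
    rw [← Real.log_pow]
    apply Real.log_le_log (by positivity)
    exact_mod_cast hr
  have hηp : 0 < η := Real.rpow_pos_of_pos (by exact_mod_cast hj1) _
  have hδ1 : δ ≤ 1 := by
    rw [hδ, div_le_one (by positivity)]
    have : (1:ℝ) ≤ ℓ^7 := one_le_pow₀ (by linarith)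
    linarith
  have hηδ : 720 * ℓ^2 * η ≤ δ := by
    rw [hδ, le_div_iff₀ (by positivity)]
    refine le_trans (le_of_eq ?_) h1
    ring
  have hgood : ∀ r : ℕ, ∀ _ : NeZero r, 1 < r → r ≤ j^A → ∀ χ : DirichletCharacter ℂ r, χ ≠ 1 → δ ≤ ‖LFunction χ 1‖ →
      ‖psi χ j‖ ≤ j.factorial / (j:ℝ)^B := by
    intro r _ hr1 hr χ hχ hb
    have hl := hlogr r hr1 hr
    refine (psi_nonbad χ hχ ℓ δ η ?_ hηp hδ1 hηδ hb j).trans ?_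
    · rw [hℓ, ellA]; push_cast; nlinarith [mul_nonneg (Nat.cast_nonneg (α := ℝ) A) hlj]
    · rw [mul_div_assoc, div_eq_mul_one_div (j.factorial : ℝ) ((j:ℝ)^B)]
      exact mul_le_mul_of_nonneg_left h2 (by positivity)
  by_cases hbad : ∃ (r : ℕ) (_ : NeZero r), 1 < r ∧ r ≤ j^A ∧ ∃ χ : DirichletCharacter ℂ r, χ.IsPrimitive ∧ χ ≠ 1 ∧
      ‖LFunction χ 1‖ < δ
  · obtain ⟨rs, _, hrs1, hrs, χs, hps, hχs, hbs⟩ := hbad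
    refine ⟨rs, fun r hr1 hr hor χ hp hχ => ?_⟩
    have inst0 : NeZero r := ⟨by omega⟩
    refine hgood r inst0 hr1 hr χ hχ ?_
    rcases hor with hne | hdvd
    · by_contra hcon
      push Not at hcon
      have hl := hlogr r hr1 hr
      have hls := hlogr rs hrs1 hrs
      have hAl : 0 ≤ (A:ℝ) * Real.log j := by positivity
      have e1 : 2 + Real.log r + Real.log rs ≤ ℓ := by
        rw [hℓ, ellA]; push_cast; nlinarith
      have l1 : 0 ≤ Real.log r := Real.log_natCast_nonneg r
      have l2 : 0 ≤ Real.log rs := Real.log_natCast_nonneg rs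
      by_cases q1 : χ^2 = 1
      · by_cases q2 : χs^2 = 1
        · exact lower_real_pair χ χs hp hps hχ hχs hne q1 q2 ℓ e1 hcon hbs
        · have := lower_nonreal χs q2 ℓ (by linarith)
          linarith
      · have := lower_nonreal χ q1 ℓ (by linarith)
        linarith
    · exact hfix r (Nat.mem_divisors.mpr ⟨hdvd, hW⟩) ⟨by omega⟩ χ hχ
  · push Not at hbad
    exact ⟨0, fun r hr1 hr _ χ hp hχ => hgood r ⟨by omega⟩ hr1 hr χ hχ (hbad r ⟨by omega⟩ hr1 hr χ hp hχ)⟩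

end DSR
end

section
namespace DSR
open Complex Filter Topology DirichletCharacter

lemma abel_anti (a : ℕ → ℂ) (g : ℕ → ℝ) (hg : Antitone g) (hg0 : ∀ n, 0 ≤ g n) (B : ℝ)
    (hB : ∀ N, ‖∑ n ∈ Finset.range N, a n‖ ≤ B) (N : ℕ) :
    ‖∑ n ∈ Finset.range N, a n * (g n : ℂ)‖ ≤ B * g 0 := by
  rw [abel_fin]
  have h1 : ‖(∑ i ∈ Finset.range N, a i) * (g N : ℂ)‖ ≤ B * g N := by
    rw [norm_mul, Complex.norm_real, Real.norm_of_nonneg (hg0 N)]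
    exact mul_le_mul_of_nonneg_right (hB N) (hg0 N)
  have h2 : ‖∑ i ∈ Finset.range N, (∑ l ∈ Finset.range (i+1), a l) * ((g i : ℂ) - (g (i+1) : ℂ))‖
      ≤ ∑ i ∈ Finset.range N, B * (g i - g (i+1)) := by
    refine (norm_sum_le _ _).trans (Finset.sum_le_sum fun i _ => ?_)
    have h0 : 0 ≤ g i - g (i+1) := sub_nonneg.mpr (hg (Nat.le_succ i))
    rw [norm_mul, ← Complex.ofReal_sub, Complex.norm_real, Real.norm_of_nonneg h0]
    exact mul_le_mul_of_nonneg_right (hB _) h0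
  refine (norm_add_le _ _).trans ((add_le_add h1 h2).trans (le_of_eq ?_))
  rw [← Finset.mul_sum, Finset.sum_range_sub']
  ring

open ComplexConjugate in
lemma large_sieve {ι : Type*} (I : Finset ι) (f : ι → ℕ → ℂ) (hf : ∀ i n, ‖f i n‖ ≤ 1)
    (B G : ℝ) (hBn : 0 ≤ B)
    (hB : ∀ i ∈ I, ∀ i' ∈ I, i ≠ i' → ∀ N, ‖∑ n ∈ Finset.range N, f i n * conj (f i' n)‖ ≤ B)
    (g : ℕ → ℝ) (hg : Antitone g) (hg0 : ∀ n, 0 < g n) (hG : ∀ N, ∑ n ∈ Finset.range N, g n ≤ G)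
    (hBI : B * g 0 * I.card ≤ 1) (c : ℕ → ℂ) (N : ℕ) :
    ∑ i ∈ I, ‖∑ n ∈ Finset.range N, c n * f i n‖^2 ≤ (G + 1) * ∑ n ∈ Finset.range N, ‖c n‖^2 / g n := by
  classical
  set S : ι → ℂ := fun i => ∑ n ∈ Finset.range N, c n * f i n with hS
  set T : ℝ := ∑ i ∈ I, ‖S i‖^2 with hT
  set Z : ℝ := ∑ n ∈ Finset.range N, ‖c n‖^2 / g n with hZ
  have hT0 : 0 ≤ T := Finset.sum_nonneg fun i _ => by positivity
  have hZ0 : 0 ≤ Z := Finset.sum_nonneg fun n _ => by have := hg0 n; positivity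
  have hG0 : 0 ≤ G := by simpa using hG 0
  set D : ℕ → ℂ := fun n => ∑ i ∈ I, conj (S i) * f i n with hD
  -- second moment
  have h2 : ∑ n ∈ Finset.range N, g n * ‖D n‖^2 ≤ (G+1) * T := by
    have e1 : ((∑ n ∈ Finset.range N, g n * ‖D n‖^2 : ℝ) : ℂ) =
        ∑ i ∈ I, ∑ i' ∈ I, (conj (S i) * S i') * ∑ n ∈ Finset.range N, (f i n * conj (f i' n)) * (g n : ℂ) := by
      push_cast
      have : ∀ n, ((g n : ℂ) * (‖D n‖:ℂ)^2) = ∑ i ∈ I, ∑ i' ∈ I, (conj (S i) * S i') * ((f i n * conj (f i' n)) * (g n : ℂ)) := by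
        intro n
        rw [← Complex.mul_conj', hD]
        simp only [map_sum, map_mul, Complex.conj_conj]
        rw [Finset.sum_mul_sum, Finset.mul_sum]
        refine Finset.sum_congr rfl fun i _ => ?_
        rw [Finset.mul_sum]
        refine Finset.sum_congr rfl fun i' _ => ?_
        ring
      rw [Finset.sum_congr rfl fun n _ => this n, Finset.sum_comm]
      refine Finset.sum_congr rfl fun i _ => ?_
      rw [Finset.sum_comm]
      refine Finset.sum_congr rfl fun i' _ => ?_
      rw [← Finset.mul_sum]
    have e2 : ∑ n ∈ Finset.range N, g n * ‖D n‖^2 = ‖((∑ n ∈ Finset.range N, g n * ‖D n‖^2 : ℝ) : ℂ)‖ := by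
      rw [Complex.norm_real, Real.norm_of_nonneg]
      exact Finset.sum_nonneg fun n _ => by have := hg0 n; positivity
    rw [e2, e1]
    have e3 : ∀ i ∈ I, ∀ i' ∈ I, ‖(conj (S i) * S i') * ∑ n ∈ Finset.range N, (f i n * conj (f i' n)) * (g n : ℂ)‖ ≤
        (if i = i' then G * ‖S i‖^2 else 0) + B * g 0 * (‖S i‖ * ‖S i'‖) := by
      intro i hi i' hi'
      rw [norm_mul, norm_mul, RCLike.norm_conj]
      have hnn : 0 ≤ B * g 0 * (‖S i‖ * ‖S i'‖) := by have := hg0 0; positivity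
      by_cases h : i = i'
      · subst h
        simp only [if_true]
        have : ‖∑ n ∈ Finset.range N, (f i n * conj (f i n)) * (g n : ℂ)‖ ≤ G := by
          refine (norm_sum_le _ _).trans ((Finset.sum_le_sum fun n _ => ?_).trans (hG N))
          rw [norm_mul, norm_mul, RCLike.norm_conj, Complex.norm_real, Real.norm_of_nonneg (hg0 n).le]
          have h1 := hf i n
          have h3 : ‖f i n‖ * ‖f i n‖ ≤ 1 := mul_le_one₀ h1 (norm_nonneg _) h1
          exact mul_le_of_le_one_left (hg0 n).le h3
        have := mul_le_mul_of_nonneg_left this (show 0 ≤ ‖S i‖ * ‖S i‖ by positivity)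
        nlinarith
      · simp only [h, if_false, zero_add]
        have := abel_anti (fun n => f i n * conj (f i' n)) g hg (fun n => (hg0 n).le) B (hB i hi i' hi' h) N
        calc _ ≤ ‖S i‖ * ‖S i'‖ * (B * g 0) := by gcongr
          _ = _ := by ring
    calc _ ≤ ∑ i ∈ I, ∑ i' ∈ I, ((if i = i' then G * ‖S i‖^2 else 0) + B * g 0 * (‖S i‖ * ‖S i'‖)) := by
          refine (norm_sum_le _ _).trans (Finset.sum_le_sum fun i hi => ?_)
          refine (norm_sum_le _ _).trans (Finset.sum_le_sum fun i' hi' => e3 i hi i' hi')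
      _ = G * T + B * g 0 * (∑ i ∈ I, ‖S i‖)^2 := by
          simp only [Finset.sum_add_distrib, Finset.sum_ite_eq]
          congr 1
          · rw [hT, Finset.mul_sum]
            refine Finset.sum_congr rfl fun i hi => by simp [hi]
          · rw [sq, Finset.sum_mul_sum, Finset.mul_sum]
            refine Finset.sum_congr rfl fun i _ => ?_
            rw [Finset.mul_sum]
      _ ≤ G * T + B * g 0 * (I.card * T) := by
          have := sq_sum_le_card_mul_sum_sq (s := I) (f := fun i => ‖S i‖)
          have h0 := hg0 0
          gcongr
      _ = G * T + (B * g 0 * I.card) * T := by ring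
      _ ≤ G * T + 1 * T := by gcongr
      _ = _ := by ring
  -- T ≤ sum |c| |D|
  have h3 : T ≤ ∑ n ∈ Finset.range N, ‖c n‖ * ‖D n‖ := by
    have e1 : (T : ℂ) = ∑ n ∈ Finset.range N, c n * D n := by
      rw [hT]; push_cast
      have : ∀ i, ((‖S i‖:ℂ))^2 = ∑ n ∈ Finset.range N, c n * (conj (S i) * f i n) := by
        intro i
        rw [← Complex.mul_conj']
        conv_lhs => rw [hS]
        simp only
        rw [Finset.sum_mul]
        exact Finset.sum_congr rfl fun n _ => by ring
      rw [Finset.sum_congr rfl fun i _ => this i, Finset.sum_comm]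
      exact Finset.sum_congr rfl fun n _ => by rw [hD, Finset.mul_sum]
    have : T = ‖(T:ℂ)‖ := by rw [Complex.norm_real, Real.norm_of_nonneg hT0]
    rw [this, e1]
    refine (norm_sum_le _ _).trans (le_of_eq ?_)
    exact Finset.sum_congr rfl fun n _ => norm_mul _ _
  have h4 : T^2 ≤ Z * ((G+1) * T) := by
    refine le_trans (pow_le_pow_left₀ hT0 h3 2) ?_
    refine le_trans ?_ (mul_le_mul_of_nonneg_left h2 hZ0)
    refine Finset.sum_sq_le_sum_mul_sum_of_sq_eq_mul _ (fun n _ => ?_) (fun n _ => ?_) (fun n _ => ?_)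
    · have := hg0 n; positivity
    · have := hg0 n; positivity
    · have := hg0 n; field_simp
  rcases hT0.eq_or_lt with h | h
  · rw [← h]; positivity
  · have : T * T ≤ ((G+1) * Z) * T := by nlinarith
    exact le_of_mul_le_mul_right this h

lemma conv_sum_le (f g : ℕ → ℝ) (hf : ∀ n, 0 ≤ f n) (hg : ∀ n, 0 ≤ g n) (N : ℕ) :
    ∑ n ∈ Finset.Icc 1 N, ∑ p ∈ n.divisorsAntidiagonal, f p.1 * g p.2 ≤
      (∑ n ∈ Finset.Icc 1 N, f n) * ∑ n ∈ Finset.Icc 1 N, g n := by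
  rw [Finset.sum_mul_sum, ← Finset.sum_product', Finset.sum_sigma']
  have hinj : Set.InjOn (fun x : (_ : ℕ) × (ℕ × ℕ) => x.2)
      (((Finset.Icc 1 N).sigma fun n => n.divisorsAntidiagonal : Finset _) : Set ((_ : ℕ) × (ℕ × ℕ))) := by
    rintro ⟨n, p⟩ h ⟨n', p'⟩ h' e
    simp only [Finset.coe_sigma, Set.mem_sigma_iff, Finset.mem_coe, Nat.mem_divisorsAntidiagonal] at h h' e
    subst e
    have : n = n' := h.2.1.symm.trans h'.2.1
    subst this; rfl
  rw [← Finset.sum_image (f := fun p : ℕ × ℕ => f p.1 * g p.2) hinj]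
  refine Finset.sum_le_sum_of_subset_of_nonneg ?_ (fun p _ _ => mul_nonneg (hf _) (hg _))
  intro p hp
  simp only [Finset.mem_image, Finset.mem_sigma, Finset.mem_Icc, Nat.mem_divisorsAntidiagonal] at hp
  obtain ⟨⟨n, q⟩, ⟨⟨h1, h2⟩, h3, h4⟩, rfl⟩ := hp
  simp only [Finset.mem_product, Finset.mem_Icc]
  dsimp only at h1 h2 h3 h4
  have ha : q.1 ≠ 0 := by intro h; rw [h] at h3; simp at h3; omega
  have hb : q.2 ≠ 0 := by intro h; rw [h] at h3; simp at h3; omega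
  have : q.1 ≤ n := Nat.le_of_dvd (by omega) ⟨q.2, h3.symm⟩
  have : q.2 ≤ n := Nat.le_of_dvd (by omega) ⟨q.1, by rw [mul_comm]; exact h3.symm⟩
  omega

lemma tau_mul_le (a b : ℕ) : (a*b).divisors.card ≤ a.divisors.card * b.divisors.card := by
  rw [Nat.divisors_mul]
  exact Finset.card_mul_le

lemma zeta_fin (σ : ℝ) (hσ : 0 < σ) (N : ℕ) : ∑ n ∈ Finset.Icc 1 N, (n:ℝ)^(-1-σ) ≤ 1 + 1/σ := by
  have h := zeta_tail σ hσ 1 le_rfl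
  have hr : Finset.Icc 1 N = Finset.image (fun i => i + 1) (Finset.range N) := by
    ext x; simp only [Finset.mem_Icc, Finset.mem_image, Finset.mem_range]
    constructor
    · intro h; exact ⟨x-1, by omega, by omega⟩
    · rintro ⟨y, h, rfl⟩; omega
  rw [hr, Finset.sum_image (fun a _ b _ h => by simpa using h)]
  rcases N with _ | N
  · simp; positivity
  rw [Finset.sum_range_succ']
  have h2 : ∑ i ∈ Finset.range N, ((i + 1 + 1 : ℕ) : ℝ) ^ (-1 - σ) ≤ 1/σ := by
    rw [show -1 - σ = -σ - 1 by ring]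
    refine (h.1.sum_le_tsum _ (fun i _ => by positivity)).trans (h.2.trans ?_)
    simp
  simp only [zero_add, Nat.cast_one, Real.one_rpow]
  linarith

lemma tau_fin (σ : ℝ) (hσ : 0 < σ) (N : ℕ) :
    ∑ n ∈ Finset.Icc 1 N, (n.divisors.card : ℝ)^2 * (n:ℝ)^(-1-σ) ≤ (1 + 1/σ)^4 := by
  have hz := zeta_fin σ hσ N
  have hpos : 0 ≤ ∑ n ∈ Finset.Icc 1 N, (n:ℝ)^(-1-σ) := Finset.sum_nonneg fun n _ => by positivity
  have h1 : ∑ n ∈ Finset.Icc 1 N, (n.divisors.card : ℝ) * (n:ℝ)^(-1-σ) ≤ (1 + 1/σ)^2 := by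
    calc _ = ∑ n ∈ Finset.Icc 1 N, ∑ p ∈ n.divisorsAntidiagonal, (p.1:ℝ)^(-1-σ) * (p.2:ℝ)^(-1-σ) := by
          refine Finset.sum_congr rfl fun n _ => ?_
          rw [Finset.sum_congr rfl (g := fun _ => (n:ℝ)^(-1-σ))]
          · rw [Finset.sum_const, nsmul_eq_mul, ← Nat.map_div_right_divisors, Finset.card_map]
          · intro p hp
            rw [← Real.mul_rpow (by positivity) (by positivity), ← (Nat.mem_divisorsAntidiagonal.mp hp).1]
            push_cast; rfl
      _ ≤ _ := conv_sum_le (fun n => (n:ℝ)^(-1-σ)) (fun n => (n:ℝ)^(-1-σ)) (fun n => by positivity) (fun n => by positivity) N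
      _ ≤ (1 + 1/σ) * (1+1/σ) := by gcongr
      _ = _ := by ring
  have hpos2 : 0 ≤ ∑ n ∈ Finset.Icc 1 N, (n.divisors.card : ℝ) * (n:ℝ)^(-1-σ) := Finset.sum_nonneg fun n _ => by positivity
  calc _ ≤ ∑ n ∈ Finset.Icc 1 N, ∑ p ∈ n.divisorsAntidiagonal, 
        ((p.1.divisors.card : ℝ) * (p.1:ℝ)^(-1-σ)) * ((p.2.divisors.card : ℝ) * (p.2:ℝ)^(-1-σ)) := by
          refine Finset.sum_le_sum fun n _ => ?_
          calc _ = ∑ p ∈ n.divisorsAntidiagonal, ((n.divisors.card : ℝ) * (n:ℝ)^(-1-σ)) := by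
                rw [Finset.sum_const, nsmul_eq_mul, ← Nat.map_div_right_divisors, Finset.card_map]; ring
            _ ≤ _ := by
              refine Finset.sum_le_sum fun p hp => ?_
              rw [← (Nat.mem_divisorsAntidiagonal.mp hp).1]
              have h3 : (((p.1*p.2).divisors.card : ℕ) : ℝ) ≤ (p.1.divisors.card : ℝ) * p.2.divisors.card := by
                exact_mod_cast tau_mul_le p.1 p.2
              push_cast
              rw [Real.mul_rpow (by positivity) (by positivity)]
              calc _ ≤ ((p.1.divisors.card : ℝ) * p.2.divisors.card) * ((p.1:ℝ)^(-1-σ) * (p.2:ℝ)^(-1-σ)) := by gcongr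
                _ = _ := by ring
    _ ≤ _ := conv_sum_le (fun n => (n.divisors.card : ℝ) * (n:ℝ)^(-1-σ)) (fun n => (n.divisors.card : ℝ) * (n:ℝ)^(-1-σ)) (fun n => by positivity) (fun n => by positivity) N
    _ ≤ (1 + 1/σ)^2 * (1+1/σ)^2 := by gcongr
    _ = _ := by ring
end DSR
end

section
namespace DSR
open Complex Filter Topology DirichletCharacter

lemma summ_le {a b : ℕ → ℂ} {s : ℂ} (h : LSeriesSummable a s) (hb : ∀ n, ‖b n‖ ≤ ‖a n‖) : LSeriesSummable b s :=
  Summable.of_norm <| h.norm.of_nonneg_of_le (fun _ ↦ norm_nonneg _) fun n ↦ LSeries.norm_term_le s (hb n)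

/-- finite Dirichlet polynomial -/
noncomputable def DP (a : ℕ → ℂ) (U : ℕ) (s : ℂ) : ℂ := ∑ n ∈ Finset.Icc 1 U, a n * (n:ℂ)^(-s)

/-- tail -/
noncomputable def tl (U : ℕ) (a : ℕ → ℂ) (n : ℕ) : ℂ := if U < n then a n else 0

lemma tl_norm_le (U : ℕ) (a : ℕ → ℂ) (n : ℕ) : ‖tl U a n‖ ≤ ‖a n‖ := by
  unfold tl; split_ifs <;> simp

lemma tl_summable (U : ℕ) (a : ℕ → ℂ) (s : ℂ) (h : LSeriesSummable a s) : LSeriesSummable (tl U a) s :=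
  summ_le h (tl_norm_le U a) 

lemma LSeries_tl (U : ℕ) (a : ℕ → ℂ) (s : ℂ) (h : LSeriesSummable a s) :
    LSeries (tl U a) s = LSeries a s - DP a U s := by
  have h1 : DP a U s = ∑' n, LSeries.term (fun n => if n ∈ Finset.Icc 1 U then a n else 0) s n := by
    rw [tsum_eq_sum (s := Finset.Icc 1 U)]
    · unfold DP
      refine Finset.sum_congr rfl fun n hn => ?_
      have : n ≠ 0 := by have := Finset.mem_Icc.mp hn; omega
      rw [LSeries.term_of_ne_zero this, if_pos hn, Complex.cpow_neg]; rfl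
    · intro n hn
      unfold LSeries.term
      simp [hn]
  have h2 : LSeriesSummable (fun n => if n ∈ Finset.Icc 1 U then a n else 0) s :=
    summ_le h (fun n => by split_ifs <;> simp)
  rw [h1, eq_sub_iff_add_eq, LSeries, LSeries, ← Summable.tsum_add (tl_summable U a s h) h2]
  refine tsum_congr fun n => ?_
  rcases eq_or_ne n 0 with rfl | hn
  · simp
  · rw [LSeries.term_of_ne_zero hn, LSeries.term_of_ne_zero hn, LSeries.term_of_ne_zero hn, ← add_div]
    congr 1
    unfold tl
    by_cases h : U < n
    · simp [h]
    · have : n ∈ Finset.Icc 1 U := Finset.mem_Icc.mpr ⟨by omega, by omega⟩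
      rw [if_neg h, if_pos this, zero_add]

lemma DP_diff (a : ℕ → ℂ) (U : ℕ) : Differentiable ℂ (DP a U) := by
  unfold DP
  refine Differentiable.fun_sum fun n hn => ?_
  have : n ≠ 0 := by have := Finset.mem_Icc.mp hn; omega
  refine Differentiable.const_mul ?_ _
  intro s
  exact (differentiableAt_id.neg).const_cpow (Or.inl (by exact_mod_cast this))

lemma DP_bound (a : ℕ → ℂ) (U : ℕ) (A : ℝ) (ha : ∀ n ∈ Finset.Icc 1 U, ‖a n‖ ≤ A) (s : ℂ) (hs : 0 ≤ s.re) :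
    ‖DP a U s‖ ≤ U * A := by
  unfold DP
  refine (norm_sum_le _ _).trans ?_
  calc _ ≤ ∑ n ∈ Finset.Icc 1 U, A := by
        refine Finset.sum_le_sum fun n hn => ?_
        have : 0 < n := by have := Finset.mem_Icc.mp hn; omega
        rw [norm_mul, Complex.norm_natCast_cpow_of_pos this]
        have h1 : (n:ℝ)^((-s).re) ≤ 1 := by
          apply Real.rpow_le_one_of_one_le_of_nonpos
          · exact_mod_cast this
          · simpa using hs
        exact (mul_le_of_le_one_right (norm_nonneg _) h1).trans (ha n hn)
    _ = _ := by simp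

open ArithmeticFunction ArithmeticFunction.Moebius

noncomputable def bU (U : ℕ) (n : ℕ) : ℂ := ∑ p ∈ n.divisorsAntidiagonal, tl U (fun m => ((μ m : ℤ) : ℂ)) p.2

lemma bU_zero (U n : ℕ) (h : n ≤ U) : bU U n = 0 := by
  unfold bU
  refine Finset.sum_eq_zero fun p hp => ?_
  have h1 := Nat.mem_divisorsAntidiagonal.mp hp
  have : p.2 ≤ n := Nat.le_of_dvd (Nat.pos_of_ne_zero h1.2) ⟨p.1, by rw [mul_comm]; exact h1.1.symm⟩
  unfold tl
  rw [if_neg (by omega)]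

lemma bU_le (U n : ℕ) : ‖bU U n‖ ≤ n.divisors.card := by
  unfold bU
  refine (norm_sum_le _ _).trans ?_
  calc _ ≤ ∑ p ∈ n.divisorsAntidiagonal, (1:ℝ) := by
        refine Finset.sum_le_sum fun p _ => (tl_norm_le _ _ _).trans ?_
        rw [Complex.norm_intCast]
        exact_mod_cast abs_moebius_le_one
    _ = _ := by rw [Finset.sum_const, nsmul_eq_mul, ← Nat.map_div_right_divisors, Finset.card_map]; simp

lemma tl_mul (U : ℕ) (a b : ℕ → ℂ) : tl U (fun n => a n * b n) = fun n => a n * tl U b n := by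
  ext n; unfold tl; split_ifs <;> simp

lemma chi_bU {r : ℕ} (χ : DirichletCharacter ℂ r) (U : ℕ) :
    (fun n : ℕ => χ n * bU U n) = LSeries.convolution (fun n => χ n) (tl U (fun n => χ n * ((μ n : ℤ) : ℂ))) := by
  ext n
  rw [LSeries.convolution_def, bU, Finset.mul_sum]
  refine Finset.sum_congr rfl fun p hp => ?_
  rw [tl_mul, ← (Nat.mem_divisorsAntidiagonal.mp hp).1]
  have : χ ((p.1 * p.2 : ℕ) : ZMod r) = χ p.1 * χ p.2 := by push_cast; exact map_mul χ _ _
  rw [this, mul_assoc]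

lemma mu_summable {r : ℕ} (χ : DirichletCharacter ℂ r) {s : ℂ} (hs : 1 < s.re) :
    LSeriesSummable (fun n => χ n * ((μ n : ℤ) : ℂ)) s := by
  have h := ArithmeticFunction.LSeriesSummable_moebius_iff.mpr hs
  refine summ_le h fun n => ?_
  rw [norm_mul]
  exact mul_le_of_le_one_left (norm_nonneg _) (χ.norm_le_one _)

lemma mu_one {r : ℕ} (χ : DirichletCharacter ℂ r) {s : ℂ} (hs : 1 < s.re) :
    LSeries (fun n => χ n) s * LSeries (fun n => χ n * ((μ n : ℤ) : ℂ)) s = 1 :=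
  DirichletCharacter.LSeries.mul_mu_eq_one χ hs

lemma Y_eq {r : ℕ} [NeZero r] (χ : DirichletCharacter ℂ r) (U : ℕ) {s : ℂ} (hs : 1 < s.re) :
    LSeriesSummable (fun n : ℕ => χ n * bU U n) s ∧
    LSeries (fun n : ℕ => χ n * bU U n) s = 1 - LFunction χ s * DP (fun n => χ n * ((μ n : ℤ) : ℂ)) U s := by
  have hχ := LSeriesSummable_of_one_lt_re χ hs
  have hμ' := tl_summable U _ s (mu_summable χ hs)
  rw [chi_bU]
  have h1 := hχ.convolution hμ'
  refine ⟨h1, ?_⟩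
  rw [LSeries_convolution' hχ hμ', LSeries_tl U _ s (mu_summable χ hs), mul_sub, LFunction_eq_LSeries χ hs, mu_one χ hs]

noncomputable def XS {r : ℕ} (χ : DirichletCharacter ℂ r) (U i : ℕ) : ℂ :=
  ∑' n : ℕ, (χ n * tl U (fun m => ((Λ m : ℝ) : ℂ)) n) * (Fw i n : ℂ)

noncomputable def YS {r : ℕ} (χ : DirichletCharacter ℂ r) (U i : ℕ) : ℂ :=
  ∑' n : ℕ, (χ n * bU U n) * (Fw i n : ℂ)

lemma X_eq {r : ℕ} [NeZero r] (χ : DirichletCharacter ℂ r) (U : ℕ) {s : ℂ} (hs : 1 < s.re) :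
    LSeriesSummable (fun n => χ n * tl U (fun m => ((Λ m : ℝ) : ℂ)) n) s ∧
    LSeries (fun n => χ n * tl U (fun m => ((Λ m : ℝ) : ℂ)) n) s = -(deriv (LFunction χ) s / LFunction χ s) -
      DP (fun n => χ n * ((Λ n : ℝ) : ℂ)) U s := by
  have h := LSeriesSummable_twist_vonMangoldt χ hs
  have h2 := tl_summable U _ s h
  have e : tl U ((fun n : ℕ => χ n) * fun n => ((Λ n : ℝ) : ℂ)) = fun n : ℕ => χ n * tl U (fun m => ((Λ m : ℝ) : ℂ)) n :=
    tl_mul U _ _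
  rw [← e]
  refine ⟨h2, ?_⟩
  rw [LSeries_tl U _ s h, psi_eq χ hs]
  rfl

lemma L_deriv_crude {r : ℕ} [NeZero r] (χ : DirichletCharacter ℂ r) (hχ : χ ≠ 1) (s : ℂ)
    (hs : 3/4 ≤ s.re) (hs' : ‖s‖ ≤ 7/2) : ‖deriv (LFunction χ) s‖ ≤ 68 * r := by
  have := Complex.norm_deriv_le_of_forall_mem_sphere_norm_le (c := s) (R := 1/4) (C := 17 * r) (f := LFunction χ) (by norm_num)
    (differentiable_LFunction hχ).diffContOnCl ?_
  · refine this.trans (le_of_eq (by ring))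
  · intro z hz
    have hz' : ‖z - s‖ = 1/4 := by simpa [dist_eq_norm] using hz
    apply L_crude χ hχ
    · have h1 := Complex.abs_re_le_norm (z - s)
      rw [hz', Complex.sub_re, abs_le] at h1
      linarith
    · have : ‖z‖ ≤ ‖z - s‖ + ‖s‖ := by simpa using norm_add_le (z - s) s
      linarith

lemma vaughan {r : ℕ} [NeZero r] (χ : DirichletCharacter ℂ r) (hχ : χ ≠ 1) (U j : ℕ) (hU : 1 ≤ U) :
    ‖psi χ j‖ ≤ j.factorial * (102 * r * (U:ℝ)^3) / (5/4)^j +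
      ∑ i ∈ Finset.range (j+1), j.choose i * (‖XS χ U i‖ * ‖YS χ U (j-i)‖) := by
  set F := DP (fun n => χ n * ((Λ n : ℝ) : ℂ)) U with hF
  set G := DP (fun n => χ n * ((μ n : ℤ) : ℂ)) U with hG
  set X := LSeries (fun n => χ n * tl U (fun m => ((Λ m : ℝ) : ℂ)) n) with hX
  set Y := LSeries (fun n => χ n * bU U n) with hY
  set H : ℂ → ℂ := fun s => F s - LFunction χ s * F s * G s - deriv (LFunction χ) s * G s with hH
  have hmem : {z : ℂ | 1 < z.re} ∈ 𝓝 (2:ℂ) :=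
    (isOpen_lt continuous_const continuous_re).mem_nhds (by simp)
  have hFd : Differentiable ℂ F := DP_diff _ _
  have hGd : Differentiable ℂ G := DP_diff _ _
  have hLd := differentiable_LFunction hχ
  have hL'd := deriv_L_diff χ hχ
  have hHd : Differentiable ℂ H := (hFd.sub ((hLd.mul hFd).mul hGd)).sub (hL'd.mul hGd)
  have hid : ∀ s : ℂ, 1 < s.re → H s + X s * Y s = LSeries (fun n => χ n * (ArithmeticFunction.vonMangoldt n : ℂ)) s := by
    intro s hs
    rw [hX, hY, (X_eq χ U hs).2, (Y_eq χ U hs).2, ← psi_eq χ hs]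
    have hne : LFunction χ s ≠ 0 := by
      rw [LFunction_eq_LSeries χ hs]; exact LSeries_ne_zero_of_one_lt_re χ hs
    simp only [hH]
    field_simp
    ring
  have hXa : ContDiffAt ℂ j X 2 := by
    refine (LSeries_analyticOnNhd _ _ ?_).contDiffAt
    refine lt_of_le_of_lt (abscissa_le_one _ fun s hs => (X_eq χ U hs).1) ?_
    simp
    exact_mod_cast (by norm_num : (1:ℝ) < 2)
  have hYa : ContDiffAt ℂ j Y 2 := by
    refine (LSeries_analyticOnNhd _ _ ?_).contDiffAt
    refine lt_of_le_of_lt (abscissa_le_one _ fun s hs => (Y_eq χ U hs).1) ?_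
    simp
    exact_mod_cast (by norm_num : (1:ℝ) < 2)
  have e1 : psi χ j = (-1)^j * iteratedDeriv j (fun s => H s + X s * Y s) 2 :=
    sumF_eq _ (fun s hs => LSeriesSummable_twist_vonMangoldt χ hs) _ hid j
  have eX : ∀ i, ‖iteratedDeriv i X 2‖ = ‖XS χ U i‖ := by
    intro i
    rw [XS, sumF_eq _ (fun s hs => (X_eq χ U hs).1) X (fun s hs => rfl) i, norm_mul]
    simp
  have eY : ∀ i, ‖iteratedDeriv i Y 2‖ = ‖YS χ U i‖ := by
    intro i
    rw [YS, sumF_eq _ (fun s hs => (Y_eq χ U hs).1) Y (fun s hs => rfl) i, norm_mul]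
    simp
  have e2 : iteratedDeriv j (fun s => H s + X s * Y s) 2 = iteratedDeriv j H 2 + iteratedDeriv j (fun s => X s * Y s) 2 := by
    have := iteratedDeriv_fun_add (n := j) (x := (2:ℂ)) (f := H) (g := fun s => X s * Y s) (hHd.contDiff.contDiffAt) (hXa.mul hYa)
    exact this
  have e3 : iteratedDeriv j (fun s => X s * Y s) 2 = _ := iteratedDeriv_fun_mul hXa hYa
  have h1 : ‖iteratedDeriv j H 2‖ ≤ j.factorial * (102 * r * (U:ℝ)^3) / (5/4)^j := by
    refine Complex.norm_iteratedDeriv_le_of_forall_mem_sphere_norm_le j (by norm_num) hHd.diffContOnCl ?_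
    intro z hz
    have hz' : ‖z - 2‖ = 5/4 := by simpa [dist_eq_norm] using hz
    have hre : 3/4 ≤ z.re := by
      have h1 := Complex.abs_re_le_norm (z - 2)
      rw [hz', Complex.sub_re, abs_le] at h1
      simp at h1
      linarith
    have hn : ‖z‖ ≤ 7/2 := by
      have : ‖z‖ ≤ ‖z - 2‖ + ‖(2:ℂ)‖ := by simpa using norm_add_le (z - 2) 2
      simp at this
      linarith
    have b1 : ‖F z‖ ≤ U * U := by
      refine DP_bound _ _ _ (fun n hn => ?_) z (by linarith)
      rw [norm_mul, Complex.norm_real, Real.norm_of_nonneg vonMangoldt_nonneg]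
      refine (mul_le_of_le_one_left vonMangoldt_nonneg (χ.norm_le_one _)).trans ?_
      refine vonMangoldt_le_log.trans ?_
      have h2 := Real.log_le_self (Nat.cast_nonneg (α := ℝ) n)
      have : (n:ℝ) ≤ U := by exact_mod_cast (Finset.mem_Icc.mp hn).2
      linarith
    have b2 : ‖G z‖ ≤ U * 1 := by
      refine DP_bound _ _ _ (fun n hn => ?_) z (by linarith)
      rw [norm_mul, Complex.norm_intCast]
      have : |((μ n : ℤ) : ℝ)| ≤ 1 := by exact_mod_cast abs_moebius_le_one
      exact mul_le_one₀ (χ.norm_le_one _) (abs_nonneg _) this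
    have b3 := L_crude χ hχ z (by linarith) (by linarith)
    have b4 := L_deriv_crude χ hχ z hre hn
    have hU1 : (1:ℝ) ≤ U := by exact_mod_cast hU
    have hr1 : (1:ℝ) ≤ r := by exact_mod_cast NeZero.one_le
    calc ‖H z‖ ≤ ‖F z‖ + ‖LFunction χ z‖ * ‖F z‖ * ‖G z‖ + ‖deriv (LFunction χ) z‖ * ‖G z‖ := by
          refine (norm_sub_le _ _).trans (add_le_add ((norm_sub_le _ _).trans (add_le_add le_rfl ?_)) ?_)
          · rw [norm_mul, norm_mul]
          · rw [norm_mul]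
      _ ≤ U * U + (17 * r) * (U * U) * (U * 1) + (68 * r) * (U * 1) := by gcongr
      _ ≤ 1 * r * (U * U * U) + (17 * r) * (U * U) * (U * 1) + (68 * r) * (U * U * U) := by
          have h3 : (U:ℝ) ≤ U * U := by nlinarith
          have h4 : (U:ℝ) * U ≤ U * U * U := by nlinarith
          have h5 : (U:ℝ) * U * U ≤ r * (U * U * U) := by
            have : (0:ℝ) ≤ U * U * U := by positivity
            nlinarith
          refine add_le_add (add_le_add (by linarith) le_rfl) ?_
          have : (U:ℝ) * 1 ≤ U * U * U := by linarith
          gcongr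
      _ ≤ 102 * r * (U:ℝ)^3 := by
          have : (0:ℝ) ≤ r * U^3 := by positivity
          nlinarith
  rw [e1, norm_mul, e2]
  simp only [norm_pow, norm_neg, norm_one, one_pow, one_mul]
  refine (norm_add_le _ _).trans (add_le_add h1 ?_)
  rw [e3]
  refine (norm_sum_le _ _).trans (le_of_eq (Finset.sum_congr rfl fun i _ => ?_))
  rw [norm_mul, norm_mul, eX, eY, Complex.norm_natCast]
  ring

end DSR
end

section
namespace DSR
open Complex Filter Topology DirichletCharacter
open ArithmeticFunction ArithmeticFunction.Moebius

abbrev Chars := Σ r : ℕ, DirichletCharacter ℂ r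

def good (Q : ℕ) (i : Chars) : Prop := 1 < i.1 ∧ i.1 ≤ Q ∧ i.2.IsPrimitive

lemma card_chars (Q : ℕ) (I : Finset Chars) (hI : ∀ i ∈ I, good Q i) : I.card ≤ Q * Q := by
  classical
  have h1 : ∀ i ∈ I, (fun i : Chars => i.1) i ∈ Finset.Icc 1 Q := by
    intro i hi
    have := hI i hi
    simp only [Finset.mem_Icc]
    exact ⟨this.1.le, this.2.1⟩
  have := Finset.card_le_mul_card_image_of_maps_to (s := I) (t := Finset.Icc 1 Q) (f := fun i => i.1) h1 Q ?_
  · simpa using this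
  · intro r hr
    have hr := Finset.mem_Icc.mp hr
    have : NeZero r := ⟨by omega⟩
    have hsub : I.filter (fun i => i.1 = r) ⊆ (Finset.univ : Finset (DirichletCharacter ℂ r)).image (fun χ => (⟨r, χ⟩ : Chars)) := by
      rintro ⟨r', χ⟩ hi
      have := (Finset.mem_filter.mp hi).2
      simp only at this
      subst this
      simp
    refine (Finset.card_le_card hsub).trans (Finset.card_image_le.trans ?_)
    rw [Finset.card_univ, ← Nat.card_eq_fintype_card, card_eq_totient_of_hasEnoughRootsOfUnity]
    exact (Nat.totient_le r).trans hr.2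

lemma conj_char {r : ℕ} [NeZero r] (χ : DirichletCharacter ℂ r) (n : ZMod r) : (starRingEnd ℂ) (χ n) = χ⁻¹ n := by
  rw [← MulChar.star_eq_inv]; rfl

lemma offdiag (Q : ℕ) (i i' : Chars) (hi : good Q i) (hi' : good Q i') (hne : i ≠ i') (M N : ℕ) :
    ‖∑ n ∈ Finset.range N, i.2 ((n + M : ℕ) : ZMod i.1) * (starRingEnd ℂ) (i'.2 ((n + M : ℕ) : ZMod i'.1))‖ ≤ 2 * (Q:ℝ)^2 := by
  obtain ⟨r, χ⟩ := i
  obtain ⟨r', χ'⟩ := i'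
  obtain ⟨h1, h2, h3⟩ := hi
  obtain ⟨h1', h2', h3'⟩ := hi'
  simp only at h1 h2 h3 h1' h2' h3' ⊢
  have : NeZero r := ⟨by omega⟩
  have : NeZero r' := ⟨by omega⟩
  have key : prodChar χ χ'⁻¹ ≠ 1 := by
    by_cases h : r = r'
    · subst h
      refine prodChar_ne_one' χ χ' (fun h => hne (by rw [h]))
    · refine prodChar_ne_one χ χ'⁻¹ h3 ?_ h
      unfold DirichletCharacter.IsPrimitive
      rw [conductor_inv]; exact h3'
  have e : ∀ n ∈ Finset.range N, χ ((n + M : ℕ) : ZMod r) * (starRingEnd ℂ) (χ' ((n + M : ℕ) : ZMod r')) =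
      prodChar χ χ'⁻¹ ((n + M : ℕ) : ZMod (r * r')) := by
    intro n _
    rw [prodChar_apply, conj_char]
  rw [Finset.sum_congr rfl e]
  refine (char_sum_shift_le _ key M N).trans ?_
  push_cast
  have a1 : (r:ℝ) ≤ Q := by exact_mod_cast h2
  have a2 : (r':ℝ) ≤ Q := by exact_mod_cast h2'
  have : (r:ℝ) * r' ≤ Q * Q := by gcongr
  nlinarith

lemma ls_chars (Q U j : ℕ) (hj : 1 ≤ j) (hU : 2 * Q^4 ≤ U) (hU1 : 1 ≤ U) (I : Finset Chars) (hI : ∀ i ∈ I, good Q i)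
    (c : ℕ → ℂ) (hc : ∀ n ≤ U, c n = 0) (Z : ℝ)
    (hZ : ∀ N, ∑ n ∈ Finset.Icc 1 N, ‖c n‖^2 * (n:ℝ)^(1 + 1/(j:ℝ)) ≤ Z)
    (hs : ∀ i ∈ I, Summable (fun n : ℕ => i.2 n * c n)) :
    ∑ i ∈ I, ‖∑' n : ℕ, i.2 n * c n‖^2 ≤ (j + 1) * Z := by
  have hj0 : (0:ℝ) < j := by exact_mod_cast hj
  set g : ℕ → ℝ := fun n => ((n + U + 1 : ℕ) : ℝ)^(-(1/(j:ℝ)) - 1) with hg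
  have hgpos : ∀ n, 0 < g n := fun n => by simp only [hg]; positivity
  have hganti : Antitone g := by
    intro a b hab
    simp only [hg]
    apply Real.rpow_le_rpow_of_nonpos (by positivity)
    · exact_mod_cast (by omega)
    · have : 0 < 1/(j:ℝ) := by positivity
      linarith
  have hzt := zeta_tail (1/(j:ℝ)) (by positivity) U hU1
  have hG : ∀ N, ∑ n ∈ Finset.range N, g n ≤ j := by
    intro N
    refine (hzt.1.sum_le_tsum _ (fun i _ => by positivity)).trans (hzt.2.trans ?_)
    rw [div_le_iff₀ (by positivity), mul_one_div, div_self hj0.ne']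
    apply Real.rpow_le_one_of_one_le_of_nonpos
    · exact_mod_cast hU1
    · have : 0 < 1/(j:ℝ) := by positivity
      linarith
  have hcard : (I.card : ℝ) ≤ Q * Q := by exact_mod_cast card_chars Q I hI
  have hBI : 2 * (Q:ℝ)^2 * g 0 * I.card ≤ 1 := by
    have h1 : g 0 ≤ 1/(U+1) := by
      simp only [hg]
      rw [zero_add, Real.rpow_sub (by positivity), Real.rpow_one]
      push_cast
      gcongr
      apply Real.rpow_le_one_of_one_le_of_nonpos
      · linarith [show (0:ℝ) ≤ U by positivity]
      · have : 0 < 1/(j:ℝ) := by positivity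
        linarith
    have hU' : 2 * (Q:ℝ)^4 ≤ U := by exact_mod_cast hU
    calc 2 * (Q:ℝ)^2 * g 0 * I.card ≤ 2 * (Q:ℝ)^2 * (1/(U+1)) * (Q * Q) := by
          have := hgpos 0; gcongr
      _ = (2 * (Q:ℝ)^4)/(U+1) := by ring
      _ ≤ 1 := by rw [div_le_one (by positivity)]; linarith
  have key := fun N => large_sieve I (fun i n => i.2 ((n + (U+1) : ℕ) : ZMod i.1)) (fun i n => i.2.norm_le_one _)
    (2 * (Q:ℝ)^2) j (by positivity) (fun i hi i' hi' hne N => offdiag Q i i' (hI i hi) (hI i' hi') hne (U+1) N)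
    g hganti hgpos hG hBI (fun n => c (n + (U+1))) N
  have hlim : ∀ i ∈ I, Tendsto (fun N => ∑ n ∈ Finset.range N, c (n + (U+1)) * i.2 ((n + (U+1) : ℕ) : ZMod i.1)) atTop
      (𝓝 (∑' n : ℕ, i.2 n * c n)) := by
    intro i hi
    have h1 := (hs i hi).sum_add_tsum_nat_add (U+1)
    have h2 : ∑ n ∈ Finset.range (U+1), i.2 (n : ZMod i.1) * c n = 0 := by
      refine Finset.sum_eq_zero fun n hn => ?_
      rw [hc n (by have := Finset.mem_range.mp hn; omega), mul_zero]
    rw [h2, zero_add] at h1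
    rw [← h1]
    have h3 := ((summable_nat_add_iff (U+1)).mpr (hs i hi)).hasSum.tendsto_sum_nat
    refine h3.congr fun N => Finset.sum_congr rfl fun n _ => mul_comm _ _
  have hlim2 : Tendsto (fun N => ∑ i ∈ I, ‖∑ n ∈ Finset.range N, c (n + (U+1)) * i.2 ((n + (U+1) : ℕ) : ZMod i.1)‖^2) atTop
      (𝓝 (∑ i ∈ I, ‖∑' n : ℕ, i.2 n * c n‖^2)) :=
    tendsto_finsetSum _ fun i hi => ((hlim i hi).norm).pow 2
  refine le_of_tendsto' hlim2 fun N => (key N).trans ?_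
  refine mul_le_mul_of_nonneg_left ?_ (by positivity)
  refine le_trans ?_ (hZ (N + U + 1))
  have e : ∀ n ∈ Finset.range N, ‖c (n + (U+1))‖^2 / g n = ‖c (n + (U+1))‖^2 * ((n + (U+1) : ℕ) : ℝ)^(1 + 1/(j:ℝ)) := by
    intro n _
    rw [div_eq_mul_inv]
    simp only [hg]
    rw [← Real.rpow_neg (by positivity)]
    congr 2
    ring
  rw [Finset.sum_congr rfl e]
  rw [← Finset.sum_image (s := Finset.range N) (g := fun n => n + (U+1)) (f := fun m => ‖c m‖^2 * (m : ℝ)^(1 + 1/(j:ℝ)))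
    (fun a _ b _ h => by simpa using h)]
  refine Finset.sum_le_sum_of_subset_of_nonneg ?_ (fun n _ _ => by positivity)
  intro m hm
  obtain ⟨n, hn, rfl⟩ := Finset.mem_image.mp hm
  have := Finset.mem_range.mp hn
  simp only [Finset.mem_Icc]; omega

lemma fact_bound (i j : ℕ) (hi : i ≤ j) (hj : 2 ≤ j) :
    ((2*i).factorial : ℝ) / (2 - 2/(j:ℝ))^(2*i) ≤ 81 * (i.factorial:ℝ)^2 := by
  have hj0 : (2:ℝ) ≤ j := by exact_mod_cast hj
  have h1 : ((2*i).factorial : ℝ) ≤ 4^i * (i.factorial:ℝ)^2 := by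
    have h := Nat.choose_mul_factorial_mul_factorial (show i ≤ 2*i by omega)
    rw [show 2 * i - i = i by omega] at h
    have h2 := Nat.choose_le_two_pow (2*i) i
    rw [pow_mul] at h2
    norm_num at h2
    have h3 : (2*i).factorial ≤ 4^i * (i.factorial)^2 := by
      rw [← h, mul_assoc, ← sq]
      exact Nat.mul_le_mul_right _ h2
    exact_mod_cast h3
  have h2 : Real.exp (-(2/(j:ℝ))) ≤ 1 - 1/(j:ℝ) := by
    have h3 : (1 - 1/(j:ℝ))⁻¹ ≤ Real.exp (2/(j:ℝ)) := by
      refine le_trans ?_ (Real.add_one_le_exp _)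
      rw [inv_le_iff_one_le_mul₀ (by rw [sub_pos, div_lt_one (by linarith)]; linarith)]
      field_simp
      nlinarith
    rw [Real.exp_neg]
    rw [inv_le_comm₀ (Real.exp_pos _) (by rw [sub_pos, div_lt_one (by linarith)]; linarith)]
    exact h3
  have h3 : Real.exp (-4) ≤ (1 - 1/(j:ℝ))^(2*i) := by
    calc Real.exp (-4) ≤ Real.exp (-(2/(j:ℝ)))^(2*i) := by
          rw [← Real.exp_nat_mul]
          apply Real.exp_le_exp.mpr
          have : (i:ℝ) ≤ j := by exact_mod_cast hi
          push_cast
          have h5 : (i:ℝ)/j ≤ 1 := by rw [div_le_one (by linarith)]; exact this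
          have : 2 * (i:ℝ) * -(2/(j:ℝ)) = -4 * (i/j) := by ring
          rw [this]; linarith
      _ ≤ _ := by gcongr
  have h4 : (1:ℝ)/81 ≤ Real.exp (-4) := by
    rw [Real.exp_neg, one_div]
    apply inv_anti₀ (Real.exp_pos _)
    have h6 : Real.exp 4 = (Real.exp 1)^4 := by rw [← Real.exp_nat_mul]; norm_num
    have h5 := Real.exp_one_lt_d9
    rw [h6]
    calc (Real.exp 1)^4 ≤ 3^4 := by gcongr; linarith
      _ = 81 := by norm_num
  have h5 : (2 - 2/(j:ℝ))^(2*i) = 4^i * (1 - 1/(j:ℝ))^(2*i) := by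
    rw [show 2 - 2/(j:ℝ) = 2 * (1 - 1/j) by ring, mul_pow, pow_mul]; norm_num
  rw [h5, div_le_iff₀ (by have := h4.trans h3; have : (0:ℝ) < (1 - 1/(j:ℝ))^(2*i) := by linarith
                          positivity)]
  have h6 := h4.trans h3
  have h7 : (0:ℝ) ≤ 4^i * (i.factorial:ℝ)^2 := by positivity
  nlinarith

/-- passing from weighted mean square to the Fw-mean square -/
lemma ms_bound (a : ℕ → ℂ) (i j : ℕ) (hi : i ≤ j) (hj : 2 ≤ j) (M : ℝ)
    (hM : ∀ N, ∑ n ∈ Finset.Icc 1 N, ‖a n‖^2 * (n:ℝ)^(-1 - 1/(j:ℝ)) ≤ M) (N : ℕ) :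
    ∑ n ∈ Finset.Icc 1 N, ‖a n * (Fw i n : ℂ)‖^2 * (n:ℝ)^(1 + 1/(j:ℝ)) ≤ 81 * (i.factorial:ℝ)^2 * M := by
  have hj0 : (2:ℝ) ≤ j := by exact_mod_cast hj
  have hlam : (0:ℝ) < 2 - 2/(j:ℝ) := by rw [sub_pos, div_lt_iff₀ (by linarith)]; linarith
  calc _ ≤ ∑ n ∈ Finset.Icc 1 N, (81 * (i.factorial:ℝ)^2) * (‖a n‖^2 * (n:ℝ)^(-1 - 1/(j:ℝ))) := by
        refine Finset.sum_le_sum fun n hn => ?_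
        have hn1 := (Finset.mem_Icc.mp hn).1
        have hn0 : (0:ℝ) < n := by exact_mod_cast hn1
        have h1 := log_pow_le (2*i) n hn1 _ hlam
        rw [norm_mul, Complex.norm_real, Real.norm_of_nonneg (Fw_nonneg i n), mul_pow]
        have h2 : (Fw i n)^2 = (Real.log n)^(2*i) * (n:ℝ)^(-4:ℝ) := by
          unfold Fw
          rw [div_pow, ← pow_mul, ← pow_mul, mul_comm i 2, Real.rpow_neg hn0.le, div_eq_mul_inv]
          norm_num
        rw [h2]
        calc ‖a n‖^2 * ((Real.log n)^(2*i) * (n:ℝ)^(-4:ℝ)) * (n:ℝ)^(1 + 1/(j:ℝ)) 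
            ≤ ‖a n‖^2 * ((((2*i).factorial : ℝ) * (n:ℝ)^(2 - 2/(j:ℝ)) / (2 - 2/(j:ℝ))^(2*i)) * (n:ℝ)^(-4:ℝ)) * (n:ℝ)^(1 + 1/(j:ℝ)) := by gcongr
          _ = (((2*i).factorial : ℝ) / (2 - 2/(j:ℝ))^(2*i)) * (‖a n‖^2 * ((n:ℝ)^(2 - 2/(j:ℝ)) * (n:ℝ)^(-4:ℝ) * (n:ℝ)^(1 + 1/(j:ℝ)))) := by ring
          _ = (((2*i).factorial : ℝ) / (2 - 2/(j:ℝ))^(2*i)) * (‖a n‖^2 * (n:ℝ)^(-1 - 1/(j:ℝ))) := by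
              rw [← Real.rpow_add hn0, ← Real.rpow_add hn0]
              congr 3; ring
          _ ≤ _ := by
              refine mul_le_mul_of_nonneg_right (fact_bound i j hi hj) (by positivity)
    _ = (81 * (i.factorial:ℝ)^2) * ∑ n ∈ Finset.Icc 1 N, (‖a n‖^2 * (n:ℝ)^(-1 - 1/(j:ℝ))) := by rw [Finset.mul_sum]
    _ ≤ _ := by gcongr; exact hM N

lemma M1_bound (U j : ℕ) (hj : 1 ≤ j) (N : ℕ) :
    ∑ n ∈ Finset.Icc 1 N, ‖tl U (fun m => ((Λ m : ℝ) : ℂ)) n‖^2 * (n:ℝ)^(-1 - 1/(j:ℝ)) ≤ 16 * ((j:ℝ)+1)^4 := by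
  have hj0 : (1:ℝ) ≤ j := by exact_mod_cast hj
  have hj00 : (0:ℝ) < 1/(2*j) := by positivity
  calc _ ≤ ∑ n ∈ Finset.Icc 1 N, (8 * (j:ℝ)^2) * (n:ℝ)^(-1 - 1/(2*(j:ℝ))) := by
        refine Finset.sum_le_sum fun n hn => ?_
        have hn1 := (Finset.mem_Icc.mp hn).1
        have hn0 : (0:ℝ) < n := by exact_mod_cast hn1
        have h1 : ‖tl U (fun m => ((Λ m : ℝ) : ℂ)) n‖ ≤ Real.log n := by
          refine (tl_norm_le _ _ _).trans ?_
          rw [Complex.norm_real, Real.norm_of_nonneg vonMangoldt_nonneg]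
          exact vonMangoldt_le_log
        have h2 := log_pow_le 2 n hn1 _ hj00
        calc _ ≤ (Real.log n)^2 * (n:ℝ)^(-1 - 1/(j:ℝ)) := by gcongr
          _ ≤ (((2:ℕ).factorial:ℝ) * (n:ℝ)^(1/(2*(j:ℝ))) / (1/(2*(j:ℝ)))^2) * (n:ℝ)^(-1 - 1/(j:ℝ)) := by gcongr
          _ = 8 * (j:ℝ)^2 * ((n:ℝ)^(1/(2*(j:ℝ))) * (n:ℝ)^(-1 - 1/(j:ℝ))) := by
              simp only [Nat.factorial]; push_cast; field_simp; ring
          _ = _ := by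
              rw [← Real.rpow_add hn0]; congr 2; field_simp; ring
    _ = (8 * (j:ℝ)^2) * ∑ n ∈ Finset.Icc 1 N, (n:ℝ)^(-1 - 1/(2*(j:ℝ))) := by rw [Finset.mul_sum]
    _ ≤ (8 * (j:ℝ)^2) * (1 + 1/(1/(2*(j:ℝ)))) := by gcongr; exact zeta_fin _ hj00 N
    _ = 8 * (j:ℝ)^2 * (1 + 2 * j) := by simp
    _ ≤ _ := by nlinarith [pow_pos (show (0:ℝ) < j by linarith) 3, pow_pos (show (0:ℝ) < j by linarith) 4]

lemma M2_bound (U j : ℕ) (hj : 1 ≤ j) (N : ℕ) :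
    ∑ n ∈ Finset.Icc 1 N, ‖bU U n‖^2 * (n:ℝ)^(-1 - 1/(j:ℝ)) ≤ 16 * ((j:ℝ)+1)^4 := by
  have hj0 : (0:ℝ) < 1/j := by positivity
  calc _ ≤ _ := by
        refine Finset.sum_le_sum (g := fun n : ℕ => (n.divisors.card : ℝ)^2 * (n:ℝ)^(-1 - 1/(j:ℝ))) fun n hn => ?_
        have := bU_le U n
        gcongr
    _ ≤ _ := tau_fin (1/(j:ℝ)) hj0 N
    _ = ((j:ℝ)+1)^4 := by rw [one_div_one_div]; ring
    _ ≤ _ := by have : (0:ℝ) ≤ ((j:ℝ)+1)^4 := by positivity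
                linarith

lemma psi_sum (Q j : ℕ) (hQ : 1 ≤ Q) (hj : 100000 ≤ j) (hQj : (Q:ℝ) ≤ Real.exp (j/100)) (I : Finset Chars)
    (hI : ∀ i ∈ I, good Q i) : ∑ i ∈ I, ‖psi i.2 j‖ ≤ (j:ℝ)^7 * j.factorial := by
  set U := 2 * Q^4 with hU
  have hU1 : 1 ≤ U := by have := Nat.one_le_pow 4 Q hQ; omega
  set M : ℝ := 16 * ((j:ℝ)+1)^4 with hM
  have hQ1 : (1:ℝ) ≤ Q := by exact_mod_cast hQ
  have hX : ∀ i ≤ j, ∑ χ ∈ I, ‖XS χ.2 U i‖^2 ≤ (j+1) * (81 * (i.factorial:ℝ)^2 * M) := by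
    intro i hi
    have := ls_chars Q U j (by omega) le_rfl hU1 I hI (fun n => tl U (fun m => ((Λ m : ℝ) : ℂ)) n * (Fw i n : ℂ))
      (fun n hn => by simp [tl, Nat.not_lt.mpr hn]) _ (ms_bound _ i j hi (by omega) M (M1_bound U j (by omega)))
      (fun χ hχ => by
        have : NeZero χ.1 := ⟨by have := (hI χ hχ).1; omega⟩
        exact (sumF_summable _ (fun s hs => (X_eq χ.2 U hs).1) i).congr (fun n => by ring))
    refine le_trans (le_of_eq ?_) this
    refine Finset.sum_congr rfl fun χ _ => ?_
    rw [XS]; congr 2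
    exact tsum_congr fun n => by ring
  have hY : ∀ i ≤ j, ∑ χ ∈ I, ‖YS χ.2 U i‖^2 ≤ (j+1) * (81 * (i.factorial:ℝ)^2 * M) := by
    intro i hi
    have := ls_chars Q U j (by omega) le_rfl hU1 I hI (fun n => bU U n * (Fw i n : ℂ))
      (fun n hn => by rw [bU_zero U n hn, zero_mul]) _ (ms_bound _ i j hi (by omega) M (M2_bound U j (by omega)))
      (fun χ hχ => by
        have : NeZero χ.1 := ⟨by have := (hI χ hχ).1; omega⟩
        exact (sumF_summable _ (fun s hs => (Y_eq χ.2 U hs).1) i).congr (fun n => by ring))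
    refine le_trans (le_of_eq ?_) this
    refine Finset.sum_congr rfl fun χ _ => ?_
    rw [YS]; congr 2
    exact tsum_congr fun n => by ring
  have hXY : ∀ i ∈ Finset.range (j+1), ∑ χ ∈ I, (j.choose i : ℝ) * (‖XS χ.2 U i‖ * ‖YS χ.2 U (j-i)‖) ≤
      j.factorial * ((j+1) * (81 * M)) := by
    intro i hi
    have hi : i ≤ j := by have := Finset.mem_range.mp hi; omega
    have f1 : (0:ℝ) < i.factorial := by positivity
    have f2 : (0:ℝ) < (j-i).factorial := by positivity
    have h1 := hX i hi
    have h2 := hY (j-i) (by omega)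
    have h3 : ∀ χ ∈ I, (j.choose i : ℝ) * (‖XS χ.2 U i‖ * ‖YS χ.2 U (j-i)‖) ≤ 
        (j.choose i : ℝ) * i.factorial * (j-i).factorial * (1/2 * (1/(i.factorial:ℝ)^2 * ‖XS χ.2 U i‖^2 + 1/((j-i).factorial:ℝ)^2 * ‖YS χ.2 U (j-i)‖^2)) := by
      intro χ _
      have h4 := two_mul_le_add_sq (‖XS χ.2 U i‖ / i.factorial) (‖YS χ.2 U (j-i)‖ / (j-i).factorial)
      have h5 : ‖XS χ.2 U i‖ * ‖YS χ.2 U (j-i)‖ = (i.factorial * (j-i).factorial) * (1/2 * (2 * (‖XS χ.2 U i‖ / i.factorial) * (‖YS χ.2 U (j-i)‖ / (j-i).factorial))) := by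
        field_simp
      rw [h5]
      calc _ ≤ (j.choose i : ℝ) * ((i.factorial * (j-i).factorial) * (1/2 * ((‖XS χ.2 U i‖ / i.factorial)^2 + (‖YS χ.2 U (j-i)‖ / (j-i).factorial)^2))) := by gcongr
        _ = _ := by rw [div_pow, div_pow]; ring
    refine (Finset.sum_le_sum h3).trans ?_
    rw [← Finset.mul_sum, ← Finset.mul_sum, Finset.sum_add_distrib, ← Finset.mul_sum, ← Finset.mul_sum]
    have h6 : (j.choose i : ℝ) * i.factorial * (j-i).factorial = j.factorial := by
      exact_mod_cast Nat.choose_mul_factorial_mul_factorial hi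
    rw [h6]
    have h7 : 1/(i.factorial:ℝ)^2 * ∑ χ ∈ I, ‖XS χ.2 U i‖^2 ≤ (j+1) * (81 * M) := by
      calc _ ≤ 1/(i.factorial:ℝ)^2 * ((j+1) * (81 * (i.factorial:ℝ)^2 * M)) := by gcongr
        _ = _ := by field_simp
    have h8 : 1/((j-i).factorial:ℝ)^2 * ∑ χ ∈ I, ‖YS χ.2 U (j-i)‖^2 ≤ (j+1) * (81 * M) := by
      calc _ ≤ 1/((j-i).factorial:ℝ)^2 * ((j+1) * (81 * ((j-i).factorial:ℝ)^2 * M)) := by gcongr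
        _ = _ := by field_simp
    refine mul_le_mul_of_nonneg_left ?_ (by positivity)
    linarith
  have hV : ∀ χ ∈ I, ‖psi χ.2 j‖ ≤ j.factorial * (102 * Q * (U:ℝ)^3) / (5/4)^j +
      ∑ i ∈ Finset.range (j+1), j.choose i * (‖XS χ.2 U i‖ * ‖YS χ.2 U (j-i)‖) := by
    intro χ hχ
    obtain ⟨g1, g2, g3⟩ := hI χ hχ
    have : NeZero χ.1 := ⟨by omega⟩
    have hne : χ.2 ≠ 1 := by
      intro h
      unfold DirichletCharacter.IsPrimitive at g3
      rw [h, conductor_one] at g3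
      omega
    refine (vaughan χ.2 hne U j hU1).trans ?_
    have : (χ.1:ℝ) ≤ Q := by exact_mod_cast g2
    gcongr
  refine (Finset.sum_le_sum hV).trans ?_
  rw [Finset.sum_add_distrib, Finset.sum_comm]
  have hT2 := Finset.sum_le_sum hXY
  have hT1 : ∑ χ ∈ I, (j.factorial * (102 * Q * (U:ℝ)^3) / (5/4)^j : ℝ) ≤ 816 * j.factorial := by
    rw [Finset.sum_const, nsmul_eq_mul]
    have hcard : (I.card : ℝ) ≤ Q * Q := by exact_mod_cast card_chars Q I hI
    have hQ15 : (Q:ℝ)^15 ≤ (5/4)^j := by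
      calc (Q:ℝ)^15 ≤ (Real.exp (j/100))^15 := by gcongr
        _ = (Real.exp (15/100))^j := by rw [← Real.exp_nat_mul, ← Real.exp_nat_mul]; congr 1; push_cast; ring
        _ ≤ _ := by
          gcongr
          have := Real.exp_bound_div_one_sub_of_interval (x := 15/100) (by norm_num) (by norm_num)
          refine this.trans (by norm_num)
    calc _ ≤ (Q * Q : ℝ) * (j.factorial * (102 * Q * (U:ℝ)^3) / (5/4)^j) := by gcongr
      _ = 816 * j.factorial * ((Q:ℝ)^15 / (5/4)^j) := by rw [hU]; push_cast; ring
      _ ≤ 816 * j.factorial * 1 := by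
          gcongr
          rw [div_le_one (by positivity)]; exact hQ15
      _ = _ := by ring
  refine (add_le_add hT1 hT2).trans ?_
  rw [Finset.sum_const, nsmul_eq_mul, Finset.card_range]
  push_cast
  have hj0 : (100000:ℝ) ≤ j := by exact_mod_cast hj
  have h9 : ((j:ℝ)+1)^6 ≤ 2 * (j:ℝ)^6 := by
    calc ((j:ℝ)+1)^6 ≤ (1.1 * j)^6 := by gcongr; linarith
      _ = 1.1^6 * (j:ℝ)^6 := by ring
      _ ≤ _ := by gcongr; norm_num
  have h10 : (1:ℝ) ≤ (j:ℝ)^6 := one_le_pow₀ (by linarith)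
  calc _ = (816 + 1296 * ((j:ℝ)+1)^6) * j.factorial := by rw [hM]; ring
    _ ≤ (j:ℝ)^7 * j.factorial := by
      gcongr
      calc 816 + 1296 * ((j:ℝ)+1)^6 ≤ 100000 * (j:ℝ)^6 := by linarith
        _ ≤ j * (j:ℝ)^6 := by gcongr
        _ = _ := by ring
end DSR
end

section
namespace DSR
open Complex Filter Topology DirichletCharacter

local notation "Λ" => ArithmeticFunction.vonMangoldt

noncomputable def vp (R n : ℕ) : ℝ := if n.Prime ∧ R < n then Real.log n else 0

lemma vp_nonneg (R n : ℕ) : 0 ≤ vp R n := by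
  unfold vp; split_ifs
  · exact Real.log_natCast_nonneg n
  · exact le_rfl

lemma vp_le (R n : ℕ) : vp R n ≤ Λ n := by
  unfold vp; split_ifs with h
  · rw [ArithmeticFunction.vonMangoldt_apply_prime h.1]
  · exact ArithmeticFunction.vonMangoldt_nonneg

lemma nonprime_summable : Summable (fun n : ℕ => (if n.Prime then 0 else Λ n) * (n:ℝ)^(-(0.6:ℝ))) := by
  set i : Nat.Primes × ℕ → ℕ := fun pk => (pk.1:ℕ)^(pk.2+2) with hi
  have hinj : Function.Injective i := by
    intro a b hab
    have h1 : (Nat.Primes.prodNatEquiv (a.1, a.2+1)) = Nat.Primes.prodNatEquiv (b.1, b.2+1) := by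
      rw [Nat.Primes.prodNatEquiv_apply, Nat.Primes.prodNatEquiv_apply]
      exact Subtype.ext hab
    have h2 := Nat.Primes.prodNatEquiv.injective h1
    simp only [Prod.mk.injEq, add_left_inj] at h2
    exact Prod.ext h2.1 h2.2
  refine (hinj.summable_iff ?_).mp ?_
  · intro n hn
    by_cases hp : n.Prime
    · simp [hp]
    · simp only [hp, if_false]
      rw [ArithmeticFunction.vonMangoldt_eq_zero_iff.mpr, zero_mul]
      intro h
      obtain ⟨p, k, hpp, hk, rfl⟩ := (isPrimePow_nat_iff n).mp h
      have hk1 : k ≠ 1 := by rintro rfl; simp at hp; exact hp hpp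
      exact hn ⟨(⟨p, hpp⟩, k-2), by simp only [hi]; congr 1; omega⟩
  · have s1 : Summable (fun p : Nat.Primes => 20 * (p:ℝ)^(-(1.1:ℝ))) :=
      (Nat.Primes.summable_rpow.mpr (by norm_num)).mul_left 20
    have h2lt : (2:ℝ)^(-(0.6:ℝ)) < 1 := Real.rpow_lt_one_of_one_lt_of_neg (by norm_num) (by norm_num)
    have s2 : Summable (fun k : ℕ => ((2:ℝ)^(-(0.6:ℝ)))^k) :=
      summable_geometric_of_lt_one (by positivity) h2lt
    refine Summable.of_nonneg_of_le ?_ ?_ (s1.mul_of_nonneg s2 (fun p => by positivity) (fun k => by positivity))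
    · intro pk
      simp only [Function.comp_apply]
      split_ifs
      · simp
      · have : 0 ≤ Λ (i pk) := ArithmeticFunction.vonMangoldt_nonneg
        positivity
    · rintro ⟨p, k⟩
      have hp := p.2
      have hp2 : (2:ℝ) ≤ (p:ℕ) := by exact_mod_cast hp.two_le
      have hp0 : (0:ℝ) < (p:ℕ) := by linarith
      have hnp : ¬ ((p:ℕ)^(k+2)).Prime := Nat.Prime.not_prime_pow (by omega)
      simp only [Function.comp_apply, hi, hnp, if_false]
      rw [ArithmeticFunction.vonMangoldt_apply_pow (by omega), ArithmeticFunction.vonMangoldt_apply_prime hp]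
      have h1 : Real.log (p:ℕ) ≤ 20 * ((p:ℕ):ℝ)^(0.05:ℝ) := by
        have := Real.log_le_rpow_div hp0.le (show (0:ℝ) < 0.05 by norm_num)
        refine this.trans (le_of_eq ?_); ring
      have h2 : (((p:ℕ)^(k+2) : ℕ):ℝ)^(-(0.6:ℝ)) = ((p:ℕ):ℝ)^(-(1.2:ℝ)) * (((p:ℕ):ℝ)^(-(0.6:ℝ)))^k := by
        push_cast
        rw [← Real.rpow_natCast, ← Real.rpow_natCast, ← Real.rpow_mul hp0.le, ← Real.rpow_mul hp0.le, ← Real.rpow_add hp0]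
        congr 1; push_cast; ring
      rw [h2]
      have h3 : ((p:ℕ):ℝ)^(-(0.6:ℝ)) ≤ (2:ℝ)^(-(0.6:ℝ)) :=
        Real.rpow_le_rpow_of_nonpos (by norm_num) hp2 (by norm_num)
      have h4 : ((p:ℕ):ℝ)^(0.05:ℝ) * ((p:ℕ):ℝ)^(-(1.2:ℝ)) ≤ ((p:ℕ):ℝ)^(-(1.1:ℝ)) := by
        rw [← Real.rpow_add hp0]
        exact Real.rpow_le_rpow_of_exponent_le (by linarith) (by norm_num)
      calc Real.log (p:ℕ) * (((p:ℕ):ℝ)^(-(1.2:ℝ)) * (((p:ℕ):ℝ)^(-(0.6:ℝ)))^k)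
          ≤ (20 * ((p:ℕ):ℝ)^(0.05:ℝ)) * (((p:ℕ):ℝ)^(-(1.2:ℝ)) * ((2:ℝ)^(-(0.6:ℝ)))^k) := by gcongr
        _ = 20 * (((p:ℕ):ℝ)^(0.05:ℝ) * ((p:ℕ):ℝ)^(-(1.2:ℝ))) * ((2:ℝ)^(-(0.6:ℝ)))^k := by ring
        _ ≤ _ := by gcongr

lemma LF_summable (j : ℕ) : Summable (fun n => Λ n * Fw j n) := by
  have := (sumF_summable (fun n => (Λ n : ℂ)) (fun s hs => ArithmeticFunction.LSeriesSummable_vonMangoldt hs) j).norm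
  refine this.congr fun n => ?_
  rw [norm_mul, Complex.norm_real, Complex.norm_real, Real.norm_of_nonneg ArithmeticFunction.vonMangoldt_nonneg,
    Real.norm_of_nonneg (Fw_nonneg j n)]

lemma vpF_summable (R j : ℕ) : Summable (fun n => vp R n * Fw j n) :=
  (LF_summable j).of_nonneg_of_le (fun n => mul_nonneg (vp_nonneg R n) (Fw_nonneg j n))
    (fun n => mul_le_mul_of_nonneg_right (vp_le R n) (Fw_nonneg j n))

noncomputable def Dd (R j : ℕ) : ℝ := ∑' n, (Λ n - vp R n) * Fw j n

lemma Dd_summable (R j : ℕ) : Summable (fun n => (Λ n - vp R n) * Fw j n) :=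
  ((LF_summable j).sub (vpF_summable R j)).congr fun n => by ring

lemma Dd_nonneg (R j : ℕ) : 0 ≤ Dd R j :=
  tsum_nonneg fun n => mul_nonneg (sub_nonneg.mpr (vp_le R n)) (Fw_nonneg j n)

lemma Dd_le : ∃ C : ℝ, 0 ≤ C ∧ ∀ R j : ℕ, 1 ≤ R → Dd R j ≤ C * j.factorial * (R:ℝ)^2 / 1.4^j := by
  set a : ℕ → ℝ := fun n : ℕ => (if n.Prime then 0 else Λ n) * (n:ℝ)^(-(0.6:ℝ)) with ha
  have ha0 : ∀ n, 0 ≤ a n := by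
    intro n; simp only [ha]
    split_ifs
    · simp
    · have : 0 ≤ Λ n := ArithmeticFunction.vonMangoldt_nonneg
      positivity
  refine ⟨1 + ∑' n, a n, by have : 0 ≤ ∑' n, a n := tsum_nonneg ha0
                            linarith, fun R j hR => ?_⟩
  have hR1 : (1:ℝ) ≤ R := by exact_mod_cast hR
  set b : ℕ → ℝ := fun n => if n ∈ Finset.Icc 1 R then (R:ℝ) else 0 with hb
  have hbs : Summable b := summable_of_ne_finset_zero (s := Finset.Icc 1 R) (fun n hn => by simp only [hb, hn, if_false])
  have hbt : ∑' n, b n = R * R := by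
    rw [tsum_eq_sum (s := Finset.Icc 1 R) (fun n hn => by simp only [hb, hn, if_false])]
    rw [Finset.sum_congr rfl (g := fun _ => (R:ℝ)) (fun n hn => by simp only [hb, hn, if_true])]
    simp
  set c : ℝ := j.factorial / 1.4^j with hc
  have hc0 : 0 ≤ c := by positivity
  have hle : ∀ n, (Λ n - vp R n) * Fw j n ≤ c * (a n + b n) := by
    intro n
    rcases Nat.eq_zero_or_pos n with rfl | hn
    · rw [Fw_zero, mul_zero]; have := ha0 0; have : 0 ≤ b 0 := by simp [hb]
      positivity
    have hF := Fw_le j n hn 1.4 (by norm_num)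
    have e : (1.4:ℝ) - 2 = -0.6 := by norm_num
    rw [e] at hF
    have hF' : Fw j n ≤ c * (n:ℝ)^(-(0.6:ℝ)) := by rw [hc]; refine hF.trans (le_of_eq (by ring))
    have hn0 : (0:ℝ) < n := by exact_mod_cast hn
    have hb0 : 0 ≤ b n := by simp only [hb]; split_ifs <;> positivity
    by_cases hp : n.Prime
    · by_cases hRn : R < n
      · simp only [vp, hp, hRn, and_self, if_true, ArithmeticFunction.vonMangoldt_apply_prime hp, sub_self, zero_mul]
        have := ha0 n
        positivity
      · have h1 : b n = R := by simp only [hb]; rw [if_pos (Finset.mem_Icc.mpr ⟨hn, by omega⟩)]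
        simp only [vp, hRn, and_false, if_false, ArithmeticFunction.vonMangoldt_apply_prime hp, sub_zero]
        have h2 : Real.log n ≤ R := by
          have := Real.log_le_sub_one_of_pos hn0
          have : (n:ℝ) ≤ R := by exact_mod_cast (by omega : n ≤ R)
          linarith
        have h3 : (n:ℝ)^(-(0.6:ℝ)) ≤ 1 := Real.rpow_le_one_of_one_le_of_nonpos (by exact_mod_cast hn) (by norm_num)
        calc Real.log n * Fw j n ≤ R * (c * 1) := by
              apply mul_le_mul h2 (hF'.trans (by gcongr)) (Fw_nonneg _ _) (by positivity)
          _ = c * b n := by rw [h1]; ring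
          _ ≤ _ := by have := ha0 n; gcongr; linarith
    · simp only [vp, hp, false_and, if_false, sub_zero]
      have h1 : a n = Λ n * (n:ℝ)^(-(0.6:ℝ)) := by simp [ha, hp]
      calc Λ n * Fw j n ≤ Λ n * (c * (n:ℝ)^(-(0.6:ℝ))) := by
            apply mul_le_mul_of_nonneg_left hF' ArithmeticFunction.vonMangoldt_nonneg
        _ = c * a n := by rw [h1]; ring
        _ ≤ _ := by gcongr; linarith
  have hs := nonprime_summable
  have h := (Dd_summable R j).tsum_le_tsum hle ((hs.add hbs).mul_left c)
  rw [tsum_mul_left, hs.tsum_add hbs, hbt] at h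
  refine h.trans ?_
  have h5 : 0 ≤ ∑' n, a n := tsum_nonneg ha0
  calc c * (∑' n, a n + R * R) ≤ c * ((1 + ∑' n, a n) * R^2) := by
        gcongr; nlinarith [mul_nonneg h5 (sub_nonneg.mpr (one_le_pow₀ hR1 : (1:ℝ) ≤ (R:ℝ)^2))]
    _ = _ := by rw [hc]; ring

end DSR
end

section
namespace DSR
open Complex Filter Topology DirichletCharacter

local notation "Λ" => ArithmeticFunction.vonMangoldt

open Classical in
noncomputable def Xi (N j : ℕ) : ℝ :=
  ∑' χ : DirichletCharacter ℂ N, ‖if χ = 1 then 0 else psi χ.primitiveCharacter j‖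

noncomputable def Err (N j R : ℕ) : ℝ :=
  (N.totient:ℝ)⁻¹ * (|∑' n, Λ n * Fw j n - j.factorial| + Xi N j) + Dd R j

lemma char_norm_le {r : ℕ} (χ : DirichletCharacter ℂ r) (a : ZMod r) : ‖χ a‖ ≤ 1 := χ.norm_le_one a

lemma chiV_summable {r : ℕ} (χ : DirichletCharacter ℂ r) (R j : ℕ) :
    Summable (fun n : ℕ => χ n * ((vp R n * Fw j n : ℝ) : ℂ)) := by
  refine Summable.of_norm_bounded (vpF_summable R j) fun n => ?_
  rw [norm_mul, Complex.norm_real, Real.norm_of_nonneg (mul_nonneg (vp_nonneg R n) (Fw_nonneg j n))]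
  exact mul_le_of_le_one_left (mul_nonneg (vp_nonneg R n) (Fw_nonneg j n)) (char_norm_le χ _)

lemma vp_coprime {N R n : ℕ} (hp : ∀ p, p.Prime → p ∣ N → p ≤ R) (hN : N ≠ 0) (h : vp R n ≠ 0) : n.Coprime N := by
  unfold vp at h
  split_ifs at h with h1
  · rw [Nat.Prime.coprime_iff_not_dvd h1.1]
    intro hd
    have := hp n h1.1 hd
    omega
  · simp at h

lemma chiV_prim {N : ℕ} (χ : DirichletCharacter ℂ N) (R j : ℕ) (hN : N ≠ 0)
    (hp : ∀ p, p.Prime → p ∣ N → p ≤ R) :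
    ‖∑' n : ℕ, χ n * ((vp R n * Fw j n : ℝ) : ℂ) - psi χ.primitiveCharacter j‖ ≤ Dd R j := by
  have h1 : ∀ n : ℕ, χ n * ((vp R n * Fw j n : ℝ) : ℂ) = χ.primitiveCharacter n * ((vp R n * Fw j n : ℝ) : ℂ) := by
    intro n
    by_cases h : vp R n = 0
    · simp [h]
    · have hc := vp_coprime hp hN h
      congr 1
      conv_lhs => rw [← changeLevel_primitiveCharacter χ]
      exact changeLevel_nat _ _ hc
  have hs : Summable (fun n : ℕ => (χ.primitiveCharacter n * (Λ n : ℂ)) * (Fw j n : ℂ)) := by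
    refine Summable.of_norm_bounded (LF_summable j) fun n => ?_
    rw [norm_mul, norm_mul, Complex.norm_real, Complex.norm_real, Real.norm_of_nonneg (Fw_nonneg j n),
      Real.norm_of_nonneg ArithmeticFunction.vonMangoldt_nonneg]
    refine mul_le_mul_of_nonneg_right ?_ (Fw_nonneg j n)
    exact mul_le_of_le_one_left ArithmeticFunction.vonMangoldt_nonneg (char_norm_le _ _)
  rw [tsum_congr h1, psi, ← (chiV_summable _ R j).tsum_sub hs, Dd]
  refine tsum_of_norm_bounded (Dd_summable R j).hasSum fun n => ?_
  have e : χ.primitiveCharacter n * ((vp R n * Fw j n : ℝ) : ℂ) - (χ.primitiveCharacter n * (Λ n : ℂ)) * (Fw j n : ℂ)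
      = - (χ.primitiveCharacter n * (((Λ n - vp R n) * Fw j n : ℝ) : ℂ)) := by push_cast; ring
  have h0 : 0 ≤ (Λ n - vp R n) * Fw j n := mul_nonneg (sub_nonneg.mpr (vp_le R n)) (Fw_nonneg j n)
  rw [e, norm_neg, norm_mul, Complex.norm_real, Real.norm_of_nonneg h0]
  exact mul_le_of_le_one_left h0 (char_norm_le _ _)

lemma one_V {N : ℕ} (R j : ℕ) (hN : N ≠ 0)
    (hp : ∀ p, p.Prime → p ∣ N → p ≤ R) :
    ‖∑' n : ℕ, (1 : DirichletCharacter ℂ N) n * ((vp R n * Fw j n : ℝ) : ℂ) - j.factorial‖ ≤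
      |∑' n, Λ n * Fw j n - j.factorial| + Dd R j := by
  have h1 : ∀ n : ℕ, (1 : DirichletCharacter ℂ N) n * ((vp R n * Fw j n : ℝ) : ℂ) = ((vp R n * Fw j n : ℝ) : ℂ) := by
    intro n
    by_cases h : vp R n = 0
    · simp [h]
    · have hc := vp_coprime hp hN h
      rw [MulChar.one_apply ((ZMod.isUnit_iff_coprime n N).mpr hc), one_mul]
  have e : Dd R j = ∑' n, Λ n * Fw j n - ∑' n, vp R n * Fw j n := by
    rw [← (LF_summable j).tsum_sub (vpF_summable R j)]
    exact tsum_congr fun n => by ring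
  have h2 := Dd_nonneg R j
  rw [tsum_congr h1, ← Complex.ofReal_tsum, ← Complex.ofReal_natCast, ← Complex.ofReal_sub, Complex.norm_real, Real.norm_eq_abs]
  have : ∑' n, vp R n * Fw j n - (j.factorial:ℝ) = (∑' n, Λ n * Fw j n - j.factorial) - Dd R j := by rw [e]; ring
  rw [this]
  refine (abs_sub _ _).trans ?_
  rw [abs_of_nonneg h2]

lemma Xi_nonneg (N j : ℕ) : 0 ≤ Xi N j := tsum_nonneg fun _ => norm_nonneg _

lemma AP (N R j a : ℕ) (hN : N ≠ 0) (hp : ∀ p, p.Prime → p ∣ N → p ≤ R) (ha : a.Coprime N) :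
    |∑' n : ℕ, (if n % N = a % N then vp R n * Fw j n else 0) - j.factorial / N.totient| ≤ Err N j R := by
  haveI : NeZero N := ⟨hN⟩
  have hau : IsUnit (a : ZMod N) := (ZMod.isUnit_iff_coprime a N).mpr ha
  have hφ : (0:ℝ) < N.totient := by exact_mod_cast Nat.totient_pos.mpr (Nat.pos_of_ne_zero hN)
  have hφc : (N.totient : ℂ) ≠ 0 := by exact_mod_cast hφ.ne'
  set T : DirichletCharacter ℂ N → ℂ := fun χ => ∑' n : ℕ, χ n * ((vp R n * Fw j n : ℝ) : ℂ) with hT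
  set c : DirichletCharacter ℂ N → ℂ := fun χ => if χ = 1 then (j.factorial : ℂ) else 0 with hc
  have key : ((∑' n : ℕ, (if n % N = a % N then vp R n * Fw j n else 0) - j.factorial / N.totient : ℝ) : ℂ)
      = (N.totient : ℂ)⁻¹ * ∑ χ : DirichletCharacter ℂ N, χ (a:ZMod N)⁻¹ * (T χ - c χ) := by
    have e1 : ∀ n : ℕ, (((if n % N = a % N then vp R n * Fw j n else 0 : ℝ)) : ℂ) =
        (N.totient : ℂ)⁻¹ * ∑ χ : DirichletCharacter ℂ N, χ (a:ZMod N)⁻¹ * (χ n * ((vp R n * Fw j n : ℝ) : ℂ)) := by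
      intro n
      simp_rw [← mul_assoc]
      rw [← Finset.sum_mul, sum_char_inv_mul_char_eq ℂ hau (n : ZMod N)]
      have : ((a:ZMod N) = n) ↔ n % N = a % N := by
        rw [ZMod.natCast_eq_natCast_iff']; exact eq_comm
      by_cases h : n % N = a % N
      · rw [if_pos h, if_pos (this.mpr h), ← mul_assoc, inv_mul_cancel₀ hφc, one_mul]
      · rw [if_neg h, if_neg (fun h' => h (this.mp h'))]; simp
    have e2 : ∑ χ : DirichletCharacter ℂ N, χ (a:ZMod N)⁻¹ * c χ = j.factorial := by
      have : ∀ χ : DirichletCharacter ℂ N, χ (a:ZMod N)⁻¹ * c χ = if χ = 1 then (j.factorial : ℂ) else 0 := by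
        intro χ
        simp only [hc]
        split_ifs with h
        · have hinv : IsUnit ((a:ZMod N)⁻¹) := by
            obtain ⟨u, hu⟩ := hau
            exact ⟨u⁻¹, by rw [← hu, ZMod.inv_coe_unit]⟩
          rw [h, MulChar.one_apply hinv, one_mul]
        · simp
      rw [Finset.sum_congr rfl (fun χ _ => this χ)]
      simp
    simp_rw [mul_sub]
    rw [Finset.sum_sub_distrib, e2, Complex.ofReal_sub, Complex.ofReal_tsum, tsum_congr e1, tsum_mul_left,
      Summable.tsum_finsetSum (fun χ _ => (chiV_summable χ R j).mul_left _)]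
    simp_rw [tsum_mul_left]
    simp only [hT]
    push_cast
    ring
  have hcard : (Fintype.card (DirichletCharacter ℂ N) : ℝ) = N.totient := by
    rw [← Nat.card_eq_fintype_card, card_eq_totient_of_hasEnoughRootsOfUnity]
  have hb : ∀ χ : DirichletCharacter ℂ N, ‖T χ - c χ‖ ≤
      (if χ = 1 then |∑' n, Λ n * Fw j n - j.factorial| else 0) +
        ‖if χ = 1 then 0 else psi χ.primitiveCharacter j‖ + Dd R j := by
    intro χ
    by_cases h : χ = 1
    · have := one_V (N := N) R j hN hp
      subst h
      simpa [hT, hc] using this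
    · have h1 := chiV_prim χ R j hN hp
      simp only [hT, hc, h, if_false, sub_zero, zero_add]
      have h2 := norm_sub_norm_le (∑' n : ℕ, χ n * ((vp R n * Fw j n : ℝ) : ℂ)) (psi χ.primitiveCharacter j)
      linarith
  rw [← Real.norm_eq_abs, ← Complex.norm_real, key, norm_mul, norm_inv, Complex.norm_natCast]
  calc (N.totient:ℝ)⁻¹ * ‖∑ χ : DirichletCharacter ℂ N, χ (a:ZMod N)⁻¹ * (T χ - c χ)‖
      ≤ (N.totient:ℝ)⁻¹ * ∑ χ : DirichletCharacter ℂ N, ((if χ = 1 then |∑' n, Λ n * Fw j n - j.factorial| else 0) +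
        ‖if χ = 1 then 0 else psi χ.primitiveCharacter j‖ + Dd R j) := by
        refine mul_le_mul_of_nonneg_left ?_ (by positivity)
        refine (norm_sum_le _ _).trans (Finset.sum_le_sum fun χ _ => ?_)
        rw [norm_mul]
        exact (mul_le_of_le_one_left (norm_nonneg _) (char_norm_le _ _)).trans (hb χ)
    _ = Err N j R := by
        rw [Finset.sum_add_distrib, Finset.sum_add_distrib, Err, Xi, tsum_fintype (f := fun χ : DirichletCharacter ℂ N => _)]
        simp only [Finset.sum_ite_eq', Finset.mem_univ, if_true, Finset.sum_const, Finset.card_univ, nsmul_eq_mul, hcard]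
        field_simp
        congr!

end DSR
end

section
namespace DSR
open Complex Filter Topology DirichletCharacter

local notation "Λ" => ArithmeticFunction.vonMangoldt

/-- products over sets of primes are injective -/
lemma prod_injOn (P : Finset ℕ) (hP : ∀ p ∈ P, p.Prime) :
    Set.InjOn (fun s : Finset ℕ => ∏ p ∈ s, p) (P.powerset : Set (Finset ℕ)) := by
  intro s hs t ht h
  simp only [Finset.coe_powerset, Set.mem_preimage, Set.mem_powerset_iff, Finset.coe_subset] at hs ht
  rw [← Nat.primeFactors_prod (fun p hp => hP p (hs hp)), ← Nat.primeFactors_prod (fun p hp => hP p (ht hp))]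
  exact congrArg _ h

lemma prod_le_icc (f : ℕ → ℝ) (hf : ∀ n, 0 ≤ f n) (P : Finset ℕ) (hP : ∀ p ∈ P, p.Prime) (T : Finset (Finset ℕ))
    (hT : T ⊆ P.powerset) (N : ℕ) (hN : ∀ s ∈ T, ∏ p ∈ s, p ≤ N) :
    ∑ s ∈ T, f (∏ p ∈ s, p) ≤ ∑ n ∈ Finset.Icc 1 N, f n := by
  rw [← Finset.sum_image (f := f) (g := fun s : Finset ℕ => ∏ p ∈ s, p)
    ((prod_injOn P hP).mono (by exact_mod_cast hT))]
  refine Finset.sum_le_sum_of_subset_of_nonneg ?_ (fun n _ _ => hf n)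
  intro n hn
  rw [Finset.mem_image] at hn
  obtain ⟨s, hs, rfl⟩ := hn
  rw [Finset.mem_Icc]
  refine ⟨Nat.one_le_iff_ne_zero.mpr (Finset.prod_ne_zero_iff.mpr fun p hp => ?_), hN s hs⟩
  exact (hP p (Finset.mem_powerset.mp (hT hs) hp)).ne_zero

lemma V_sigma (σ : ℝ) (hσ : 0 < σ) (P : Finset ℕ) (hP : ∀ p ∈ P, p.Prime) :
    ∏ p ∈ P, (1 + (p:ℝ)^(-1-σ)) ≤ 1 + 1/σ := by
  rw [Finset.prod_one_add]
  have e : ∀ s ∈ P.powerset, ∏ p ∈ s, (p:ℝ)^(-1-σ) = ((∏ p ∈ s, p : ℕ):ℝ)^(-1-σ) := by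
    intro s hs
    rw [Real.finsetProd_rpow _ _ (fun p _ => by positivity)]
    push_cast; rfl
  rw [Finset.sum_congr rfl e]
  refine (prod_le_icc (fun n => (n:ℝ)^(-1-σ)) (fun n => by positivity) P hP P.powerset (le_refl _)
    (∏ p ∈ P, p) ?_).trans (zeta_fin σ hσ _)
  intro s hs
  exact Finset.prod_le_prod_of_subset_of_one_le' (Finset.mem_powerset.mp hs) (fun p hp _ => (hP p hp).one_lt.le)

lemma V_bound (C R : ℕ) (hR : 2 ≤ R) (P : Finset ℕ) (hP : ∀ p ∈ P, p.Prime ∧ p ≤ R) :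
    ∏ p ∈ P, (1 + (C:ℝ)/(p-1)) ≤ (1 + Real.log R)^(6*C) := by
  have hL : 0 < Real.log R := Real.log_pos (by exact_mod_cast hR)
  set σ := 1 / Real.log R with hσ
  have hσ0 : 0 < σ := by positivity
  have h1 : ∀ p ∈ P, 1 + (C:ℝ)/(p-1) ≤ (1 + (p:ℝ)^(-1-σ))^(6*C) := by
    intro p hp
    obtain ⟨hpp, hpR⟩ := hP p hp
    have hp2 : (2:ℝ) ≤ p := by exact_mod_cast hpp.two_le
    have hp0 : (0:ℝ) < p := by linarith
    have hps : (p:ℝ)^σ ≤ 3 := by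
      rw [Real.rpow_def_of_pos hp0]
      have : Real.log p * σ ≤ 1 := by
        rw [hσ, mul_one_div, div_le_one hL]
        exact Real.log_le_log hp0 (by exact_mod_cast hpR)
      calc _ ≤ Real.exp 1 := Real.exp_le_exp.mpr this
        _ ≤ 3 := by have := Real.exp_one_lt_d9; linarith
    have e : (p:ℝ)^(-1-σ) = 1/(p * (p:ℝ)^σ) := by
      rw [Real.rpow_sub hp0, Real.rpow_neg_one]; field_simp
    have h3 : 1/(3*(p:ℝ)) ≤ (p:ℝ)^(-1-σ) := by
      rw [e]
      apply one_div_le_one_div_of_le (by positivity)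
      nlinarith
    have h4 : 1/((p:ℝ)-1) ≤ 6 * (p:ℝ)^(-1-σ) := by
      have : 1/((p:ℝ)-1) ≤ 6 * (1/(3*(p:ℝ))) := by
        rw [show 6 * (1/(3*(p:ℝ))) = 2/p by field_simp; norm_num, div_le_div_iff₀ (by linarith) hp0]
        linarith
      linarith
    calc 1 + (C:ℝ)/(p-1) = 1 + C * (1/((p:ℝ)-1)) := by ring
      _ ≤ 1 + C * (6 * (p:ℝ)^(-1-σ)) := by gcongr
      _ = 1 + (6*C : ℕ) * (p:ℝ)^(-1-σ) := by push_cast; ring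
      _ ≤ _ := one_add_mul_le_pow (by have : 0 ≤ (p:ℝ)^(-1-σ) := by positivity
                                      linarith) _
  calc ∏ p ∈ P, (1 + (C:ℝ)/(p-1)) ≤ ∏ p ∈ P, (1 + (p:ℝ)^(-1-σ))^(6*C) := by
        apply Finset.prod_le_prod _ h1
        intro p hp
        have : (2:ℝ) ≤ p := by exact_mod_cast (hP p hp).1.two_le
        have : (0:ℝ) ≤ (C:ℝ)/(p-1) := div_nonneg (by positivity) (by linarith)
        linarith
    _ = (∏ p ∈ P, (1 + (p:ℝ)^(-1-σ)))^(6*C) := Finset.prod_pow _ _ _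
    _ ≤ (1 + 1/σ)^(6*C) := by
        gcongr
        exact V_sigma σ hσ0 P (fun p hp => (hP p hp).1)
    _ = _ := by rw [hσ, one_div_one_div]

lemma totient_prod (W : ℕ) (s : Finset ℕ) (hs : ∀ p ∈ s, p.Prime ∧ ¬ p ∣ W) :
    (W * ∏ p ∈ s, p).totient = W.totient * ∏ p ∈ s, (p - 1) := by
  induction s using Finset.induction_on with
  | empty => simp
  | insert p s hp ih =>
    have h1 := hs p (Finset.mem_insert_self _ _)
    have h2 : ∀ q ∈ s, q.Prime ∧ ¬ q ∣ W := fun q hq => hs q (Finset.mem_insert_of_mem hq)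
    rw [Finset.prod_insert hp, Finset.prod_insert hp, show W * (p * ∏ x ∈ s, x) = p * (W * ∏ x ∈ s, x) by ring,
      Nat.totient_mul, ih h2, Nat.totient_prime h1.1]
    · ring
    · rw [Nat.Prime.coprime_iff_not_dvd h1.1, h1.1.dvd_mul, not_or]
      refine ⟨h1.2, ?_⟩
      rw [Prime.dvd_finsetProd_iff h1.1.prime]
      rintro ⟨q, hq, hpq⟩
      rw [Nat.prime_dvd_prime_iff_eq h1.1 (h2 q hq).1] at hpq
      exact hp (hpq ▸ hq)

/-- sum over supersets -/
lemma superset_sum (w : ℕ → ℝ) (P t : Finset ℕ) (hw : ∀ p ∈ P, 0 ≤ w p) (ht : t ⊆ P) (T : Finset (Finset ℕ))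
    (hT : ∀ s ∈ T, s ⊆ P ∧ t ⊆ s) :
    ∑ s ∈ T, ∏ p ∈ s, w p ≤ (∏ p ∈ t, w p) * ∏ p ∈ P, (1 + w p) := by
  rw [Finset.prod_one_add]
  have e : ∀ s ∈ T, ∏ p ∈ s, w p = (∏ p ∈ t, w p) * ∏ p ∈ s \ t, w p := by
    intro s hs
    rw [← Finset.prod_sdiff (hT s hs).2, mul_comm]
  rw [Finset.sum_congr rfl e, ← Finset.mul_sum]
  refine mul_le_mul_of_nonneg_left ?_ (Finset.prod_nonneg fun p hp => hw p (ht hp))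
  rw [← Finset.sum_image (f := fun s : Finset ℕ => ∏ p ∈ s, w p) (g := fun s => s \ t)]
  · refine Finset.sum_le_sum_of_subset_of_nonneg ?_ ?_
    · intro u hu
      rw [Finset.mem_image] at hu
      obtain ⟨s, hs, rfl⟩ := hu
      exact Finset.mem_powerset.mpr (Finset.sdiff_subset.trans (hT s hs).1)
    · intro u hu _
      exact Finset.prod_nonneg fun p hp => hw p (Finset.mem_powerset.mp hu hp)
  · intro s hs s' hs' h
    rw [← Finset.sdiff_union_of_subset (hT s hs).2, ← Finset.sdiff_union_of_subset (hT s' hs').2]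
    simp only at h
    rw [h]

lemma dvd_reduce (W r : ℕ) (P s : Finset ℕ) (hP : ∀ p ∈ P, p.Prime ∧ ¬ p ∣ W) (hs : s ⊆ P) (hr : r ∣ W * ∏ p ∈ s, p) :
    (P.filter (fun p => p ∣ r)) ⊆ s ∧ r ∣ W * ∏ p ∈ P.filter (fun p => p ∣ r), p := by
  have h1 : (P.filter (fun p => p ∣ r)) ⊆ s := by
    intro p hp
    rw [Finset.mem_filter] at hp
    obtain ⟨hpp, hpW⟩ := hP p hp.1
    rcases (hpp.dvd_mul).mp (hp.2.trans hr) with h | h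
    · exact absurd h hpW
    · rw [Prime.dvd_finsetProd_iff hpp.prime] at h
      obtain ⟨q, hq, hpq⟩ := h
      rw [Nat.prime_dvd_prime_iff_eq hpp (hP q (hs hq)).1] at hpq
      exact hpq ▸ hq
  refine ⟨h1, ?_⟩
  rw [← Finset.prod_sdiff h1, mul_comm (∏ p ∈ s \ _, p), ← mul_assoc] at hr
  refine Nat.Coprime.dvd_of_dvd_mul_right ?_ hr
  apply Nat.Coprime.prod_right
  intro q hq
  rw [Finset.mem_sdiff, Finset.mem_filter, not_and] at hq
  rw [Nat.coprime_comm, Nat.Prime.coprime_iff_not_dvd (hP q (hs hq.1)).1]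
  exact hq.2 (hs hq.1)

/-- Xi as a sum over primitive characters -/
lemma Xi_eq (N j : ℕ) (hN : N ≠ 0) : ∃ I : Finset Chars, (∀ i ∈ I, good N i ∧ i.1 ∣ N ∧ i.2 ≠ 1) ∧
    Xi N j = ∑ i ∈ I, ‖psi i.2 j‖ := by
  classical
  haveI : NeZero N := ⟨hN⟩
  set f : DirichletCharacter ℂ N → Chars := fun χ => ⟨χ.conductor, χ.primitiveCharacter⟩ with hf
  set S : Finset (DirichletCharacter ℂ N) := Finset.univ.filter (fun χ => χ ≠ 1) with hS
  have hinj : Set.InjOn f (S : Set _) := by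
    intro χ _ χ' _ h
    have : ∀ i : Chars, ∀ hi : i.1 ∣ N, ∀ i' : Chars, ∀ hi' : i'.1 ∣ N, i = i' → changeLevel hi i.2 = changeLevel hi' i'.2 := by
      rintro i hi i' hi' rfl; rfl
    have h2 := this (f χ) χ.conductor_dvd_level (f χ') χ'.conductor_dvd_level h
    have e1 : changeLevel χ.conductor_dvd_level (f χ).2 = χ := changeLevel_primitiveCharacter χ
    have e2 : changeLevel χ'.conductor_dvd_level (f χ').2 = χ' := changeLevel_primitiveCharacter χ'
    exact e1.symm.trans (h2.trans e2)
  refine ⟨S.image f, ?_, ?_⟩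
  · intro i hi
    rw [Finset.mem_image] at hi
    obtain ⟨χ, hχ, rfl⟩ := hi
    have hχ1 : χ ≠ 1 := by simpa [hS] using hχ
    have hd := χ.conductor_dvd_level
    have h0 : χ.conductor ≠ 0 := fun h => hN (Nat.eq_zero_of_zero_dvd (h ▸ hd))
    have h1 : χ.conductor ≠ 1 := fun h => hχ1 ((eq_one_iff_conductor_eq_one).mpr h)
    refine ⟨⟨?_, Nat.le_of_dvd (Nat.pos_of_ne_zero hN) hd, χ.primitiveCharacter_isPrimitive⟩, hd, ?_⟩
    · show 1 < χ.conductor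
      omega
    · show χ.primitiveCharacter ≠ 1
      intro h
      apply hχ1
      rw [← changeLevel_primitiveCharacter χ, h, changeLevel_one]
  · rw [Finset.sum_image hinj, Xi, tsum_fintype, hS, Finset.sum_filter]
    refine Finset.sum_congr rfl fun χ _ => ?_
    by_cases h : χ = 1
    · simp [h]
    · simp only [h, if_false, ne_eq, not_false_eq_true, if_true]
      rfl

end DSR
end

section
namespace DSR
open Complex Filter Topology DirichletCharacter

local notation "Λ" => ArithmeticFunction.vonMangoldt

lemma XiSum (C W R j : ℕ) (hW : W ≠ 0) (hC : ∀ p : ℕ, p.Prime → ¬ p ∣ W → (C:ℝ) * √p ≤ p - 1)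
    (P : Finset ℕ) (hP : ∀ p ∈ P, p.Prime ∧ ¬ p ∣ W) (T : Finset (Finset ℕ)) (hT : ∀ s ∈ T, s ⊆ P ∧ ∏ p ∈ s, p ≤ R^2) :
    ∃ I : Finset Chars, (∀ i ∈ I, good (W*R^2) i ∧ i.2 ≠ 1 ∧ ∃ s ∈ T, i.1 ∣ W * ∏ p ∈ s, p) ∧
      ∑ s ∈ T, (∏ p ∈ s, ((C:ℝ)/(p-1))) * Xi (W * ∏ p ∈ s, p) j ≤
        ∑ i ∈ I, ‖psi i.2 j‖ * (√W / √(i.1) * ∏ p ∈ P, (1 + (C:ℝ)/(p-1))) := by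
  classical
  have hN : ∀ s : Finset ℕ, s ∈ T → W * ∏ p ∈ s, p ≠ 0 := by
    intro s hs
    exact mul_ne_zero hW (Finset.prod_ne_zero_iff.mpr fun p hp => (hP p ((hT s hs).1 hp)).1.ne_zero)
  choose! J hJ1 hJ2 using fun (s : Finset ℕ) (hs : s ∈ T) => Xi_eq (W * ∏ p ∈ s, p) j (hN s hs)
  have hw : ∀ p ∈ P, 0 ≤ (C:ℝ)/(p-1) := by
    intro p hp
    have : (2:ℝ) ≤ p := by exact_mod_cast (hP p hp).1.two_le
    exact div_nonneg (by positivity) (by linarith)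
  have hw2 : ∀ p ∈ P, (C:ℝ)/(p-1) ≤ 1/√p := by
    intro p hp
    have h2 : (2:ℝ) ≤ p := by exact_mod_cast (hP p hp).1.two_le
    have := hC p (hP p hp).1 (hP p hp).2
    rw [div_le_div_iff₀ (by linarith) (by positivity)]
    linarith
  refine ⟨T.biUnion J, ?_, ?_⟩
  · intro i hi
    rw [Finset.mem_biUnion] at hi
    obtain ⟨s, hs, his⟩ := hi
    obtain ⟨⟨h1, h2, h3⟩, h4, h5⟩ := hJ1 s hs i his
    exact ⟨⟨h1, h2.trans (Nat.mul_le_mul_left _ (hT s hs).2), h3⟩, h5, s, hs, h4⟩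
  · have e1 : ∀ s ∈ T, (∏ p ∈ s, ((C:ℝ)/(p-1))) * Xi (W * ∏ p ∈ s, p) j =
        ∑ i ∈ T.biUnion J, if i ∈ J s then (∏ p ∈ s, ((C:ℝ)/(p-1))) * ‖psi i.2 j‖ else 0 := by
      intro s hs
      rw [hJ2 s hs, Finset.mul_sum, ← Finset.sum_filter]
      refine Finset.sum_congr ?_ fun _ _ => rfl
      ext i
      simp only [Finset.mem_filter, Finset.mem_biUnion]
      exact ⟨fun h => ⟨⟨s, hs, h⟩, h⟩, fun h => h.2⟩
    rw [Finset.sum_congr rfl e1, Finset.sum_comm]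
    refine Finset.sum_le_sum fun i hi => ?_
    rw [← Finset.sum_filter, ← Finset.sum_mul, mul_comm]
    refine mul_le_mul_of_nonneg_left ?_ (norm_nonneg _)
    rw [Finset.mem_biUnion] at hi
    obtain ⟨s0, hs0, his0⟩ := hi
    have hr1 := (hJ1 s0 hs0 i his0).1.1
    set t := P.filter (fun p => p ∣ i.1) with ht
    have hred : ∀ s ∈ T, i ∈ J s → t ⊆ s ∧ i.1 ∣ W * ∏ p ∈ t, p := fun s hs his =>
      dvd_reduce W i.1 P s hP (hT s hs).1 (hJ1 s hs i his).2.1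
    refine (superset_sum (fun p : ℕ => (C:ℝ)/(p-1)) P t hw (Finset.filter_subset _ _) _ ?_).trans ?_
    · intro s hs
      rw [Finset.mem_filter] at hs
      exact ⟨(hT s hs.1).1, (hred s hs.1 hs.2).1⟩
    · refine mul_le_mul_of_nonneg_right ?_ (Finset.prod_nonneg fun p hp => by have := hw p hp; linarith)
      have htP : ∀ p ∈ t, p ∈ P := fun p hp => (Finset.mem_filter.mp hp).1
      have h1 : ∏ p ∈ t, ((C:ℝ)/(p-1)) ≤ ∏ p ∈ t, 1/√(p:ℝ) :=
        Finset.prod_le_prod (fun p hp => hw p (htP p hp)) (fun p hp => hw2 p (htP p hp))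
      have h2 : ∏ p ∈ t, 1/√(p:ℝ) = 1/√(∏ p ∈ t, p : ℕ) := by
        rw [Finset.prod_div_distrib]; push_cast
        rw [Real.sqrt_prod _ (fun p _ => by positivity)]; simp
      have hpos : 0 < ∏ p ∈ t, p := Finset.prod_pos fun p hp => (hP p (htP p hp)).1.pos
      have h3 : i.1 ≤ W * ∏ p ∈ t, p := Nat.le_of_dvd (by positivity) (hred s0 hs0 his0).2
      refine h1.trans ?_
      rw [h2, div_le_div_iff₀ (Real.sqrt_pos.mpr (by exact_mod_cast hpos)) (Real.sqrt_pos.mpr (by exact_mod_cast (by omega : 0 < i.1)))]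
      rw [one_mul, ← Real.sqrt_mul (by positivity)]
      exact Real.sqrt_le_sqrt (by exact_mod_cast h3)

lemma ev_pow (c : ℝ) (ρ : ℝ) (hρ : 1 < ρ) (D : ℕ) (hc : 0 ≤ c) : ∀ᶠ j : ℕ in atTop, c / ρ^j * (j:ℝ)^D ≤ 1/4 := by
  have h := tendsto_pow_const_div_const_pow_of_one_lt D hρ
  have h2 := (h.const_mul c)
  rw [mul_zero] at h2
  filter_upwards [h2.eventually (gt_mem_nhds (show (0:ℝ) < 1/4 by norm_num))] with j hj
  refine le_trans (le_of_eq ?_) hj.le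
  ring

lemma BV (C B W : ℕ) (hW : W ≠ 0) (hC1 : 1 ≤ C) (hC : ∀ p : ℕ, p.Prime → ¬ p ∣ W → (C:ℝ) * √p ≤ p - 1) :
    ∀ᶠ j : ℕ in atTop, ∃ ps : ℕ, ∀ R : ℕ, W ≤ R → 2 ≤ R → (R:ℝ) ≤ Real.exp (j/1000) →
      ∀ P : Finset ℕ, (∀ p ∈ P, p.Prime ∧ p ≤ R ∧ ¬ p ∣ W ∧ p ≠ ps) →
      ∑ s ∈ P.powerset.filter (fun s => ∏ p ∈ s, p ≤ R^2), (C:ℝ)^s.card * Err (W * ∏ p ∈ s, p) j R ≤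
        j.factorial / (j:ℝ)^B := by
  classical
  obtain ⟨C1, ρ, hC10, hρ, hLF⟩ := sum_LF
  obtain ⟨C2, hC20, hDd⟩ := Dd_le
  set A' := 8 + 6*C + B with hA'
  have hpsi := psi_small (2*A') (4*A' + 6*C + B + 1) W hW
  have e3 := ev_pow C2 (1.4/1.1) (by norm_num) B hC20
  have e1 := ev_pow C1 ρ hρ (6*C+B) hC10
  filter_upwards [hpsi, e1, e3, eventually_ge_atTop 100000, eventually_ge_atTop ⌈8 * √W⌉₊] with j hpsi e1 e3 hj hjW
  obtain ⟨rs, hrs⟩ := hpsi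
  have hps : ∃ ps : ℕ, (∃ p, p.Prime ∧ p ∣ rs ∧ ¬ p ∣ W) → (ps.Prime ∧ ps ∣ rs ∧ ¬ ps ∣ W) := by
    by_cases h : ∃ p, p.Prime ∧ p ∣ rs ∧ ¬ p ∣ W
    · obtain ⟨p, hp⟩ := h; exact ⟨p, fun _ => hp⟩
    · exact ⟨0, fun h' => absurd h' h⟩
  obtain ⟨ps, hps⟩ := hps
  refine ⟨ps, fun R hWR hR hRj P hP => ?_⟩
  have hP' : ∀ p ∈ P, p.Prime ∧ ¬ p ∣ W := fun p hp => ⟨(hP p hp).1, (hP p hp).2.2.1⟩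
  set T := P.powerset.filter (fun s => ∏ p ∈ s, p ≤ R^2) with hTdef
  have hT : ∀ s ∈ T, s ⊆ P ∧ ∏ p ∈ s, p ≤ R^2 := by
    intro s hs
    rw [hTdef, Finset.mem_filter, Finset.mem_powerset] at hs; exact hs
  have hj1 : (100000:ℝ) ≤ j := by exact_mod_cast hj
  have hj0 : (0:ℝ) < j := by linarith
  have hjW' : 8 * √W ≤ j := (Nat.le_ceil _).trans (by exact_mod_cast hjW)
  have hR0 : (0:ℝ) < R := by positivity
  have hR1 : (1:ℝ) ≤ R := by exact_mod_cast (by omega : 1 ≤ R)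
  set V := ∏ p ∈ P, (1 + (C:ℝ)/(p-1)) with hV
  have hw : ∀ p ∈ P, 0 ≤ (C:ℝ)/(p-1) := by
    intro p hp
    have : (2:ℝ) ≤ p := by exact_mod_cast (hP p hp).1.two_le
    exact div_nonneg (by positivity) (by linarith)
  have hV0 : 0 ≤ V := Finset.prod_nonneg fun p hp => by have := hw p hp; linarith
  have hVb : V ≤ (j:ℝ)^(6*C) := by
    refine (V_bound C R hR P (fun p hp => ⟨(hP p hp).1, (hP p hp).2.1⟩)).trans ?_
    have : Real.log R ≤ j/1000 := by
      rw [Real.log_le_iff_le_exp hR0]; exact hRj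
    have h0 : 0 ≤ Real.log R := Real.log_nonneg hR1
    gcongr
    linarith
  set D0 := |∑' n, Λ n * Fw j n - j.factorial| with hD0
  have hD00 : 0 ≤ D0 := abs_nonneg _
  -- split of each term
  have hterm : ∀ s ∈ T, (C:ℝ)^s.card * Err (W * ∏ p ∈ s, p) j R ≤
      (∏ p ∈ s, ((C:ℝ)/(p-1))) * D0 + (∏ p ∈ s, ((C:ℝ)/(p-1))) * Xi (W * ∏ p ∈ s, p) j
        + (R:ℝ)^2 * Dd R j := by
    intro s hs
    obtain ⟨hsP, hsR⟩ := hT s hs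
    have hd := Dd_nonneg R j
    have hx := Xi_nonneg (W * ∏ p ∈ s, p) j
    have h1 : (C:ℝ)^s.card * (((W * ∏ p ∈ s, p).totient : ℝ))⁻¹ ≤ ∏ p ∈ s, ((C:ℝ)/(p-1)) := by
      rw [totient_prod W s (fun p hp => hP' p (hsP hp)), Finset.prod_div_distrib, Finset.prod_const, div_eq_mul_inv]
      have hcast : ((∏ p ∈ s, (p-1) : ℕ) : ℝ) = ∏ p ∈ s, ((p:ℝ)-1) := by
        push_cast
        refine Finset.prod_congr rfl fun p hp => ?_
        rw [Nat.cast_sub (hP' p (hsP hp)).1.one_lt.le]; simp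
      have hpos : (0:ℝ) < ∏ p ∈ s, ((p:ℝ)-1) := Finset.prod_pos fun p hp => by
        have : (2:ℝ) ≤ p := by exact_mod_cast (hP' p (hsP hp)).1.two_le
        linarith
      gcongr
      rw [Nat.cast_mul, hcast]
      have : (1:ℝ) ≤ W.totient := by exact_mod_cast Nat.totient_pos.mpr (Nat.pos_of_ne_zero hW)
      nlinarith
    have h2 : (C:ℝ)^s.card ≤ (R:ℝ)^2 := by
      rw [← Finset.prod_const]
      calc ∏ p ∈ s, (C:ℝ) ≤ ∏ p ∈ s, (p:ℝ) := by
            refine Finset.prod_le_prod (fun _ _ => by positivity) fun p hp => ?_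
            have h3 := hC p (hP' p (hsP hp)).1 (hP' p (hsP hp)).2
            have : (1:ℝ) ≤ √p := Real.one_le_sqrt.mpr (by exact_mod_cast (hP' p (hsP hp)).1.one_lt.le)
            have : (C:ℝ) ≤ C * √p := le_mul_of_one_le_right (by positivity) this
            linarith
        _ ≤ (R:ℝ)^2 := by
            have h9 := (Nat.cast_le (α := ℝ)).mpr hsR
            push_cast at h9; exact h9
    rw [Err, mul_add, ← mul_assoc, ← mul_add]
    gcongr
  refine (Finset.sum_le_sum hterm).trans ?_
  rw [Finset.sum_add_distrib, Finset.sum_add_distrib, ← Finset.sum_mul, Finset.sum_const, nsmul_eq_mul]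
  -- first
  have b1 : (∑ s ∈ T, ∏ p ∈ s, ((C:ℝ)/(p-1))) * D0 ≤ j.factorial/(j:ℝ)^B * (1/4) := by
    have h1 : ∑ s ∈ T, ∏ p ∈ s, ((C:ℝ)/(p-1)) ≤ V := by
      have := superset_sum (fun p : ℕ => (C:ℝ)/(p-1)) P ∅ hw (by simp) T (fun s hs => ⟨(hT s hs).1, by simp⟩)
      simpa using this
    have h2 : D0 ≤ C1 * j.factorial / ρ^j := hLF j
    calc _ ≤ (j:ℝ)^(6*C) * (C1 * j.factorial / ρ^j) := by
          apply mul_le_mul (h1.trans hVb) h2 hD00 (by positivity)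
      _ = j.factorial/(j:ℝ)^B * (C1/ρ^j * (j:ℝ)^(6*C+B)) := by
          rw [pow_add]; field_simp
      _ ≤ _ := by gcongr
  -- third
  have b3 : (T.card:ℝ) * ((R:ℝ)^2 * Dd R j) ≤ j.factorial/(j:ℝ)^B * (1/4) := by
    have h1 : (T.card:ℝ) ≤ (R:ℝ)^2 := by
      have := prod_le_icc (fun _ => 1) (fun _ => zero_le_one) P (fun p hp => (hP p hp).1) T (Finset.filter_subset _ _) (R^2)
        (fun s hs => (hT s hs).2)
      simpa using this
    have h2 := hDd R j (by omega)
    have h3 : (R:ℝ)^6 ≤ 1.1^j := by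
      calc (R:ℝ)^6 ≤ (Real.exp (j/1000))^6 := by gcongr
        _ = (Real.exp (6/1000))^j := by rw [← Real.exp_nat_mul, ← Real.exp_nat_mul]; congr 1; push_cast; ring
        _ ≤ 1.1^j := by
          gcongr
          have := Real.exp_bound_div_one_sub_of_interval (x := 6/1000) (by norm_num) (by norm_num)
          refine this.trans (by norm_num)
    calc _ ≤ (R:ℝ)^2 * ((R:ℝ)^2 * (C2 * j.factorial * (R:ℝ)^2 / 1.4^j)) := by
          have := Dd_nonneg R j
          gcongr
      _ = C2 * j.factorial * (R:ℝ)^6 / 1.4^j := by ring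
      _ ≤ C2 * j.factorial * 1.1^j / 1.4^j := by gcongr
      _ = j.factorial/(j:ℝ)^B * (C2/(1.4/1.1)^j * (j:ℝ)^B) := by
          rw [div_pow]; field_simp
      _ ≤ _ := by gcongr
  -- second
  have b2 : ∑ s ∈ T, (∏ p ∈ s, ((C:ℝ)/(p-1))) * Xi (W * ∏ p ∈ s, p) j ≤ j.factorial/(j:ℝ)^B * (1/4) := by
    obtain ⟨I, hI, hle⟩ := XiSum C W R j hW hC P hP' T hT
    refine hle.trans ?_
    rw [← Finset.sum_filter_add_sum_filter_not I (fun i => i.1 ≤ j^(2*A'))]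
    have c1 : ∑ i ∈ I.filter (fun i => i.1 ≤ j^(2*A')), ‖psi i.2 j‖ * (√W / √(i.1) * V) ≤
        j.factorial/(j:ℝ)^B * (√W / j) := by
      have hcard := card_chars (j^(2*A')) (I.filter (fun i => i.1 ≤ j^(2*A'))) (fun i hi => by
        rw [Finset.mem_filter] at hi
        exact ⟨(hI i hi.1).1.1, hi.2, (hI i hi.1).1.2.2⟩)
      have hcard' : ((I.filter (fun i => i.1 ≤ j^(2*A'))).card : ℝ) ≤ (j:ℝ)^(4*A') := by
        calc _ ≤ ((j^(2*A') * j^(2*A') : ℕ):ℝ) := by exact_mod_cast hcard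
          _ = _ := by push_cast; ring
      have hb : ∀ i ∈ I.filter (fun i => i.1 ≤ j^(2*A')), ‖psi i.2 j‖ * (√W / √(i.1) * V) ≤
          j.factorial/(j:ℝ)^(4*A' + 6*C + B + 1) * (√W * (j:ℝ)^(6*C)) := by
        intro i hi
        rw [Finset.mem_filter] at hi
        obtain ⟨⟨g1, g2, g3⟩, g4, s, hs, hds⟩ := hI i hi.1
        have hne : i.1 ≠ rs ∨ i.1 ∣ W := by
          by_contra hcon
          push Not at hcon
          obtain ⟨hc1, hc2⟩ := hcon
          have hred := dvd_reduce W i.1 P s hP' (hT s hs).1 hds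
          by_cases hex : ∃ p, p.Prime ∧ p ∣ rs ∧ ¬ p ∣ W
          · obtain ⟨q1, q2, q3⟩ := hps hex
            rw [← hc1] at q2
            rcases (q1.dvd_mul).mp (q2.trans hds) with h | h
            · exact q3 h
            · rw [Prime.dvd_finsetProd_iff q1.prime] at h
              obtain ⟨q, hq, hpq⟩ := h
              have hqP := (hT s hs).1 hq
              rw [Nat.prime_dvd_prime_iff_eq q1 (hP q hqP).1] at hpq
              exact (hP q hqP).2.2.2 hpq.symm
          · have hemp : P.filter (fun p => p ∣ i.1) = ∅ := by
              rw [Finset.filter_eq_empty_iff]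
              intro p hp hpi
              exact hex ⟨p, (hP p hp).1, hc1 ▸ hpi, (hP' p hp).2⟩
            rw [hemp] at hred
            simp at hred
            exact hc2 hred
        have h1 := hrs i.1 g1 hi.2 hne i.2 g3 g4
        have hsq : (1:ℝ) ≤ √(i.1) := Real.one_le_sqrt.mpr (by exact_mod_cast g1.le)
        have h2 : √W / √(i.1) ≤ √W := div_le_self (Real.sqrt_nonneg _) hsq
        gcongr
      refine (Finset.sum_le_card_nsmul _ _ _ hb).trans ?_
      rw [nsmul_eq_mul]
      calc _ ≤ (j:ℝ)^(4*A') * (j.factorial/(j:ℝ)^(4*A' + 6*C + B + 1) * (√W * (j:ℝ)^(6*C))) := by gcongr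
        _ = _ := by rw [pow_add, pow_add, pow_add]; field_simp
    have c2 : ∑ i ∈ I.filter (fun i => ¬ i.1 ≤ j^(2*A')), ‖psi i.2 j‖ * (√W / √(i.1) * V) ≤
        j.factorial/(j:ℝ)^B * (√W / j) := by
      have hQ : ((W*R^2 : ℕ):ℝ) ≤ Real.exp (j/100) := by
        calc ((W*R^2 : ℕ):ℝ) ≤ (R:ℝ)^3 := by
              push_cast
              have : (W:ℝ) ≤ R := by exact_mod_cast hWR
              nlinarith [sq_nonneg (R:ℝ)]
          _ ≤ (Real.exp (j/1000))^3 := by gcongr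
          _ = Real.exp (3*j/1000) := by rw [← Real.exp_nat_mul]; congr 1; push_cast; ring
          _ ≤ _ := Real.exp_le_exp.mpr (by linarith)
      have hsum := psi_sum (W*R^2) j (Nat.one_le_iff_ne_zero.mpr (by positivity)) hj hQ
        (I.filter (fun i => ¬ i.1 ≤ j^(2*A'))) (fun i hi => (hI i (Finset.mem_filter.mp hi).1).1)
      have hb : ∀ i ∈ I.filter (fun i => ¬ i.1 ≤ j^(2*A')), ‖psi i.2 j‖ * (√W / √(i.1) * V) ≤
          ‖psi i.2 j‖ * (√W / (j:ℝ)^A' * (j:ℝ)^(6*C)) := by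
        intro i hi
        rw [Finset.mem_filter, not_le] at hi
        have : (j:ℝ)^A' ≤ √(i.1) := by
          apply Real.le_sqrt_of_sq_le
          rw [← pow_mul, mul_comm]
          exact_mod_cast hi.2.le
        gcongr
      refine (Finset.sum_le_sum hb).trans ?_
      rw [← Finset.sum_mul]
      calc _ ≤ ((j:ℝ)^7 * j.factorial) * (√W / (j:ℝ)^A' * (j:ℝ)^(6*C)) := by gcongr
        _ = _ := by rw [hA', show 8 + 6*C + B = 7 + 6*C + B + 1 by ring, pow_add, pow_add, pow_add]; field_simp
    have c3 : √W / j ≤ 1/8 := by rw [div_le_iff₀ hj0]; linarith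
    calc _ ≤ j.factorial/(j:ℝ)^B * (√W / j) + j.factorial/(j:ℝ)^B * (√W / j) := add_le_add c1 c2
      _ ≤ j.factorial/(j:ℝ)^B * (1/8) + j.factorial/(j:ℝ)^B * (1/8) := by gcongr
      _ = _ := by ring
  have : 0 ≤ j.factorial/(j:ℝ)^B := by positivity
  linarith

end DSR
end

section
namespace DSR
open Filter Topology

section tensor
variable {ι κ : Type*} [Fintype ι] [DecidableEq ι] [Fintype κ] [DecidableEq κ]

def psd {κ : Type*} [Fintype κ] (M : κ → κ → ℝ) : Prop :=
  (∀ a b, M a b = M b a) ∧ ∀ y : κ → ℝ, 0 ≤ ∑ a, ∑ b, y a * y b * M a b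

lemma psd_iff {κ : Type*} [Fintype κ] (M : κ → κ → ℝ) : psd M ↔ (Matrix.of M).PosSemidef := by
  rw [Matrix.posSemidef_iff_dotProduct_mulVec, psd]
  refine and_congr ?_ (forall_congr' fun y => ?_)
  · rw [Matrix.IsHermitian.ext_iff]
    simp only [Matrix.of_apply, star_trivial]
    exact ⟨fun h a b => h b a, fun h a b => h b a⟩
  · have : ∑ a, ∑ b, y a * y b * M a b = star y ⬝ᵥ (Matrix.of M).mulVec y := by
      simp only [dotProduct, Matrix.mulVec, Pi.star_apply, star_trivial, Matrix.of_apply, Finset.mul_sum]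
      exact Finset.sum_congr rfl fun a _ => Finset.sum_congr rfl fun b _ => by ring
    rw [this]

lemma tensor_psd_fin (M : ι → κ → κ → ℝ) (hM : ∀ p, psd (M p)) (s : Finset ι) :
    psd (fun u v : ι → κ => ∏ p ∈ s, M p (u p) (v p)) := by
  induction s using Finset.induction_on with
  | empty =>
    refine ⟨fun a b => by simp, fun y => ?_⟩
    simp only [Finset.prod_empty, mul_one]
    simp_rw [← Finset.mul_sum]
    rw [← Finset.sum_mul]
    exact mul_self_nonneg _
  | insert p s hp ih =>
    rw [psd_iff] at ih ⊢
    have h1 := ((psd_iff _).mp (hM p)).submatrix (fun u : ι → κ => u p)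
    have h2 := h1.hadamard ih
    have e : (Matrix.of fun u v : ι → κ => ∏ p ∈ insert p s, M p (u p) (v p)) =
        ((Matrix.of (M p)).submatrix (fun u : ι → κ => u p) fun u => u p).hadamard
          (Matrix.of fun u v => ∏ p ∈ s, M p (u p) (v p)) := by
      ext u v
      simp [Finset.prod_insert hp, Matrix.hadamard]
    rw [e]
    exact h2

/-- tensor quadratic form -/
def tq (M : ι → κ → κ → ℝ) (x : (ι → κ) → ℝ) : ℝ := ∑ u, ∑ v, x u * x v * ∏ p, M p (u p) (v p)

lemma tq_mono (K E : ι → κ → κ → ℝ) (hK : ∀ p, psd (K p)) (hE : ∀ p, psd (E p)) (x : (ι → κ) → ℝ) :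
    tq K x ≤ tq (fun p a b => K p a b + E p a b) x := by
  unfold tq
  simp_rw [Finset.prod_add, Finset.mul_sum]
  have : ∀ t : Finset ι, 0 ≤ ∑ u : ι → κ, ∑ v : ι → κ, x u * x v *
      ((∏ p ∈ t, K p (u p) (v p)) * ∏ p ∈ Finset.univ \ t, E p (u p) (v p)) := by
    intro t
    have h := (tensor_psd_fin (fun p => if p ∈ t then K p else E p) (fun p => by split_ifs; exacts [hK p, hE p]) Finset.univ).2 x
    refine h.trans (le_of_eq ?_)
    refine Finset.sum_congr rfl fun u _ => Finset.sum_congr rfl fun v _ => ?_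
    congr 1
    show ∏ p, (if p ∈ t then K p else E p) (u p) (v p) = _
    rw [← Finset.prod_sdiff (Finset.subset_univ t), mul_comm]
    congr 1
    · exact Finset.prod_congr rfl fun p hp => by simp [hp]
    · exact Finset.prod_congr rfl fun p hp => by
        rw [Finset.mem_sdiff] at hp
        simp [hp.2]
  have e : ∑ u : ι → κ, ∑ v : ι → κ, ∑ t ∈ Finset.univ.powerset, x u * x v *
      ((∏ p ∈ t, K p (u p) (v p)) * ∏ p ∈ Finset.univ \ t, E p (u p) (v p)) =
      ∑ t ∈ Finset.univ.powerset, ∑ u : ι → κ, ∑ v : ι → κ, x u * x v *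
      ((∏ p ∈ t, K p (u p) (v p)) * ∏ p ∈ Finset.univ \ t, E p (u p) (v p)) := by
    rw [Finset.sum_comm_cycle]
  rw [e, ← Finset.add_sum_erase _ _ (Finset.mem_powerset.mpr (Finset.Subset.refl Finset.univ))]
  simp only [Finset.sdiff_self, Finset.prod_empty, mul_one]
  exact le_add_of_nonneg_right (Finset.sum_nonneg fun t _ => this t)

lemma tq_diag (M T : ι → κ → κ → ℝ) (D : ι → κ → ℝ) (h : ∀ p a b, M p a b = ∑ c, D p c * T p c a * T p c b)
    (x : (ι → κ) → ℝ) :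
    tq M x = ∑ w : ι → κ, (∏ p, D p (w p)) * (∑ u, x u * ∏ p, T p (w p) (u p))^2 := by
  unfold tq
  have e : ∀ u v : ι → κ, ∏ p, M p (u p) (v p) =
      ∑ w : ι → κ, (∏ p, D p (w p)) * (∏ p, T p (w p) (u p)) * ∏ p, T p (w p) (v p) := by
    intro u v
    simp_rw [h, ← Finset.prod_mul_distrib]
    rw [Finset.prod_univ_sum]
    simp
  simp_rw [e, Finset.mul_sum]
  simp_rw [sq, Finset.sum_mul_sum, Finset.mul_sum]
  rw [Finset.sum_comm_cycle]
  refine Finset.sum_congr rfl fun w _ => Finset.sum_congr rfl fun u _ => Finset.sum_congr rfl fun v _ => ?_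
  ring

/-- composition -/
lemma tensor_comp (T S : ι → κ → κ → ℝ) (c : (ι → κ) → ℝ) (w : ι → κ) :
    ∑ v : ι → κ, (∑ u, c u * ∏ p, S p (v p) (u p)) * ∏ p, T p (w p) (v p) =
      ∑ u, c u * ∏ p, ∑ b, T p (w p) b * S p b (u p) := by
  have e : ∀ u : ι → κ, ∏ p, ∑ b, T p (w p) b * S p b (u p) = ∑ v : ι → κ, ∏ p, (T p (w p) (v p) * S p (v p) (u p)) := by
    intro u
    rw [Finset.prod_univ_sum]; simp
  simp_rw [e, Finset.prod_mul_distrib, Finset.sum_mul, Finset.mul_sum]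
  rw [Finset.sum_comm]
  refine Finset.sum_congr rfl fun u _ => Finset.sum_congr rfl fun v _ => ?_
  ring

end tensor

section localforms
variable {k : ℕ}

def K1 (s : ℝ) : Option (Fin k) → Option (Fin k) → ℝ
  | none, none => 1
  | none, some _ => s
  | some _, none => s
  | some i, some i' => if i = i' then s else 0

def K2 (m : Fin k) (t : ℝ) : Option (Fin k) → Option (Fin k) → ℝ
  | none, none => 1
  | none, some i => if i = m then 0 else t
  | some i, none => if i = m then 0 else t
  | some i, some i' => if i = i' then (if i = m then 0 else t) else 0

/-- unitriangular local matrix -/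
def Tm (a : Fin k → ℝ) : Option (Fin k) → Option (Fin k) → ℝ
  | none, none => 1
  | none, some i => a i
  | some _, none => 0
  | some i, some i' => if i = i' then 1 else 0

def Dm (b : ℝ) (a : Fin k → ℝ) : Option (Fin k) → ℝ
  | none => b
  | some i => a i

lemma quad_TD (b : ℝ) (a d : Fin k → ℝ) (y : Option (Fin k) → ℝ) :
    ∑ x, ∑ z, y x * y z * (∑ c, Dm b d c * Tm a c x * Tm a c z) =
      b * (y none + ∑ i, a i * y (some i))^2 + ∑ i, d i * (y (some i))^2 := by
  have e : ∑ x, ∑ z, y x * y z * (∑ c, Dm b d c * Tm a c x * Tm a c z) =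
      ∑ c, Dm b d c * (∑ x, Tm a c x * y x)^2 := by
    simp_rw [sq, Finset.sum_mul_sum, Finset.mul_sum]
    rw [Finset.sum_comm_cycle]
    refine Finset.sum_congr rfl fun w _ => Finset.sum_congr rfl fun u _ => Finset.sum_congr rfl fun v _ => ?_
    ring
  rw [e]
  simp [Fintype.sum_option, Dm, Tm]

lemma psd_TD (b : ℝ) (a d : Fin k → ℝ) (hb : 0 ≤ b) (hd : ∀ i, 0 ≤ d i) :
    psd (fun x z : Option (Fin k) => ∑ c, Dm b d c * Tm a c x * Tm a c z) := by
  refine ⟨fun x z => Finset.sum_congr rfl fun c _ => by ring, fun y => ?_⟩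
  rw [quad_TD]
  have : 0 ≤ ∑ i, d i * (y (some i))^2 := Finset.sum_nonneg fun (i : Fin k) _ => mul_nonneg (hd i) (sq_nonneg (y (some i)))
  positivity

lemma quad_sub {κ : Type*} [Fintype κ] (A B : κ → κ → ℝ) (y : κ → ℝ) : ∑ x, ∑ z, y x * y z * (A x z - B x z) =
    ∑ x, ∑ z, y x * y z * A x z - ∑ x, ∑ z, y x * y z * B x z := by
  simp_rw [mul_sub, Finset.sum_sub_distrib]

lemma quad_K1 (s : ℝ) (y : Option (Fin k) → ℝ) :
    ∑ x, ∑ z, y x * y z * K1 s x z = (y none)^2 + 2 * s * y none * ∑ i, y (some i) + s * ∑ i, (y (some i))^2 := by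
  simp only [Fintype.sum_option, K1, Finset.sum_add_distrib, mul_ite, mul_zero, Finset.sum_ite_eq, Finset.mem_univ, if_true]
  have e1 : ∑ i, y none * y (some i) * s = s * y none * ∑ i, y (some i) := by
    rw [Finset.mul_sum]; exact Finset.sum_congr rfl fun i _ => by ring
  have e2 : ∑ i, y (some i) * y none * s = s * y none * ∑ i, y (some i) := by
    rw [Finset.mul_sum]; exact Finset.sum_congr rfl fun i _ => by ring
  have e3 : ∑ i, y (some i) * y (some i) * s = s * ∑ i, (y (some i))^2 := by
    rw [Finset.mul_sum]; exact Finset.sum_congr rfl fun i _ => by ring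
  rw [e1, e2, e3]
  ring

lemma K1_symm (s : ℝ) (x z : Option (Fin k)) : K1 s x z = K1 s z x := by
  rcases x with _ | i <;> rcases z with _ | i' <;> simp [K1, eq_comm]

lemma K2_symm (m : Fin k) (s : ℝ) (x z : Option (Fin k)) : K2 m s x z = K2 m s z x := by
  rcases x with _ | i <;> rcases z with _ | i'
  · rfl
  · rfl
  · rfl
  · by_cases h : i = i'
    · subst h; rfl
    · simp [K2, h, Ne.symm h]

lemma quad_K2 (m : Fin k) (t : ℝ) (y : Option (Fin k) → ℝ) :
    ∑ x, ∑ z, y x * y z * K2 m t x z = (y none)^2 + 2 * t * y none * ∑ i, (if i = m then 0 else y (some i))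
      + t * ∑ i, (if i = m then 0 else y (some i))^2 := by
  have e := quad_K1 t (fun o : Option (Fin k) => match o with | none => y none | some i => if i = m then 0 else y (some i))
  simp only at e
  rw [← e]
  refine Finset.sum_congr rfl fun x _ => Finset.sum_congr rfl fun z _ => ?_
  rcases x with _ | i <;> rcases z with _ | i' <;> simp only [K1, K2] <;> split_ifs <;> simp_all

lemma psd_K1 (s : ℝ) (hs : 0 ≤ s) (hk : k * s ≤ 1) : psd (K1 (k := k) s) := by
  refine ⟨?_, fun y => ?_⟩
  · rintro (_ | i) (_ | i') <;> simp [K1, eq_comm]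
  · rw [quad_K1]
    have h := sq_sum_le_card_mul_sum_sq (s := Finset.univ) (f := fun i : Fin k => y (some i))
    simp at h
    set S := ∑ i, y (some i)
    set Q := ∑ i, (y (some i))^2
    have hQ : 0 ≤ Q := Finset.sum_nonneg fun i _ => sq_nonneg _
    have : s^2 * S^2 ≤ s * Q := by
      calc s^2 * S^2 ≤ s^2 * (k * Q) := by gcongr
        _ = s * Q * (k * s) := by ring
        _ ≤ s * Q * 1 := by gcongr
        _ = _ := mul_one _
    nlinarith [sq_nonneg (y none + s * S)]

lemma psd_E1 (s : ℝ) (hs : 0 ≤ s) :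
    psd (fun x z : Option (Fin k) => ∑ c, Dm 1 (fun _ => s) c * Tm (fun _ => s) c x * Tm (fun _ => s) c z - K1 s x z) := by
  refine ⟨?_, fun y => ?_⟩
  · intro x z
    beta_reduce
    rw [K1_symm s x z]
    congr 1
    exact Finset.sum_congr rfl fun c _ => by ring
  · rw [quad_sub, quad_TD, quad_K1]
    rw [← Finset.mul_sum, ← Finset.mul_sum]
    nlinarith [sq_nonneg (s * ∑ i, y (some i))]

lemma psd_E2 (m : Fin k) (s t : ℝ) (hs : 0 < s) (hs1 : s ≤ 1/2) (ht : t = s + s * t) :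
    psd (fun x z : Option (Fin k) => K2 m t x z -
      ∑ c, Dm (1 - s^2) (fun i => if i = m then 0 else s * (1 - 8 * k * s)) c *
        Tm (fun i => if i = m then 0 else s) c x * Tm (fun i => if i = m then 0 else s) c z) := by
  refine ⟨?_, fun y => ?_⟩
  · intro x z
    beta_reduce
    rw [K2_symm m t x z]
    congr 1
    exact Finset.sum_congr rfl fun c _ => by ring
  · rw [quad_sub, quad_TD, quad_K2]
    set f : Fin k → ℝ := fun i => if i = m then 0 else y (some i) with hf
    have h := sq_sum_le_card_mul_sum_sq (s := Finset.univ) (f := f)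
    simp only [Finset.card_univ, Fintype.card_fin] at h
    have e1 : ∑ i, (if i = m then 0 else s) * y (some i) = s * ∑ i, f i := by
      rw [Finset.mul_sum]; exact Finset.sum_congr rfl fun i _ => by simp only [hf]; split_ifs <;> ring
    have e2 : ∑ i, (if i = m then 0 else s * (1 - 8 * k * s)) * y (some i)^2 = s * (1 - 8 * k * s) * ∑ i, (f i)^2 := by
      rw [Finset.mul_sum]; exact Finset.sum_congr rfl fun i _ => by simp only [hf]; split_ifs <;> ring
    rw [e1, e2]
    set S := ∑ i, f i
    set Q := ∑ i, (f i)^2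
    have hQ : 0 ≤ Q := Finset.sum_nonneg fun i _ => sq_nonneg _
    have ht0 : 0 < t := by
      by_contra hh; push Not at hh; nlinarith
    have ht2 : t ≤ 2 * s := by nlinarith
    have hst : s ≤ t := by nlinarith
    set z := y none + s * S with hz
    have ez : y none = z - s * S := by rw [hz]; ring
    rw [ez]
    have h1 : t^2 * S^2 ≤ 4 * k * s^2 * Q := by
      calc t^2 * S^2 ≤ (2*s)^2 * (k * Q) := by gcongr
        _ = _ := by ring
    have h3 : t - s = s * t := by linarith
    have h4 : (z - s*S)^2 + 2 * t * (z - s*S) * S + t * Q - ((1 - s^2) * z^2 + s * (1 - 8*k*s) * Q)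
       = (s * z + t * S)^2 + (t - s) * Q + 2 * z * S * (t - s - s * t) + (8 * k * s^2 * Q - 2 * (t^2 * S^2)) + ((t-s)^2 - (s*t)^2 + (s*t)^2) * S^2 := by ring
    rw [h4, h3]
    have : 0 ≤ s * t * Q := by positivity
    have : 0 ≤ ((s * t)^2 - (s*t)^2 + (s*t)^2) * S^2 := by ring_nf; positivity
    nlinarith [sq_nonneg (s * z + t * S)]

end localforms
end DSR
end

section
namespace DSR
open Filter Topology

section forms
variable {ι : Type*} [Fintype ι] [DecidableEq ι] {k : ℕ}

/-- sieve weights from diagonalizing coefficients -/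
noncomputable def lamOf (s : ι → ℝ) (c : (ι → Option (Fin k)) → ℝ) (d : ι → Option (Fin k)) : ℝ :=
  ∑ u, c u * ∏ p, Tm (fun _ => - s p) (d p) (u p)

lemma Tm_comp (a b : Fin k → ℝ) (x z : Option (Fin k)) :
    ∑ y, Tm a x y * Tm b y z = Tm (fun i => a i + b i) x z := by
  rcases x with _ | i <;> rcases z with _ | i' <;> simp [Fintype.sum_option, Tm]
  ring

lemma Tm_zero (x z : Option (Fin k)) : Tm (fun _ => (0:ℝ)) x z = if x = z then 1 else 0 := by
  rcases x with _ | i <;> rcases z with _ | i' <;> simp [Tm]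

lemma Q1_le (s : ι → ℝ) (hs : ∀ p, 0 ≤ s p) (hk : ∀ p, k * s p ≤ 1) (c : (ι → Option (Fin k)) → ℝ) :
    tq (fun p => K1 (s p)) (lamOf s c) ≤ ∑ u, (∏ p, Dm 1 (fun _ => s p) (u p)) * (c u)^2 := by
  have h1 := tq_mono (fun p => K1 (s p)) (fun p x z => ∑ c, Dm 1 (fun _ => s p) c * Tm (fun _ => s p) c x * Tm (fun _ => s p) c z - K1 (k := k) (s p) x z)
    (fun p => psd_K1 (s p) (hs p) (hk p)) (fun p => psd_E1 (s p) (hs p)) (lamOf s c)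
  refine h1.trans (le_of_eq ?_)
  rw [tq_diag _ (fun p => Tm (fun _ => s p)) (fun p => Dm 1 (fun _ => s p)) (fun p a b => by ring)]
  refine Finset.sum_congr rfl fun w _ => ?_
  congr 2
  unfold lamOf
  rw [tensor_comp]
  simp only [Tm_comp, add_neg_cancel, Tm_zero]
  have : ∀ u : ι → Option (Fin k), (∏ p, if w p = u p then (1:ℝ) else 0) = if w = u then 1 else 0 := by
    intro u
    split_ifs with h
    · subst h; simp
    · obtain ⟨p, hp⟩ := Function.ne_iff.mp h
      exact Finset.prod_eq_zero (Finset.mem_univ p) (if_neg hp)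
  simp [this]

lemma Q2_ge (m : Fin k) (s t : ι → ℝ) (hs : ∀ p, 0 < s p) (hs1 : ∀ p, s p ≤ 1/2) (ht : ∀ p, t p = s p + s p * t p)
    (hk : ∀ p, 8 * k * s p ≤ 1) (c : (ι → Option (Fin k)) → ℝ) :
    ∑ w : ι → Option (Fin k), (∏ p, Dm (1 - s p^2) (fun i => if i = m then 0 else s p * (1 - 8 * k * s p)) (w p)) *
      (∑ u, c u * ∏ p, Tm (fun i => if i = m then - s p else 0) (w p) (u p))^2
      ≤ tq (fun p => K2 m (t p)) (lamOf s c) := by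
  have h1 := tq_mono (fun p x z => ∑ c, Dm (1 - s p^2) (fun i => if i = m then 0 else s p * (1 - 8 * k * s p)) c *
        Tm (fun i => if i = m then 0 else s p) c x * Tm (fun i => if i = m then 0 else s p) c z)
      (fun p x z => K2 m (t p) x z -
      ∑ c, Dm (1 - s p^2) (fun i => if i = m then 0 else s p * (1 - 8 * k * s p)) c *
        Tm (fun i => if i = m then 0 else s p) c x * Tm (fun i => if i = m then 0 else s p) c z)
      (fun p => psd_TD _ _ _ (by nlinarith [hs p, hs1 p]) (fun i => by
        split_ifs
        · exact le_rfl
        · exact mul_nonneg (hs p).le (by linarith [hk p])))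
      (fun p => psd_E2 m (s p) (t p) (hs p) (hs1 p) (ht p)) (lamOf s c)
  simp only [add_sub_cancel] at h1
  refine le_trans (le_of_eq ?_) h1
  rw [tq_diag _ (fun p => Tm (fun i => if i = m then 0 else s p)) (fun p => Dm (1 - s p^2) (fun i => if i = m then 0 else s p * (1 - 8 * k * s p))) (fun p a b => rfl)]
  refine Finset.sum_congr rfl fun w _ => ?_
  congr 2
  unfold lamOf
  rw [tensor_comp]
  simp only [Tm_comp]
  refine Finset.sum_congr rfl fun u _ => ?_
  congr 1
  refine Finset.prod_congr rfl fun p _ => ?_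
  congr 1
  ext i
  split_ifs <;> ring

/-- fibre -/
def fib (u : ι → Option (Fin k)) (i : Fin k) : Finset ι := Finset.univ.filter fun p => u p = some i
def supp (u : ι → Option (Fin k)) : Finset ι := Finset.univ.filter fun p => u p ≠ none

lemma mem_fib (u : ι → Option (Fin k)) (i : Fin k) (p : ι) : p ∈ fib u i ↔ u p = some i := by simp [fib]
lemma mem_supp (u : ι → Option (Fin k)) (p : ι) : p ∈ supp u ↔ u p ≠ none := by simp [supp]

lemma fib_inj : Function.Injective (fib : (ι → Option (Fin k)) → Fin k → Finset ι) := by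
  intro u v h
  ext p i
  rw [← mem_fib, ← mem_fib, h]

lemma fib_surj (S : Fin k → Finset ι) (h : ∀ i j, i ≠ j → ∀ p ∈ S i, p ∉ S j) : ∃ u, fib u = S := by
  classical
  refine ⟨fun p => if h : ∃ i, p ∈ S i then some h.choose else none, ?_⟩
  ext i p
  rw [mem_fib]
  constructor
  · intro h1
    split_ifs at h1 with h2
    rw [← Option.some.inj h1]
    exact h2.choose_spec
  · intro h1
    have h2 : ∃ i, p ∈ S i := ⟨i, h1⟩
    rw [dif_pos h2]
    congr 1
    by_contra h3
    exact h _ _ h3 p h2.choose_spec h1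

lemma supp_eq (u : ι → Option (Fin k)) : supp u = Finset.univ.biUnion (fib u) := by
  ext p
  simp [mem_supp, mem_fib, Option.ne_none_iff_exists']

lemma fib_disj (u : ι → Option (Fin k)) : ((Finset.univ : Finset (Fin k)) : Set (Fin k)).PairwiseDisjoint (fib u) := by
  intro i _ j _ hij
  rw [Function.onFun, Finset.disjoint_left]
  intro p hp hq
  rw [mem_fib] at hp hq
  exact hij (Option.some.inj (hp.symm.trans hq))

lemma prod_supp (u : ι → Option (Fin k)) (f : ι → ℝ) : ∏ p ∈ supp u, f p = ∏ i, ∏ p ∈ fib u i, f p := by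
  rw [supp_eq, Finset.prod_biUnion (fib_disj u)]

lemma sum_supp (u : ι → Option (Fin k)) (f : ι → ℝ) : ∑ p ∈ supp u, f p = ∑ i, ∑ p ∈ fib u i, f p := by
  rw [supp_eq, Finset.sum_biUnion (fib_disj u)]

lemma prod_Dm_supp (u : ι → Option (Fin k)) (b f : ι → ℝ) :
    ∏ p, Dm (b p) (fun _ => f p) (u p) = (∏ p ∈ Finset.univ \ supp u, b p) * ∏ p ∈ supp u, f p := by
  rw [← Finset.prod_sdiff (Finset.subset_univ (supp u))]
  congr 1
  · refine Finset.prod_congr rfl fun p hp => ?_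
    have : u p = none := by simpa [mem_supp] using hp
    rw [this, Dm]
  · refine Finset.prod_congr rfl fun p hp => ?_
    obtain ⟨i, hi⟩ := Option.ne_none_iff_exists'.mp ((mem_supp u p).mp hp)
    rw [hi, Dm]

/-- the choice of weights -/
noncomputable def Yw (G : Finset ι → ℝ) (ℓ : ι → ℝ) (L : ℝ) (u : ι → Option (Fin k)) : ℝ :=
  if ∑ p ∈ supp u, ℓ p ≤ L then ∏ i, G (fib u i) else 0

noncomputable def cw (G : Finset ι → ℝ) (ℓ : ι → ℝ) (L : ℝ) (u : ι → Option (Fin k)) : ℝ :=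
  (∏ p, Dm 1 (fun _ => -1) (u p)) * Yw G ℓ L u

lemma sgn_sq (u : ι → Option (Fin k)) : (∏ p, Dm (1:ℝ) (fun _ => -1) (u p))^2 = 1 := by
  rw [← Finset.prod_pow]
  refine Finset.prod_eq_one fun p _ => ?_
  rcases u p with _ | i <;> simp [Dm]

lemma Q1_bound (s : ι → ℝ) (hs : ∀ p, 0 ≤ s p) (hk : ∀ p, k * s p ≤ 1) (G : Finset ι → ℝ) (ℓ : ι → ℝ) (L : ℝ) :
    tq (fun p => K1 (s p)) (lamOf s (cw (k := k) G ℓ L)) ≤ (∑ S : Finset ι, G S^2 * ∏ p ∈ S, s p)^k := by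
  refine (Q1_le s hs hk _).trans ?_
  have e : (∑ S : Finset ι, G S^2 * ∏ p ∈ S, s p)^k = ∑ S : Fin k → Finset ι, ∏ i, (G (S i)^2 * ∏ p ∈ S i, s p) := by
    have := Finset.prod_univ_sum (fun _ : Fin k => (Finset.univ : Finset (Finset ι))) (fun _ S => G S^2 * ∏ p ∈ S, s p)
    simpa using this
  rw [e]
  have h0 : ∀ S : Fin k → Finset ι, 0 ≤ ∏ i, (G (S i)^2 * ∏ p ∈ S i, s p) := fun S =>
    Finset.prod_nonneg fun i _ => mul_nonneg (sq_nonneg _) (Finset.prod_nonneg fun p _ => hs p)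
  calc _ ≤ ∑ u : ι → Option (Fin k), ∏ i, (G (fib u i)^2 * ∏ p ∈ fib u i, s p) := by
        refine Finset.sum_le_sum fun u _ => ?_
        rw [prod_Dm_supp, Finset.prod_const_one, one_mul, prod_supp, Finset.prod_mul_distrib, mul_comm]
        refine mul_le_mul_of_nonneg_right ?_ (Finset.prod_nonneg fun i _ => Finset.prod_nonneg fun p _ => hs p)
        rw [cw, mul_pow, sgn_sq, one_mul, Yw]
        split_ifs
        · rw [Finset.prod_pow]
        · rw [zero_pow two_ne_zero]; exact Finset.prod_nonneg fun i _ => sq_nonneg _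
    _ = ∑ S ∈ Finset.univ.image (fib : (ι → Option (Fin k)) → Fin k → Finset ι), ∏ i, (G (S i)^2 * ∏ p ∈ S i, s p) := by
        rw [Finset.sum_image fib_inj.injOn]
    _ ≤ _ := Finset.sum_le_sum_of_subset_of_nonneg (Finset.subset_univ _) fun S _ _ => h0 S

/-- adding a fibre at m -/
def addm (m : Fin k) (u : ι → Option (Fin k)) (S : Finset ι) : ι → Option (Fin k) := fun p => if p ∈ S then some m else u p

lemma fib_addm_self (m : Fin k) (u : ι → Option (Fin k)) (hu : fib u m = ∅) (S : Finset ι) : fib (addm m u S) m = S := by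
  ext p
  rw [mem_fib, addm]
  have : u p ≠ some m := fun h => by
    have : p ∈ fib u m := (mem_fib _ _ _).mpr h
    rw [hu] at this; simp at this
  split_ifs with h <;> simp [h, this]

lemma fib_addm_ne (m i : Fin k) (hi : i ≠ m) (u : ι → Option (Fin k)) (S : Finset ι) (hS : Disjoint S (supp u)) :
    fib (addm m u S) i = fib u i := by
  ext p
  rw [mem_fib, mem_fib, addm]
  split_ifs with h
  · have : u p = none := by
      by_contra h2
      exact Finset.disjoint_left.mp hS h ((mem_supp u p).mpr h2)
    simp [this, hi.symm]
  · rfl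

lemma supp_addm (m : Fin k) (u : ι → Option (Fin k)) (S : Finset ι) : supp (addm m u S) = S ∪ supp u := by
  ext p
  rw [Finset.mem_union, mem_supp, mem_supp, addm]
  split_ifs with h <;> simp [h]

lemma notdisj_sum_le (f : Finset ι → ℝ) (hf : ∀ S, 0 ≤ f S) (T : Finset ι) :
    ∑ S ∈ Finset.univ.filter (fun S => ¬ Disjoint S T), f S ≤ ∑ p ∈ T, ∑ S ∈ Finset.univ.filter (fun S => p ∈ S), f S := by
  simp_rw [Finset.sum_filter]
  rw [Finset.sum_comm]
  refine Finset.sum_le_sum fun S _ => ?_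
  have h0 : ∀ p ∈ T, 0 ≤ (if p ∈ S then f S else 0) := fun p _ => by split_ifs; exacts [hf S, le_rfl]
  by_cases h : Disjoint S T
  · rw [if_neg (not_not.mpr h)]
    exact Finset.sum_nonneg h0
  · rw [if_pos h]
    rw [Finset.not_disjoint_iff] at h
    obtain ⟨p, hp, hq⟩ := h
    refine le_trans ?_ (Finset.single_le_sum h0 hq)
    rw [if_pos hp]

lemma mem_sum_le (c : ℝ) (hc : 0 ≤ c) (f : Finset ι → ℝ) (hf : ∀ S, 0 ≤ f S) (p : ι)
    (h : ∀ S, p ∉ S → f (insert p S) ≤ c * f S) :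
    ∑ S ∈ Finset.univ.filter (fun S => p ∈ S), f S ≤ c * ∑ S, f S := by
  rw [Finset.mul_sum]
  calc ∑ S ∈ Finset.univ.filter (fun S => p ∈ S), f S
      ≤ ∑ S ∈ Finset.univ.filter (fun S : Finset ι => p ∈ S), c * f (S.erase p) := by
        refine Finset.sum_le_sum fun S hS => ?_
        have hp : p ∈ S := (Finset.mem_filter.mp hS).2
        have := h (S.erase p) (Finset.notMem_erase p S)
        rwa [Finset.insert_erase hp] at this
    _ = ∑ T ∈ (Finset.univ.filter (fun S : Finset ι => p ∈ S)).image (fun S => S.erase p), c * f T := by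
        rw [Finset.sum_image]
        intro S hS T hT h
        have h1 : p ∈ S := (Finset.mem_filter.mp hS).2
        have h2 : p ∈ T := (Finset.mem_filter.mp hT).2
        rw [← Finset.insert_erase h1, ← Finset.insert_erase h2]
        simp only at h
        rw [h]
    _ ≤ _ := Finset.sum_le_sum_of_subset_of_nonneg (Finset.subset_univ _) fun T _ _ => mul_nonneg hc (hf _)

lemma inner_ge (m : Fin k) (s : ι → ℝ) (hs : ∀ p, 0 < s p) (G : Finset ι → ℝ) (hG0 : ∀ S, 0 ≤ G S)
    (hGe : G ∅ = 1) (hGa : ∀ p S, p ∉ S → G (insert p S) ≤ G S) (ℓ : ι → ℝ) (L : ℝ)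
    (hGL : ∀ S, G S ≠ 0 → ∑ p ∈ S, ℓ p ≤ L / 2) (u : ι → Option (Fin k)) (hu : fib u m = ∅)
    (huL : ∑ p ∈ supp u, ℓ p ≤ L / 2) (hus : ∑ p ∈ supp u, s p ≤ 1/2) :
    ((∑ S : Finset ι, G S * ∏ p ∈ S, s p) / 2 * ∏ i, G (fib u i))^2 ≤
     (∑ v, cw G ℓ L v * ∏ p, Tm (fun i => if i = m then - s p else 0) (u p) (v p))^2 := by
  set β := ∑ S : Finset ι, G S * ∏ p ∈ S, s p with hβ
  have hws : ∀ S : Finset ι, 0 ≤ ∏ p ∈ S, s p := fun S => Finset.prod_nonneg fun p _ => (hs p).le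
  have hβ0 : 0 ≤ β := Finset.sum_nonneg fun S _ => mul_nonneg (hG0 S) (hws S)
  have e1 : ∑ v, cw G ℓ L v * ∏ p, Tm (fun i => if i = m then - s p else 0) (u p) (v p) =
      (∏ p, Dm (1:ℝ) (fun _ => -1) (u p)) * ∑ v, Yw G ℓ L v * ∏ p, Tm (fun i => if i = m then s p else 0) (u p) (v p) := by
    rw [Finset.mul_sum]
    refine Finset.sum_congr rfl fun v _ => ?_
    have : (∏ p, Dm (1:ℝ) (fun _ => -1) (v p)) * ∏ p, Tm (fun i => if i = m then - s p else 0) (u p) (v p) =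
      (∏ p, Dm (1:ℝ) (fun _ => -1) (u p)) * ∏ p, Tm (fun i => if i = m then s p else 0) (u p) (v p) := by
      rw [← Finset.prod_mul_distrib, ← Finset.prod_mul_distrib]
      refine Finset.prod_congr rfl fun p _ => ?_
      rcases u p with _ | i <;> rcases v p with _ | i' <;> simp [Tm, Dm]
    rw [cw]
    linear_combination (Yw G ℓ L v) * this
  rw [e1, mul_pow _ (∑ v, _), sgn_sq, one_mul]
  have hY0 : ∀ v : ι → Option (Fin k), 0 ≤ Yw G ℓ L v := by
    intro v; rw [Yw]; split_ifs
    · exact Finset.prod_nonneg fun i _ => hG0 _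
    · exact le_rfl
  have hT0 : ∀ v : ι → Option (Fin k), 0 ≤ ∏ p, Tm (fun i => if i = m then s p else 0) (u p) (v p) := by
    intro v
    refine Finset.prod_nonneg fun p _ => ?_
    rcases u p with _ | i <;> rcases v p with _ | i' <;> simp [Tm]
    · split_ifs; exacts [(hs p).le, le_rfl]
    · split_ifs <;> norm_num
  have hinj : Function.Injective (addm m u) := by
    intro S T h
    rw [← fib_addm_self m u hu S, h, fib_addm_self m u hu T]
  set g := ∏ i, G (fib u i) with hg
  have hg0 : 0 ≤ g := Finset.prod_nonneg fun i _ => hG0 _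
  have step : ∀ S : Finset ι, Disjoint S (supp u) → Yw G ℓ L (addm m u S) * ∏ p, Tm (fun i => if i = m then s p else 0) (u p) (addm m u S p)
      = g * (G S * ∏ p ∈ S, s p) := by
    intro S hS
    have h1 : ∏ p, Tm (fun i => if i = m then s p else 0) (u p) (addm m u S p) = ∏ p ∈ S, s p := by
      rw [← Finset.prod_subset (Finset.subset_univ S)]
      · refine Finset.prod_congr rfl fun p hp => ?_
        have : u p = none := by
          by_contra h2
          exact Finset.disjoint_left.mp hS hp ((mem_supp u p).mpr h2)
        simp [addm, hp, this, Tm]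
      · intro p _ hp
        simp only [addm, hp, if_false]
        rcases u p with _ | i <;> simp [Tm]
    rw [h1]
    have h2 : ∏ i, G (fib (addm m u S) i) = G S * g := by
      rw [hg, ← Finset.mul_prod_erase _ _ (Finset.mem_univ m), ← Finset.mul_prod_erase _ (fun i => G (fib u i)) (Finset.mem_univ m),
        fib_addm_self m u hu, hu, hGe, one_mul]
      congr 1
      refine Finset.prod_congr rfl fun i hi => ?_
      rw [fib_addm_ne m i (Finset.ne_of_mem_erase hi) u S hS]
    rw [Yw, h2]
    split_ifs with h3
    · ring
    · have : G S = 0 := by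
        by_contra h4
        apply h3
        rw [supp_addm, Finset.sum_union hS]
        linarith [hGL S h4]
      rw [this]; ring
  have hlow : g * (β / 2) ≤ ∑ v, Yw G ℓ L v * ∏ p, Tm (fun i => if i = m then s p else 0) (u p) (v p) := by
    calc g * (β / 2) ≤ g * ∑ S ∈ Finset.univ.filter (fun S => Disjoint S (supp u)), G S * ∏ p ∈ S, s p := by
          refine mul_le_mul_of_nonneg_left ?_ hg0
          have hsplit := Finset.sum_filter_add_sum_filter_not Finset.univ (fun S => Disjoint S (supp u)) (fun S => G S * ∏ p ∈ S, s p)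
          have hbad : ∑ S ∈ Finset.univ.filter (fun S => ¬ Disjoint S (supp u)), G S * ∏ p ∈ S, s p ≤ ∑ p ∈ supp u, s p * β := by
            refine (notdisj_sum_le (fun S => G S * ∏ p ∈ S, s p) (fun S => mul_nonneg (hG0 _) (hws _)) _).trans ?_
            refine Finset.sum_le_sum fun p _ => mem_sum_le (s p) (hs p).le (fun S => G S * ∏ p ∈ S, s p) (fun S => mul_nonneg (hG0 _) (hws _)) p ?_
            intro S hS
            beta_reduce
            rw [Finset.prod_insert hS]
            have h5 : 0 ≤ s p * ∏ q ∈ S, s q := mul_nonneg (hs p).le (hws _)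
            nlinarith [mul_le_mul_of_nonneg_right (hGa p S hS) h5]
          rw [← Finset.sum_mul] at hbad
          have : (∑ p ∈ supp u, s p) * β ≤ 1/2 * β := mul_le_mul_of_nonneg_right hus hβ0
          rw [← hβ] at hsplit
          linarith
      _ = ∑ S ∈ Finset.univ.filter (fun S => Disjoint S (supp u)), Yw G ℓ L (addm m u S) * ∏ p, Tm (fun i => if i = m then s p else 0) (u p) (addm m u S p) := by
          rw [Finset.mul_sum]
          exact Finset.sum_congr rfl fun S hS => (step S (Finset.mem_filter.mp hS).2).symm
      _ = ∑ v ∈ (Finset.univ.filter (fun S => Disjoint S (supp u))).image (addm m u), Yw G ℓ L v * ∏ p, Tm (fun i => if i = m then s p else 0) (u p) (v p) := by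
          rw [Finset.sum_image hinj.injOn]
      _ ≤ _ := Finset.sum_le_sum_of_subset_of_nonneg (Finset.subset_univ _) fun v _ _ => mul_nonneg (hY0 v) (hT0 v)
  have : β / 2 * g ≤ ∑ v, Yw G ℓ L v * ∏ p, Tm (fun i => if i = m then s p else 0) (u p) (v p) := by
    rw [mul_comm]; exact hlow
  exact pow_le_pow_left₀ (by positivity) this 2

end forms
end DSR
end

section
namespace DSR
open Filter Topology

section forms2
variable {ι : Type*} [Fintype ι] [DecidableEq ι] {k : ℕ}

lemma one_sub_sum_le (T : Finset ι) (x : ι → ℝ) (h0 : ∀ p ∈ T, 0 ≤ x p) (h1 : ∀ p ∈ T, x p ≤ 1) :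
    1 - ∑ p ∈ T, x p ≤ ∏ p ∈ T, (1 - x p) := by
  induction T using Finset.induction_on with
  | empty => simp
  | insert p T hp ih =>
    rw [Finset.sum_insert hp, Finset.prod_insert hp]
    have i1 := ih (fun q hq => h0 q (Finset.mem_insert_of_mem hq)) (fun q hq => h1 q (Finset.mem_insert_of_mem hq))
    have i2 := h0 p (Finset.mem_insert_self _ _)
    have i3 := h1 p (Finset.mem_insert_self _ _)
    have i4 : 0 ≤ ∑ p ∈ T, x p := Finset.sum_nonneg fun q hq => h0 q (Finset.mem_insert_of_mem hq)
    nlinarith [mul_le_mul_of_nonneg_left i1 (sub_nonneg.mpr i3)]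

lemma pi_le (Φ : Fin k → Finset (Finset ι)) (g : Finset ι → ℝ) (hg : ∀ S, 0 ≤ g S) (φ : Fin k → Finset ι → ℝ)
    (hφ : ∀ i S, 0 ≤ φ i S) (e : Fin k → ℝ) (he : ∀ i, ∑ S ∈ Φ i, g S * φ i S ≤ e i * ∑ S ∈ Φ i, g S) :
    ∑ S ∈ Fintype.piFinset Φ, (∏ i, g (S i)) * ∏ i, φ i (S i) ≤ (∏ i, e i) * ∏ i, ∑ S ∈ Φ i, g S := by
  simp_rw [← Finset.prod_mul_distrib]
  rw [← Finset.prod_univ_sum Φ (fun i S => g S * φ i S)]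
  exact Finset.prod_le_prod (fun i _ => Finset.sum_nonneg fun S _ => mul_nonneg (hg S) (hφ i S)) fun i _ => he i

lemma pi_le_one (Φ : Fin k → Finset (Finset ι)) (g : Finset ι → ℝ) (hg : ∀ S, 0 ≤ g S) (φ : Finset ι → ℝ)
    (hφ : ∀ S, 0 ≤ φ S) (i : Fin k) (e : ℝ) (he : ∑ S ∈ Φ i, g S * φ S ≤ e * ∑ S ∈ Φ i, g S) :
    ∑ S ∈ Fintype.piFinset Φ, (∏ i, g (S i)) * φ (S i) ≤ e * ∏ i, ∑ S ∈ Φ i, g S := by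
  have := pi_le Φ g hg (fun j S => if j = i then φ S else 1) (fun j S => by split_ifs; exacts [hφ S, zero_le_one])
    (fun j => if j = i then e else 1) (fun j => by
      split_ifs with h
      · subst h; exact he
      · simp)
  simpa using this

lemma pi_le_two (Φ : Fin k → Finset (Finset ι)) (g : Finset ι → ℝ) (hg : ∀ S, 0 ≤ g S) (φ : Finset ι → ℝ)
    (hφ : ∀ S, 0 ≤ φ S) (i i' : Fin k) (hi : i ≠ i') (e : ℝ) (he : ∀ j, ∑ S ∈ Φ j, g S * φ S ≤ e * ∑ S ∈ Φ j, g S) :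
    ∑ S ∈ Fintype.piFinset Φ, (∏ i, g (S i)) * (φ (S i) * φ (S i')) ≤ e ^ 2 * ∏ i, ∑ S ∈ Φ i, g S := by
  have := pi_le Φ g hg (fun j S => (if j = i then φ S else 1) * (if j = i' then φ S else 1))
    (fun j S => by refine mul_nonneg ?_ ?_ <;> split_ifs <;> first | exact hφ S | exact zero_le_one)
    (fun j => (if j = i then e else 1) * (if j = i' then e else 1)) (fun j => by
      by_cases h : j = i
      · have : j ≠ i' := by rw [h]; exact hi
        simp only [h, if_true, hi, if_false, mul_one]; exact he i
      · by_cases h' : j = i'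
        · simp only [h', if_true, hi.symm, if_false, one_mul]; exact he i'
        · simp [h, h'])
  simp only [Finset.prod_mul_distrib, Finset.prod_ite_eq', Finset.mem_univ, if_true] at this
  rw [sq]; exact this

lemma Q2_bound (m : Fin k) (s t : ι → ℝ) (hs : ∀ p, 0 < s p) (hs1 : ∀ p, s p ≤ 1/2) (ht : ∀ p, t p = s p + s p * t p)
    (hk : ∀ p, 8 * k * s p ≤ 1) (hs2 : 64 * (k:ℝ)^2 * ∑ p, s p ^ 2 ≤ 1) (G : Finset ι → ℝ) (hG0 : ∀ S, 0 ≤ G S)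
    (hGe : G ∅ = 1) (hGa : ∀ p S, p ∉ S → G (insert p S) ≤ G S) (ℓ : ι → ℝ) (hℓ : ∀ p, 0 ≤ ℓ p) (L : ℝ) (hL : 0 < L)
    (hGL : ∀ S, G S ≠ 0 → ∑ p ∈ S, ℓ p ≤ L / 2)
    (hlog : ∑ S, G S ^ 2 * (∏ p ∈ S, s p) * ∑ p ∈ S, ℓ p ≤ L / (8 * k) * ∑ S, G S^2 * ∏ p ∈ S, s p) :
    (∑ S, G S * ∏ p ∈ S, s p)^2 * (∑ S, G S^2 * ∏ p ∈ S, s p)^(k-1) / 64 ≤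
      tq (fun p => K2 m (t p)) (lamOf s (cw (k := k) G ℓ L)) := by
  have hk1 : (1:ℝ) ≤ k := by
    have : 0 < k := m.pos
    exact_mod_cast this
  set β := ∑ S, G S * ∏ p ∈ S, s p with hβ
  set α := ∑ S, G S^2 * ∏ p ∈ S, s p with hα
  set g : Finset ι → ℝ := fun S => G S^2 * ∏ p ∈ S, s p with hgdef
  have hg0 : ∀ S, 0 ≤ g S := fun S => mul_nonneg (sq_nonneg _) (Finset.prod_nonneg fun p _ => (hs p).le)
  have hα0 : 0 ≤ α := Finset.sum_nonneg fun S _ => hg0 S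
  have hge : g ∅ = 1 := by simp [hgdef, hGe]
  have hδ0 : 0 ≤ ∑ p, s p ^2 := Finset.sum_nonneg fun p _ => sq_nonneg _
  have hδ : ∑ p, s p ^2 ≤ 1/64 := by nlinarith [mul_le_mul hk1 hk1 zero_le_one (by linarith)]
  set good : (ι → Option (Fin k)) → Prop := fun u => fib u m = ∅ ∧ ∑ p ∈ supp u, ℓ p ≤ L / 2 ∧ 16 * k * ∑ p ∈ supp u, s p ≤ 1 with hgood
  classical
  refine le_trans ?_ (Q2_ge m s t hs hs1 ht hk _)
  have hterm0 : ∀ w : ι → Option (Fin k), 0 ≤ (∏ p, Dm (1 - s p^2) (fun i => if i = m then 0 else s p * (1 - 8 * k * s p)) (w p)) *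
      (∑ u, cw G ℓ L u * ∏ p, Tm (fun i => if i = m then - s p else 0) (w p) (u p))^2 := by
    intro w
    refine mul_nonneg (Finset.prod_nonneg fun p _ => ?_) (sq_nonneg _)
    rcases w p with _ | i
    · simp only [Dm]; nlinarith [hs p, hs1 p]
    · simp only [Dm]; split_ifs
      · exact le_rfl
      · exact mul_nonneg (hs p).le (by linarith [hk p])
  refine le_trans ?_ (Finset.sum_le_sum_of_subset_of_nonneg (Finset.subset_univ (Finset.univ.filter good)) fun w _ _ => hterm0 w)
  have hterm : ∀ w ∈ Finset.univ.filter good, β^2/16 * ∏ i, g (fib w i) ≤ (∏ p, Dm (1 - s p^2) (fun i => if i = m then 0 else s p * (1 - 8 * k * s p)) (w p)) *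
      (∑ u, cw G ℓ L u * ∏ p, Tm (fun i => if i = m then - s p else 0) (w p) (u p))^2 := by
    intro w hw
    obtain ⟨hw1, hw2, hw3⟩ := (Finset.mem_filter.mp hw).2
    have hsum0 : 0 ≤ ∑ p ∈ supp w, s p := Finset.sum_nonneg fun p _ => (hs p).le
    have h1 := inner_ge m s hs G hG0 hGe hGa ℓ L hGL w hw1 hw2 (by nlinarith)
    have h2 : (1/4) * ∏ p ∈ supp w, s p ≤ ∏ p, Dm (1 - s p^2) (fun i => if i = m then 0 else s p * (1 - 8 * k * s p)) (w p) := by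
      have e : ∏ p, Dm (1 - s p^2) (fun i => if i = m then 0 else s p * (1 - 8 * k * s p)) (w p) =
          ∏ p, Dm (1 - s p^2) (fun _ => s p * (1 - 8 * k * s p)) (w p) := by
        refine Finset.prod_congr rfl fun p _ => ?_
        rcases h : w p with _ | i
        · rfl
        · have : i ≠ m := by
            rintro rfl
            have h5 := (mem_fib w i p).mpr h
            rw [hw1] at h5; simp at h5
          simp [Dm, this]
      rw [e, prod_Dm_supp, Finset.prod_mul_distrib]
      have a1 := one_sub_sum_le (Finset.univ \ supp w) (fun p => s p^2) (fun p _ => sq_nonneg _) (fun p _ => by nlinarith [hs p, hs1 p])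
      have a2 : ∑ p ∈ Finset.univ \ supp w, s p^2 ≤ ∑ p, s p^2 := Finset.sum_le_sum_of_subset_of_nonneg (Finset.subset_univ _) fun p _ _ => sq_nonneg _
      have a3 := one_sub_sum_le (supp w) (fun p => 8 * k * s p) (fun p _ => by have := hs p; positivity) (fun p _ => hk p)
      rw [← Finset.mul_sum] at a3
      have a4 : 0 ≤ ∏ p ∈ supp w, s p := Finset.prod_nonneg fun p _ => (hs p).le
      have b1 : 1/2 ≤ ∏ p ∈ Finset.univ \ supp w, (1 - s p^2) := by linarith
      have b2 : 1/2 ≤ ∏ p ∈ supp w, (1 - 8 * k * s p) := by linarith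
      have b3 : (1/2) * (1/2) ≤ (∏ p ∈ Finset.univ \ supp w, (1 - s p^2)) * ∏ p ∈ supp w, (1 - 8 * k * s p) :=
        mul_le_mul b1 b2 (by norm_num) (by linarith)
      nlinarith [mul_le_mul_of_nonneg_left b3 a4]
    calc β^2/16 * ∏ i, g (fib w i) = ((1/4) * ∏ p ∈ supp w, s p) * (β / 2 * ∏ i, G (fib w i))^2 := by
          simp only [hgdef]
          rw [Finset.prod_mul_distrib, ← prod_supp, Finset.prod_pow]
          ring
      _ ≤ _ := mul_le_mul h2 h1 (sq_nonneg _) (le_trans (mul_nonneg (by norm_num) (Finset.prod_nonneg fun p _ => (hs p).le)) h2)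
  refine le_trans ?_ (Finset.sum_le_sum hterm)
  rw [← Finset.mul_sum]
  suffices hmain : α^(k-1) / 4 ≤ ∑ w ∈ Finset.univ.filter good, ∏ i, g (fib w i) by
    have := mul_le_mul_of_nonneg_left hmain (show 0 ≤ β^2/16 by positivity)
    linarith
  set Φ : Fin k → Finset (Finset ι) := fun i => if i = m then {∅} else Finset.univ with hΦ
  have hHm : ∑ S ∈ Φ m, g S = 1 := by simp [hΦ, hge]
  have hHi : ∀ i, i ≠ m → ∑ S ∈ Φ i, g S = α := fun i hi => by simp only [hΦ, hi, if_false]; rfl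
  have hH : ∏ i, ∑ S ∈ Φ i, g S = α^(k-1) := by
    rw [← Finset.mul_prod_erase _ _ (Finset.mem_univ m), hHm, one_mul,
      Finset.prod_congr rfl (fun i hi => hHi i (Finset.ne_of_mem_erase hi))]
    simp
  set H := α^(k-1) with hHdef
  have hH0 : 0 ≤ H := pow_nonneg hα0 _
  -- the bad function
  set bad1 : (Fin k → Finset ι) → ℝ := fun S => ∑ i, 2 / L * ∑ p ∈ S i, ℓ p with hbad1
  set bad2 : (Fin k → Finset ι) → ℝ := fun S => ∑ i, ∑ i' ∈ Finset.univ.erase i, ∑ p, (if p ∈ S i then (1:ℝ) else 0) * (if p ∈ S i' then 1 else 0) with hbad2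
  set bad3 : (Fin k → Finset ι) → ℝ := fun S => ∑ i, 16 * k * ∑ p ∈ S i, s p with hbad3
  have n1 : ∀ S, 0 ≤ bad1 S := fun S => Finset.sum_nonneg fun i _ => mul_nonneg (by positivity) (Finset.sum_nonneg fun p _ => hℓ p)
  have n2 : ∀ S, 0 ≤ bad2 S := fun S => Finset.sum_nonneg fun i _ => Finset.sum_nonneg fun i' _ => Finset.sum_nonneg fun p _ => by
    split_ifs <;> norm_num
  have n3 : ∀ S, 0 ≤ bad3 S := fun S => Finset.sum_nonneg fun i _ => mul_nonneg (by positivity) (Finset.sum_nonneg fun p _ => (hs p).le)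
  have hp0 : ∀ S : Fin k → Finset ι, 0 ≤ ∏ i, g (S i) := fun S => Finset.prod_nonneg fun i _ => hg0 _
  have hmem : ∀ p j, ∑ S ∈ Φ j, g S * (if p ∈ S then (1:ℝ) else 0) ≤ s p * ∑ S ∈ Φ j, g S := by
    intro p j
    by_cases hj : j = m
    · subst hj; simp [hΦ, hge]; exact (hs p).le
    · rw [hHi j hj]
      simp only [hΦ, hj, if_false, mul_ite, mul_one, mul_zero]
      rw [← Finset.sum_filter]
      refine mem_sum_le (s p) (hs p).le g hg0 p ?_
      intro S hS
      simp only [hgdef]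
      rw [Finset.prod_insert hS]
      have h5 : 0 ≤ s p * ∏ q ∈ S, s q := mul_nonneg (hs p).le (Finset.prod_nonneg fun p _ => (hs p).le)
      nlinarith [mul_le_mul_of_nonneg_right (pow_le_pow_left₀ (hG0 _) (hGa p S hS) 2) h5]
  have E1 : ∑ S ∈ Fintype.piFinset Φ, (∏ i, g (S i)) * bad1 S ≤ 1/4 * H := by
    simp only [hbad1, Finset.mul_sum Finset.univ]
    rw [Finset.sum_comm]
    calc _ ≤ ∑ i : Fin k, 1 / (4 * k) * H := by
          refine Finset.sum_le_sum fun i _ => ?_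
          rw [← hH]
          refine pi_le_one Φ g hg0 (fun S => 2 / L * ∑ p ∈ S, ℓ p) (fun S => mul_nonneg (by positivity) (Finset.sum_nonneg fun p _ => hℓ p)) i _ ?_
          by_cases hj : i = m
          · subst hj; simp [hΦ, hge]
          · rw [hHi i hj]
            simp only [hΦ, hj, if_false]
            calc _ = 2 / L * ∑ S, G S ^ 2 * (∏ p ∈ S, s p) * ∑ p ∈ S, ℓ p := by
                  rw [Finset.mul_sum]
                  exact Finset.sum_congr rfl fun S _ => by simp only [hgdef]; ring
              _ ≤ 2 / L * (L / (8 * k) * α) := mul_le_mul_of_nonneg_left hlog (by positivity)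
              _ = _ := by field_simp; ring
      _ = _ := by
          rw [Finset.sum_const, Finset.card_univ, Fintype.card_fin, nsmul_eq_mul]
          field_simp
  have E3 : ∑ S ∈ Fintype.piFinset Φ, (∏ i, g (S i)) * bad3 S ≤ 1/4 * H := by
    simp only [hbad3, Finset.mul_sum Finset.univ]
    rw [Finset.sum_comm]
    calc _ ≤ ∑ i : Fin k, 16 * k * (∑ p, s p^2) * H := by
          refine Finset.sum_le_sum fun i _ => ?_
          rw [← hH]
          refine pi_le_one Φ g hg0 (fun S => 16 * k * ∑ p ∈ S, s p) (fun S => mul_nonneg (by positivity) (Finset.sum_nonneg fun p _ => (hs p).le)) i _ ?_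
          calc _ = ∑ p, 16 * k * s p * ∑ S ∈ Φ i, g S * (if p ∈ S then (1:ℝ) else 0) := by
                simp_rw [Finset.mul_sum]
                rw [Finset.sum_comm]
                refine Finset.sum_congr rfl fun S _ => ?_
                rw [← Finset.sum_subset (Finset.subset_univ S)]
                · exact Finset.sum_congr rfl fun p hp => by rw [if_pos hp]; ring
                · intro p _ hp; rw [if_neg hp]; ring
            _ ≤ ∑ p, 16 * k * s p * (s p * ∑ S ∈ Φ i, g S) := by
                refine Finset.sum_le_sum fun p _ => mul_le_mul_of_nonneg_left (hmem p i) ?_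
                have := hs p; positivity
            _ = _ := by
                rw [Finset.mul_sum (Finset.univ : Finset ι), Finset.sum_mul]
                exact Finset.sum_congr rfl fun p _ => by ring
      _ = 16 * (k:ℝ)^2 * (∑ p, s p^2) * H := by
          rw [Finset.sum_const, Finset.card_univ, Fintype.card_fin, nsmul_eq_mul]
          ring
      _ ≤ _ := mul_le_mul_of_nonneg_right (by linarith) hH0
  have E2 : ∑ S ∈ Fintype.piFinset Φ, (∏ i, g (S i)) * bad2 S ≤ 1/4 * H := by
    have e : ∑ S ∈ Fintype.piFinset Φ, (∏ i, g (S i)) * bad2 S = ∑ i, ∑ i' ∈ Finset.univ.erase i, ∑ p,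
        ∑ S ∈ Fintype.piFinset Φ, (∏ i, g (S i)) * ((if p ∈ S i then (1:ℝ) else 0) * (if p ∈ S i' then 1 else 0)) := by
      simp only [hbad2]
      simp_rw [Finset.mul_sum]
      rw [Finset.sum_comm]
      refine Finset.sum_congr rfl fun i _ => ?_
      rw [Finset.sum_comm]
      refine Finset.sum_congr rfl fun i' _ => ?_
      rw [Finset.sum_comm]
    rw [e]
    calc _ ≤ ∑ i : Fin k, ∑ i' ∈ Finset.univ.erase i, ∑ p, s p^2 * H := by
          refine Finset.sum_le_sum fun i _ => Finset.sum_le_sum fun i' hi' => Finset.sum_le_sum fun p _ => ?_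
          rw [← hH]
          exact pi_le_two Φ g hg0 (fun S => if p ∈ S then (1:ℝ) else 0) (fun S => by split_ifs <;> norm_num) i i' (Finset.ne_of_mem_erase hi').symm (s p) (hmem p)
      _ ≤ ∑ i : Fin k, ∑ i' : Fin k, ∑ p, s p^2 * H := by
          refine Finset.sum_le_sum fun i _ => Finset.sum_le_sum_of_subset_of_nonneg (Finset.erase_subset _ _) fun i' _ _ => Finset.sum_nonneg fun p _ => ?_
          positivity
      _ = (k:ℝ)^2 * (∑ p, s p^2) * H := by
          simp only [← Finset.sum_mul, Finset.sum_const, Finset.card_univ, Fintype.card_fin, nsmul_eq_mul]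
          ring
      _ ≤ _ := mul_le_mul_of_nonneg_right (by nlinarith [mul_nonneg (sq_nonneg (k:ℝ)) hδ0]) hH0
  have hsumH : ∑ S ∈ Fintype.piFinset Φ, ∏ i, g (S i) = H := by
    rw [← hH, Finset.prod_univ_sum Φ (fun i S => g S)]
  calc H / 4 ≤ ∑ S ∈ Fintype.piFinset Φ, (∏ i, g (S i)) * (1 - (bad1 S + bad2 S + bad3 S)) := by
        simp only [mul_sub, mul_add, mul_one, Finset.sum_sub_distrib, Finset.sum_add_distrib]
        rw [hsumH]; linarith
    _ ≤ ∑ S ∈ (Fintype.piFinset Φ).filter (fun S => bad1 S + bad2 S + bad3 S < 1), ∏ i, g (S i) := by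
        rw [Finset.sum_filter]
        refine Finset.sum_le_sum fun S _ => ?_
        split_ifs with h
        · nlinarith [hp0 S, mul_nonneg (hp0 S) (add_nonneg (add_nonneg (n1 S) (n2 S)) (n3 S))]
        · exact mul_nonpos_of_nonneg_of_nonpos (hp0 S) (by linarith)
    _ ≤ ∑ S ∈ (Finset.univ.filter good).image fib, ∏ i, g (S i) := by
        refine Finset.sum_le_sum_of_subset_of_nonneg ?_ fun S _ _ => hp0 S
        intro S hS
        obtain ⟨hS1, hS2⟩ := Finset.mem_filter.mp hS
        have hd : ∀ i j, i ≠ j → ∀ p ∈ S i, p ∉ S j := by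
          intro i j hij p hp hq
          have h1 : 1 ≤ bad2 S := by
            have z : ∀ i i' p, (0:ℝ) ≤ (if p ∈ S i then (1:ℝ) else 0) * (if p ∈ S i' then 1 else 0) := fun i i' p => by split_ifs <;> norm_num
            calc (1:ℝ) = (if p ∈ S i then (1:ℝ) else 0) * (if p ∈ S j then 1 else 0) := by rw [if_pos hp, if_pos hq]; norm_num
              _ ≤ ∑ p, (if p ∈ S i then (1:ℝ) else 0) * (if p ∈ S j then 1 else 0) :=
                  Finset.single_le_sum (f := fun p => (if p ∈ S i then (1:ℝ) else 0) * (if p ∈ S j then 1 else 0)) (fun p _ => z i j p) (Finset.mem_univ p)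
              _ ≤ ∑ i' ∈ Finset.univ.erase i, ∑ p, (if p ∈ S i then (1:ℝ) else 0) * (if p ∈ S i' then 1 else 0) :=
                  Finset.single_le_sum (f := fun i' => ∑ p, (if p ∈ S i then (1:ℝ) else 0) * (if p ∈ S i' then 1 else 0)) (fun i' _ => Finset.sum_nonneg fun p _ => z i i' p) (Finset.mem_erase.mpr ⟨hij.symm, Finset.mem_univ j⟩)
              _ ≤ _ := Finset.single_le_sum (f := fun i => ∑ i' ∈ Finset.univ.erase i, ∑ p, (if p ∈ S i then (1:ℝ) else 0) * (if p ∈ S i' then 1 else 0)) (fun i _ => Finset.sum_nonneg fun i' _ => Finset.sum_nonneg fun p _ => z i i' p) (Finset.mem_univ i)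
          linarith [n1 S, n3 S]
        obtain ⟨u, hu⟩ := fib_surj S hd
        refine Finset.mem_image.mpr ⟨u, Finset.mem_filter.mpr ⟨Finset.mem_univ _, ?_, ?_, ?_⟩, hu⟩
        · rw [hu]
          have := Fintype.mem_piFinset.mp hS1 m
          simpa [hΦ] using this
        · rw [sum_supp, hu]
          have h1 : bad1 S < 1 := by linarith [n2 S, n3 S]
          simp only [hbad1, ← Finset.mul_sum] at h1
          rw [div_mul_eq_mul_div, div_lt_one hL] at h1
          linarith
        · rw [sum_supp, hu]
          have h1 : bad3 S < 1 := by linarith [n1 S, n2 S]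
          simp only [hbad3, ← Finset.mul_sum] at h1
          exact h1.le
    _ = _ := by rw [Finset.sum_image fib_inj.injOn]

end forms2
end DSR
end

section
namespace DSR
open Filter Topology

noncomputable def kap (W : ℕ) : ℝ := (W.totient : ℝ) / W

lemma kap_pos (W : ℕ) (hW : W ≠ 0) : 0 < kap W := by
  have := Nat.totient_pos.mpr (Nat.pos_of_ne_zero hW)
  have h2 := Nat.pos_of_ne_zero hW
  unfold kap; positivity

lemma kap_le (W : ℕ) (hW : W ≠ 0) : kap W ≤ 1 := by
  have h2 := Nat.pos_of_ne_zero hW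
  unfold kap
  rw [div_le_one (by exact_mod_cast h2)]
  exact_mod_cast Nat.totient_le W

/-- reciprocal sum over integers below x coprime to W -/
noncomputable def Nn (W n : ℕ) : ℝ := ∑ a ∈ (Finset.range n).filter (fun a : ℕ => a.Coprime W), (1 / (a:ℝ))

lemma Nn_mono (W : ℕ) : Monotone (Nn W) := by
  intro m n h
  refine Finset.sum_le_sum_of_subset_of_nonneg ?_ fun a _ _ => by positivity
  exact Finset.filter_subset_filter _ (Finset.range_subset_range.mpr h)

lemma Nn_nonneg (W n : ℕ) : 0 ≤ Nn W n := Finset.sum_nonneg fun a _ => by positivity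

lemma Nn_base (W : ℕ) : Nn W W ≤ W := by
  calc Nn W W ≤ ∑ a ∈ (Finset.range W).filter (fun a : ℕ => a.Coprime W), (1:ℝ) := by
        refine Finset.sum_le_sum fun a _ => ?_
        rcases Nat.eq_zero_or_pos a with h | h
        · subst h; simp
        · rw [div_le_one (by exact_mod_cast h)]; exact_mod_cast h
    _ ≤ ∑ a ∈ Finset.range W, (1:ℝ) := Finset.sum_le_sum_of_subset_of_nonneg (Finset.filter_subset _ _) fun _ _ _ => zero_le_one
    _ = W := by simp

lemma Nn_block (W q : ℕ) : Nn W ((q+1)*W) = Nn W (q*W) + ∑ a ∈ (Finset.Ico (q*W) (q*W+W)).filter (fun a : ℕ => a.Coprime W), (1 / (a:ℝ)) := by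
  unfold Nn
  simp_rw [Finset.sum_filter]
  rw [Finset.range_eq_Ico, Finset.range_eq_Ico, add_mul, one_mul, Finset.sum_Ico_consecutive _ (by simp) (by simp)]

lemma block_card (W q : ℕ) : (((Finset.Ico (q*W) (q*W+W)).filter (fun a : ℕ => a.Coprime W)).card : ℝ) = W.totient := by
  have := Nat.filter_coprime_Ico_eq_totient W (q*W)
  rw [← this]
  congr 2
  ext a; simp [Nat.coprime_comm]

lemma Nn_upper (W : ℕ) (hW : W ≠ 0) (q : ℕ) : Nn W ((q+1)*W) ≤ W + kap W * (harmonic q : ℝ) := by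
  have hW0 : (0:ℝ) < W := by exact_mod_cast Nat.pos_of_ne_zero hW
  induction q with
  | zero => simp; exact Nn_base W
  | succ q ih =>
    rw [Nn_block, harmonic_succ]
    have : ∑ a ∈ (Finset.Ico ((q+1)*W) ((q+1)*W+W)).filter (fun a : ℕ => a.Coprime W), (1 / (a:ℝ)) ≤ kap W * (1 / ((q:ℝ)+1)) := by
      calc _ ≤ ∑ a ∈ (Finset.Ico ((q+1)*W) ((q+1)*W+W)).filter (fun a : ℕ => a.Coprime W), (1 / (((q:ℝ)+1)*W)) := by
            refine Finset.sum_le_sum fun a ha => ?_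
            have h1 := (Finset.mem_Ico.mp (Finset.mem_filter.mp ha).1).1
            have h2 : ((q:ℝ)+1)*W ≤ a := by exact_mod_cast h1
            gcongr
        _ = _ := by
            rw [Finset.sum_const, nsmul_eq_mul, block_card, kap]
            field_simp
    push_cast
    rw [one_div] at this
    linarith

lemma Nn_lower (W : ℕ) (hW : W ≠ 0) (q : ℕ) (hq : 1 ≤ q) : kap W * ((harmonic q : ℝ) - 1) ≤ Nn W (q*W) := by
  have hW0 : (0:ℝ) < W := by exact_mod_cast Nat.pos_of_ne_zero hW
  induction q, hq using Nat.le_induction with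
  | base => simp [harmonic]; exact Nn_nonneg _ _
  | succ q hq ih =>
    rw [Nn_block, harmonic_succ]
    have : kap W * (1 / ((q:ℝ)+1)) ≤ ∑ a ∈ (Finset.Ico (q*W) (q*W+W)).filter (fun a : ℕ => a.Coprime W), (1 / (a:ℝ)) := by
      calc _ = ∑ a ∈ (Finset.Ico (q*W) (q*W+W)).filter (fun a : ℕ => a.Coprime W), (1 / (((q:ℝ)+1)*W)) := by
            rw [Finset.sum_const, nsmul_eq_mul, block_card, kap]
            field_simp
        _ ≤ _ := by
            refine Finset.sum_le_sum fun a ha => ?_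
            have h1 := Finset.mem_Ico.mp (Finset.mem_filter.mp ha).1
            have h2 : (a:ℝ) ≤ ((q:ℝ)+1)*W := by
              have : a ≤ (q+1) * W := by rw [add_mul, one_mul]; omega
              exact_mod_cast this
            have h3 : 0 < a := by
              have : 0 < q * W := Nat.mul_pos hq (Nat.pos_of_ne_zero hW)
              omega
            have h4 : (0:ℝ) < a := by exact_mod_cast h3
            gcongr
    push_cast
    rw [one_div] at this
    linarith

lemma Nn_le (W : ℕ) (hW : W ≠ 0) (x : ℝ) (hx : 1 ≤ x) : Nn W ⌈x⌉₊ ≤ kap W * Real.log x + (W + 1) := by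
  have hk := kap_pos W hW
  have hk1 := kap_le W hW
  have hW1 : (1:ℝ) ≤ W := by exact_mod_cast Nat.pos_of_ne_zero hW
  set q := ⌊x / W⌋₊ with hq
  have h1 : Nn W ⌈x⌉₊ ≤ Nn W ((q+1)*W) := by
    apply Nn_mono
    rw [Nat.ceil_le]
    have := Nat.lt_floor_add_one (x / W)
    rw [div_lt_iff₀ (by linarith)] at this
    push_cast; exact this.le
  have h2 := Nn_upper W hW q
  have h3 : (harmonic q : ℝ) ≤ 1 + Real.log x := by
    rcases Nat.eq_zero_or_pos q with h | h
    · rw [h]; simp; linarith [Real.log_nonneg hx]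
    · have := harmonic_le_one_add_log q
      have h4 : Real.log q ≤ Real.log x := by
        apply Real.log_le_log (by exact_mod_cast h)
        calc (q:ℝ) ≤ x / W := Nat.floor_le (by positivity)
          _ ≤ x := div_le_self (by linarith) hW1
      linarith
  nlinarith [mul_le_mul_of_nonneg_left h3 hk.le]

lemma Nn_ge (W : ℕ) (hW : W ≠ 0) (x : ℝ) (hx : 1 ≤ x) : kap W * Real.log x - (W + 1) ≤ Nn W ⌈x⌉₊ := by
  have hk := kap_pos W hW
  have hk1 := kap_le W hW
  have hW1 : (1:ℝ) ≤ W := by exact_mod_cast Nat.pos_of_ne_zero hW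
  set q := ⌊x / W⌋₊ with hq
  have hlW : Real.log W ≤ W - 1 := Real.log_le_sub_one_of_pos (by linarith)
  have hl : Real.log x ≤ Real.log (q+1) + Real.log W := by
    rw [← Real.log_mul (by positivity) (by positivity)]
    apply Real.log_le_log (by linarith)
    have := Nat.lt_floor_add_one (x / W)
    rw [div_lt_iff₀ (by linarith)] at this
    exact this.le
  have hlw0 : 0 ≤ Real.log W := Real.log_nonneg hW1
  rcases Nat.eq_zero_or_pos q with h | h
  · rw [h] at hl
    simp at hl
    have := Nn_nonneg W ⌈x⌉₊
    nlinarith [mul_le_mul_of_nonneg_left hl hk.le]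
  · have h1 : Nn W (q*W) ≤ Nn W ⌈x⌉₊ := by
      apply Nn_mono
      have : (q:ℝ) * W ≤ x := by
        have := Nat.floor_le (show 0 ≤ x / W by positivity)
        rwa [le_div_iff₀ (by linarith)] at this
      have h4 : ((q * W : ℕ):ℝ) ≤ (⌈x⌉₊ : ℝ) := by push_cast; exact this.trans (Nat.le_ceil x)
      exact_mod_cast h4
    have h2 := Nn_lower W hW q h
    have h3 := log_add_one_le_harmonic q
    push_cast at h3
    have h5 : Real.log x - W ≤ (harmonic q : ℝ) - 1 := by linarith
    nlinarith [mul_le_mul_of_nonneg_left h5 hk.le]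

/-- reciprocal sum in a window -/
noncomputable def Tn (W : ℕ) (x y : ℝ) : ℝ := ∑ a ∈ (Finset.range ⌈y⌉₊).filter (fun a : ℕ => a.Coprime W ∧ x ≤ (a:ℝ)), (1 / (a:ℝ))

lemma Tn_eq (W : ℕ) (x y : ℝ) (hxy : x ≤ y) : Nn W ⌈y⌉₊ = Nn W ⌈x⌉₊ + Tn W x y := by
  unfold Nn Tn
  rw [← Finset.sum_filter_add_sum_filter_not ((Finset.range ⌈y⌉₊).filter (fun a : ℕ => a.Coprime W)) (fun a : ℕ => (a:ℝ) < x)]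
  congr 1
  · refine Finset.sum_congr ?_ fun _ _ => rfl
    ext a
    simp only [Finset.mem_filter, Finset.mem_range, Nat.lt_ceil]
    constructor
    · rintro ⟨⟨h1, h2⟩, h3⟩; exact ⟨h3, h2⟩
    · rintro ⟨h3, h2⟩; exact ⟨⟨lt_of_lt_of_le h3 hxy, h2⟩, h3⟩
  · refine Finset.sum_congr ?_ fun _ _ => rfl
    ext a
    simp only [Finset.mem_filter, Finset.mem_range, Nat.lt_ceil, not_lt, and_assoc]

lemma Tn_le (W : ℕ) (hW : W ≠ 0) (x y : ℝ) (hx : 0 < x) (hxy : x ≤ y) : Tn W x y ≤ kap W * Real.log (y/x) + 2 * (W+1) := by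
  have hk := kap_pos W hW
  have hl : 0 ≤ Real.log (y/x) := Real.log_nonneg ((one_le_div hx).mpr hxy)
  have hy : 0 < y := by linarith
  have e := Tn_eq W x y hxy
  have hW1 : (1:ℝ) ≤ W := by exact_mod_cast Nat.pos_of_ne_zero hW
  have hkl := mul_nonneg hk.le hl
  by_cases h1 : 1 ≤ x
  · have a := Nn_le W hW y (h1.trans hxy)
    have b := Nn_ge W hW x h1
    rw [Real.log_div hy.ne' hx.ne', mul_sub]; linarith
  · push Not at h1
    have b := Nn_nonneg W ⌈x⌉₊
    by_cases h2 : 1 ≤ y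
    · have a := Nn_le W hW y h2
      have : Real.log y ≤ Real.log (y/x) := Real.log_le_log hy (by rw [le_div_iff₀ hx]; nlinarith)
      nlinarith [mul_le_mul_of_nonneg_left this hk.le]
    · push Not at h2
      have : Nn W ⌈y⌉₊ ≤ Nn W 1 := Nn_mono W (by rw [Nat.ceil_le]; simpa using h2.le)
      have h3 : Nn W 1 = 0 := by
        unfold Nn; refine Finset.sum_eq_zero fun a ha => ?_
        have : a = 0 := by simpa using (Finset.mem_filter.mp ha).1
        simp [this]
      linarith

lemma Tn_ge (W : ℕ) (hW : W ≠ 0) (x y : ℝ) (hx : 1 ≤ x) (hxy : x ≤ y) : kap W * Real.log (y/x) - 2 * (W+1) ≤ Tn W x y := by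
  have e := Tn_eq W x y hxy
  have a := Nn_ge W hW y (hx.trans hxy)
  have b := Nn_le W hW x hx
  rw [Real.log_div (by linarith) (by linarith), mul_sub]; linarith

lemma Tn_mul (W : ℕ) (hW : W ≠ 0) (x y : ℝ) (hx : 0 < x) (hxy : x ≤ y) (m : ℕ) (hm : 0 < m) :
    ∑ a ∈ (Finset.range ⌈y⌉₊).filter (fun a : ℕ => (a.Coprime W ∧ x ≤ (a:ℝ)) ∧ m ∣ a), (1 / (a:ℝ)) ≤
      1 / m * (kap W * Real.log (y/x) + 2 * (W+1)) := by
  have hm0 : (0:ℝ) < m := by exact_mod_cast hm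
  have h := Tn_le W hW (x/m) (y/m) (by positivity) (by gcongr)
  rw [div_div_div_cancel_right₀ hm0.ne'] at h
  refine le_trans ?_ (mul_le_mul_of_nonneg_left h (by positivity))
  unfold Tn
  rw [Finset.mul_sum]
  calc _ = ∑ a ∈ (Finset.range ⌈y⌉₊).filter (fun a : ℕ => (a.Coprime W ∧ x ≤ (a:ℝ)) ∧ m ∣ a), 1 / (m:ℝ) * (1 / ((a/m : ℕ):ℝ)) := by
        refine Finset.sum_congr rfl fun a ha => ?_
        obtain ⟨b, rfl⟩ := (Finset.mem_filter.mp ha).2.2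
        rw [Nat.mul_div_cancel_left _ hm]
        push_cast
        rw [one_div_mul_one_div]
    _ = ∑ b ∈ ((Finset.range ⌈y⌉₊).filter (fun a : ℕ => (a.Coprime W ∧ x ≤ (a:ℝ)) ∧ m ∣ a)).image (fun a => a / m), 1 / (m:ℝ) * (1 / (b:ℝ)) := by
        rw [Finset.sum_image]
        intro a ha b hb hab
        have h1 := (Finset.mem_filter.mp ha).2.2
        have h2 := (Finset.mem_filter.mp hb).2.2
        simp only at hab
        rw [← Nat.mul_div_cancel' h1, ← Nat.mul_div_cancel' h2, hab]
    _ ≤ _ := by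
        refine Finset.sum_le_sum_of_subset_of_nonneg ?_ fun _ _ _ => by positivity
        intro b hb
        obtain ⟨a, ha, rfl⟩ := Finset.mem_image.mp hb
        simp only [Finset.mem_filter, Finset.mem_range, Nat.lt_ceil] at ha ⊢
        obtain ⟨h1, ⟨h2, h3⟩, c, rfl⟩ := ha
        rw [Nat.mul_div_cancel_left _ hm]
        push_cast at h1 h3
        refine ⟨?_, ?_, ?_⟩
        · rw [lt_div_iff₀ hm0]; linarith
        · exact Nat.Coprime.coprime_mul_left h2
        · rw [div_le_iff₀ hm0]; linarith

lemma T_sf (W : ℕ) (hW : W ≠ 0) (D0 : ℕ) (hD0 : 1 ≤ D0) (hWD : ∀ p, p.Prime → p ≤ D0 → p ∣ W) (ps : ℕ)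
    (x y : ℝ) (hx : 1 ≤ x) (hxy : x ≤ y) :
    kap W * Real.log (y/x) * (1 - 2 / D0) - 6 * (W+1) ≤
      ∑ a ∈ (Finset.range ⌈y⌉₊).filter (fun a : ℕ => (a.Coprime W ∧ x ≤ (a:ℝ)) ∧ Squarefree a ∧ (ps.Prime → ps ∣ a → ps ∣ W)), (1 / (a:ℝ)) := by
  classical
  have hD : (1:ℝ) ≤ D0 := by exact_mod_cast hD0
  set E := kap W * Real.log (y/x) + 2 * (W+1) with hE
  have hE0 : 0 ≤ E := by
    have := kap_pos W hW
    have hl : 0 ≤ Real.log (y/x) := Real.log_nonneg ((one_le_div (by linarith)).mpr hxy)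
    positivity
  have h1 := Tn_ge W hW x y hx hxy
  unfold Tn at h1
  set A := (Finset.range ⌈y⌉₊).filter (fun a : ℕ => a.Coprime W ∧ x ≤ (a:ℝ)) with hA
  set Bs : ℕ → Finset ℕ := fun m => (Finset.range ⌈y⌉₊).filter (fun a : ℕ => (a.Coprime W ∧ x ≤ (a:ℝ)) ∧ m ∣ a) with hBs
  set Gd := (Finset.range ⌈y⌉₊).filter (fun a : ℕ => (a.Coprime W ∧ x ≤ (a:ℝ)) ∧ Squarefree a ∧ (ps.Prime → ps ∣ a → ps ∣ W)) with hGd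
  set J := Finset.Ioc D0 (max D0 ⌈y⌉₊) with hJ
  have hps : ∑ a ∈ A.filter (fun a : ℕ => ps.Prime ∧ ps ∣ a ∧ ¬ ps ∣ W), (1/(a:ℝ)) ≤ 1 / D0 * E := by
    by_cases h : ps.Prime ∧ ¬ ps ∣ W
    · have hlt : D0 < ps := by
        by_contra h3; push Not at h3
        exact h.2 (hWD ps h.1 h3)
      calc _ ≤ ∑ a ∈ Bs ps, (1/(a:ℝ)) := by
            refine Finset.sum_le_sum_of_subset_of_nonneg ?_ fun _ _ _ => by positivity
            intro a ha
            simp only [hA, hBs, Finset.mem_filter] at ha ⊢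
            tauto
        _ ≤ 1 / ps * E := Tn_mul W hW x y (by linarith) hxy ps h.1.pos
        _ ≤ _ := by gcongr
    · rw [Finset.sum_eq_zero]
      · positivity
      · intro a ha
        exfalso; apply h
        have := (Finset.mem_filter.mp ha).2
        exact ⟨this.1, this.2.2⟩
  have hsq : ∑ a ∈ A.filter (fun a : ℕ => ¬ Squarefree a), (1/(a:ℝ)) ≤ 1 / D0 * E := by
    calc _ ≤ ∑ a ∈ J.biUnion (fun d => Bs (d^2)), (1/(a:ℝ)) := by
          refine Finset.sum_le_sum_of_subset_of_nonneg ?_ fun _ _ _ => by positivity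
          intro a ha
          simp only [hA, Finset.mem_filter, Finset.mem_range, Nat.lt_ceil] at ha
          obtain ⟨⟨ha1, ha2, ha3⟩, ha4⟩ := ha
          rw [Nat.squarefree_iff_prime_squarefree] at ha4
          push Not at ha4
          obtain ⟨p, hp, hpa⟩ := ha4
          have ha0 : 0 < a := by
            have : (0:ℝ) < a := by linarith
            exact_mod_cast this
          have hpd : D0 < p := by
            by_contra h3; push Not at h3
            have h4 := hWD p hp h3
            have h5 : p ∣ a := (Dvd.intro _ rfl).trans hpa
            have := Nat.dvd_gcd h5 h4
            rw [ha2] at this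
            exact hp.one_lt.ne' (Nat.dvd_one.mp this)
          simp only [Finset.mem_biUnion, hJ, Finset.mem_Ioc, hBs, Finset.mem_filter, Finset.mem_range, Nat.lt_ceil]
          refine ⟨p, ⟨hpd, le_max_of_le_right ?_⟩, ha1, ⟨ha2, ha3⟩, by rw [sq]; exact hpa⟩
          have h6 : p ≤ a := Nat.le_of_dvd ha0 ((Dvd.intro _ rfl).trans hpa)
          have h7 : (a:ℝ) ≤ (⌈y⌉₊:ℝ) := ha1.le.trans (Nat.le_ceil y)
          exact h6.trans (by exact_mod_cast h7)
      _ ≤ ∑ d ∈ J, ∑ a ∈ Bs (d^2), (1/(a:ℝ)) := by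
          have : ∀ (J : Finset ℕ), ∑ a ∈ J.biUnion (fun d => Bs (d^2)), (1/(a:ℝ)) ≤ ∑ d ∈ J, ∑ a ∈ Bs (d^2), (1/(a:ℝ)) := by
            intro J
            induction J using Finset.induction_on with
            | empty => simp
            | insert d J hd ih =>
              rw [Finset.biUnion_insert, Finset.sum_insert hd]
              have := Finset.sum_union_inter (s₁ := Bs (d^2)) (s₂ := J.biUnion (fun d => Bs (d^2))) (f := fun a : ℕ => (1/(a:ℝ)))
              have h0 : 0 ≤ ∑ a ∈ Bs (d^2) ∩ J.biUnion (fun d => Bs (d^2)), (1/(a:ℝ)) := Finset.sum_nonneg fun _ _ => by positivity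
              linarith
          exact this J
      _ ≤ ∑ d ∈ J, ((d:ℝ)^2)⁻¹ * E := by
          refine Finset.sum_le_sum fun d hd => ?_
          have hd0 : 0 < d := by have := (Finset.mem_Ioc.mp hd).1; omega
          have := Tn_mul W hW x y (by linarith) hxy (d^2) (by positivity)
          rw [one_div, ← hE] at this
          push_cast at this
          exact this
      _ ≤ _ := by
          rw [← Finset.sum_mul]
          refine mul_le_mul_of_nonneg_right ?_ hE0
          have := sum_Ioc_inv_sq_le_sub (α := ℝ) (show D0 ≠ 0 by omega) (le_max_left D0 ⌈y⌉₊)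
          refine this.trans ?_
          rw [one_div]
          have : (0:ℝ) ≤ ((max D0 ⌈y⌉₊ : ℕ):ℝ)⁻¹ := by positivity
          linarith
  have hcov : ∑ a ∈ A, (1/(a:ℝ)) ≤ ∑ a ∈ Gd, (1/(a:ℝ)) + ∑ a ∈ A.filter (fun a : ℕ => ps.Prime ∧ ps ∣ a ∧ ¬ ps ∣ W), (1/(a:ℝ)) + ∑ a ∈ A.filter (fun a : ℕ => ¬ Squarefree a), (1/(a:ℝ)) := by
    have e : Gd = A.filter (fun a : ℕ => Squarefree a ∧ (ps.Prime → ps ∣ a → ps ∣ W)) := by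
      rw [hGd, hA, Finset.filter_filter]
    rw [e]
    simp only [Finset.sum_filter (s := A), ← Finset.sum_add_distrib]
    refine Finset.sum_le_sum fun a _ => ?_
    have : (0:ℝ) ≤ 1 / a := by positivity
    by_cases c1 : Squarefree a
    · by_cases c2 : ps.Prime → ps ∣ a → ps ∣ W
      · rw [if_pos ⟨c1, c2⟩]; split_ifs <;> linarith
      · have c3 : ps.Prime ∧ ps ∣ a ∧ ¬ ps ∣ W := by tauto
        rw [if_pos c3]; split_ifs <;> linarith
    · rw [if_pos c1]; split_ifs <;> linarith
  have hfin : 1 / (D0:ℝ) * (2 * (2 * (W+1))) ≤ 4 * (W+1) := by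
    have : 1 / (D0:ℝ) ≤ 1 := by rw [div_le_one (by linarith)]; exact hD
    nlinarith [show (0:ℝ) ≤ W by positivity]
  have hexp : kap W * Real.log (y/x) * (1 - 2 / D0) = kap W * Real.log (y/x) - 2 * (1 / D0 * (kap W * Real.log (y/x))) := by ring
  rw [hexp]
  rw [hE] at hps hsq
  nlinarith

end DSR
end

section
namespace DSR
open Filter Topology

section oned
variable (P : Finset ℕ)

def aS (S : Finset ↥P) : ℕ := ∏ p ∈ S, (p:ℕ)

lemma aS_pos (hP : ∀ p ∈ P, p.Prime) (S : Finset ↥P) : 0 < aS P S := Finset.prod_pos fun p _ => (hP p p.2).pos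

lemma aS_inj (hP : ∀ p ∈ P, p.Prime) : Function.Injective (aS P) := by
  intro S T h
  have key : ∀ S : Finset ↥P, ∀ p : ↥P, p ∈ S ↔ (p:ℕ) ∣ aS P S := by
    intro S p
    constructor
    · intro hp; exact Finset.dvd_prod_of_mem (fun p : ↥P => (p:ℕ)) hp
    · intro hp
      obtain ⟨q, hq, hpq⟩ := (Prime.dvd_finset_prod_iff (hP p p.2).prime _).mp hp
      rw [Nat.prime_dvd_prime_iff_eq (hP p p.2) (hP q q.2)] at hpq
      rw [Subtype.ext hpq]; exact hq
  ext p
  rw [key, key, h]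

lemma aS_log (hP : ∀ p ∈ P, p.Prime) (S : Finset ↥P) : ∑ p ∈ S, Real.log ((p:ℕ):ℝ) = Real.log (aS P S) := by
  rw [aS]; push_cast
  rw [Real.log_prod]
  intro p _
  have := (hP p p.2).ne_zero
  exact_mod_cast this

lemma aS_inv (S : Finset ↥P) : ∏ p ∈ S, (1 / ((p:ℕ):ℝ)) = 1 / (aS P S : ℝ) := by
  rw [aS]; push_cast
  rw [Finset.prod_div_distrib, Finset.prod_const_one]

noncomputable def lev (τ : ℝ) (a : ℕ) : ℕ := Nat.log 2 ⌊Real.log a / τ + 1⌋₊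

noncomputable def Gw (M : ℕ) (τ : ℝ) (a : ℕ) : ℝ := if lev τ a < M then (1/2 : ℝ)^(lev τ a) else 0

lemma lev_mono (τ : ℝ) (hτ : 0 < τ) (a b : ℕ) (ha : 0 < a) (hab : a ≤ b) : lev τ a ≤ lev τ b := by
  unfold lev
  apply Nat.log_mono_right
  apply Nat.floor_mono
  have : Real.log a ≤ Real.log b := Real.log_le_log (by exact_mod_cast ha) (by exact_mod_cast hab)
  gcongr

lemma lev_iff (τ : ℝ) (hτ : 0 < τ) (a : ℕ) (ha : 0 < a) (l : ℕ) :
    lev τ a = l ↔ Real.exp ((2^l-1)*τ) ≤ a ∧ (a:ℝ) < Real.exp ((2^(l+1)-1)*τ) := by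
  have ha0 : (0:ℝ) < a := by exact_mod_cast ha
  have hl : 0 ≤ Real.log a := Real.log_nonneg (by exact_mod_cast ha)
  have hx : 0 ≤ Real.log a / τ := by positivity
  have h1 : 1 ≤ ⌊Real.log a / τ + 1⌋₊ := by rw [Nat.one_le_floor_iff]; linarith
  unfold lev
  rw [Nat.log_eq_iff (Or.inr ⟨one_lt_two, by omega⟩), Nat.le_floor_iff (by linarith), Nat.floor_lt (by linarith),
    ← Real.le_log_iff_exp_le ha0, ← Real.log_lt_iff_lt_exp ha0]
  push_cast
  rw [← le_div_iff₀ hτ, ← div_lt_iff₀ hτ]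
  constructor <;> rintro ⟨h2, h3⟩ <;> constructor <;> linarith

lemma Gw_nonneg (M : ℕ) (τ : ℝ) (a : ℕ) : 0 ≤ Gw M τ a := by unfold Gw; split_ifs <;> positivity
lemma Gw_le (M : ℕ) (τ : ℝ) (a : ℕ) : Gw M τ a ≤ 1 := by
  unfold Gw; split_ifs
  · exact pow_le_one₀ (by norm_num) (by norm_num)
  · norm_num

lemma Gw_anti (M : ℕ) (τ : ℝ) (hτ : 0 < τ) (a b : ℕ) (ha : 0 < a) (hab : a ≤ b) : Gw M τ b ≤ Gw M τ a := by
  have h := lev_mono τ hτ a b ha hab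
  unfold Gw
  split_ifs with h1 h2
  · exact pow_le_pow_of_le_one (by norm_num) (by norm_num) h
  · omega
  · positivity
  · exact le_rfl

lemma Gw_one (M : ℕ) (hM : 1 ≤ M) (τ : ℝ) : Gw M τ 1 = 1 := by
  have : lev τ 1 = 0 := by simp [lev]
  unfold Gw; rw [this, if_pos (by omega)]; simp

noncomputable def Al (τ : ℝ) (l : ℕ) : ℝ := ∑ S ∈ Finset.univ.filter (fun S : Finset ↥P => lev τ (aS P S) = l), 1 / (aS P S : ℝ)

lemma lev_sum (M : ℕ) (τ : ℝ) (h : ℕ → ℝ) :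
    ∑ S : Finset ↥P, (if lev τ (aS P S) < M then h (lev τ (aS P S)) else 0) * (1 / (aS P S : ℝ)) = ∑ l ∈ Finset.range M, h l * Al P τ l := by
  unfold Al
  simp_rw [Finset.mul_sum, Finset.sum_filter]
  rw [Finset.sum_comm]
  refine Finset.sum_congr rfl fun S _ => ?_
  simp only [Finset.sum_ite_eq, Finset.mem_range]
  split_ifs <;> ring

lemma Al_le (W : ℕ) (hW : W ≠ 0) (hP : ∀ p ∈ P, p.Prime ∧ ¬ p ∣ W) (τ : ℝ) (hτ : 0 < τ) (l : ℕ) :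
    Al P τ l ≤ kap W * (2^l * τ) + 6 * (W+1) := by
  have h := Tn_le W hW (Real.exp ((2^l-1)*τ)) (Real.exp ((2^(l+1)-1)*τ)) (Real.exp_pos _) (Real.exp_le_exp.mpr (by
    gcongr <;> norm_num))
  rw [← Real.exp_sub, Real.log_exp] at h
  have e : (2^(l+1)-1)*τ - (2^l-1)*τ = 2^l * τ := by ring
  rw [e] at h
  have hP1 : ∀ p ∈ P, p.Prime := fun p hp => (hP p hp).1
  have : Al P τ l ≤ Tn W (Real.exp ((2^l-1)*τ)) (Real.exp ((2^(l+1)-1)*τ)) := by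
    unfold Al Tn
    rw [← Finset.sum_image (s := Finset.univ.filter (fun S : Finset ↥P => lev τ (aS P S) = l)) (f := fun a : ℕ => 1 / (a:ℝ)) (g := aS P) (aS_inj P hP1).injOn]
    refine Finset.sum_le_sum_of_subset_of_nonneg ?_ fun _ _ _ => by positivity
    intro a ha
    obtain ⟨S, hS, rfl⟩ := Finset.mem_image.mp ha
    have h1 := (lev_iff τ hτ _ (aS_pos P hP1 S) l).mp (Finset.mem_filter.mp hS).2
    rw [Finset.mem_filter, Finset.mem_range, Nat.lt_ceil]
    refine ⟨h1.2, ?_, h1.1⟩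
    exact Nat.Coprime.prod_left fun p _ => ((Nat.Prime.coprime_iff_not_dvd (hP p p.2).1).mpr (hP p p.2).2)
  have : (0:ℝ) ≤ W := by positivity
  linarith

lemma Al_ge (W : ℕ) (hW : W ≠ 0) (D0 : ℕ) (hD0 : 8 ≤ D0) (hWD : ∀ p, p.Prime → p ≤ D0 → p ∣ W) (R ps : ℕ)
    (hP : ∀ p, p ∈ P ↔ p.Prime ∧ p ≤ R ∧ ¬ p ∣ W ∧ p ≠ ps) (τ : ℝ) (hτ : 0 < τ) (l : ℕ)
    (hR : Real.exp ((2^(l+1)-1)*τ) ≤ R) :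
    3/4 * (kap W * (2^l * τ)) - 6 * (W+1) ≤ Al P τ l := by
  have hpow : (1:ℝ) ≤ 2^l := one_le_pow₀ (by norm_num)
  have h := T_sf W hW D0 (by omega) hWD ps (Real.exp ((2^l-1)*τ)) (Real.exp ((2^(l+1)-1)*τ)) (by
    apply Real.one_le_exp; exact mul_nonneg (by linarith) hτ.le) (Real.exp_le_exp.mpr (by
    gcongr <;> norm_num))
  rw [← Real.exp_sub, Real.log_exp] at h
  have e : (2^(l+1)-1)*τ - (2^l-1)*τ = 2^l * τ := by ring
  rw [e] at h
  have hP1 : ∀ p ∈ P, p.Prime := fun p hp => ((hP p).mp hp).1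
  have hk := kap_pos W hW
  have h2 : 3/4 * (kap W * (2^l * τ)) ≤ kap W * (2^l*τ) * (1 - 2/D0) := by
    have : (2:ℝ)/D0 ≤ 1/4 := by
      have h8 : (8:ℝ) ≤ D0 := by exact_mod_cast hD0
      rw [div_le_iff₀ (by linarith)]; linarith
    have h3 : 0 ≤ kap W * (2^l * τ) := by positivity
    nlinarith
  refine le_trans (by linarith) (h.trans ?_)
  unfold Al
  rw [← Finset.sum_image (s := Finset.univ.filter (fun S : Finset ↥P => lev τ (aS P S) = l)) (f := fun a : ℕ => 1 / (a:ℝ)) (g := aS P) (aS_inj P hP1).injOn]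
  refine Finset.sum_le_sum_of_subset_of_nonneg ?_ fun _ _ _ => by positivity
  intro a ha
  rw [Finset.mem_filter, Finset.mem_range, Nat.lt_ceil] at ha
  obtain ⟨h1, ⟨h2, h3⟩, h4, h5⟩ := ha
  have ha0 : 0 < a := by
    have : (0:ℝ) < a := lt_of_lt_of_le (Real.exp_pos _) h3
    exact_mod_cast this
  have haR : a ≤ R := by
    have := h1.le.trans hR
    exact_mod_cast this
  have hsub : ∀ p ∈ a.primeFactors, p ∈ P := by
    intro p hp
    have hpp := Nat.prime_of_mem_primeFactors hp
    have hpd := Nat.dvd_of_mem_primeFactors hp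
    have hnW : ¬ p ∣ W := by
      intro hd
      have := Nat.dvd_gcd hpd hd
      rw [h2] at this
      exact hpp.one_lt.ne' (Nat.dvd_one.mp this)
    refine (hP p).mpr ⟨hpp, (Nat.le_of_dvd ha0 hpd).trans haR, hnW, ?_⟩
    rintro rfl
    exact hnW (h5 hpp hpd)
  have hprod : aS P (Finset.univ.filter fun p : ↥P => (p:ℕ) ∈ a.primeFactors) = a := by
    unfold aS
    conv_rhs => rw [← Nat.prod_primeFactors_of_squarefree h4]
    refine Finset.prod_bij (fun p _ => (p:ℕ)) ?_ ?_ ?_ ?_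
    · intro p hp; exact (Finset.mem_filter.mp hp).2
    · intro p _ q _ h; exact Subtype.ext h
    · intro p hp; exact ⟨⟨p, hsub p hp⟩, by simpa using hp, rfl⟩
    · intro p _; rfl
  refine Finset.mem_image.mpr ⟨_, Finset.mem_filter.mpr ⟨Finset.mem_univ _, ?_⟩, hprod⟩
  rw [hprod]
  exact (lev_iff τ hτ a ha0 l).mpr ⟨h3, h1⟩

lemma geom_half (M : ℕ) : ∑ l ∈ Finset.range M, (1/2:ℝ)^l ≤ 2 := by
  have := sum_geometric_two_le M
  simpa using this

/-- one-dimensional estimates -/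
lemma oned (W : ℕ) (hW : W ≠ 0) (D0 : ℕ) (hD0 : 8 ≤ D0) (hWD : ∀ p, p.Prime → p ≤ D0 → p ∣ W) (R ps : ℕ)
    (hP : ∀ p, p ∈ P ↔ p.Prime ∧ p ≤ R ∧ ¬ p ∣ W ∧ p ≠ ps) (M : ℕ) (hM : 1 ≤ M) (L τ : ℝ) (hL : L = Real.log R)
    (hτL : τ = L / (64 * 2^M * M)) (hR : 1 ≤ R) (hτ : 24 * (W+1) ≤ kap W * τ) :
    (∑ S : Finset ↥P, Gw M τ (aS P S)^2 * ∏ p ∈ S, (1 / ((p:ℕ):ℝ)) ≤ 3 * (kap W * τ)) ∧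
    (kap W * τ * M / 2 ≤ ∑ S : Finset ↥P, Gw M τ (aS P S) * ∏ p ∈ S, (1 / ((p:ℕ):ℝ))) ∧
    (∑ S : Finset ↥P, Gw M τ (aS P S)^2 * (∏ p ∈ S, (1 / ((p:ℕ):ℝ))) * ∑ p ∈ S, Real.log ((p:ℕ):ℝ) ≤
      L / (8 * 2^M) * ∑ S : Finset ↥P, Gw M τ (aS P S)^2 * ∏ p ∈ S, (1 / ((p:ℕ):ℝ))) ∧
    (∀ S : Finset ↥P, Gw M τ (aS P S) ≠ 0 → ∑ p ∈ S, Real.log ((p:ℕ):ℝ) ≤ L / 2) := by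
  have hk := kap_pos W hW
  have hM1 : (1:ℝ) ≤ M := by exact_mod_cast hM
  have hW0 : (0:ℝ) ≤ W := by positivity
  have hτ0 : 0 < τ := by
    by_contra h; push Not at h
    nlinarith [mul_nonneg hk.le (neg_nonneg.mpr h)]
  have hP1 : ∀ p ∈ P, p.Prime := fun p hp => ((hP p).mp hp).1
  have hP2 : ∀ p ∈ P, p.Prime ∧ ¬ p ∣ W := fun p hp => ⟨((hP p).mp hp).1, ((hP p).mp hp).2.2.1⟩
  have hLe : L = 64 * 2^M * M * τ := by rw [hτL]; field_simp
  have hL0 : 0 < L := by rw [hLe]; positivity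
  have hbound : ∀ l < M, (2^(l+1) : ℝ) ≤ 2^M := fun l hl => pow_le_pow_right₀ (by norm_num) hl
  have hLbig : 2^M * τ ≤ L / 2 := by
    rw [hLe]
    have : 0 < 2^M * τ := by positivity
    nlinarith [mul_le_mul_of_nonneg_left hM1 this.le]
  set κ := kap W with hκ
  have hC : 6 * ((W:ℝ)+1) ≤ κ * τ / 4 := by linarith
  have Aup : ∀ l, Al P τ l ≤ 5/4 * (κ * (2^l * τ)) := by
    intro l
    have h1 := Al_le P W hW hP2 τ hτ0 l
    have hpow : (1:ℝ) ≤ 2^l := one_le_pow₀ (by norm_num)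
    have : κ * τ ≤ κ * (2^l * τ) := by
      have : 0 < κ * τ := by positivity
      nlinarith
    rw [← hκ] at h1
    linarith
  have Alow : ∀ l < M, 1/2 * (κ * (2^l * τ)) ≤ Al P τ l := by
    intro l hl
    have h1 := Al_ge P W hW D0 hD0 hWD R ps hP τ hτ0 l (by
      have : (R:ℝ) = Real.exp L := by rw [hL, Real.exp_log (by exact_mod_cast hR)]
      rw [this]
      apply Real.exp_le_exp.mpr
      have := hbound l hl
      nlinarith)
    have hpow : (1:ℝ) ≤ 2^l := one_le_pow₀ (by norm_num)
    have : κ * τ ≤ κ * (2^l * τ) := by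
      have : 0 < κ * τ := by positivity
      nlinarith
    rw [← hκ] at h1
    linarith
  have Apos : ∀ l, 0 ≤ Al P τ l := fun l => Finset.sum_nonneg fun S _ => by positivity
  have eα : ∑ S : Finset ↥P, Gw M τ (aS P S)^2 * ∏ p ∈ S, (1 / ((p:ℕ):ℝ)) = ∑ l ∈ Finset.range M, ((1/2:ℝ)^l)^2 * Al P τ l := by
    rw [← lev_sum]
    refine Finset.sum_congr rfl fun S _ => ?_
    rw [aS_inv, Gw]
    split_ifs <;> ring
  have eβ : ∑ S : Finset ↥P, Gw M τ (aS P S) * ∏ p ∈ S, (1 / ((p:ℕ):ℝ)) = ∑ l ∈ Finset.range M, (1/2:ℝ)^l * Al P τ l := by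
    rw [← lev_sum]
    refine Finset.sum_congr rfl fun S _ => ?_
    rw [aS_inv, Gw]
  have hhalf : ∀ l : ℕ, (1/2:ℝ)^l * 2^l = 1 := fun l => by rw [← mul_pow]; norm_num
  have hlogS : ∀ S : Finset ↥P, Real.log (aS P S) ≤ 2^(lev τ (aS P S) + 1) * τ := by
    intro S
    have h1 := ((lev_iff τ hτ0 _ (aS_pos P hP1 S) _).mp rfl).2
    have h2 : (0:ℝ) < aS P S := by exact_mod_cast aS_pos P hP1 S
    rw [← Real.log_lt_iff_lt_exp h2] at h1
    nlinarith
  have hα1 : κ * τ / 2 ≤ ∑ S : Finset ↥P, Gw M τ (aS P S)^2 * ∏ p ∈ S, (1 / ((p:ℕ):ℝ)) := by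
    rw [eα]
    have h1 := Finset.single_le_sum (f := fun l => ((1/2:ℝ)^l)^2 * Al P τ l) (fun l _ => mul_nonneg (by positivity) (Apos l)) (Finset.mem_range.mpr (show 0 < M by omega))
    have h2 := Alow 0 (by omega)
    simp at h1 h2
    simp only [one_div, inv_pow]
    linarith
  refine ⟨?_, ?_, ?_, ?_⟩
  · rw [eα]
    calc _ ≤ ∑ l ∈ Finset.range M, (1/2:ℝ)^l * (5/4 * (κ * τ)) := by
          refine Finset.sum_le_sum fun l _ => ?_
          calc _ ≤ ((1/2:ℝ)^l)^2 * (5/4 * (κ * (2^l * τ))) := mul_le_mul_of_nonneg_left (Aup l) (by positivity)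
            _ = (1/2:ℝ)^l * ((1/2:ℝ)^l * 2^l) * (5/4 * (κ * τ)) := by ring
            _ = _ := by rw [hhalf, mul_one]
      _ ≤ 2 * (5/4 * (κ * τ)) := by
          rw [← Finset.sum_mul]
          exact mul_le_mul_of_nonneg_right (geom_half M) (by positivity)
      _ ≤ _ := by
          have : 0 < κ * τ := by positivity
          linarith
  · rw [eβ]
    calc κ * τ * M / 2 = ∑ l ∈ Finset.range M, (κ * τ / 2) := by
          rw [Finset.sum_const, Finset.card_range, nsmul_eq_mul]; ring
      _ ≤ _ := by
          refine Finset.sum_le_sum fun l hl => ?_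
          calc κ * τ / 2 = ((1/2:ℝ)^l * 2^l) * (κ * τ / 2) := by rw [hhalf, one_mul]
            _ = (1/2:ℝ)^l * (1/2 * (κ * (2^l * τ))) := by ring
            _ ≤ _ := mul_le_mul_of_nonneg_left (Alow l (Finset.mem_range.mp hl)) (by positivity)
  · calc _ ≤ ∑ l ∈ Finset.range M, (((1/2:ℝ)^l)^2 * (2^(l+1) * τ)) * Al P τ l := by
          rw [← lev_sum P M τ (fun l => ((1/2:ℝ)^l)^2 * (2^(l+1) * τ))]
          refine Finset.sum_le_sum fun S _ => ?_
          rw [aS_inv, aS_log P hP1, Gw]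
          have h2 : (0:ℝ) < aS P S := by exact_mod_cast aS_pos P hP1 S
          split_ifs
          · have := mul_le_mul_of_nonneg_left (hlogS S) (show 0 ≤ ((1/2:ℝ)^(lev τ (aS P S)))^2 * (1 / (aS P S : ℝ)) by positivity)
            nlinarith
          · simp
      _ ≤ ∑ l ∈ Finset.range M, (5/2 * κ * τ^2) := by
          refine Finset.sum_le_sum fun l _ => ?_
          calc _ ≤ (((1/2:ℝ)^l)^2 * (2^(l+1) * τ)) * (5/4 * (κ * (2^l * τ))) := mul_le_mul_of_nonneg_left (Aup l) (by positivity)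
            _ = ((1/2:ℝ)^l * 2^l)^2 * (5/2 * κ * τ^2) := by ring
            _ = _ := by rw [hhalf, one_pow, one_mul]
      _ = M * (5/2 * κ * τ^2) := by rw [Finset.sum_const, Finset.card_range, nsmul_eq_mul]
      _ ≤ (8 * M * τ) * (κ * τ / 2) := by
          have : 0 ≤ M * (κ * τ^2) := by positivity
          nlinarith
      _ = L / (8 * 2^M) * (κ * τ / 2) := by rw [hLe]; field_simp; ring
      _ ≤ _ := mul_le_mul_of_nonneg_left hα1 (by positivity)
  · intro S hS
    rw [aS_log P hP1]
    have h1 : lev τ (aS P S) < M := by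
      by_contra h
      exact hS (by rw [Gw, if_neg h])
    have h2 := hbound _ h1
    have := hlogS S
    nlinarith

end oned
end DSR
end

section
namespace DSR
open Filter Topology

section lam
variable {ι : Type*} [Fintype ι] [DecidableEq ι] {k : ℕ}

lemma lam_bound (s : ι → ℝ) (hs : ∀ p, 0 ≤ s p) (c : (ι → Option (Fin k)) → ℝ) (hc : ∀ u, |c u| ≤ 1)
    (d : ι → Option (Fin k)) : |lamOf s c d| ≤ ∏ p, (1 + k * s p) := by
  unfold lamOf
  calc |∑ u, c u * ∏ p, Tm (fun _ => - s p) (d p) (u p)|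
      ≤ ∑ u : ι → Option (Fin k), ∏ p, |Tm (fun _ => - s p) (d p) (u p)| := by
        refine (Finset.abs_sum_le_sum_abs _ _).trans (Finset.sum_le_sum fun u _ => ?_)
        rw [abs_mul, Finset.abs_prod]
        have h0 : 0 ≤ ∏ p, |Tm (fun _ => - s p) (d p) (u p)| := Finset.prod_nonneg fun _ _ => abs_nonneg _
        nlinarith [hc u]
    _ = ∏ p, ∑ x, |Tm (fun _ => - s p) (d p) x| := by
        rw [Finset.prod_univ_sum]
        simp
    _ ≤ _ := by
        refine Finset.prod_le_prod (fun p _ => Finset.sum_nonneg fun _ _ => abs_nonneg _) fun p _ => ?_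
        have := hs p
        rcases d p with _ | i
        · simp [Fintype.sum_option, Tm, abs_of_nonneg this]
        · have h1 : ∀ x : Fin k, |if i = x then (1:ℝ) else 0| = if i = x then 1 else 0 := by
            intro x; split_ifs <;> simp
          simp only [Fintype.sum_option, Tm, h1]
          simp
          positivity

lemma lam_supp (s : ι → ℝ) (c : (ι → Option (Fin k)) → ℝ) (d : ι → Option (Fin k)) (h : lamOf s c d ≠ 0) :
    ∃ u, c u ≠ 0 ∧ supp d ⊆ supp u := by
  obtain ⟨u, _, hu⟩ := Finset.exists_ne_zero_of_sum_ne_zero h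
  refine ⟨u, left_ne_zero_of_mul hu, ?_⟩
  have h2 := right_ne_zero_of_mul hu
  rw [Finset.prod_ne_zero_iff] at h2
  intro p hp
  rw [mem_supp] at hp ⊢
  intro h3
  apply h2 p (Finset.mem_univ _)
  rw [h3]
  obtain ⟨i, hi⟩ := Option.ne_none_iff_exists'.mp hp
  rw [hi, Tm]

lemma cw_abs (G : Finset ι → ℝ) (hG0 : ∀ S, 0 ≤ G S) (hG1 : ∀ S, G S ≤ 1) (ℓ : ι → ℝ) (L : ℝ) (u : ι → Option (Fin k)) :
    |cw G ℓ L u| ≤ 1 := by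
  unfold cw
  rw [abs_mul]
  have h1 : |∏ p, Dm (1:ℝ) (fun _ => -1) (u p)| = 1 := by
    rw [← sq_eq_sq₀ (abs_nonneg _) zero_le_one, sq_abs, sgn_sq]; norm_num
  rw [h1, one_mul, Yw]
  split_ifs with h
  · rw [abs_of_nonneg (Finset.prod_nonneg fun i _ => hG0 _)]
    exact Finset.prod_le_one (fun i _ => hG0 _) fun i _ => hG1 _
  · simp

end lam

lemma inv_sq_sum (D0 R : ℕ) (hD0 : 1 ≤ D0) (P : Finset ℕ) (hP : ∀ p ∈ P, D0 < p ∧ p ≤ R) :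
    ∑ p : ↥P, (1/((p:ℕ):ℝ))^2 ≤ 1 / (D0:ℝ) := by
  have e : ∑ p : ↥P, (1/((p:ℕ):ℝ))^2 = ∑ p ∈ P, (1/(p:ℝ))^2 := Finset.sum_coe_sort P (fun p => (1/(p:ℝ))^2)
  rw [e]
  calc ∑ p ∈ P, (1/(p:ℝ))^2 ≤ ∑ p ∈ Finset.Ioc D0 (max D0 R), (1/(p:ℝ))^2 := by
        refine Finset.sum_le_sum_of_subset_of_nonneg ?_ fun _ _ _ => by positivity
        intro p hp
        have := hP p hp
        rw [Finset.mem_Ioc]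
        exact ⟨this.1, this.2.trans (le_max_right _ _)⟩
    _ ≤ _ := by
        have := sum_Ioc_inv_sq_le_sub (α := ℝ) (show D0 ≠ 0 by omega) (le_max_left D0 R)
        simp only [one_div, inv_pow]
        refine this.trans ?_
        have : (0:ℝ) ≤ ((max D0 R : ℕ):ℝ)⁻¹ := by positivity
        push_cast at *
        linarith

lemma alg7 (α β x : ℝ) (M k : ℕ) (hk1 : 1 ≤ k) (hα0 : 0 ≤ α) (hx : 0 ≤ x) (hα : α ≤ 3 * x) (hβ : x * M / 2 ≤ β) :
    x * M^2 / 768 * α^k ≤ β^2 * α^(k-1) / 64 := by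
  have e : α^k = α * α^(k-1) := by rw [← pow_succ']; congr 1; omega
  rw [e]
  have h3 : (x*M/2)^2 ≤ β^2 := by
    have : 0 ≤ x*M/2 := by positivity
    gcongr
  have h4 : x * M^2 * α ≤ 12 * β^2 := by
    have : x * M^2 * α ≤ x * M^2 * (3*x) := by gcongr
    nlinarith
  have h5 : 0 ≤ α^(k-1) := by positivity
  have : x * M^2 / 768 * α ≤ β^2 / 64 := by linarith
  calc _ = (x * M^2 / 768 * α) * α^(k-1) := by ring
    _ ≤ (β^2/64) * α^(k-1) := by gcongr
    _ = _ := by ring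

set_option maxHeartbeats 1000000 in
theorem sieve7 (M : ℕ) (hM : 1 ≤ M) (P : Finset ℕ) (W : ℕ) (hW : W ≠ 0) (D0 : ℕ) (hD0 : 128 * (2^M)^2 ≤ D0)
    (hWD : ∀ p, p.Prime → p ≤ D0 → p ∣ W) (R ps : ℕ) (hP : ∀ p, p ∈ P ↔ p.Prime ∧ p ≤ R ∧ ¬ p ∣ W ∧ p ≠ ps)
    (L τ : ℝ) (hL : L = Real.log R) (hτL : τ = L/(64*2^M*M)) (hR : 2 ≤ R) (hτ : 24*(W+1) ≤ kap W*τ) :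
    ∃ lam : (↥P → Option (Fin (2^M))) → ℝ, ∃ α : ℝ, 1 ≤ α ∧ (∀ d, |lam d| ≤ (1 + Real.log R)^(6*2^M)) ∧
      (∀ d, lam d ≠ 0 → aS P (supp d) ≤ R) ∧ tq (fun p : ↥P => K1 (1/((p:ℕ):ℝ))) lam ≤ α^(2^M) ∧
      ∀ m, kap W * τ * M^2 / 768 * α^(2^M) ≤ tq (fun p : ↥P => K2 m (1/(((p:ℕ):ℝ) - 1))) lam := by
  have hPp : ∀ p ∈ P, p.Prime := fun p hp => ((hP p).mp hp).1
  have hPD : ∀ p ∈ P, D0 < p := by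
    intro p hp
    by_contra h
    exact ((hP p).mp hp).2.2.1 (hWD p (hPp p hp) (by omega))
  have hk1 : 1 ≤ 2^M := Nat.one_le_two_pow
  have hD8 : 8 ≤ D0 := by nlinarith
  have hkpos := kap_pos W hW
  have hW0 : (0:ℝ) ≤ W := by positivity
  have hτ0 : 0 < τ := by
    by_contra h
    have : kap W * τ ≤ 0 := mul_nonpos_of_nonneg_of_nonpos hkpos.le (not_lt.mp h)
    linarith
  have hLpos : 0 < L := by rw [hL]; exact Real.log_pos (by exact_mod_cast hR)
  obtain ⟨hα, hβ, hlog, hGL⟩ := oned P W hW D0 hD8 hWD R ps hP M hM L τ hL hτL (by omega) hτ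
  set s : ↥P → ℝ := fun p => 1/((p:ℕ):ℝ) with hs
  set G : Finset ↥P → ℝ := fun S => Gw M τ (aS P S) with hG
  set ℓ : ↥P → ℝ := fun p => Real.log ((p:ℕ):ℝ) with hℓ
  have hppos : ∀ p : ↥P, (0:ℝ) < (p:ℕ) := fun p => by exact_mod_cast (hPp p p.2).pos
  have hs0 : ∀ p, 0 < s p := fun p => by have := hppos p; simp only [hs]; positivity
  have hpD : ∀ p : ↥P, (128 * (2^M)^2 : ℝ) ≤ (p:ℕ) := fun p => by
    have := hPD p p.2
    exact_mod_cast (hD0.trans this.le)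
  have hkr : (1:ℝ) ≤ 2^M := by exact_mod_cast hk1
  have hk8 : ∀ p, 8 * ((2^M:ℕ):ℝ) * s p ≤ 1 := by
    intro p
    simp only [hs]
    push_cast
    rw [mul_one_div, div_le_one (hppos p)]
    nlinarith [hpD p]
  have hG0 : ∀ S, 0 ≤ G S := fun S => Gw_nonneg _ _ _
  have hG1 : ∀ S, G S ≤ 1 := fun S => Gw_le _ _ _
  have hGe : G ∅ = 1 := by simp only [hG, aS, Finset.prod_empty]; exact Gw_one M hM τ
  have hcs : ∀ u, |cw (k := 2^M) G ℓ L u| ≤ 1 := cw_abs G hG0 hG1 ℓ L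
  refine ⟨lamOf s (cw (k := 2^M) G ℓ L), ∑ S : Finset ↥P, G S^2 * ∏ p ∈ S, s p, ?_, ?_, ?_, ?_, ?_⟩
  · calc (1:ℝ) = G ∅^2 * ∏ p ∈ ∅, s p := by rw [hGe]; simp
      _ ≤ _ := Finset.single_le_sum (f := fun S => G S^2 * ∏ p ∈ S, s p) (fun S _ => mul_nonneg (sq_nonneg _) (Finset.prod_nonneg fun p _ => (hs0 p).le)) (Finset.mem_univ _)
  · intro d
    refine (lam_bound s (fun p => (hs0 p).le) _ hcs d).trans ?_
    have h1 := V_bound (2^M) R hR P (fun p hp => ⟨hPp p hp, ((hP p).mp hp).2.1⟩)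
    refine le_trans ?_ h1
    rw [← Finset.prod_coe_sort P]
    refine Finset.prod_le_prod (fun p _ => by have := hs0 p; positivity) fun p _ => ?_
    have h2 : (1:ℝ) < (p:ℕ) := by exact_mod_cast (hPp p p.2).one_lt
    simp only [hs]
    rw [mul_one_div]
    gcongr
    linarith
  · intro d hd
    obtain ⟨u, hu, hsub⟩ := lam_supp _ _ _ hd
    have h1 : ∑ p ∈ supp u, ℓ p ≤ L := by
      by_contra h
      apply hu
      rw [cw, Yw, if_neg h, mul_zero]
    have hℓ0 : ∀ p, 0 ≤ ℓ p := fun p => Real.log_natCast_nonneg _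
    have h2 : ∑ p ∈ supp d, ℓ p ≤ L := (Finset.sum_le_sum_of_subset_of_nonneg hsub fun p _ _ => hℓ0 p).trans h1
    simp only [hℓ] at h2
    rw [aS_log P hPp, hL, Real.log_le_log_iff (by exact_mod_cast aS_pos P hPp _) (by positivity)] at h2
    exact_mod_cast h2
  · refine Q1_bound s (fun p => (hs0 p).le) (fun p => ?_) G ℓ L
    have := hk8 p
    have := hs0 p
    have : 0 ≤ ((2^M:ℕ):ℝ) * s p := by positivity
    linarith
  · intro m
    have hQ := Q2_bound m s (fun p => 1/(((p:ℕ):ℝ) - 1)) hs0 (fun p => ?_) (fun p => ?_) hk8 ?_ G hG0 hGe ?_ ℓ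
      (fun p => Real.log_natCast_nonneg _) L hLpos hGL (by push_cast; exact hlog)
    · refine le_trans ?_ hQ
      have hα0 : 0 ≤ ∑ S : Finset ↥P, G S^2 * ∏ p ∈ S, s p := Finset.sum_nonneg fun S _ => mul_nonneg (sq_nonneg _) (Finset.prod_nonneg fun p _ => (hs0 p).le)
      exact alg7 _ _ (kap W * τ) M (2^M) hk1 hα0 (by positivity) hα hβ
    · have := hk8 p
      have h6 := hs0 p
      have : (1:ℝ) ≤ ((2^M:ℕ):ℝ) := by exact_mod_cast hk1
      nlinarith
    · have h2 : (1:ℝ) < (p:ℕ) := by exact_mod_cast (hPp p p.2).one_lt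
      simp only [hs]
      have : ((p:ℕ):ℝ) - 1 ≠ 0 := by linarith
      have := (hppos p).ne'
      field_simp
      ring
    · have := inv_sq_sum D0 R (by omega) P (fun p hp => ⟨hPD p hp, ((hP p).mp hp).2.1⟩)
      have hD : (128 * (2^M)^2 : ℝ) ≤ D0 := by exact_mod_cast hD0
      have hDp : (0:ℝ) < D0 := by nlinarith
      simp only [hs]
      push_cast
      calc _ ≤ 64 * ((2:ℝ)^M)^2 * (1/D0) := by gcongr
        _ ≤ 1 := by
          rw [mul_one_div, div_le_one hDp]
          nlinarith
    · intro p S hp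
      simp only [hG]
      refine Gw_anti M τ hτ0 _ _ (aS_pos P hPp _) ?_
      simp only [aS]
      rw [Finset.prod_insert hp]
      exact Nat.le_mul_of_pos_left _ (hPp p p.2).pos

end DSR
end

section
namespace DSR
open Filter Topology

section quad
variable (P : Finset ℕ) {k : ℕ}

def nm (S : Finset ↥P) : Finset ℕ := S.map (Function.Embedding.subtype (· ∈ P))

lemma nm_prod (S : Finset ↥P) : ∏ p ∈ nm P S, p = aS P S := by
  rw [nm, Finset.prod_map, aS]; rfl

lemma nm_card (S : Finset ↥P) : (nm P S).card = S.card := Finset.card_map _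

lemma nm_sub (S : Finset ↥P) : nm P S ⊆ P := by
  intro p hp
  rw [nm, Finset.mem_map] at hp
  obtain ⟨q, _, rfl⟩ := hp
  exact q.2

lemma nm_inj : Function.Injective (nm P) := Finset.map_injective _

def ind (h : Fin k → ℕ) (d : ↥P → Option (Fin k)) (n : ℕ) : Prop := ∀ p : ↥P, ∀ i, d p = some i → (p:ℕ) ∣ n + h i

open Classical in
noncomputable def AA (h : Fin k → ℕ) (lam : (↥P → Option (Fin k)) → ℝ) (n : ℕ) : ℝ := ∑ d, if ind P h d n then lam d else 0

lemma card_sub (S : Finset ↥P) : ∑ d : ↥P → Option (Fin k), (if supp d ⊆ S then (1:ℝ) else 0) = ((k:ℝ)+1)^S.card := by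
  classical
  have e : ∀ d : ↥P → Option (Fin k), (if supp d ⊆ S then (1:ℝ) else 0) = ∏ p, if p ∈ S ∨ d p = none then 1 else 0 := by
    intro d
    rw [Finset.prod_ite_zero]
    simp only [Finset.prod_const_one]
    congr 1
    rw [eq_iff_iff]
    constructor
    · intro h1 p _
      by_contra h2
      push Not at h2
      exact h2.1 (h1 ((mem_supp _ _).mpr h2.2))
    · intro h1 p hp
      rcases h1 p (Finset.mem_univ _) with h2 | h2
      · exact h2
      · exact absurd h2 ((mem_supp _ _).mp hp)
  simp_rw [e]
  have e2 := Finset.prod_univ_sum (fun _ : ↥P => (Finset.univ : Finset (Option (Fin k)))) (fun p x => if p ∈ S ∨ x = none then (1:ℝ) else 0)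
  rw [Fintype.piFinset_univ] at e2
  rw [← e2]
  have e3 : ∀ p : ↥P, ∑ x : Option (Fin k), (if p ∈ S ∨ x = none then (1:ℝ) else 0) = if p ∈ S then (k:ℝ)+1 else 1 := by
    intro p
    by_cases hp : p ∈ S <;> simp [hp]
  simp_rw [e3]
  rw [Finset.prod_ite_mem, Finset.univ_inter, Finset.prod_const]

lemma pairsum (hP : ∀ p ∈ P, p.Prime) (R : ℕ) (lam : (↥P → Option (Fin k)) → ℝ) (V : ℝ) (hV0 : 0 ≤ V) (hV : ∀ d, |lam d| ≤ V)
    (hs : ∀ d, lam d ≠ 0 → aS P (supp d) ≤ R) (Er : Finset ℕ → ℝ) (hE : ∀ S, 0 ≤ Er (nm P S)) :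
    ∑ d, ∑ e, |lam d| * |lam e| * Er (nm P (supp d ∪ supp e)) ≤
      V^2 * ∑ s ∈ P.powerset.filter (fun s => ∏ p ∈ s, p ≤ R^2), (((k+1)^2 : ℕ):ℝ)^s.card * Er s := by
  classical
  have h1 : ∀ d e, |lam d| * |lam e| * Er (nm P (supp d ∪ supp e)) ≤
      ∑ S ∈ Finset.univ.filter (fun S : Finset ↥P => aS P S ≤ R^2), (if supp d ⊆ S then (1:ℝ) else 0) * (if supp e ⊆ S then 1 else 0) * (V^2 * Er (nm P S)) := by
    intro d e
    have hnn : ∀ S ∈ Finset.univ.filter (fun S : Finset ↥P => aS P S ≤ R^2), 0 ≤ (if supp d ⊆ S then (1:ℝ) else 0) * (if supp e ⊆ S then 1 else 0) * (V^2 * Er (nm P S)) := by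
      intro S _
      have := hE S
      split_ifs <;> simp <;> positivity
    by_cases hz : lam d = 0 ∨ lam e = 0
    · have : |lam d| * |lam e| * Er (nm P (supp d ∪ supp e)) = 0 := by rcases hz with hz | hz <;> simp [hz]
      rw [this]
      exact Finset.sum_nonneg hnn
    · push Not at hz
      have hm : supp d ∪ supp e ∈ Finset.univ.filter (fun S : Finset ↥P => aS P S ≤ R^2) := by
        rw [Finset.mem_filter]
        refine ⟨Finset.mem_univ _, ?_⟩
        calc aS P (supp d ∪ supp e) ≤ aS P (supp d) * aS P (supp e) := by
              have := Finset.prod_union_inter (s₁ := supp d) (s₂ := supp e) (f := fun p : ↥P => (p:ℕ))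
              unfold aS
              rw [← this]
              exact Nat.le_mul_of_pos_right _ (aS_pos P hP _)
          _ ≤ R^2 := by rw [sq]; exact Nat.mul_le_mul (hs d hz.1) (hs e hz.2)
      refine le_trans ?_ (Finset.single_le_sum hnn hm)
      rw [if_pos Finset.subset_union_left, if_pos Finset.subset_union_right, one_mul, one_mul, sq]
      have := hE (supp d ∪ supp e)
      have := hV d
      have := hV e
      gcongr
  refine (Finset.sum_le_sum fun d _ => Finset.sum_le_sum fun e _ => h1 d e).trans ?_
  have h2 : ∑ d : ↥P → Option (Fin k), ∑ e : ↥P → Option (Fin k), ∑ S ∈ Finset.univ.filter (fun S : Finset ↥P => aS P S ≤ R^2), (if supp d ⊆ S then (1:ℝ) else 0) * (if supp e ⊆ S then 1 else 0) * (V^2 * Er (nm P S))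
      = ∑ S ∈ Finset.univ.filter (fun S : Finset ↥P => aS P S ≤ R^2), V^2 * ((((k+1)^2 : ℕ):ℝ)^(nm P S).card * Er (nm P S)) := by
    simp_rw [Finset.sum_comm (s := (Finset.univ : Finset (↥P → Option (Fin k)))) (t := Finset.univ.filter (fun S : Finset ↥P => aS P S ≤ R^2))]
    refine Finset.sum_congr rfl fun S _ => ?_
    simp_rw [← Finset.sum_mul, ← Finset.mul_sum, ← Finset.sum_mul]
    rw [card_sub, nm_card]
    push_cast
    rw [← pow_mul]
    ring
  rw [h2, ← Finset.mul_sum]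
  gcongr
  rw [← Finset.sum_image (f := fun s : Finset ℕ => (((k+1)^2 : ℕ):ℝ)^s.card * Er s) (g := nm P) (fun x _ y _ h => nm_inj P h)]
  have hsub : ∀ s ∈ P.powerset, ∃ S, nm P S = s := by
    intro s hs
    rw [Finset.mem_powerset] at hs
    refine ⟨Finset.subtype (· ∈ P) s, ?_⟩
    rw [nm, Finset.subtype_map_of_mem]
    exact hs
  refine Finset.sum_le_sum_of_subset_of_nonneg ?_ ?_
  · intro s hs
    rw [Finset.mem_image] at hs
    obtain ⟨S, hS, rfl⟩ := hs
    rw [Finset.mem_filter] at hS ⊢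
    rw [nm_prod]
    exact ⟨Finset.mem_powerset.mpr (nm_sub P S), hS.2⟩
  · intro s hs _
    obtain ⟨S, rfl⟩ := hsub s (Finset.mem_filter.mp hs).1
    have := hE S
    positivity

open Classical in
lemma quad (h : Fin k → ℕ) (lam : (↥P → Option (Fin k)) → ℝ) (w : ℕ → ℝ) (hw : Summable w) (hw0 : ∀ n, 0 ≤ w n) (X : ℝ)
    (Mm : ↥P → Option (Fin k) → Option (Fin k) → ℝ) (Er : Finset ℕ → ℝ)
    (hE : ∀ d e, |∑' n, (if ind P h d n ∧ ind P h e n then w n else 0) - X * ∏ p, Mm p (d p) (e p)| ≤ Er (nm P (supp d ∪ supp e))) :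
    Summable (fun n => w n * AA P h lam n^2) ∧ |∑' n, w n * AA P h lam n^2 - X * tq Mm lam| ≤ ∑ d, ∑ e, |lam d| * |lam e| * Er (nm P (supp d ∪ supp e)) := by
  have e1 : ∀ n, w n * AA P h lam n^2 = ∑ d, ∑ e, lam d * lam e * (if ind P h d n ∧ ind P h e n then w n else 0) := by
    intro n
    rw [AA, sq, Finset.sum_mul_sum, Finset.mul_sum]
    refine Finset.sum_congr rfl fun d _ => ?_
    rw [Finset.mul_sum]
    refine Finset.sum_congr rfl fun e _ => ?_
    by_cases h1 : ind P h d n <;> by_cases h2 : ind P h e n <;> simp [h1, h2] <;> ring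
  have hsum : ∀ d e, Summable (fun n => lam d * lam e * (if ind P h d n ∧ ind P h e n then w n else 0)) := by
    intro d e
    apply Summable.mul_left
    refine Summable.of_nonneg_of_le (fun n => ?_) (fun n => ?_) hw
    · split_ifs; exacts [hw0 n, le_rfl]
    · split_ifs; exacts [le_rfl, hw0 n]
  simp_rw [e1]
  refine ⟨summable_sum fun d _ => summable_sum fun e _ => hsum d e, ?_⟩
  rw [Summable.tsum_finsetSum (fun d _ => summable_sum fun e _ => hsum d e)]
  simp_rw [Summable.tsum_finsetSum (fun e _ => hsum _ e), tsum_mul_left]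
  rw [tq, Finset.mul_sum, ← Finset.sum_sub_distrib]
  refine (Finset.abs_sum_le_sum_abs _ _).trans (Finset.sum_le_sum fun d _ => ?_)
  rw [Finset.mul_sum, ← Finset.sum_sub_distrib]
  refine (Finset.abs_sum_le_sum_abs _ _).trans (Finset.sum_le_sum fun e _ => ?_)
  have := hE d e
  rw [show ∀ x y : ℝ, lam d * lam e * x - X * (lam d * lam e * y) = (lam d * lam e) * (x - X * y) by intros; ring, abs_mul, abs_mul]
  gcongr

end quad
end DSR
end

section
namespace DSR
open Filter Topology

lemma F_summable (i : ℕ) : Summable (fun n => Fw i n) := by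
  have h : Summable (fun n : ℕ => (i.factorial / (1/2:ℝ)^i) * (n:ℝ)^(-(3/2:ℝ))) :=
    (Real.summable_nat_rpow.mpr (by norm_num)).mul_left _
  refine Summable.of_nonneg_of_le (fun n => Fw_nonneg i n) (fun n => ?_) h
  rcases Nat.eq_zero_or_pos n with rfl | hn
  · rw [Fw_zero]; positivity
  · refine (Fw_le i n hn (1/2) (by norm_num)).trans (le_of_eq ?_)
    rw [show (1/2 - 2 : ℝ) = -(3/2) by norm_num]
    ring

lemma log_pow_le_real (i : ℕ) (x : ℝ) (hx : 1 ≤ x) :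
    (Real.log x)^i ≤ i.factorial * x^(3/2:ℝ) / (3/2)^i := by
  have hn0 : (0:ℝ) < x := by positivity
  have h0 : 0 ≤ (3/2) * Real.log x := by
    have : 0 ≤ Real.log x := Real.log_nonneg hx
    positivity
  have := Real.pow_div_factorial_le_exp ((3/2) * Real.log x) h0 i
  rw [Real.rpow_def_of_pos hn0, mul_comm (Real.log x)]
  rw [div_le_iff₀ (by positivity)] at this
  rw [le_div_iff₀ (by positivity)]
  calc _ = ((3/2) * Real.log x)^i := by rw [mul_pow]; ring
    _ ≤ _ := by linarith

lemma Fw_diff (i n : ℕ) (hn : 1 ≤ n) :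
    |Fw (i+1) n - Fw (i+1) (n+1)| ≤ 7/2 * ((i+1).factorial / (3/2)^(i+1)) * (n:ℝ)^(-(3/2:ℝ)) := by
  have hn0 : (1:ℝ) ≤ n := by exact_mod_cast hn
  set f : ℝ → ℝ := fun x => (Real.log x)^(i+1) / x^2 with hf
  set f' : ℝ → ℝ := fun x => ((((i+1:ℕ):ℝ) * (Real.log x)^i * x⁻¹) * x^2 - (Real.log x)^(i+1) * (2 * x)) / (x^2)^2 with hf'
  have hd : ∀ x ∈ Set.Icc (n:ℝ) (n+1), HasDerivWithinAt f (f' x) (Set.Icc (n:ℝ) (n+1)) x := by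
    intro x hx
    have hx0 : x ≠ 0 := by linarith [hx.1]
    have h1 := (Real.hasDerivAt_log hx0).pow (i+1)
    have h2 := hasDerivAt_pow 2 x
    have h3 := h1.div h2 (by positivity)
    refine HasDerivAt.hasDerivWithinAt ?_
    have e : f' x = (((i+1:ℕ):ℝ) * Real.log x ^ (i + 1 - 1) * x⁻¹ * x ^ 2 - (Real.log ^ (i + 1)) x * (((2:ℕ):ℝ) * x ^ (2 - 1))) / (x ^ 2) ^ 2 := by
      simp only [hf', Pi.pow_apply]; norm_num
    rw [e]
    exact h3
  have hb : ∀ x ∈ Set.Icc (n:ℝ) (n+1), ‖f' x‖ ≤ 7/2 * ((i+1).factorial / (3/2)^(i+1)) * (n:ℝ)^(-(3/2:ℝ)) := by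
    intro x hx
    have hx1 : 1 ≤ x := by linarith [hx.1]
    have hx0 : 0 < x := by linarith
    have hl : 0 ≤ Real.log x := Real.log_nonneg hx1
    have e : f' x = (((i+1:ℕ):ℝ) * (Real.log x)^i - 2 * (Real.log x)^(i+1)) / x^3 := by
      simp only [hf']; field_simp
    have h1 := log_pow_le_real i x hx1
    have h2 := log_pow_le_real (i+1) x hx1
    have h3 : ((i+1:ℕ):ℝ) * (Real.log x)^i ≤ 3/2 * ((i+1).factorial * x^(3/2:ℝ) / (3/2)^(i+1)) := by
      calc ((i+1:ℕ):ℝ) * (Real.log x)^i ≤ ((i+1:ℕ):ℝ) * (i.factorial * x^(3/2:ℝ) / (3/2)^i) := by gcongr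
        _ = _ := by
          rw [Nat.factorial_succ, pow_succ]; push_cast; field_simp
    have ex : x^3 = x^(3/2:ℝ) * x^(3/2:ℝ) := by
      rw [← Real.rpow_add hx0, ← Real.rpow_natCast]; norm_num
    have hp : 0 < x^(3/2:ℝ) := by positivity
    rw [e, Real.norm_eq_abs, abs_div, abs_of_pos (by positivity : 0 < x^3), div_le_iff₀ (by positivity)]
    have h4 : 0 ≤ ((i+1:ℕ):ℝ) * (Real.log x)^i := by positivity
    have h5 : 0 ≤ (Real.log x)^(i+1) := by positivity
    have h6 : |((i+1:ℕ):ℝ) * (Real.log x)^i - 2 * (Real.log x)^(i+1)| ≤ 7/2 * ((i+1).factorial / (3/2)^(i+1)) * x^(3/2:ℝ) := by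
      have : 7/2 * (((i+1).factorial:ℝ) / (3/2)^(i+1)) * x^(3/2:ℝ) = 7/2 * ((i+1).factorial * x^(3/2:ℝ) / (3/2)^(i+1)) := by ring
      rw [this, abs_le]; constructor <;> linarith
    refine h6.trans ?_
    rw [mul_assoc (7/2 * _)]
    refine mul_le_mul_of_nonneg_left ?_ (by positivity)
    rw [ex, ← mul_assoc]
    have h7 : 1 ≤ (n:ℝ)^(-(3/2:ℝ)) * x^(3/2:ℝ) := by
      rw [Real.rpow_neg (by linarith), ← div_eq_inv_mul, one_le_div (by positivity)]
      exact Real.rpow_le_rpow (by linarith) hx.1 (by norm_num)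
    nlinarith
  have := Convex.norm_image_sub_le_of_norm_hasDerivWithin_le hd hb (convex_Icc (n:ℝ) (n+1)) (x := (n:ℝ)+1) (y := (n:ℝ)) (by simp) (by simp)
  simp only [Real.norm_eq_abs] at this
  have e1 : |(n:ℝ) - (n+1)| = 1 := by norm_num
  rw [e1, mul_one] at this
  simpa [hf, Fw] using this

lemma count_err (N a m : ℕ) (hN : N ≠ 0) : |∑ n ∈ Finset.range m, ((if n % N = a % N then (1:ℝ) else 0) - 1/N)| ≤ 1 := by
  have hN0 : (0:ℝ) < N := by exact_mod_cast Nat.pos_of_ne_zero hN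
  rw [Finset.sum_sub_distrib, ← Finset.sum_filter, Finset.sum_const, Finset.sum_const, Finset.card_range]
  have h1 := Nat.count_modEq_card m (Nat.pos_of_ne_zero hN) a
  rw [Nat.count_eq_card_filter_range] at h1
  have h2 : (Finset.filter (fun n => n % N = a % N) (Finset.range m)).card = m / N + if a % N < m % N then 1 else 0 := h1
  rw [h2]
  have h3 := Nat.div_add_mod m N
  have h4 := Nat.mod_lt m (Nat.pos_of_ne_zero hN)
  have h5 : (m:ℝ) = N * (m/N : ℕ) + (m % N : ℕ) := by exact_mod_cast h3.symm
  have h6 : ((m % N : ℕ):ℝ) < N := by exact_mod_cast h4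
  have h7 : (0:ℝ) ≤ ((m % N : ℕ):ℝ) := by positivity
  have h8 : ((m % N : ℕ):ℝ) / N ≤ 1 := by rw [div_le_one hN0]; exact h6.le
  have h9 : 0 ≤ ((m % N : ℕ):ℝ) / N := by positivity
  have e : m • (1/(N:ℝ)) = (m/N : ℕ) + ((m % N : ℕ):ℝ) / N := by
    rw [nsmul_eq_mul]; nth_rw 1 [h5]; field_simp
  rw [e]
  split_ifs <;> simp <;> rw [abs_le] <;> constructor <;> linarith

lemma F_AP : ∃ C : ℝ, 0 ≤ C ∧ ∀ i N a : ℕ, N ≠ 0 →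
    |∑' n : ℕ, (if n % N = a % N then Fw (i+1) n else 0) - (i+1).factorial / N| ≤ C * (i+1).factorial / (3/2)^(i+1) := by
  obtain ⟨C, hC0, hC⟩ := sum_F
  have hz : Summable (fun n : ℕ => (n:ℝ)^(-(3/2:ℝ))) := Real.summable_nat_rpow.mpr (by norm_num)
  set Z := ∑' n : ℕ, (n:ℝ)^(-(3/2:ℝ)) with hZ
  have hZ0 : 0 ≤ Z := tsum_nonneg fun n => by positivity
  refine ⟨C + 7/2 * Z, by positivity, fun i N a hN => ?_⟩
  have hN1 : (1:ℝ) ≤ N := by exact_mod_cast Nat.one_le_iff_ne_zero.mpr hN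
  set c : ℝ := (i+1).factorial / (3/2)^(i+1) with hc
  have hc0 : 0 ≤ c := by positivity
  have hFs := F_summable (i+1)
  have hdiff : ∀ n : ℕ, |Fw (i+1) n - Fw (i+1) (n+1)| ≤ 7/2 * c * (n:ℝ)^(-(3/2:ℝ)) := by
    intro n
    rcases Nat.eq_zero_or_pos n with rfl | hn
    · rw [Fw_zero]
      have : Fw (i+1) (0+1) = 0 := by simp [Fw]
      rw [this]; simp
    · exact Fw_diff i n hn
  have hVs : Summable fun n => |Fw (i+1) n - Fw (i+1) (n+1)| :=
    Summable.of_nonneg_of_le (fun n => abs_nonneg _) hdiff (hz.mul_left _)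
  have hV : ∑' n, |Fw (i+1) n - Fw (i+1) (n+1)| ≤ 7/2 * c * Z := by
    rw [hZ, ← tsum_mul_left]
    exact hVs.tsum_le_tsum hdiff (hz.mul_left _)
  set g : ℕ → ℝ := fun n => (if n % N = a % N then (1:ℝ) else 0) - 1/N with hg
  have hs1 : Summable (fun n => (if n % N = a % N then Fw (i+1) n else 0)) := by
    refine Summable.of_nonneg_of_le (fun n => ?_) (fun n => ?_) hFs
    · split_ifs; exacts [Fw_nonneg _ _, le_rfl]
    · split_ifs; exacts [le_rfl, Fw_nonneg _ _]
  have e1 : ∀ n, g n * Fw (i+1) n = (if n % N = a % N then Fw (i+1) n else 0) - 1/N * Fw (i+1) n := by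
    intro n; simp only [hg]; split_ifs <;> ring
  have hgs : Summable (fun n => g n * Fw (i+1) n) := by
    simp_rw [e1]; exact hs1.sub (hFs.mul_left _)
  have hab := abel_bound (fun n => (g n : ℂ)) (fun n => (Fw (i+1) n : ℂ)) 1 (fun m => by
      have := count_err N a m hN
      rw [← Complex.ofReal_sum, Complex.norm_real]; exact this)
    (by
      have := Complex.ofRealCLM.summable hgs
      simpa using this)
    (by
      have := hFs.tendsto_atTop_zero
      exact_mod_cast (Complex.continuous_ofReal.tendsto 0).comp this)
    (by
      refine hVs.congr fun n => ?_
      rw [← Complex.ofReal_sub, Complex.norm_real, Real.norm_eq_abs])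
  have e2 : ‖∑' n, (g n : ℂ) * (Fw (i+1) n : ℂ)‖ = |∑' n, g n * Fw (i+1) n| := by
    rw [← Real.norm_eq_abs, ← Complex.norm_real, Complex.ofReal_tsum]
    simp
  have e3 : ∑' n, ‖(Fw (i+1) n : ℂ) - (Fw (i+1) (n+1) : ℂ)‖ = ∑' n, |Fw (i+1) n - Fw (i+1) (n+1)| := by
    refine tsum_congr fun n => ?_
    rw [← Complex.ofReal_sub, Complex.norm_real, Real.norm_eq_abs]
  rw [e2, e3, one_mul] at hab
  have e4 : ∑' n, g n * Fw (i+1) n = ∑' n : ℕ, (if n % N = a % N then Fw (i+1) n else 0) - 1/N * ∑' n, Fw (i+1) n := by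
    simp_rw [e1]
    rw [hs1.tsum_sub (hFs.mul_left _), tsum_mul_left]
  rw [e4] at hab
  have h5 := hC (i+1)
  have h6 : |1/(N:ℝ) * (∑' n, Fw (i+1) n - (i+1).factorial)| ≤ C * (i+1).factorial / (3/2)^(i+1) := by
    rw [abs_mul, abs_of_nonneg (by positivity)]
    have : 1/(N:ℝ) ≤ 1 := by rw [div_le_one (by linarith)]; exact hN1
    calc _ ≤ 1 * |∑' n, Fw (i+1) n - (i+1).factorial| := by gcongr
      _ ≤ _ := by rw [one_mul]; exact h5
  have e7 : ∑' n : ℕ, (if n % N = a % N then Fw (i+1) n else 0) - (i+1).factorial / N =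
    (∑' n : ℕ, (if n % N = a % N then Fw (i+1) n else 0) - 1/N * ∑' n, Fw (i+1) n) + 1/(N:ℝ) * (∑' n, Fw (i+1) n - (i+1).factorial) := by ring
  rw [e7]
  refine (abs_add_le _ _).trans ?_
  have : (C + 7/2*Z) * (i+1).factorial / (3/2)^(i+1) = 7/2 * c * Z + C * (i+1).factorial / (3/2)^(i+1) := by
    rw [hc]; ring
  rw [this]
  linarith

end DSR
end

section
namespace DSR
open Filter Topology

lemma crt {ι : Type*} [DecidableEq ι] (W ν : ℕ) (q r : ι → ℕ) (S : Finset ι) (hq : ∀ i ∈ S, 0 < q i)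
    (hW : ∀ i ∈ S, W.Coprime (q i)) (hc : ∀ i ∈ S, ∀ j ∈ S, i ≠ j → (q i).Coprime (q j)) :
    ∃ a : ℕ, ∀ n : ℕ, (n % W = ν % W ∧ ∀ i ∈ S, q i ∣ n + r i) ↔ n % (W * ∏ i ∈ S, q i) = a % (W * ∏ i ∈ S, q i) := by
  induction S using Finset.induction_on with
  | empty => exact ⟨ν, fun n => by simp⟩
  | insert x S hx ih =>
    obtain ⟨a, ha⟩ := ih (fun i hi => hq i (Finset.mem_insert_of_mem hi)) (fun i hi => hW i (Finset.mem_insert_of_mem hi))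
      (fun i hi j hj => hc i (Finset.mem_insert_of_mem hi) j (Finset.mem_insert_of_mem hj))
    have hco : (W * ∏ i ∈ S, q i).Coprime (q x) := by
      refine Nat.Coprime.mul_left (hW x (Finset.mem_insert_self _ _)) ?_
      refine Nat.Coprime.prod_left fun i hi => ?_
      exact hc i (Finset.mem_insert_of_mem hi) x (Finset.mem_insert_self _ _) (fun h => hx (h ▸ hi))
    obtain ⟨y, hy1, hy2⟩ := Nat.chineseRemainder hco a ((q x - 1) * r x)
    have hqx := hq x (Finset.mem_insert_self _ _)
    refine ⟨y, fun n => ?_⟩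
    rw [Finset.prod_insert hx, show W * (q x * ∏ i ∈ S, q i) = (W * ∏ i ∈ S, q i) * q x by ring]
    have h1 : n % ((W * ∏ i ∈ S, q i) * q x) = y % ((W * ∏ i ∈ S, q i) * q x) ↔ n ≡ y [MOD (W * ∏ i ∈ S, q i)] ∧ n ≡ y [MOD q x] :=
      (Nat.modEq_and_modEq_iff_modEq_mul hco).symm
    rw [h1]
    have h2 : n ≡ y [MOD (W * ∏ i ∈ S, q i)] ↔ n % (W * ∏ i ∈ S, q i) = a % (W * ∏ i ∈ S, q i) :=
      ⟨fun h => h.trans hy1, fun h => Nat.ModEq.trans h hy1.symm⟩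
    have h3 : n ≡ y [MOD q x] ↔ q x ∣ n + r x := by
      have e0 : (q x - 1) * r x + r x = q x * r x := by
        obtain ⟨z, hz⟩ := Nat.exists_eq_add_of_le hqx
        rw [hz]; simp; ring
      have h4 : q x ∣ n + r x ↔ n + r x ≡ (q x - 1) * r x + r x [MOD q x] := by
        rw [e0]
        constructor
        · intro h; exact ((Nat.modEq_zero_iff_dvd).mpr h).trans ((Nat.modEq_zero_iff_dvd).mpr (dvd_mul_right _ _)).symm
        · intro h; exact (Nat.modEq_zero_iff_dvd).mp (h.trans ((Nat.modEq_zero_iff_dvd).mpr (dvd_mul_right _ _)))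
      rw [h4]
      constructor
      · intro h; exact (h.trans hy2).add_right _
      · intro h; exact (Nat.ModEq.add_right_cancel' _ h).trans hy2.symm
    rw [h2, h3, ← ha n]
    simp only [Finset.mem_insert, forall_eq_or_imp]
    tauto

section pairs
variable (P : Finset ℕ) {k : ℕ}

def compat (d e : ↥P → Option (Fin k)) : Prop := ∀ p i i', d p = some i → e p = some i' → i = i'

def mrg (d e : ↥P → Option (Fin k)) (p : ↥P) : Option (Fin k) := match d p with
  | some i => some i
  | none => e p

lemma ind_mrg (h : Fin k → ℕ) (d e : ↥P → Option (Fin k)) (hc : compat P d e) (n : ℕ) :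
    (ind P h d n ∧ ind P h e n) ↔ ∀ p i, mrg P d e p = some i → (p:ℕ) ∣ n + h i := by
  constructor
  · rintro ⟨h1, h2⟩ p i hp
    unfold mrg at hp
    cases hd : d p with
    | none => rw [hd] at hp; exact h2 p i hp
    | some j =>
      rw [hd] at hp
      simp at hp
      rw [← hp]; exact h1 p j hd
  · intro h1
    constructor
    · intro p i hp
      refine h1 p i ?_
      unfold mrg; rw [hp]
    · intro p i hp
      refine h1 p i ?_
      unfold mrg
      cases hd : d p with
      | none => exact hp
      | some j => rw [hc p j i hd hp]

lemma mrg_supp (d e : ↥P → Option (Fin k)) : supp (mrg P d e) = supp d ∪ supp e := by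
  ext p
  rw [Finset.mem_union, mem_supp, mem_supp, mem_supp]
  unfold mrg
  cases hd : d p <;> simp

lemma ind_incompat (h : Fin k → ℕ) (hh : ∀ p ∈ P, ∀ i i', i ≠ i' → ¬ (h i ≡ h i' [MOD p])) (d e : ↥P → Option (Fin k))
    (hc : ¬ compat P d e) (n : ℕ) : ¬ (ind P h d n ∧ ind P h e n) := by
  rintro ⟨h1, h2⟩
  unfold compat at hc
  push Not at hc
  obtain ⟨p, i, i', hd, he, hne⟩ := hc
  have a1 := h1 p i hd
  have a2 := h2 p i' he
  apply hh p p.2 i i' hne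
  have b1 := (Nat.modEq_zero_iff_dvd).mpr a1
  have b2 := (Nat.modEq_zero_iff_dvd).mpr a2
  exact Nat.ModEq.add_left_cancel' n (b1.trans b2.symm)

lemma K1_prod (s : ↥P → ℝ) (d e : ↥P → Option (Fin k)) (hc : compat P d e) :
    ∏ p, K1 (s p) (d p) (e p) = ∏ p ∈ supp d ∪ supp e, s p := by
  rw [← Finset.prod_subset (Finset.subset_univ (supp d ∪ supp e))]
  · refine Finset.prod_congr rfl fun p hp => ?_
    rw [Finset.mem_union, mem_supp, mem_supp] at hp
    have := hc p
    cases hd : d p <;> cases he : e p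
    · simp [hd, he] at hp
    · rfl
    · rfl
    · rw [K1, if_pos (this _ _ hd he)]
  · intro p _ hp
    rw [Finset.mem_union, mem_supp, mem_supp] at hp
    push Not at hp
    rw [hp.1, hp.2]; rfl

lemma K1_incompat (s : ↥P → ℝ) (d e : ↥P → Option (Fin k)) (hc : ¬ compat P d e) : ∏ p, K1 (s p) (d p) (e p) = 0 := by
  unfold compat at hc
  push Not at hc
  obtain ⟨p, i, i', hd, he, hne⟩ := hc
  refine Finset.prod_eq_zero (Finset.mem_univ p) ?_
  rw [hd, he, K1, if_neg hne]

lemma K2_prod (m : Fin k) (s : ↥P → ℝ) (d e : ↥P → Option (Fin k)) (hc : compat P d e) (hm : ∀ p, mrg P d e p ≠ some m) :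
    ∏ p, K2 m (s p) (d p) (e p) = ∏ p ∈ supp d ∪ supp e, s p := by
  rw [← Finset.prod_subset (Finset.subset_univ (supp d ∪ supp e))]
  · refine Finset.prod_congr rfl fun p hp => ?_
    rw [Finset.mem_union, mem_supp, mem_supp] at hp
    have := hc p
    have hmp := hm p
    unfold mrg at hmp
    cases hd : d p <;> cases he : e p <;> rw [hd] at hmp <;> simp [he] at hmp
    · simp [hd, he] at hp
    · rw [K2, if_neg hmp]
    · rw [K2, if_neg hmp]
    · rw [K2, if_pos (this _ _ hd he), if_neg hmp]
  · intro p _ hp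
    rw [Finset.mem_union, mem_supp, mem_supp] at hp
    push Not at hp
    rw [hp.1, hp.2]; rfl

lemma K2_incompat (m : Fin k) (s : ↥P → ℝ) (d e : ↥P → Option (Fin k)) (hc : ¬ compat P d e) : ∏ p, K2 m (s p) (d p) (e p) = 0 := by
  unfold compat at hc
  push Not at hc
  obtain ⟨p, i, i', hd, he, hne⟩ := hc
  refine Finset.prod_eq_zero (Finset.mem_univ p) ?_
  rw [hd, he, K2, if_neg hne]

lemma K2_m (m : Fin k) (s : ↥P → ℝ) (d e : ↥P → Option (Fin k)) (p : ↥P) (hp : mrg P d e p = some m) : ∏ p, K2 m (s p) (d p) (e p) = 0 := by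
  refine Finset.prod_eq_zero (Finset.mem_univ p) ?_
  unfold mrg at hp
  cases hd : d p <;> cases he : e p <;> rw [hd] at hp <;> simp [he] at hp
  · rw [hp, K2, if_pos rfl]
  · rw [hp, K2, if_pos rfl]
  · rw [hp, K2]; simp

/-- CRT class for a merged condition -/
lemma crt_mrg (hP : ∀ p ∈ P, p.Prime) (W ν : ℕ) (hPW : ∀ p ∈ P, ¬ p ∣ W) (h : Fin k → ℕ) (u : ↥P → Option (Fin k)) :
    ∃ a : ℕ, ∀ n : ℕ, (n % W = ν % W ∧ ∀ p i, u p = some i → (p:ℕ) ∣ n + h i) ↔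
      n % (W * aS P (supp u)) = a % (W * aS P (supp u)) := by
  obtain ⟨a, ha⟩ := crt W ν (fun p : ↥P => (p:ℕ)) (fun p => match u p with
    | some i => h i
    | none => 0) (supp u) (fun p _ => (hP p p.2).pos) (fun p _ => ((Nat.Prime.coprime_iff_not_dvd (hP p p.2)).mpr (hPW p p.2)).symm)
    (fun p _ q _ hpq => (Nat.coprime_primes (hP p p.2) (hP q q.2)).mpr fun h => hpq (Subtype.ext h))
  refine ⟨a, fun n => ?_⟩
  unfold aS
  rw [← ha n]
  refine and_congr_right fun _ => ?_
  constructor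
  · intro h1 p hp
    rw [mem_supp] at hp
    obtain ⟨i, hi⟩ := Option.ne_none_iff_exists'.mp hp
    simp only [hi]
    exact h1 p i hi
  · intro h1 p i hi
    have := h1 p ((mem_supp _ _).mpr (by simp [hi]))
    simpa only [hi] using this

end pairs
end DSR
end

section
namespace DSR
open Filter Topology

section pairs
variable (P : Finset ℕ) {k : ℕ}

open Classical in
lemma pair1 (hP : ∀ p ∈ P, p.Prime) (W ν : ℕ) (hW : W ≠ 0) (hPW : ∀ p ∈ P, ¬ p ∣ W) (h : Fin k → ℕ)
    (hh : ∀ p ∈ P, ∀ i i', i ≠ i' → ¬ (h i ≡ h i' [MOD p])) (j : ℕ) (E : ℝ)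
    (hE : ∀ N a, N ≠ 0 → |∑' n : ℕ, (if n % N = a % N then Fw j n else 0) - j.factorial / N| ≤ E)
    (d e : ↥P → Option (Fin k)) :
    |∑' n : ℕ, (if ind P h d n ∧ ind P h e n then (if n % W = ν % W then Fw j n else 0) else 0)
      - (j.factorial / W : ℝ) * ∏ p : ↥P, K1 (1/((p:ℕ):ℝ)) (d p) (e p)| ≤ E := by
  have hE0 : 0 ≤ E := (abs_nonneg _).trans (hE 1 0 one_ne_zero)
  by_cases hc : compat P d e
  · obtain ⟨a, ha⟩ := crt_mrg P hP W ν hPW h (mrg P d e)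
    rw [mrg_supp] at ha
    have e1 : ∀ n : ℕ, (if ind P h d n ∧ ind P h e n then (if n % W = ν % W then Fw j n else 0) else 0) =
        if n % (W * aS P (supp d ∪ supp e)) = a % (W * aS P (supp d ∪ supp e)) then Fw j n else 0 := by
      intro n
      rw [← ite_and]
      congr 1
      rw [eq_iff_iff, ← ha n, ind_mrg P h d e hc, and_comm]
    simp_rw [e1]
    rw [K1_prod P (fun p : ↥P => 1/((p:ℕ):ℝ)) d e hc, aS_inv]
    have := hE (W * aS P (supp d ∪ supp e)) a (Nat.mul_ne_zero hW (aS_pos P hP _).ne')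
    push_cast at this
    rw [div_mul_div_comm, mul_one]
    exact this
  · rw [K1_incompat P (fun p : ↥P => 1/((p:ℕ):ℝ)) d e hc]
    simp_rw [if_neg (ind_incompat P h hh d e hc _)]
    simpa using hE0

lemma Err_nonneg (W j R : ℕ) (hW : W ≠ 0) (hWR : W ≤ R) (hP : ∀ p ∈ P, p.Prime ∧ p ≤ R) (S : Finset ↥P) :
    0 ≤ Err (W * aS P S) j R := by
  refine (abs_nonneg _).trans (AP (W * aS P S) R j 1 (Nat.mul_ne_zero hW (aS_pos P (fun p hp => (hP p hp).1) S).ne') ?_ (Nat.coprime_one_left _))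
  intro p hp hd
  rcases (Nat.Prime.dvd_mul hp).mp hd with h1 | h1
  · exact (Nat.le_of_dvd (Nat.pos_of_ne_zero hW) h1).trans hWR
  · obtain ⟨q, hq, hpq⟩ := (Prime.dvd_finset_prod_iff hp.prime _).mp h1
    have := Nat.le_of_dvd (hP q q.2).1.pos hpq
    exact this.trans (hP q q.2).2

open Classical in
lemma pair2 (R : ℕ) (hP : ∀ p ∈ P, p.Prime ∧ p ≤ R) (W ν : ℕ) (hW : W ≠ 0) (hWR : W ≤ R) (hPW : ∀ p ∈ P, ¬ p ∣ W) (h : Fin k → ℕ)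
    (hh : ∀ p ∈ P, ∀ i i', i ≠ i' → ¬ (h i ≡ h i' [MOD p])) (j : ℕ) (m : Fin k) (hmR : h m ≤ R)
    (hν : (ν + h m).Coprime W) (d e : ↥P → Option (Fin k)) :
    |∑' n : ℕ, (if ind P h d n ∧ ind P h e n then (if n % W = ν % W then vp R (n + h m) * Fw j (n + h m) else 0) else 0)
      - (j.factorial / W.totient : ℝ) * ∏ p : ↥P, K2 m (1/(((p:ℕ):ℝ)-1)) (d p) (e p)| ≤ Err (W * aS P (supp d ∪ supp e)) j R := by
  have hPp : ∀ p ∈ P, p.Prime := fun p hp => (hP p hp).1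
  have hE0 := Err_nonneg P W j R hW hWR hP (supp d ∪ supp e)
  by_cases hc : compat P d e
  · by_cases hm : ∃ p, mrg P d e p = some m
    · obtain ⟨p, hp⟩ := hm
      rw [K2_m P m (fun p : ↥P => 1/(((p:ℕ):ℝ)-1)) d e p hp]
      have e1 : ∀ n : ℕ, (if ind P h d n ∧ ind P h e n then (if n % W = ν % W then vp R (n + h m) * Fw j (n + h m) else 0) else 0) = 0 := by
        intro n
        split_ifs with h1 h2
        · rw [ind_mrg P h d e hc] at h1
          have h3 := h1 p m hp
          have : vp R (n + h m) = 0 := by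
            unfold vp
            rw [if_neg]
            rintro ⟨h4, h5⟩
            have := (Nat.prime_dvd_prime_iff_eq (hPp p p.2) h4).mp h3
            have := (hP p p.2).2
            omega
          rw [this, zero_mul]
        · rfl
        · rfl
      simp_rw [e1]
      simpa using hE0
    · push Not at hm
      obtain ⟨a, ha⟩ := crt_mrg P hPp W ν hPW h (mrg P d e)
      rw [mrg_supp] at ha
      set S := supp d ∪ supp e with hS
      set N := W * aS P S with hN
      have hN0 : N ≠ 0 := Nat.mul_ne_zero hW (aS_pos P hPp _).ne'
      set f : ℕ → ℝ := fun n => if n % N = (a + h m) % N then vp R n * Fw j n else 0 with hf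
      have e1 : ∀ n : ℕ, (if ind P h d n ∧ ind P h e n then (if n % W = ν % W then vp R (n + h m) * Fw j (n + h m) else 0) else 0) =
          f (n + h m) := by
        intro n
        simp only [hf]
        rw [← ite_and]
        congr 1
        rw [eq_iff_iff]
        have h1 : (n + h m) % N = (a + h m) % N ↔ n % N = a % N :=
          ⟨fun h2 => Nat.ModEq.add_right_cancel' (h m) h2, fun h2 => Nat.ModEq.add_right (h m) h2⟩
        rw [h1, ← ha n, ind_mrg P h d e hc, and_comm]
      simp_rw [e1]
      have hfs : Summable f := by
        refine Summable.of_nonneg_of_le (fun n => ?_) (fun n => ?_) (vpF_summable R j)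
        · simp only [hf]; split_ifs; exacts [mul_nonneg (vp_nonneg _ _) (Fw_nonneg _ _), le_rfl]
        · simp only [hf]; split_ifs; exacts [le_rfl, mul_nonneg (vp_nonneg _ _) (Fw_nonneg _ _)]
      have e2 : ∑' n, f (n + h m) = ∑' n, f n := by
        rw [← hfs.sum_add_tsum_nat_add (h m), Finset.sum_eq_zero, zero_add]
        intro i hi
        rw [Finset.mem_range] at hi
        simp only [hf]
        have : vp R i = 0 := by
          unfold vp
          rw [if_neg]
          rintro ⟨_, h5⟩
          omega
        rw [this, zero_mul, ite_self]
      rw [e2, K2_prod P m (fun p : ↥P => 1/(((p:ℕ):ℝ)-1)) d e hc hm]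
      obtain ⟨ha1, ha2⟩ := (ha a).mpr rfl
      have hcop : (a + h m).Coprime N := by
        rw [hN]
        refine Nat.Coprime.mul_right ?_ ?_
        · have h3 : a + h m ≡ ν + h m [MOD W] := Nat.ModEq.add_right _ ha1
          have := h3.gcd_eq
          rw [Nat.Coprime, this]; exact hν
        · refine Nat.Coprime.prod_right fun p hp => ?_
          rw [Nat.coprime_comm, Nat.Prime.coprime_iff_not_dvd (hPp p p.2)]
          intro h4
          rw [hS, ← mrg_supp, mem_supp] at hp
          obtain ⟨i, hi⟩ := Option.ne_none_iff_exists'.mp hp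
          have h5 := ha2 p i hi
          have hne : i ≠ m := fun h6 => hm p (h6 ▸ hi)
          apply hh p p.2 i m hne
          exact Nat.ModEq.add_left_cancel' a (((Nat.modEq_zero_iff_dvd).mpr h5).trans ((Nat.modEq_zero_iff_dvd).mpr h4).symm)
      have hAP := AP N R j (a + h m) hN0 (by
        intro p hp hd
        rcases (Nat.Prime.dvd_mul hp).mp hd with h1 | h1
        · exact (Nat.le_of_dvd (Nat.pos_of_ne_zero hW) h1).trans hWR
        · obtain ⟨q, hq, hpq⟩ := (Prime.dvd_finset_prod_iff hp.prime _).mp h1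
          have := Nat.le_of_dvd (hP q q.2).1.pos hpq
          exact this.trans (hP q q.2).2) hcop
      have htot : ((N.totient : ℕ):ℝ) = W.totient * ∏ p ∈ S, (((p:ℕ):ℝ) - 1) := by
        rw [hN, ← nm_prod, totient_prod W (nm P S) (fun p hp => ⟨hPp p (nm_sub P S hp), hPW p (nm_sub P S hp)⟩), nm, Finset.prod_map]
        push_cast
        congr 1
        refine Finset.prod_congr rfl fun p _ => ?_
        have : 1 ≤ (p:ℕ) := (hPp p p.2).one_lt.le
        simp only [Function.Embedding.subtype_apply]
        rw [Nat.cast_sub this, Nat.cast_one]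
      rw [htot] at hAP
      rw [Finset.prod_div_distrib, Finset.prod_const_one, div_mul_div_comm, mul_one]
      exact hAP
  · rw [K2_incompat P m (fun p : ↥P => 1/(((p:ℕ):ℝ)-1)) d e hc]
    simp_rw [if_neg (ind_incompat P h hh d e hc _)]
    simpa using hE0

end pairs
end DSR
end

section
namespace DSR
open Filter Topology

lemma Fw_shift (j n h : ℕ) (hn : 3 ≤ n) (hh : 2 * (j+1) * h ≤ n) : Fw (j+1) (n + h) ≤ 2 * Fw (j+1) n := by
  have hn0 : (0:ℝ) < n := by positivity
  have hl : 1 ≤ Real.log n := by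
    rw [Real.le_log_iff_exp_le hn0]
    have : (3:ℝ) ≤ n := by exact_mod_cast hn
    linarith [Real.exp_one_lt_d9]
  have h1 : Real.log ((n+h:ℕ):ℝ) ≤ Real.log n * (1 + h/n) := by
    have e : ((n+h:ℕ):ℝ) = n * (1 + h/n) := by push_cast; field_simp
    have hp : 0 < 1 + (h:ℝ)/n := by positivity
    rw [e, Real.log_mul hn0.ne' hp.ne']
    have h2 := Real.log_le_sub_one_of_pos hp
    have h3 : 0 ≤ (h:ℝ)/n := by positivity
    nlinarith
  have h4 : (1 + (h:ℝ)/n)^(j+1) ≤ 2 := by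
    calc (1 + (h:ℝ)/n)^(j+1) ≤ (Real.exp (h/n))^(j+1) := by
          gcongr; linarith [Real.add_one_le_exp ((h:ℝ)/n)]
      _ = Real.exp ((j+1:ℕ) * (h/n)) := by rw [← Real.exp_nat_mul]
      _ ≤ Real.exp (1/2) := by
          apply Real.exp_le_exp.mpr
          have : ((2 * (j+1) * h : ℕ):ℝ) ≤ n := by exact_mod_cast hh
          push_cast at this ⊢
          rw [← mul_div_assoc, div_le_iff₀ hn0]
          linarith
      _ ≤ 2 := by
          have h5 : Real.exp (1/2) * Real.exp (1/2) = Real.exp 1 := by rw [← Real.exp_add]; norm_num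
          have h6 := Real.exp_pos (1/2)
          nlinarith [Real.exp_one_lt_d9]
  have hlog0 : 0 ≤ Real.log ((n+h:ℕ):ℝ) := Real.log_natCast_nonneg _
  unfold Fw
  calc Real.log ((n+h:ℕ):ℝ)^(j+1) / ((n+h:ℕ):ℝ)^2 ≤ (Real.log n * (1 + h/n))^(j+1) / (n:ℝ)^2 := by
        gcongr
        omega
    _ = (1 + (h:ℝ)/n)^(j+1) * (Real.log n^(j+1) / (n:ℝ)^2) := by rw [mul_pow]; ring
    _ ≤ 2 * (Real.log n^(j+1) / (n:ℝ)^2) := by gcongr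

lemma vpF (R j n : ℕ) : vp R n * Fw j n = if n.Prime ∧ R < n then Fw (j+1) n else 0 := by
  unfold vp Fw
  split_ifs
  · rw [pow_succ]; ring
  · ring

open Classical in
lemma compare {k : ℕ} (h : Fin k → ℕ) (H n0 R j K n : ℕ) (hH : ∀ m, h m ≤ H) (hR : n0 + H ≤ R) (hR2 : (2*j+3)*H+3 ≤ R)
    (hn : n0 < n → (Finset.univ.filter (fun m => (n + h m).Prime)).card ≤ K) :
    ∑ m, vp R (n + h m) * Fw j (n + h m) ≤ 2 * K * Fw (j+1) n := by
  have h0 := Fw_nonneg (j+1) n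
  have h1 : ∀ m, vp R (n + h m) * Fw j (n + h m) ≤ if n0 < n ∧ (n + h m).Prime then 2 * Fw (j+1) n else 0 := by
    intro m
    rw [vpF]
    have := hH m
    by_cases h2 : (n + h m).Prime ∧ R < n + h m
    · rw [if_pos h2, if_pos ⟨by omega, h2.1⟩]
      apply Fw_shift
      · have : H ≤ (2*j+3)*H := Nat.le_mul_of_pos_left _ (by omega)
        omega
      · have e : (2*j+3)*H = 2*(j+1)*H + H := by ring
        have : 2*(j+1)*h m ≤ 2*(j+1)*H := Nat.mul_le_mul_left _ (hH m)
        omega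
    · rw [if_neg h2]
      split_ifs <;> linarith
  refine (Finset.sum_le_sum fun m _ => h1 m).trans ?_
  by_cases h3 : n0 < n
  · simp only [h3, true_and]
    rw [← Finset.sum_filter, Finset.sum_const, nsmul_eq_mul]
    have : (((Finset.univ.filter (fun m => (n + h m).Prime)).card : ℕ):ℝ) ≤ K := by exact_mod_cast hn h3
    nlinarith
  · simp only [h3, false_and, if_false, Finset.sum_const_zero]
    positivity

lemma count_R4 (P : Finset ℕ) (hP : ∀ p ∈ P, p.Prime) (C R : ℕ) (hC : ∀ p ∈ P, C ≤ p) (E : ℝ) (hE : 0 ≤ E) :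
    ∑ s ∈ P.powerset.filter (fun s => ∏ p ∈ s, p ≤ R^2), (C:ℝ)^s.card * E ≤ (R:ℝ)^4 * E := by
  rw [← Finset.sum_mul]
  gcongr
  calc ∑ s ∈ P.powerset.filter (fun s => ∏ p ∈ s, p ≤ R^2), (C:ℝ)^s.card
      ≤ ∑ s ∈ P.powerset.filter (fun s => ∏ p ∈ s, p ≤ R^2), (fun _ : ℕ => (R:ℝ)^2) (∏ p ∈ s, p) := by
        refine Finset.sum_le_sum fun s hs => ?_
        rw [Finset.mem_filter, Finset.mem_powerset] at hs
        have : C^s.card ≤ R^2 := by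
          refine le_trans ?_ hs.2
          rw [← Finset.prod_const]
          exact Finset.prod_le_prod' fun p hp => hC p (hs.1 hp)
        have h2 : ((C^s.card : ℕ):ℝ) ≤ ((R^2 : ℕ):ℝ) := Nat.cast_le.mpr this
        push_cast at h2
        exact h2
    _ ≤ ∑ n ∈ Finset.Icc 1 (R^2), (R:ℝ)^2 := prod_le_icc (fun _ => (R:ℝ)^2) (fun _ => by positivity) P hP _ (Finset.filter_subset _ _) (R^2)
        (fun s hs => (Finset.mem_filter.mp hs).2)
    _ = (R:ℝ)^4 := by
        rw [Finset.sum_const, Nat.card_Icc, nsmul_eq_mul]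
        rw [Nat.add_sub_cancel]
        push_cast
        ring

lemma final_alg (K M j k : ℕ) (L τ a : ℝ) (hK : 1 ≤ K) (hM : 10^9 * K ≤ M) (hk : 1 ≤ k) (hjk : k ≤ j) (hL : (j:ℝ)/2000 ≤ L)
    (hτ : τ = L / (64 * k * M)) (ha : 1 ≤ a)
    (h : k * (τ * M^2/768 * a - 1) ≤ 2 * K * ((j+1) * (a + 1))) : False := by
  have hK1 : (1:ℝ) ≤ K := by exact_mod_cast hK
  have hM1 : (10^9:ℝ) * K ≤ M := by exact_mod_cast hM
  have hk1 : (1:ℝ) ≤ k := by exact_mod_cast hk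
  have hj : (k:ℝ) ≤ j := by exact_mod_cast hjk
  have hM0 : (0:ℝ) < M := by linarith
  have e : (k:ℝ) * (τ * M^2/768 * a) = L * M / 49152 * a := by
    rw [hτ]; field_simp; ring
  have h1 : L * M / 49152 * a - k ≤ 2 * K * ((j+1) * (a+1)) := by linarith
  have h2 : (K:ℝ) * ((j+1) * (a+1)) ≤ K * (2 * j * (2 * a)) := by
    gcongr <;> linarith
  have h3 : (k:ℝ) ≤ K * j * a := by
    calc (k:ℝ) ≤ j := hj
      _ = 1 * j * 1 := by ring
      _ ≤ K * j * a := by gcongr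
  have h4 : (j:ℝ)/2000 * (10^9 * K) ≤ L * M := by
    have : (0:ℝ) ≤ j/2000 := by positivity
    gcongr
    linarith
  have h5 : (j:ℝ)/2000 * (10^9 * K) / 49152 * a ≤ L * M / 49152 * a := by gcongr
  have h6 : 0 < (K:ℝ) * j * a := by
    have : (0:ℝ) < j := by linarith
    positivity
  nlinarith

end DSR
end

section
namespace DSR
open Filter Topology

open Classical in
set_option maxHeartbeats 1000000 in
lemma core (K M j W ν D0 n0 R ps H : ℕ) (hK : 1 ≤ K) (hM : 10^9 * K ≤ M) (h : Fin (2^M) → ℕ) (hW : W ≠ 0)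
    (hD0 : 1000 * (2^M)^4 ≤ D0) (hWD : ∀ p, p.Prime → p ≤ D0 → p ∣ W) (hν : ∀ m, (ν + h m).Coprime W)
    (hh : ∀ p, p.Prime → ¬ p ∣ W → ∀ i i', i ≠ i' → ¬ (h i ≡ h i' [MOD p])) (hH : ∀ m, h m ≤ H)
    (hR : n0 + H ≤ R) (hR2 : (2*j+3)*H+3 ≤ R) (hWR : W ≤ R) (L τ : ℝ) (hL : L = Real.log R) (hLj : (j:ℝ)/2000 ≤ L)
    (hLj2 : 1 + L ≤ j)
    (hτL : τ = L/(64*2^M*M)) (hτ : 24*(W+1) ≤ kap W*τ) (hjk : 2^M ≤ j) (hjW : W ≤ j)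
    (E : ℝ) (hE : ∀ N a, N ≠ 0 → |∑' n : ℕ, (if n % N = a % N then Fw (j+1) n else 0) - (j+1).factorial / N| ≤ E)
    (hE2 : (j:ℝ)^(12*2^M) * ((R:ℝ)^4 * E) ≤ (j+1).factorial / W)
    (hBV : ∀ P : Finset ℕ, (∀ p ∈ P, p.Prime ∧ p ≤ R ∧ ¬ p ∣ W ∧ p ≠ ps) →
      ∑ s ∈ P.powerset.filter (fun s => ∏ p ∈ s, p ≤ R^2), (((2^M+1)^2:ℕ):ℝ)^s.card * Err (W * ∏ p ∈ s, p) j R ≤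
        j.factorial / (j:ℝ)^(12*2^M+1))
    (hno : ∀ n, n0 < n → n % W = ν % W → (Finset.univ.filter (fun m => (n + h m).Prime)).card ≤ K) : False := by
  have hk1 : 1 ≤ 2^M := Nat.one_le_two_pow
  have hM1 : 1 ≤ M := by omega
  have hR3 : 3 ≤ R := by omega
  set P : Finset ℕ := (Finset.range (R+1)).filter (fun p => p.Prime ∧ p ≤ R ∧ ¬ p ∣ W ∧ p ≠ ps) with hPdef
  have hP : ∀ p, p ∈ P ↔ p.Prime ∧ p ≤ R ∧ ¬ p ∣ W ∧ p ≠ ps := by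
    intro p
    rw [hPdef, Finset.mem_filter, Finset.mem_range]
    constructor
    · exact fun h => h.2
    · exact fun h => ⟨by omega, h⟩
  have hPp : ∀ p ∈ P, p.Prime := fun p hp => ((hP p).mp hp).1
  have hPW : ∀ p ∈ P, ¬ p ∣ W := fun p hp => ((hP p).mp hp).2.2.1
  have hPR : ∀ p ∈ P, p.Prime ∧ p ≤ R := fun p hp => ⟨((hP p).mp hp).1, ((hP p).mp hp).2.1⟩
  have hPh : ∀ p ∈ P, ∀ i i', i ≠ i' → ¬ (h i ≡ h i' [MOD p]) := fun p hp => hh p (hPp p hp) (hPW p hp)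
  have hkk : (2^M)^2 ≤ (2^M)^4 := Nat.pow_le_pow_right hk1 (by norm_num)
  have hPC : ∀ p ∈ P, (2^M+1)^2 ≤ p := by
    intro p hp
    have h1 : D0 < p := by
      by_contra h1
      exact hPW p hp (hWD p (hPp p hp) (by omega))
    nlinarith
  obtain ⟨lam, α, hα, hV, hs, hQ1, hQ2⟩ := sieve7 M hM1 P W hW D0 (by nlinarith) hWD R ps hP L τ hL hτL (by omega) hτ
  have hWr : (0:ℝ) < W := by exact_mod_cast Nat.pos_of_ne_zero hW
  have hjr : (0:ℝ) < j := by exact_mod_cast (lt_of_lt_of_le hk1 hjk)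
  have hL0 : 0 ≤ L := by rw [hL]; exact Real.log_natCast_nonneg _
  set V : ℝ := (1 + Real.log R)^(6*2^M) with hVdef
  have hV0 : 0 ≤ V := by rw [hVdef, ← hL]; positivity
  have hV2 : V^2 ≤ (j:ℝ)^(12*2^M) := by
    rw [hVdef, ← hL, ← pow_mul, show 6*2^M*2 = 12*2^M by ring]
    gcongr
  have hE0 : 0 ≤ E := (abs_nonneg _).trans (hE 1 0 one_ne_zero)
  -- first moment
  have hw1 : Summable (fun n : ℕ => if n % W = ν % W then Fw (j+1) n else 0) := by
    refine Summable.of_nonneg_of_le (fun n => ?_) (fun n => ?_) (F_summable (j+1))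
    · split_ifs; exacts [Fw_nonneg _ _, le_rfl]
    · split_ifs; exacts [le_rfl, Fw_nonneg _ _]
  obtain ⟨hs1, hq1⟩ := quad P h lam (fun n : ℕ => if n % W = ν % W then Fw (j+1) n else 0) hw1
    (fun n => by split_ifs; exacts [Fw_nonneg _ _, le_rfl]) ((j+1).factorial / W : ℝ) (fun p : ↥P => K1 (1/((p:ℕ):ℝ))) (fun _ => E)
    (fun d e => pair1 P hPp W ν hW hPW h hPh (j+1) E hE d e)
  have hb1 := pairsum P hPp R lam V hV0 hV hs (fun _ => E) (fun _ => hE0)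
  have hb1' := count_R4 P hPp ((2^M+1)^2) R hPC E hE0
  have herr1 : |∑' n, (if n % W = ν % W then Fw (j+1) n else 0) * AA P h lam n^2 - ((j+1).factorial / W : ℝ) * tq (fun p : ↥P => K1 (1/((p:ℕ):ℝ))) lam| ≤ (j+1).factorial / W := by
    refine hq1.trans (hb1.trans (le_trans ?_ hE2))
    refine mul_le_mul hV2 hb1' (Finset.sum_nonneg fun s _ => by positivity) (by positivity)
  have hS1 : ∑' n, (if n % W = ν % W then Fw (j+1) n else 0) * AA P h lam n^2 ≤ (j+1).factorial / W * (α^(2^M) + 1) := by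
    have h1 := (abs_le.mp herr1).2
    have h2 : ((j+1).factorial / W : ℝ) * tq (fun p : ↥P => K1 (1/((p:ℕ):ℝ))) lam ≤ ((j+1).factorial / W : ℝ) * α^(2^M) := by
      gcongr
    linarith
  -- second moments
  have hw2 : ∀ m, Summable (fun n : ℕ => if n % W = ν % W then vp R (n + h m) * Fw j (n + h m) else 0) := by
    intro m
    have h1 := (summable_nat_add_iff (h m)).mpr (vpF_summable R j)
    refine Summable.of_nonneg_of_le (fun n => ?_) (fun n => ?_) h1
    · split_ifs; exacts [mul_nonneg (vp_nonneg _ _) (Fw_nonneg _ _), le_rfl]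
    · split_ifs; exacts [le_rfl, mul_nonneg (vp_nonneg _ _) (Fw_nonneg _ _)]
  have hfin := hBV P (fun p hp => (hP p).mp hp)
  have key2 : ∀ m, Summable (fun n : ℕ => (if n % W = ν % W then vp R (n + h m) * Fw j (n + h m) else 0) * AA P h lam n^2) ∧
      (j.factorial / W : ℝ) * (τ * M^2/768 * α^(2^M) - 1) ≤ ∑' n, (if n % W = ν % W then vp R (n + h m) * Fw j (n + h m) else 0) * AA P h lam n^2 := by
    intro m
    obtain ⟨hs2, hq2⟩ := quad P h lam (fun n : ℕ => if n % W = ν % W then vp R (n + h m) * Fw j (n + h m) else 0) (hw2 m)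
      (fun n => by split_ifs; exacts [mul_nonneg (vp_nonneg _ _) (Fw_nonneg _ _), le_rfl]) (j.factorial / W.totient : ℝ)
      (fun p : ↥P => K2 m (1/(((p:ℕ):ℝ)-1))) (fun s => Err (W * ∏ p ∈ s, p) j R)
      (fun d e => by
        rw [nm_prod]
        exact pair2 P R hPR W ν hW hWR hPW h hPh j m ((hH m).trans (by omega)) (hν m) d e)
    refine ⟨hs2, ?_⟩
    have hEn : ∀ S, 0 ≤ Err (W * ∏ p ∈ nm P S, p) j R := by
      intro S
      rw [nm_prod]
      exact Err_nonneg P W j R hW hWR hPR S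
    have hb2 := pairsum P hPp R lam V hV0 hV hs (fun s => Err (W * ∏ p ∈ s, p) j R) hEn
    have herr2 : V^2 * ∑ s ∈ P.powerset.filter (fun s => ∏ p ∈ s, p ≤ R^2), (((2^M+1)^2:ℕ):ℝ)^s.card * Err (W * ∏ p ∈ s, p) j R ≤ j.factorial / W := by
      calc _ ≤ (j:ℝ)^(12*2^M) * (j.factorial / (j:ℝ)^(12*2^M+1)) :=
            (mul_le_mul_of_nonneg_left hfin (sq_nonneg V)).trans (mul_le_mul_of_nonneg_right hV2 (by positivity))
        _ = j.factorial / (j:ℝ) := by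
            rw [pow_succ]; field_simp
        _ ≤ j.factorial / W := by
            have : (W:ℝ) ≤ j := by exact_mod_cast hjW
            gcongr
    have h1 := (abs_le.mp (hq2.trans (hb2.trans herr2))).1
    have h2 := hQ2 m
    have hφ : (0:ℝ) < W.totient := by exact_mod_cast Nat.totient_pos.mpr (Nat.pos_of_ne_zero hW)
    have h3 : (j.factorial / W.totient : ℝ) * (kap W * τ * M^2/768 * α^(2^M)) ≤ (j.factorial / W.totient : ℝ) * tq (fun p : ↥P => K2 m (1/(((p:ℕ):ℝ)-1))) lam := by
      gcongr
    have h4 : (j.factorial / W.totient : ℝ) * (kap W * τ * M^2/768 * α^(2^M)) = (j.factorial / W : ℝ) * (τ * M^2/768 * α^(2^M)) := by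
      unfold kap; field_simp
    rw [h4] at h3
    linarith
  have hcmp : ∑ m, ∑' n, (if n % W = ν % W then vp R (n + h m) * Fw j (n + h m) else 0) * AA P h lam n^2 ≤
      2 * K * ∑' n, (if n % W = ν % W then Fw (j+1) n else 0) * AA P h lam n^2 := by
    rw [← Summable.tsum_finsetSum (fun m _ => (key2 m).1), ← tsum_mul_left]
    refine Summable.tsum_le_tsum (fun n => ?_) (summable_sum fun m _ => (key2 m).1) (hs1.mul_left _)
    rw [← Finset.sum_mul, ← mul_assoc]
    refine mul_le_mul_of_nonneg_right ?_ (sq_nonneg _)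
    by_cases hn : n % W = ν % W
    · simp only [hn, if_true]
      exact compare h H n0 R j K n hH hR hR2 (fun h1 => hno n h1 hn)
    · simp [hn]
  have hlow : ∑ m : Fin (2^M), (j.factorial / W : ℝ) * (τ * M^2/768 * α^(2^M) - 1) ≤ ∑ m, ∑' n, (if n % W = ν % W then vp R (n + h m) * Fw j (n + h m) else 0) * AA P h lam n^2 :=
    Finset.sum_le_sum fun m _ => (key2 m).2
  rw [Finset.sum_const, Finset.card_univ, Fintype.card_fin, nsmul_eq_mul] at hlow
  refine final_alg K M j (2^M) L τ (α^(2^M)) hK hM hk1 hjk hLj (by push_cast; exact hτL) (one_le_pow₀ hα) ?_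
  have hc : (0:ℝ) < j.factorial / W := by positivity
  have h5 : (2 * K : ℝ) * ∑' n, (if n % W = ν % W then Fw (j+1) n else 0) * AA P h lam n^2 ≤ 2 * K * ((j+1).factorial / W * (α^(2^M) + 1)) := by gcongr
  have h6 := hlow.trans (hcmp.trans h5)
  refine le_of_mul_le_mul_left ?_ hc
  calc _ = ((2^M:ℕ):ℝ) * ((j.factorial / W : ℝ) * (τ * M^2/768 * α^(2^M) - 1)) := by ring
    _ ≤ _ := h6
    _ = _ := by rw [Nat.factorial_succ]; push_cast; ring

end DSR
end

section
namespace DSR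
open Filter Topology

lemma floor_half (x : ℝ) (hx : 1 ≤ x) : x / 2 ≤ (⌊x⌋₊:ℝ) := by
  have h1 := Nat.lt_floor_add_one x
  have h2 : 1 ≤ ⌊x⌋₊ := Nat.le_floor (by simpa using hx)
  have h3 : (1:ℝ) ≤ ⌊x⌋₊ := by exact_mod_cast h2
  linarith

lemma aux4 (k : ℕ) (hk1 : 1 ≤ k) : ((k+1)^2+1)^2 ≤ 1000 * k^4 := by
  have : (k+1)^2+1 ≤ 5*k^2 := by nlinarith
  calc ((k+1)^2+1)^2 ≤ (5*k^2)^2 := by gcongr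
    _ = 25*k^4 := by ring
    _ ≤ 1000 * k^4 := by gcongr; norm_num

lemma ev_floor (A : ℕ) : ∀ᶠ j : ℕ in atTop, A * j ≤ ⌊Real.exp ((j:ℝ)/1000)⌋₊ := by
  filter_upwards [eventually_ge_atTop (2000000*A)] with j hj
  apply Nat.le_floor
  have h1 := Real.quadratic_le_exp_of_nonneg (x := (j:ℝ)/1000) (by positivity)
  have h2 : (2000000*A:ℝ) ≤ j := by exact_mod_cast hj
  have h3 : (0:ℝ) ≤ j := by positivity
  push_cast
  nlinarith

lemma ev_log : ∀ᶠ j : ℕ in atTop, (j:ℝ)/2000 ≤ Real.log ⌊Real.exp ((j:ℝ)/1000)⌋₊ ∧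
    1 + Real.log ⌊Real.exp ((j:ℝ)/1000)⌋₊ ≤ j := by
  filter_upwards [eventually_ge_atTop 2000] with j hj
  have hjr : (2000:ℝ) ≤ j := by exact_mod_cast hj
  have he : 1 ≤ Real.exp ((j:ℝ)/1000) := Real.one_le_exp (by positivity)
  have h1 := floor_half _ he
  have h2 := Nat.floor_le (Real.exp_pos ((j:ℝ)/1000)).le
  have hf : (0:ℝ) < ⌊Real.exp ((j:ℝ)/1000)⌋₊ := by linarith
  constructor
  · have h3 := Real.log_le_log (by positivity) h1
    rw [Real.log_div (by positivity) (by norm_num), Real.log_exp] at h3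
    have := Real.log_two_lt_d9
    linarith
  · have h3 := Real.log_le_log hf h2
    rw [Real.log_exp] at h3
    linarith

open Classical in
theorem MT (K M W ν D0 : ℕ) (hK : 1 ≤ K) (hM : 10^9 * K ≤ M) (h : Fin (2^M) → ℕ) (hW : W ≠ 0)
    (hD0 : 1000 * (2^M)^4 ≤ D0) (hWD : ∀ p, p.Prime → p ≤ D0 → p ∣ W) (hν : ∀ m, (ν + h m).Coprime W)
    (hh : ∀ p, p.Prime → ¬ p ∣ W → ∀ i i', i ≠ i' → ¬ (h i ≡ h i' [MOD p])) (n0 : ℕ) :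
    ∃ n, n0 < n ∧ n % W = ν % W ∧ K < (Finset.univ.filter (fun m => (n + h m).Prime)).card := by
  by_contra hcon
  push Not at hcon
  have hk1 : 1 ≤ 2^M := Nat.one_le_two_pow
  set H : ℕ := ∑ m, h m with hHdef
  have hH : ∀ m, h m ≤ H := fun m => Finset.single_le_sum (f := h) (fun _ _ => Nat.zero_le _) (Finset.mem_univ m)
  have hC : ∀ p : ℕ, p.Prime → ¬ p ∣ W → (((2^M+1)^2:ℕ):ℝ)*√p ≤ p - 1 := by
    intro p hp hpW
    have h1 : D0 < p := by
      by_contra h1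
      exact hpW (hWD p hp (by omega))
    have h2 : ((2^M+1)^2+1)^2 ≤ p := by
      have := aux4 (2^M) hk1
      omega
    have h3 : ((((2^M+1)^2:ℕ):ℝ)+1) ≤ √p := by
      apply Real.le_sqrt_of_sq_le
      exact_mod_cast h2
    have h4 : √(p:ℝ) * √p = p := Real.mul_self_sqrt (by positivity)
    have h5 : (0:ℝ) ≤ (((2^M+1)^2:ℕ):ℝ) := by positivity
    nlinarith
  have hBV := BV ((2^M+1)^2) (12*2^M+1) W hW (Nat.one_le_pow _ _ (by omega)) hC
  obtain ⟨C1, hC1, hAP⟩ := F_AP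
  have hWr : (0:ℝ) < W := by exact_mod_cast Nat.pos_of_ne_zero hW
  have hev := ev_pow (C1 * W) (5/4) (by norm_num) (12*2^M) (by positivity)
  have hM1 : 1 ≤ M := by omega
  have hMr : (1:ℝ) ≤ M := by exact_mod_cast hM1
  have hkap := kap_pos W hW
  obtain ⟨N1, hN1⟩ := exists_nat_ge (2000 * (64*2^M*M) * (24*(W+1)) / kap W)
  have hall := (hBV.and (hev.and ((ev_floor (5*H+3+W+n0+2)).and (ev_log.and
    (eventually_ge_atTop (2^M+W+N1+1))))))
  obtain ⟨j, ⟨ps, hps⟩, hj2, hj3, ⟨hj4, hj5⟩, hj6⟩ := hall.exists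
  have hR1 := Nat.floor_le (Real.exp_pos ((j:ℝ)/1000)).le
  generalize hRdef : ⌊Real.exp ((j:ℝ)/1000)⌋₊ = R at *
  have hj1 : 1 ≤ j := by omega
  have a1 : H ≤ H * j := Nat.le_mul_of_pos_right _ hj1
  have a2 : W ≤ W * j := Nat.le_mul_of_pos_right _ hj1
  have a3 : n0 ≤ n0 * j := Nat.le_mul_of_pos_right _ hj1
  have a4 : (5*H+3+W+n0+2)*j = 5*(H*j) + W*j+n0*j+5*j := by ring
  have a5 : (2*j+3)*H+3 = 2*(H*j)+3*H+3 := by ring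
  refine core K M j W ν D0 n0 R ps H hK hM h hW hD0 hWD hν hh hH (by omega) (by omega) (by omega)
    (Real.log R) _ rfl hj4 hj5 rfl ?_ (by omega) (by omega) (C1 * (j+1).factorial / (3/2)^(j+1)) (hAP j) ?_
    (fun P hP => hps R (by omega) (by omega) hR1 P hP) hcon
  · have b1 : (N1:ℝ) ≤ j := by exact_mod_cast (by omega : N1 ≤ j)
    rw [div_le_iff₀ hkap] at hN1
    rw [mul_div_assoc', le_div_iff₀ (by positivity)]
    have b2 : (j:ℝ) ≤ 2000 * Real.log R := by linarith
    have b3 : (N1:ℝ) * kap W ≤ 2000 * Real.log R * kap W := by gcongr; linarith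
    nlinarith
  · have b1 : (R:ℝ)^4 ≤ (6/5)^j := by
      calc (R:ℝ)^4 ≤ (Real.exp ((j:ℝ)/1000))^4 := by gcongr
        _ = (Real.exp (1/250))^j := by
            rw [← Real.exp_nat_mul, ← Real.exp_nat_mul]; congr 1; push_cast; ring
        _ ≤ (6/5)^j := by
            gcongr
            have := Real.exp_bound_div_one_sub_of_interval (x := 1/250) (by norm_num) (by norm_num)
            norm_num at this ⊢
            linarith
    have b2 : C1 * W / (5/4)^j * (j:ℝ)^(12*2^M) ≤ 1/4 := hj2
    have b3 : (j:ℝ)^(12*2^M) * ((6/5)^j * (C1 / (3/2)^(j+1))) ≤ 1/W := by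
      have e1 : ((6:ℝ)/5)^j / (3/2)^j = 1/(5/4)^j := by
        rw [← div_pow, one_div, ← inv_pow]; norm_num
      have e2 : (j:ℝ)^(12*2^M) * ((6/5)^j * (C1 / (3/2)^(j+1))) = (C1 * W / (5/4)^j * (j:ℝ)^(12*2^M)) * (2/3) / W := by
        calc (j:ℝ)^(12*2^M) * ((6/5)^j * (C1 / (3/2)^(j+1))) = (j:ℝ)^(12*2^M) * C1 * (2/3) * (((6:ℝ)/5)^j / (3/2)^j) := by
              rw [pow_succ ((3:ℝ)/2)]; field_simp
          _ = _ := by rw [e1]; field_simp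
      rw [e2]
      gcongr
      linarith
    calc (j:ℝ)^(12*2^M) * ((R:ℝ)^4 * (C1 * (j+1).factorial / (3/2)^(j+1)))
        ≤ (j:ℝ)^(12*2^M) * ((6/5)^j * (C1 * (j+1).factorial / (3/2)^(j+1))) := by gcongr
      _ = ((j:ℝ)^(12*2^M) * ((6/5)^j * (C1 / (3/2)^(j+1)))) * (j+1).factorial := by ring
      _ ≤ 1/W * (j+1).factorial := by gcongr
      _ = _ := by ring
end DSR
end

section
namespace DSR
open Filter Topology

lemma dsum_step (g : ℕ) (hg : 2 ≤ g) (n : ℕ) : (Nat.digits g n).sum = n % g + (Nat.digits g (n/g)).sum := by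
  rcases Nat.eq_zero_or_pos n with h | h
  · subst h; simp
  · rw [Nat.digits_def' (by omega) h]; simp

lemma dsum_add (g : ℕ) (hg : 2 ≤ g) (B : ℕ) : ∀ a b, a < g^B →
    (Nat.digits g (a + g^B*b)).sum = (Nat.digits g a).sum + (Nat.digits g b).sum := by
  induction B with
  | zero => intro a b h; have : a = 0 := by simpa using h
            subst this; simp
  | succ B ih =>
    intro a b h
    rw [dsum_step g hg (a + g^(B+1)*b), dsum_step g hg a]
    have e : a + g^(B+1)*b = a + g*(g^B*b) := by ring
    rw [e, Nat.add_mul_mod_self_left, Nat.add_mul_div_left _ _ (by omega), ih (a/g) b, add_assoc]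
    apply Nat.div_lt_of_lt_mul
    rw [pow_succ] at h
    linarith

lemma dsum_pos (g m : ℕ) (hg : 2 ≤ g) (hm : 0 < m) : 0 < (Nat.digits g m).sum := by
  by_contra h
  have h0 : (Nat.digits g m).sum = 0 := by omega
  have h1 := Nat.modEq_digits_sum
  rw [List.sum_eq_zero_iff] at h0
  have h2 := Nat.ofDigits_digits g m
  have h3 : Nat.ofDigits g (Nat.digits g m) = 0 := by
    rw [Nat.ofDigits_eq_foldr]
    generalize Nat.digits g m = l at h0
    induction l with
    | nil => simp
    | cons x t ih => 
      simp only [List.foldr_cons]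
      rw [ih (fun y hy => h0 y (List.mem_cons_of_mem _ hy)), h0 x (by simp)]; simp
  omega

def hs (g E m : ℕ) : ℕ → ℕ
  | 0 => 1
  | (i+1) => hs g E m i + g^(E*(i+1)) * m

lemma hs_lt (g E m : ℕ) (hg : 2 ≤ g) (hE : m + 1 ≤ g^E) (hE1 : 1 ≤ E) (i : ℕ) : hs g E m i < g^(E*(i+1)) := by
  induction i with
  | zero => simp only [hs]; exact Nat.one_lt_pow (by omega) (by omega)
  | succ i ih =>
    simp only [hs]
    calc hs g E m i + g^(E*(i+1)) * m < g^(E*(i+1)) * (m+1) := by rw [Nat.mul_succ (g^(E*(i+1))) m]; omega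
      _ ≤ g^(E*(i+1)) * g^E := by gcongr
      _ = _ := by rw [← pow_add]; ring_nf

lemma hs_mono (g E m : ℕ) (hg : 2 ≤ g) (hm : 0 < m) : StrictMono (hs g E m) := by
  apply strictMono_nat_of_lt_succ
  intro i
  simp only [hs]
  have : 0 < g^(E*(i+1)) * m := by positivity
  omega

lemma hs_ds (g E m : ℕ) (hg : 2 ≤ g) (hm : 0 < m) (hE : m + 1 ≤ g^E) (hE1 : 1 ≤ E) :
    StrictMono (fun i => (Nat.digits g (hs g E m i)).sum) := by
  apply strictMono_nat_of_lt_succ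
  intro i
  simp only [hs]
  rw [dsum_add g hg _ _ _ (hs_lt g E m hg hE hE1 i)]
  have := dsum_pos g m hg hm
  omega

lemma hs_form (g E m : ℕ) (i : ℕ) : ∃ t, hs g E m i = 1 + m*t := by
  induction i with
  | zero => exact ⟨0, by simp [hs]⟩
  | succ i ih =>
    obtain ⟨t, ht⟩ := ih
    exact ⟨t + g^(E*(i+1)), by simp only [hs, ht]; ring⟩

/-- pigeonhole: some residue class is avoided -/
lemma avoid (k p : ℕ) (hp : p.Prime) (h : Fin k → ℕ) (hk : k < p) : ∃ r, ∀ i, ¬ (h i ≡ r [MOD p]) := by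
  by_contra hcon
  push Not at hcon
  choose f hf using hcon
  have hinj : Function.Injective (fun r : Fin p => f r) := by
    intro a b hab
    have h1 := hf a
    have h2 := hf b
    simp only at hab
    rw [hab] at h1
    have h3 : (a:ℕ) ≡ b [MOD p] := h1.symm.trans h2
    have h4 : (a:ℕ) % p = b % p := h3
    rw [Nat.mod_eq_of_lt a.2, Nat.mod_eq_of_lt b.2] at h4
    exact Fin.ext h4
  have := Fintype.card_le_of_injective _ hinj
  simp at this
  omega

open Classical in
lemma dense (g : ℕ) (hg : 2 ≤ g) (k T n c : ℕ) (h : Fin k → ℕ) (hm : StrictMono h)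
    (hs : StrictMono (fun i => (Nat.digits g (n + h i)).sum)) (hT : ∀ i, h i ≤ T)
    (hx : ∀ x ≤ T, (∀ i, h i ≠ x) → ¬ (n+x).Prime) (K : ℕ)
    (hK : K < (Finset.univ.filter (fun m => (n + h m).Prime)).card) :
    ∀ i, i + 1 < K → (Nat.digits g (Nat.nth Nat.Prime (Nat.count Nat.Prime n + i))).sum <
      (Nat.digits g (Nat.nth Nat.Prime (Nat.count Nat.Prime n + i + 1))).sum := by
  have hcount : Nat.count Nat.Prime n + K < Nat.count Nat.Prime (n + (T+1)) := by
    rw [Nat.count_add, Nat.count_eq_card_filter_range (fun x => Nat.Prime (n+x))]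
    have : (Finset.univ.filter (fun m => (n + h m).Prime)).card ≤
      ((Finset.range (T+1)).filter (fun x => Nat.Prime (n+x))).card := by
      apply Finset.card_le_card_of_injOn h
      · intro m hm
        simp at hm ⊢
        exact ⟨by have := hT m; omega, hm⟩
      · exact hm.injective.injOn
    omega
  have key : ∀ i, i < K → ∃ m, Nat.nth Nat.Prime (Nat.count Nat.Prime n + i) = n + h m := by
    intro i hi
    have h1 : Nat.nth Nat.Prime (Nat.count Nat.Prime n + i) < n + (T+1) := Nat.nth_lt_of_lt_count (by omega)
    have h2 : n ≤ Nat.nth Nat.Prime (Nat.count Nat.Prime n + i) := (Nat.count_le_iff_le_nth (p := Nat.Prime) Nat.infinite_setOf_prime).mp (Nat.le_add_right _ _)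
    have h3 : (Nat.nth Nat.Prime (Nat.count Nat.Prime n + i)).Prime := Nat.prime_nth_prime _
    obtain ⟨x, hx'⟩ := Nat.exists_eq_add_of_le h2
    rw [hx'] at h3 h1 ⊢
    by_contra hcon
    push Not at hcon
    exact hx x (by omega) (fun i hi => hcon i (by omega)) h3
  intro i hi
  obtain ⟨a, ha⟩ := key i (by omega)
  obtain ⟨b, hb⟩ := key (i+1) (by omega)
  have hlt := Nat.nth_strictMono Nat.infinite_setOf_prime (show Nat.count Nat.Prime n + i < Nat.count Nat.Prime n + (i+1) by omega)
  rw [ha, hb] at hlt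
  rw [add_assoc (Nat.count Nat.Prime n) i 1, ha, hb]
  exact hs (hm.lt_iff_lt.mp (by omega))

theorem final (g : ℕ) (hg : 2 ≤ g) (K : ℕ) (hK : 1 ≤ K) : {n : ℕ | ∀ i : ℕ, i + 1 < K → (Nat.digits g (Nat.nth Nat.Prime (n + i))).sum < (Nat.digits g (Nat.nth Nat.Prime (n + i + 1))).sum}.Infinite := by
  classical
  apply Set.infinite_of_forall_exists_gt
  intro N
  obtain ⟨M, hM⟩ : ∃ M, M = 10^9*K := ⟨_, rfl⟩
  obtain ⟨k, hk⟩ : ∃ k, k = 2^M := ⟨_, rfl⟩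
  obtain ⟨m, hmdef⟩ : ∃ m, m = g * k.factorial := ⟨_, rfl⟩
  have hm : 0 < m := by rw [hmdef]; have := k.factorial_pos; positivity
  obtain ⟨E, hE⟩ : ∃ E, E = m + 1 := ⟨_, rfl⟩
  have hE1 : 1 ≤ E := by omega
  have hE2 : m + 1 ≤ g^E := by rw [← hE]; exact (Nat.lt_pow_self (by omega)).le
  let h : Fin k → ℕ := fun i => hs g E m i
  have hmono : StrictMono h := fun a b hab => hs_mono g E m hg hm hab
  obtain ⟨B, hB⟩ : ∃ B, B = E*(k+1) := ⟨_, rfl⟩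
  have hB1 : B ≠ 0 := by rw [hB]; positivity
  have hhB : ∀ i, h i < g^B := fun i => by
    calc h i < hs g E m k := hs_mono g E m hg hm i.2
      _ < _ := by rw [hB]; exact hs_lt g E m hg hE2 hE1 k
  obtain ⟨T, hT⟩ : ∃ T, T = g^B + 1000*k^4 + g := ⟨_, rfl⟩
  have hhT : ∀ i, h i ≤ T := fun i => by have := hhB i; omega
  let e : ℕ → ℕ := fun x => Nat.nth Nat.Prime (T+1+x)
  have he : ∀ x, T < e x := by
    intro x
    have : T+1+x ≤ e x := (Nat.nth_strictMono Nat.infinite_setOf_prime).le_apply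
    omega
  have hemono : StrictMono e := fun a b hab => Nat.nth_strictMono Nat.infinite_setOf_prime (by omega)
  have hep : ∀ x, (e x).Prime := fun x => Nat.prime_nth_prime _
  have hres : ∀ p : ℕ, ∃ r, p.Prime → (∀ i, ¬ (h i ≡ r [MOD p])) ∧ (∀ x ≤ T, (∀ i, h i ≠ x) → e x = p → r = x) := by
    intro p
    by_cases hp : p.Prime
    swap
    · exact ⟨0, fun h => absurd h hp⟩
    by_cases hx : ∃ x ≤ T, (∀ i, h i ≠ x) ∧ e x = p
    · obtain ⟨x, hxT, hxi, hxp⟩ := hx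
      refine ⟨x, fun _ => ⟨?_, ?_⟩⟩
      · intro i hi
        have h1 := he x
        have h2 : h i % p = x % p := hi
        have h3 := hhT i
        rw [Nat.mod_eq_of_lt (by omega), Nat.mod_eq_of_lt (by omega)] at h2
        exact hxi i h2
      · intro y _ _ hy
        exact hemono.injective (hxp.trans hy.symm)
    · by_cases hkp : k < p
      · obtain ⟨r, hr⟩ := avoid k p hp h hkp
        exact ⟨r, fun _ => ⟨hr, fun x h1 h2 h3 => absurd ⟨x, h1, h2, h3⟩ hx⟩⟩
      · refine ⟨0, fun _ => ⟨?_, fun x h1 h2 h3 => absurd ⟨x, h1, h2, h3⟩ hx⟩⟩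
        intro i hi
        obtain ⟨t, ht⟩ := hs_form g E m i
        have h1 : p ∣ h i := (Nat.modEq_zero_iff_dvd).mp hi
        have h2 : p ∣ m := by
          rw [hmdef]; exact Dvd.dvd.mul_left ((Nat.Prime.dvd_factorial hp).mpr (by omega)) _
        have h3 : p ∣ 1 := by
          have h4 : p ∣ 1 + m*t := by rw [← ht]; exact h1
          exact (Nat.dvd_add_left (h2.mul_right t)).mp h4
        exact hp.one_lt.ne' (Nat.dvd_one.mp h3)
  choose r hr using hres
  let S : Finset ℕ := (Finset.range (e T + 1)).filter (fun p => p.Prime ∧ ¬ p ∣ g)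
  have hS : ∀ p ∈ S, p.Prime ∧ ¬ p ∣ g := fun p hp => (Finset.mem_filter.mp hp).2
  obtain ⟨ν, hν⟩ := crt (g^B) 0 (fun p => p) r S (fun p hp => (hS p hp).1.pos)
    (fun p hp => Nat.Coprime.pow_left _ (((hS p hp).1.coprime_iff_not_dvd.mpr (hS p hp).2).symm))
    (fun p hp q hq hpq => (Nat.coprime_primes (hS p hp).1 (hS q hq).1).mpr hpq)
  obtain ⟨W, hWdef⟩ : ∃ W, W = g^B * ∏ p ∈ S, p := ⟨_, rfl⟩
  rw [← hWdef] at hν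
  have hW : W ≠ 0 := by
    rw [hWdef]
    exact Nat.mul_ne_zero (by positivity) (Finset.prod_ne_zero_iff.mpr fun p hp => (hS p hp).1.ne_zero)
  have hSW : ∀ p ∈ S, p ∣ W := fun p hp => by
    rw [hWdef]; exact Dvd.dvd.mul_left (Finset.dvd_prod_of_mem (fun p => p) hp) _
  have hWD : ∀ p, p.Prime → p ≤ T → p ∣ W := by
    intro p hp hpT
    by_cases hpg : p ∣ g
    · rw [hWdef]; exact Dvd.dvd.mul_right (hpg.trans (dvd_pow_self g hB1)) _
    · exact hSW p (Finset.mem_filter.mpr ⟨Finset.mem_range.mpr (by have := he T; omega), hp, hpg⟩)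
  have hνν := (hν ν).mpr rfl
  have hcop : ∀ i, (ν + h i).Coprime W := by
    intro i
    rw [Nat.coprime_iff_gcd_eq_one]
    apply Nat.coprime_of_dvd
    intro p hp h1 h2
    rw [hWdef] at h2
    rcases (hp.dvd_mul).mp h2 with h3 | h3
    · have hpg := hp.dvd_of_dvd_pow h3
      have h4 : g^B ∣ ν := Nat.dvd_of_mod_eq_zero (by simpa using hνν.1)
      have h5 : p ∣ h i := (Nat.dvd_add_right (h3.trans h4)).mp h1
      obtain ⟨t, ht⟩ := hs_form g E m i
      have h6 : p ∣ m := by rw [hmdef]; exact Dvd.dvd.mul_right hpg _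
      have h7 : p ∣ 1 + m*t := by rw [← ht]; exact h5
      have h8 : p ∣ 1 := (Nat.dvd_add_left (h6.mul_right t)).mp h7
      exact hp.one_lt.ne' (Nat.dvd_one.mp h8)
    · obtain ⟨q, hq, hpq⟩ := (hp.prime.dvd_finset_prod_iff _).mp h3
      have : p = q := (Nat.prime_dvd_prime_iff_eq hp (hS q hq).1).mp hpq
      subst this
      have h4 := hνν.2 p hq
      apply (hr p hp).1 i
      have h5 : ν + h i ≡ ν + r p [MOD p] :=
        ((Nat.modEq_zero_iff_dvd).mpr h1).trans ((Nat.modEq_zero_iff_dvd).mpr h4).symm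
      exact Nat.ModEq.add_left_cancel' _ h5
  have hh : ∀ p, p.Prime → ¬ p ∣ W → ∀ i i', i ≠ i' → ¬ (h i ≡ h i' [MOD p]) := by
    intro p hp hpW i i' hii hmod
    have h1 : T < p := by
      by_contra h1
      exact hpW (hWD p hp (by omega))
    have h2 : h i % p = h i' % p := hmod
    have h3 := hhT i
    have h4 := hhT i'
    rw [Nat.mod_eq_of_lt (by omega), Nat.mod_eq_of_lt (by omega)] at h2
    exact hii (hmono.injective h2)
  subst hk
  obtain ⟨n, hn0, hnW, hnK⟩ := MT K M W ν T hK hM.ge h hW (by omega) hWD hcop hh (e T + Nat.nth Nat.Prime N)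
  have hn := (hν n).mpr hnW
  have hnB : g^B ∣ n := Nat.dvd_of_mod_eq_zero (by simpa using hn.1)
  obtain ⟨n', hn'⟩ := hnB
  refine ⟨Nat.count Nat.Prime n, ?_, ?_⟩
  · refine dense g hg (2^M) T n 0 h hmono ?_ hhT ?_ K (by convert hnK)
    · intro a b hab
      have h1 := hs_ds g E m hg hm hE2 hE1 (show (a:ℕ) < b from hab)
      simp only [hn'] at h1 ⊢
      rw [add_comm _ (h a), add_comm _ (h b), dsum_add g hg _ _ _ (hhB a), dsum_add g hg _ _ _ (hhB b)]
      exact Nat.add_lt_add_right h1 _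
    · intro x hxT hxi hpr
      have h1 : e x ∈ S := by
        refine Finset.mem_filter.mpr ⟨Finset.mem_range.mpr ?_, hep x, ?_⟩
        · have := hemono.monotone hxT; omega
        · intro hd
          have h2 := Nat.le_of_dvd (by omega) hd
          have := he x
          omega
      have h2 := hn.2 _ h1
      rw [(hr (e x) (hep x)).2 x hxT hxi rfl] at h2
      have h3 := (Nat.prime_dvd_prime_iff_eq (hep x) hpr).mp h2
      have h4 := hemono.monotone hxT
      omega
  · have h1 : Nat.nth Nat.Prime N < n := by omega
    have := Nat.count_monotone Nat.Prime (show Nat.nth Nat.Prime N + 1 ≤ n from h1)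
    rw [Nat.count_succ, Nat.count_nth_of_infinite Nat.infinite_setOf_prime, if_pos (Nat.prime_nth_prime N)] at this
    omega
end DSR
end

/-- For every base `g ≥ 2` and every `K ≥ 1`, there are infinitely many `n` such that
the base-`g` digit sum is strictly increasing along the run of `K` consecutive primes
`p_n, p_{n+1}, …, p_{n+K-1}`. -/
theorem digitSum_increasing_runs (g : ℕ) (hg : 2 ≤ g) (K : ℕ) (hK : 1 ≤ K) :
    {n : ℕ | ∀ i : ℕ, i + 1 < K →
      (Nat.digits g (Nat.nth Nat.Prime (n + i))).sum <
        (Nat.digits g (Nat.nth Nat.Prime (n + i + 1))).sum}.Infinite := by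
  exact DSR.final g hg K hK
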